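/- Let N ≥ 3, m > 1, and let ρ satisfy the weight condition. Let Ω ⊂ ℝ^N be a (possibly unbounded) domain, 0 ≤ τ₁ < τ₂, and let u be a non-negative very weak solution of ρ u_t = Δ(u^m) in Ω×(τ₁,τ₂). Then u ∈ L^∞_loc(Ω×(τ₁,τ₂)), i.e. u is essentially bounded on every compact subset of Ω×(τ₁,τ₂). -/

import Mathlib

open MeasureTheory Set Metric Filter
open scoped ENNReal Topology

noncomputable section

abbrev Eu (N : ℕ) := EuclideanSpace ℝ (Fin N)

/-- Signed power `a^q = |a|^{q-1} a`. -/
def spow (a q : ℝ) : ℝ := |a| ^ (q - 1) * a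

/-- The weight condition \eqref{weight-cond}: `ρ` is measurable and
`C̲ (1+|x|)^{-γ} ≤ ρ(x) ≤ C̄ |x|^{-γ}` for a.e. `x`, with `γ ∈ [0,2)` and `0 < C̲ < C̄`. -/
def WeightCond (N : ℕ) (γ Cl Cu : ℝ) (ρ : Eu N → ℝ) : Prop :=
  Measurable ρ ∧ 0 ≤ γ ∧ γ < 2 ∧ 0 < Cl ∧ Cl < Cu ∧
    ∀ᵐ x ∂(volume : Measure (Eu N)), Cl * (1 + ‖x‖) ^ (-γ) ≤ ρ x ∧ ρ x ≤ Cu * ‖x‖ ^ (-γ)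

/-- Time derivative `ψ_t` of a space-time test function. -/
def ptder {N : ℕ} (ψ : Eu N × ℝ → ℝ) (p : Eu N × ℝ) : ℝ := fderiv ℝ ψ p (0, 1)

/-- Spatial Laplacian `Δψ` of a space-time test function. -/
def lapX {N : ℕ} (ψ : Eu N × ℝ → ℝ) (p : Eu N × ℝ) : ℝ :=
  ∑ i : Fin N, fderiv ℝ (fun q => fderiv ℝ ψ q (EuclideanSpace.single i 1, 0)) p
    (EuclideanSpace.single i 1, 0)

/-- Very weak solution of `ρ u_t = Δ(u^m)` in `Ω × (τ₁, τ₂)`. -/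
structure VWS {N : ℕ} (ρ : Eu N → ℝ) (m : ℝ) (Ω : Set (Eu N)) (τ₁ τ₂ : ℝ)
    (u : Eu N → ℝ → ℝ) : Prop where
  aemeas : AEMeasurable (fun p : Eu N × ℝ => u p.1 p.2)
    (volume.restrict (Ω ×ˢ Ioo τ₁ τ₂))
  locint : ∀ K : Set (Eu N × ℝ), IsCompact K → K ⊆ Ω ×ˢ Ioo τ₁ τ₂ →
    IntegrableOn (fun p : Eu N × ℝ => |u p.1 p.2| * ρ p.1) K ∧
      IntegrableOn (fun p : Eu N × ℝ => |u p.1 p.2| ^ m) K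
  weak : ∀ ψ : Eu N × ℝ → ℝ, ContDiff ℝ (⊤ : ℕ∞) ψ → HasCompactSupport ψ →
    tsupport ψ ⊆ Ω ×ˢ Ioo τ₁ τ₂ →
    ∫ p in Ω ×ˢ Ioo τ₁ τ₂,
      (u p.1 p.2 * ptder ψ p * ρ p.1 + spow (u p.1 p.2) m * lapX ψ p) = 0

open Filter.Eventually (of_forall)
open ENNReal (ofReal ofReal_add ofReal_le_ofReal ofReal_mul ofReal_ne_top toReal_ofReal)
open Finset (mul_sum sum_add_distrib sum_congr sum_le_sum sum_nonneg)
open Real (mul_rpow norm_eq_abs norm_of_nonneg one_le_rpow rpow_add rpow_add_one rpow_le_rpow rpow_le_rpow_of_exponent_le rpow_le_rpow_of_nonpos rpow_mul rpow_natCast rpow_nonneg rpow_one rpow_pos_of_pos zero_rpow)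

/-- Space-time. -/
abbrev EuT (N : ℕ) := Eu N × ℝ

/-! ### Directional derivatives of smooth functions -/

section Calculus

variable {F : Type*} [NormedAddCommGroup F] [NormedSpace ℝ F]
  {G : Type*} [NormedAddCommGroup G] [NormedSpace ℝ G] {ι : Type*} [Fintype ι]

/-- Smooth real functions. -/
abbrev Sm (f : F → ℝ) : Prop := ContDiff ℝ (⊤ : ℕ∞) f

/-- Directional derivative. -/
def Dv (e : F) (f : F → ℝ) (p : F) : ℝ := fderiv ℝ f p e

/-- Sum of pure second derivatives along a family of directions. -/
def lapS (e : ι → F) (f : F → ℝ) (p : F) : ℝ := ∑ i, Dv (e i) (Dv (e i) f) p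

theorem Sm.diff {f : F → ℝ} (hf : Sm f) : Differentiable ℝ f :=
  ContDiff.differentiable hf (by simp)

theorem Sm.cont {f : F → ℝ} (hf : Sm f) : Continuous f :=
  ContDiff.continuous hf

theorem Sm.dv {f : F → ℝ} (hf : Sm f) (e : F) : Sm (Dv e f) := by
  have : ContDiff ℝ (⊤ : ℕ∞) (fderiv ℝ f) := hf.fderiv_right (by simp)
  exact this.clm_apply contDiff_const

theorem Sm.lapS {f : F → ℝ} (hf : Sm f) (e : ι → F) : Sm (lapS e f) :=
  ContDiff.sum fun i _ => (hf.dv (e i)).dv (e i)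

theorem Dv_add {f g : F → ℝ} (hf : Sm f) (hg : Sm g) (e p : F) :
    Dv e (fun x => f x + g x) p = Dv e f p + Dv e g p := by
  simp [Dv, fderiv_fun_add hf.diff.differentiableAt hg.diff.differentiableAt]

theorem Dv_sub {f g : F → ℝ} (hf : Sm f) (hg : Sm g) (e p : F) :
    Dv e (fun x => f x - g x) p = Dv e f p - Dv e g p := by
  simp [Dv, fderiv_fun_sub hf.diff.differentiableAt hg.diff.differentiableAt]

theorem Dv_mul {f g : F → ℝ} (hf : Sm f) (hg : Sm g) (e p : F) :
    Dv e (fun x => f x * g x) p = f p * Dv e g p + g p * Dv e f p := by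
  simp [Dv, fderiv_fun_mul hf.diff.differentiableAt hg.diff.differentiableAt]

theorem Dv_pow {f : F → ℝ} (hf : Sm f) (n : ℕ) (e p : F) :
    Dv e (fun x => f x ^ n) p = n * f p ^ (n - 1) * Dv e f p := by
  simp [Dv, fderiv_fun_pow n hf.diff.differentiableAt]

theorem Dv_const_mul {f : F → ℝ} (hf : Sm f) (c : ℝ) (e p : F) :
    Dv e (fun x => c * f x) p = c * Dv e f p := by
  simp [Dv, fderiv_const_mul hf.diff.differentiableAt]

theorem Dv_sum {κ : Type*} (s : Finset κ) {f : κ → F → ℝ} (hf : ∀ i, Sm (f i)) (e p : F) :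
    Dv e (fun x => ∑ i ∈ s, f i x) p = ∑ i ∈ s, Dv e (f i) p := by
  simp [Dv, fderiv_fun_sum fun i _ => (hf i).diff.differentiableAt]

theorem Dv_scomp {f : F → ℝ} (hf : Sm f) {φ : ℝ → ℝ} (hφ : Differentiable ℝ φ) (e p : F) :
    Dv e (fun x => φ (f x)) p = deriv φ (f p) * Dv e f p := by
  have h := (hφ (f p)).hasDerivAt.comp_hasFDerivAt p hf.diff.differentiableAt.hasFDerivAt
  have h2 := h.fderiv
  simp only [Function.comp_def] at h2
  simp [Dv, h2]

/-- Chain rule for affine substitutions. -/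
theorem Dv_affine {f : F → ℝ} (hf : Sm f) (L : G →L[ℝ] F) (b : F) (e p : G) :
    Dv e (fun x => f (L x + b)) p = Dv (L e) f (L p + b) := by
  have h := (hf.diff (L p + b)).hasFDerivAt.comp p ((L.hasFDerivAt (x := p)).add_const b)
  have h2 := h.fderiv
  simp only [Function.comp_def] at h2
  simp [Dv, h2]

theorem Dv_lin {f : F → ℝ} (hf : Sm f) (L : G →L[ℝ] F) (e p : G) :
    Dv e (fun x => f (L x)) p = Dv (L e) f (L p) := by
  simpa using Dv_affine hf L 0 e p

theorem Sm.affine {f : F → ℝ} (hf : Sm f) (L : G →L[ℝ] F) (b : F) :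
    Sm (fun x => f (L x + b)) :=
  hf.comp (L.contDiff.add contDiff_const)

theorem Sm.lin {f : F → ℝ} (hf : Sm f) (L : G →L[ℝ] F) : Sm (fun x => f (L x)) :=
  hf.comp L.contDiff

theorem lapS_affine {f : F → ℝ} (hf : Sm f) (L : G →L[ℝ] F) (b : F) (e : ι → G) (p : G) :
    lapS e (fun x => f (L x + b)) p = lapS (fun i => L (e i)) f (L p + b) := by
  refine sum_congr rfl fun i _ => ?_
  rw [show Dv (e i) (fun x => f (L x + b)) = fun x => Dv (L (e i)) f (L x + b) from
    funext fun x => Dv_affine hf L b _ _, Dv_affine (hf.dv _)]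

theorem lapS_lin {f : F → ℝ} (hf : Sm f) (L : G →L[ℝ] F) (e : ι → G) (p : G) :
    lapS e (fun x => f (L x)) p = lapS (fun i => L (e i)) f (L p) := by
  simpa using lapS_affine hf L 0 e p

theorem Dv_comm {f : F → ℝ} (hf : Sm f) (d e p : F) : Dv d (Dv e f) p = Dv e (Dv d f) p := by
  have hs : IsSymmSndFDerivAt ℝ f p :=
    (ContDiff.contDiffAt hf).isSymmSndFDerivAt (by
      rw [minSmoothness_of_isRCLikeNormedField]; exact WithTop.coe_le_coe.2 le_top)
  have hd : Differentiable ℝ (fderiv ℝ f) :=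
    (hf.fderiv_right (m := (⊤ : ℕ∞)) (by simp)).differentiable (by simp)
  have key : ∀ a b : F, Dv a (Dv b f) p = fderiv ℝ (fderiv ℝ f) p a b := by
    intro a b
    have := ((hd p).hasFDerivAt.clm_apply (hasFDerivAt_const b p)).fderiv
    change fderiv ℝ (fun x => fderiv ℝ f x b) p a = _
    rw [this]; simp
  rw [key, key, hs.eq]

theorem lapS_mul {f g : F → ℝ} (hf : Sm f) (hg : Sm g) (e : ι → F) (p : F) :
    lapS e (fun x => f x * g x) p
      = f p * lapS e g p + 2 * ∑ i, Dv (e i) f p * Dv (e i) g p + g p * lapS e f p := by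
  unfold lapS
  simp only [mul_sum, ← sum_add_distrib]
  refine sum_congr rfl fun i _ => ?_
  rw [show Dv (e i) (fun x => f x * g x) = fun x => f x * Dv (e i) g x + g x * Dv (e i) f x from
    funext fun x => Dv_mul hf hg _ _, Dv_add (hf.mul (hg.dv _)) (hg.mul (hf.dv _)),
    Dv_mul hf (hg.dv _), Dv_mul hg (hf.dv _)]
  ring

theorem lapS_scomp {f : F → ℝ} (hf : Sm f) {φ : ℝ → ℝ} (hφ : Sm φ) (e : ι → F) (p : F) :
    lapS e (fun x => φ (f x)) p
      = deriv φ (f p) * lapS e f p + deriv (deriv φ) (f p) * ∑ i, Dv (e i) f p ^ 2 := by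
  have hφ' : Sm (deriv φ) := by
    have := hφ.dv (1 : ℝ)
    have h2 : Dv (1 : ℝ) φ = deriv φ := by ext x; simp [Dv]
    rwa [h2] at this
  unfold lapS
  simp only [mul_sum, ← sum_add_distrib]
  refine sum_congr rfl fun i _ => ?_
  rw [show Dv (e i) (fun x => φ (f x)) = fun x => deriv φ (f x) * Dv (e i) f x from
    funext fun x => Dv_scomp hf hφ.diff _ _]
  have h := Dv_mul (f := fun x => deriv φ (f x)) (hφ'.comp hf) (hf.dv (e i)) (e i) p
  rw [h, Dv_scomp hf hφ'.diff]
  ring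

theorem HasCompactSupport.dv {f : F → ℝ} (hf : HasCompactSupport f) (e : F) :
    HasCompactSupport (Dv e f) := hf.fderiv_apply ℝ e

theorem tsupport_dv_subset (f : F → ℝ) (e : F) : tsupport (Dv e f) ⊆ tsupport f :=
  tsupport_fderiv_apply_subset ℝ e

theorem dv_eq_zero {f : F → ℝ} {p : F} (hp : p ∉ tsupport f) (e : F) : Dv e f p = 0 :=
  image_eq_zero_of_notMem_tsupport fun h => hp (tsupport_dv_subset f e h)

theorem lapS_eq_zero {f : F → ℝ} {p : F} (hp : p ∉ tsupport f) (e : ι → F) : lapS e f p = 0 :=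
  Finset.sum_eq_zero fun _ _ => dv_eq_zero (fun h => hp (tsupport_dv_subset f _ h)) _

theorem HasCompactSupport.lapS {f : F → ℝ} (hf : HasCompactSupport f) (e : ι → F) :
    HasCompactSupport (lapS e f) :=
  HasCompactSupport.intro hf fun _ hx => lapS_eq_zero hx e

end Calculus

section IBP

variable {F : Type*} [NormedAddCommGroup F] [NormedSpace ℝ F]
  [MeasurableSpace F] [BorelSpace F] {μ : Measure F} [μ.IsAddHaarMeasure]
  {ι : Type*} [Fintype ι]

theorem Sm.integrable {f : F → ℝ} (hf : Sm f) (hc : HasCompactSupport f) : Integrable f μ :=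
  hf.cont.integrable_of_hasCompactSupport hc

variable [FiniteDimensional ℝ F]

theorem integral_dv_mul {f g : F → ℝ} (hf : Sm f) (hg : Sm g) (hc : HasCompactSupport f) (e : F) :
    ∫ x, f x * Dv e g x ∂μ = -∫ x, Dv e f x * g x ∂μ :=
  integral_mul_fderiv_eq_neg_fderiv_mul_of_integrable
    (Sm.integrable ((hf.dv e).mul hg) (hc.dv e).mul_right)
    (Sm.integrable (hf.mul (hg.dv e)) hc.mul_right)
    (Sm.integrable (hf.mul hg) hc.mul_right) (fun x _ => hf.diff x) (fun x _ => hg.diff x)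

theorem integral_dv {f : F → ℝ} (hf : Sm f) (hc : HasCompactSupport f) (e : F) :
    ∫ x, Dv e f x ∂μ = 0 := by
  have := integral_dv_mul (μ := μ) hf (contDiff_const (c := (1 : ℝ))) hc e
  have h0 : ∀ x, Dv e (fun _ : F => (1 : ℝ)) x = 0 := fun x => by simp [Dv]
  simp only [h0] at this
  simpa using this

theorem integral_mul_lapS {f g : F → ℝ} (hf : Sm f) (hg : Sm g) (hc : HasCompactSupport f)
    (e : ι → F) : ∫ x, f x * lapS e g x ∂μ = ∫ x, lapS e f x * g x ∂μ := by
  unfold lapS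
  simp only [mul_sum, Finset.sum_mul]
  rw [integral_finsetSum, integral_finsetSum]
  · refine sum_congr rfl fun i _ => ?_
    rw [integral_dv_mul hf (hg.dv _) hc, integral_dv_mul (hf.dv _) hg (hc.dv _), neg_neg]
  · exact fun i _ => Sm.integrable (((hf.dv _).dv _).mul hg) ((hc.dv _).dv _).mul_right
  · exact fun i _ => Sm.integrable (hf.mul ((hg.dv _).dv _)) hc.mul_right

end IBP

/-! ### A generalized dominated convergence theorem -/

section Pratt

variable {α : Type*} [MeasurableSpace α] {μ : Measure α}

theorem tendsto_integral_abs_sub {G : ℕ → α → ℝ} {H : α → ℝ} (hG : ∀ n, Integrable (G n) μ)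
    (hH : Integrable H μ) (h0 : ∀ n, ∀ᵐ x ∂μ, 0 ≤ G n x)
    (hlim : ∀ᵐ x ∂μ, Tendsto (fun n => G n x) atTop (𝓝 (H x)))
    (hint : Tendsto (fun n => ∫ x, G n x ∂μ) atTop (𝓝 (∫ x, H x ∂μ))) :
    Tendsto (fun n => ∫ x, |G n x - H x| ∂μ) atTop (𝓝 0) := by
  have h1 : Tendsto (fun n => ∫ x, max (H x - G n x) 0 ∂μ) atTop (𝓝 (∫ _, (0 : ℝ) ∂μ)) := by
    refine tendsto_integral_of_dominated_convergence (fun x => |H x|) ?_ hH.abs ?_ ?_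
    · exact fun n => ((hH.sub (hG n)).pos_part).aestronglyMeasurable
    · intro n
      filter_upwards [h0 n] with x hx
      rw [norm_of_nonneg (le_max_right _ _)]
      exact max_le (by linarith [le_abs_self (H x)]) (abs_nonneg _)
    · filter_upwards [hlim] with x hx
      have := ((tendsto_const_nhds (x := H x)).sub hx).max (tendsto_const_nhds (x := (0 : ℝ)))
      simpa using this
  have h2 : ∀ n, ∫ x, |G n x - H x| ∂μ
      = (∫ x, G n x ∂μ) - (∫ x, H x ∂μ) + 2 * ∫ x, max (H x - G n x) 0 ∂μ := by
    intro n
    rw [← integral_sub (hG n) hH, ← integral_const_mul]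
    refine Eq.trans ?_ (integral_add (f := fun x => G n x - H x)
      (g := fun x => 2 * max (H x - G n x) 0) ((hG n).sub hH)
      (((hH.sub (hG n)).pos_part).const_mul 2))
    refine integral_congr_ae (of_forall fun x => ?_)
    change |G n x - H x| = G n x - H x + 2 * max (H x - G n x) 0
    rcases le_total (G n x) (H x) with h | h
    · rw [abs_of_nonpos (by linarith), max_eq_left (by linarith)]; ring
    · rw [abs_of_nonneg (by linarith), max_eq_right (by linarith)]; ring
  simp only [h2]
  have := (hint.sub_const (∫ x, H x ∂μ)).add (h1.const_mul 2)
  simpa using this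

theorem tendsto_integral_of_dominated_sequence {f G : ℕ → α → ℝ} {g H : α → ℝ}
    (hf : ∀ n, AEStronglyMeasurable (f n) μ) (hg : AEStronglyMeasurable g μ)
    (hG : ∀ n, Integrable (G n) μ)
    (hH : Integrable H μ) (hb : ∀ᶠ n in atTop, ∀ᵐ x ∂μ, |f n x| ≤ G n x)
    (h0 : ∀ n, ∀ᵐ x ∂μ, 0 ≤ G n x)
    (hlim : ∀ᵐ x ∂μ, Tendsto (fun n => G n x) atTop (𝓝 (H x)))
    (hint : Tendsto (fun n => ∫ x, G n x ∂μ) atTop (𝓝 (∫ x, H x ∂μ)))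
    (hfl : ∀ᵐ x ∂μ, Tendsto (fun n => f n x) atTop (𝓝 (g x))) :
    Integrable g μ ∧ Tendsto (fun n => ∫ x, f n x ∂μ) atTop (𝓝 (∫ x, g x ∂μ)) := by
  have hgH : ∀ᵐ x ∂μ, |g x| ≤ H x := by
    obtain ⟨n0, hn0⟩ := eventually_atTop.1 hb
    have hb' : ∀ᵐ x ∂μ, ∀ n, n0 ≤ n → |f n x| ≤ G n x := by
      rw [ae_all_iff]; intro n
      by_cases hn : n0 ≤ n
      · filter_upwards [hn0 n hn] with x hx _ using hx
      · exact of_forall fun x h => absurd h hn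
    filter_upwards [hb', hlim, hfl] with x h1 h2 h3
    exact le_of_tendsto_of_tendsto h3.abs h2 (eventually_atTop.2 ⟨n0, fun n hn => h1 n hn⟩)
  have hgi : Integrable g μ := hH.mono' hg hgH
  refine ⟨hgi, ?_⟩
  have hA := tendsto_integral_abs_sub hG hH h0 hlim hint
  have hB : Tendsto (fun n => ∫ x, max (|f n x - g x| - |G n x - H x|) 0 ∂μ) atTop
      (𝓝 (∫ _, (0 : ℝ) ∂μ)) := by
    refine tendsto_integral_filter_of_dominated_convergence (fun x => 2 * H x) ?_ ?_
      (hH.const_mul 2) ?_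
    · exact of_forall fun n => (((continuous_abs.comp_aestronglyMeasurable
        ((hf n).sub hg)).sub (continuous_abs.comp_aestronglyMeasurable
        ((hG n).aestronglyMeasurable.sub hH.aestronglyMeasurable))).sup
        aestronglyMeasurable_const)
    · filter_upwards [hb] with n hn
      filter_upwards [hn, hgH] with x h1 h2
      rw [norm_of_nonneg (le_max_right _ _)]
      refine max_le ?_ (by linarith [abs_nonneg (g x)])
      have := abs_sub (f n x) (g x)
      have := le_abs_self (G n x - H x)
      linarith
    · filter_upwards [hfl, hlim] with x h1 h2
      have := ((((h1.sub_const (g x)).abs).sub ((h2.sub_const (H x)).abs))).max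
        (tendsto_const_nhds (x := (0 : ℝ)))
      simpa using this
  rw [tendsto_iff_norm_sub_tendsto_zero]
  have hC := hB.add hA
  simp only [integral_zero, add_zero] at hC
  refine squeeze_zero' (of_forall fun n => norm_nonneg _) ?_ hC
  filter_upwards [hb] with n hn
  have hfi : Integrable (f n) μ := (hG n).mono' (hf n) hn
  have i1 : Integrable (fun x => |f n x - g x|) μ := (hfi.sub hgi).abs
  have i2 : Integrable (fun x => |G n x - H x|) μ := ((hG n).sub hH).abs
  rw [← integral_sub hfi hgi]
  refine (norm_integral_le_integral_norm _).trans ?_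
  refine le_trans ?_ (integral_add
    (f := fun x => max (|f n x - g x| - |G n x - H x|) 0) (g := fun x => |G n x - H x|)
    ((i1.sub i2).pos_part) i2).le
  refine integral_mono (hfi.sub hgi).norm (((i1.sub i2).pos_part).add i2) fun x => ?_
  change |f n x - g x| ≤ max (|f n x - g x| - |G n x - H x|) 0 + |G n x - H x|
  linarith [le_max_left (|f n x - g x| - |G n x - H x|) 0]

end Pratt

/-! ### Mollification -/

section Moll

variable {F : Type*} [NormedAddCommGroup F] [NormedSpace ℝ F]
  [MeasurableSpace F] [BorelSpace F] {μ : Measure F}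
  {ι : Type*} [Fintype ι]

/-- Convolution of `f` with the kernel `k`. -/
def cv (μ : Measure F) (k f : F → ℝ) (p : F) : ℝ := ∫ q, f q * k (p - q) ∂μ

variable [FiniteDimensional ℝ F] [μ.IsAddHaarMeasure]

theorem cv_smooth {k f : F → ℝ} (hk : Sm k) (hc : HasCompactSupport k)
    (hf : LocallyIntegrable f μ) : Sm (cv μ k f) :=
  hc.contDiff_convolution_right (ContinuousLinearMap.lsmul ℝ ℝ) hf hk

theorem Dv_cv {k f : F → ℝ} (hk : Sm k) (hc : HasCompactSupport k)
    (hf : LocallyIntegrable f μ) (e : F) : Dv e (cv μ k f) = cv μ (Dv e k) f := by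
  ext p
  have hk1 : ContDiff ℝ 1 k := hk.of_le (by simp)
  have h := hc.hasFDerivAt_convolution_right (ContinuousLinearMap.lsmul ℝ ℝ) hf hk1 p
  change fderiv ℝ (convolution f k (ContinuousLinearMap.lsmul ℝ ℝ) μ) p e = _
  rw [h.fderiv, convolution_precompR_apply _ hf (hc.fderiv ℝ) (hk1.continuous_fderiv (by simp))]
  rfl

theorem lapS_cv {k f : F → ℝ} (hk : Sm k) (hc : HasCompactSupport k)
    (hf : LocallyIntegrable f μ) (e : ι → F) : lapS e (cv μ k f) = cv μ (lapS e k) f := by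
  ext p
  have hi : ∀ g : F → ℝ, Continuous g → HasCompactSupport g →
      Integrable (fun q => f q * g (p - q)) μ := fun g hg hgc =>
    (hgc.convolutionExists_right (ContinuousLinearMap.lsmul ℝ ℝ) hf hg) p
  unfold lapS
  simp only [Dv_cv hk hc hf, Dv_cv (hk.dv _) (hc.dv _) hf]
  simp only [cv, mul_sum]
  rw [integral_finsetSum]
  exact fun i _ => hi _ ((hk.dv _).dv _).continuous ((hc.dv _).dv _)

theorem locallyIntegrable_const_mul {f : F → ℝ} (hf : LocallyIntegrable f μ) (c : ℝ) :
    LocallyIntegrable (fun x => c * f x) μ := by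
  intro x
  obtain ⟨s, hs, h⟩ := hf x
  exact ⟨s, hs, h.const_mul c⟩

/-- Standard sequence of bump functions shrinking to the origin. -/
def bmp (F : Type*) [NormedAddCommGroup F] [NormedSpace ℝ F] (n : ℕ) : ContDiffBump (0 : F) where
  rIn := 1 / (2 * (n + 1 : ℝ))
  rOut := 1 / (n + 1 : ℝ)
  rIn_pos := by positivity
  rIn_lt_rOut := by
    have : (0 : ℝ) < n + 1 := by positivity
    exact one_div_lt_one_div_of_lt this (by linarith)

/-- Standard mollifier sequence. -/
def eta (μ : Measure F) (n : ℕ) : F → ℝ := (bmp F n).normed μ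

theorem eta_nonneg (n : ℕ) (x : F) : 0 ≤ eta μ n x := (bmp F n).nonneg_normed x
theorem eta_smooth (n : ℕ) : Sm (eta μ n) := (bmp F n).contDiff_normed
theorem eta_compact (n : ℕ) : HasCompactSupport (eta μ n) := (bmp F n).hasCompactSupport_normed
theorem eta_int (n : ℕ) : ∫ x, eta μ n x ∂μ = 1 := (bmp F n).integral_normed
theorem eta_tsupport (n : ℕ) : tsupport (eta μ n) = closedBall 0 (1 / (n + 1 : ℝ)) :=
  (bmp F n).tsupport_normed_eq

theorem eta_integrable (n : ℕ) : Integrable (eta μ n) μ := (bmp F n).integrable_normed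

/-- Mollification of `f`. -/
abbrev mo (μ : Measure F) (n : ℕ) (f : F → ℝ) : F → ℝ := cv μ (eta μ n) f

theorem mo_smooth (n : ℕ) {f : F → ℝ} (hf : LocallyIntegrable f μ) : Sm (mo μ n f) :=
  cv_smooth (eta_smooth n) (eta_compact n) hf

theorem mo_integrand (n : ℕ) {f : F → ℝ} (hf : LocallyIntegrable f μ) (p : F) :
    Integrable (fun q => f q * eta μ n (p - q)) μ :=
  ((eta_compact n).convolutionExists_right (ContinuousLinearMap.lsmul ℝ ℝ) hf
    (eta_smooth n).continuous) p

theorem mo_ae {f : F → ℝ} (hf : LocallyIntegrable f μ) :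
    ∀ᵐ p ∂μ, Tendsto (fun n => mo μ n f p) atTop (𝓝 (f p)) := by
  have := ContDiffBump.ae_convolution_tendsto_right_of_locallyIntegrable (φ := bmp F) (l := atTop)
    (K := 2) (tendsto_one_div_add_atTop_nhds_zero_nat) (of_forall fun n => by
      simp only [bmp]; rw [mul_one_div, div_le_div_iff₀ (by positivity) (by positivity)]; linarith) hf
  filter_upwards [this] with p hp
  refine hp.congr fun n => ?_
  rw [← convolution_flip]
  simp [convolution, mo, cv, eta, mul_comm]

theorem mo_nonneg (n : ℕ) {f : F → ℝ} (hf : ∀ x, 0 ≤ f x) (p : F) : 0 ≤ mo μ n f p :=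
  integral_nonneg fun q => mul_nonneg (hf q) (eta_nonneg n _)

theorem mo_mono (n : ℕ) {f g : F → ℝ} (hf : LocallyIntegrable f μ) (hg : LocallyIntegrable g μ)
    (h : ∀ᵐ x ∂μ, f x ≤ g x) (p : F) : mo μ n f p ≤ mo μ n g p := by
  refine integral_mono_ae (mo_integrand n hf p) (mo_integrand n hg p) ?_
  filter_upwards [h] with q hq using mul_le_mul_of_nonneg_right hq (eta_nonneg n _)

theorem mo_add (n : ℕ) {f g : F → ℝ} (hf : LocallyIntegrable f μ) (hg : LocallyIntegrable g μ)
    (p : F) : mo μ n (fun x => f x + g x) p = mo μ n f p + mo μ n g p := by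
  simp only [mo, cv, add_mul]
  exact integral_add (mo_integrand n hf p) (mo_integrand n hg p)

theorem mo_sub (n : ℕ) {f g : F → ℝ} (hf : LocallyIntegrable f μ) (hg : LocallyIntegrable g μ)
    (p : F) : mo μ n (fun x => f x - g x) p = mo μ n f p - mo μ n g p := by
  simp only [mo, cv, sub_mul]
  exact integral_sub (mo_integrand n hf p) (mo_integrand n hg p)

theorem mo_const_mul (n : ℕ) (c : ℝ) (f : F → ℝ) (p : F) :
    mo μ n (fun x => c * f x) p = c * mo μ n f p := by
  simp only [mo, cv, mul_assoc, integral_const_mul]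

theorem mo_const (n : ℕ) (c : ℝ) (p : F) : mo μ n (fun _ => c) p = c := by
  simp only [mo, cv, integral_const_mul]
  rw [integral_sub_left_eq_self, eta_int, mul_one]

theorem mo_abs_le (n : ℕ) {f : F → ℝ} (p : F) :
    |mo μ n f p| ≤ mo μ n (fun x => |f x|) p := by
  refine (abs_integral_le_integral_abs).trans (le_of_eq ?_)
  refine integral_congr_ae (of_forall fun q => ?_)
  simp [abs_mul, abs_of_nonneg (eta_nonneg n _)]

theorem mo_integrable (n : ℕ) {f : F → ℝ} (hf : Integrable f μ) : Integrable (mo μ n f) μ :=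
  hf.integrable_convolution (ContinuousLinearMap.lsmul ℝ ℝ) (eta_integrable n)

theorem mo_integral (n : ℕ) {f : F → ℝ} (hf : Integrable f μ) :
    ∫ p, mo μ n f p ∂μ = ∫ p, f p ∂μ := by
  have := integral_convolution (ContinuousLinearMap.lsmul ℝ ℝ) hf (eta_integrable (μ := μ) n)
  rw [eta_int] at this
  refine this.trans ?_
  simp

/-- Sequences dominated by mollifications of an integrable function pass to the limit. -/
theorem tendsto_integral_of_le_mo {f : ℕ → F → ℝ} {g H : F → ℝ}
    (hf : ∀ n, AEStronglyMeasurable (f n) μ) (hg : AEStronglyMeasurable g μ)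
    (hH : Integrable H μ) (h0 : ∀ x, 0 ≤ H x) (hb : ∀ᶠ n in atTop, ∀ x, |f n x| ≤ mo μ n H x)
    (hfl : ∀ᵐ x ∂μ, Tendsto (fun n => f n x) atTop (𝓝 (g x))) :
    Integrable g μ ∧ Tendsto (fun n => ∫ x, f n x ∂μ) atTop (𝓝 (∫ x, g x ∂μ)) :=
  tendsto_integral_of_dominated_sequence hf hg (fun n => mo_integrable n hH) hH
    (hb.mono fun n hn => of_forall hn) (fun n => of_forall (mo_nonneg n h0))
    (mo_ae hH.locallyIntegrable)
    (by simp only [mo_integral _ hH]; exact tendsto_const_nhds) hfl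

theorem mo_rpow_le (n : ℕ) {f : F → ℝ} {r : ℝ} (hr : 1 < r) (h0 : ∀ x, 0 ≤ f x)
    (hf : LocallyIntegrable f μ) (hfr : LocallyIntegrable (fun x => f x ^ r) μ) (p : F) :
    mo μ n f p ^ r ≤ mo μ n (fun x => f x ^ r) p := by
  set c := mo μ n f p
  have hc : 0 ≤ c := mo_nonneg n h0 p
  rcases hc.eq_or_lt with hc0 | hc0
  · rw [← hc0, zero_rpow (by linarith)]
    exact mo_nonneg n (fun x => rpow_nonneg (h0 x) _) p
  have hr' : (r / (r - 1)).HolderConjugate r := by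
    rw [Real.holderConjugate_comm]; exact Real.HolderConjugate.conjExponent hr
  have hpt : ∀ x, c ^ (r - 1) * f x ≤ (r - 1) / r * c ^ r + 1 / r * f x ^ r := by
    intro x
    have h1 := Real.young_inequality_of_nonneg (rpow_nonneg hc (r - 1)) (h0 x) hr'
    rw [← rpow_mul hc] at h1
    have : (r - 1) * (r / (r - 1)) = r := by field_simp [show r - 1 ≠ 0 by linarith]
    rw [this] at h1
    refine h1.trans (le_of_eq ?_)
    field_simp
  have h2 := mo_mono (μ := μ) n (f := fun x => c ^ (r - 1) * f x)
    (g := fun x => (r - 1) / r * c ^ r + 1 / r * f x ^ r) (locallyIntegrable_const_mul hf (c ^ (r - 1)))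
    ((locallyIntegrable_const _).add (locallyIntegrable_const_mul hfr (1 / r))) (of_forall hpt) p
  rw [mo_const_mul, mo_add n (locallyIntegrable_const _) (locallyIntegrable_const_mul hfr (1 / r)), mo_const,
    mo_const_mul n (1 / r)] at h2
  change c ^ (r - 1) * c ≤ _ at h2
  rw [← rpow_add_one hc0.ne', sub_add_cancel] at h2
  have hr0 : 0 < r := by linarith
  have h3 : 1 / r * c ^ r ≤ 1 / r * mo μ n (fun x => f x ^ r) p := by
    have : (r - 1) / r * c ^ r = c ^ r - 1 / r * c ^ r := by field_simp
    linarith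
  exact le_of_mul_le_mul_left h3 (by positivity)

end Moll

/-! ### Distributional sub- and super-solutions -/

instance {N : ℕ} : (volume : Measure (EuT N)).IsAddHaarMeasure :=
  inferInstanceAs ((volume : Measure (Eu N)).prod (volume : Measure ℝ)).IsAddHaarMeasure

/-- Unit vector in a spatial direction. -/
def eX {N : ℕ} (i : Fin N) : EuT N := (EuclideanSpace.single i 1, 0)

/-- Unit vector in the time direction. -/
def eT {N : ℕ} : EuT N := (0, 1)

/-- `a_t ≤ Δ g` in the sense of distributions on `O`. -/
def SubPair {N : ℕ} (O : Set (EuT N)) (a g : EuT N → ℝ) : Prop :=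
  ∀ ψ : EuT N → ℝ, Sm ψ → HasCompactSupport ψ → tsupport ψ ⊆ O → (∀ p, 0 ≤ ψ p) →
    0 ≤ ∫ p, (a p * Dv eT ψ p + g p * lapS eX ψ p)

/-- `a_t = Δ g` in the sense of distributions on `O`. -/
def SolPair {N : ℕ} (O : Set (EuT N)) (a g : EuT N → ℝ) : Prop :=
  ∀ ψ : EuT N → ℝ, Sm ψ → HasCompactSupport ψ → tsupport ψ ⊆ O →
    ∫ p, (a p * Dv eT ψ p + g p * lapS eX ψ p) = 0

section Pairs

variable {N : ℕ} {O : Set (EuT N)} {a g : EuT N → ℝ}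

theorem SolPair.subPair (h : SolPair O a g) : SubPair O a g :=
  fun ψ h1 h2 h3 _ => (h ψ h1 h2 h3).ge

theorem SubPair.mono (h : SubPair O a g) {O' : Set (EuT N)} (hO : O' ⊆ O) : SubPair O' a g :=
  fun ψ h1 h2 h3 => h ψ h1 h2 (h3.trans hO)

theorem SolPair.mono (h : SolPair O a g) {O' : Set (EuT N)} (hO : O' ⊆ O) : SolPair O' a g :=
  fun ψ h1 h2 h3 => h ψ h1 h2 (h3.trans hO)

theorem pair_integrand_congr {a' g' : EuT N → ℝ} {ψ : EuT N → ℝ}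
    (hs : tsupport ψ ⊆ O) (ha : ∀ᵐ p, p ∈ O → a p = a' p) (hg : ∀ᵐ p, p ∈ O → g p = g' p) :
    ∫ p, (a p * Dv eT ψ p + g p * lapS eX ψ p) = ∫ p, (a' p * Dv eT ψ p + g' p * lapS eX ψ p) := by
  refine integral_congr_ae ?_
  filter_upwards [ha, hg] with p h1 h2
  by_cases hp : p ∈ tsupport ψ
  · rw [h1 (hs hp), h2 (hs hp)]
  · rw [dv_eq_zero hp, lapS_eq_zero hp]; simp

theorem SubPair.congr {a' g' : EuT N → ℝ} (h : SubPair O a g)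
    (ha : ∀ᵐ p, p ∈ O → a p = a' p) (hg : ∀ᵐ p, p ∈ O → g p = g' p) : SubPair O a' g' :=
  fun ψ h1 h2 h3 h4 => by rw [← pair_integrand_congr h3 ha hg]; exact h ψ h1 h2 h3 h4

theorem SolPair.congr {a' g' : EuT N → ℝ} (h : SolPair O a g)
    (ha : ∀ᵐ p, p ∈ O → a p = a' p) (hg : ∀ᵐ p, p ∈ O → g p = g' p) : SolPair O a' g' :=
  fun ψ h1 h2 h3 => by rw [← pair_integrand_congr h3 ha hg]; exact h ψ h1 h2 h3

theorem reflect_smooth {k : EuT N → ℝ} (hk : Sm k) (p : EuT N) : Sm (fun q => k (p - q)) :=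
  hk.comp (contDiff_const.sub contDiff_id)

theorem reflect_tsupport {k : EuT N → ℝ} (p : EuT N) :
    tsupport (fun q => k (p - q)) = (fun q => p - q) ⁻¹' tsupport k :=
  tsupport_comp_eq_preimage k (Homeomorph.subLeft p)

theorem reflect_compact {k : EuT N → ℝ} (hk : HasCompactSupport k) (p : EuT N) :
    HasCompactSupport (fun q => k (p - q)) :=
  hk.comp_homeomorph (Homeomorph.subLeft p)

theorem Dv_neg_dir {F : Type*} [NormedAddCommGroup F] [NormedSpace ℝ F] (e : F) (f : F → ℝ)
    (p : F) : Dv (-e) f p = -Dv e f p := by simp [Dv]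

theorem Dv_reflect {k : EuT N → ℝ} (hk : Sm k) (p q e : EuT N) :
    Dv e (fun q => k (p - q)) q = -Dv e k (p - q) := by
  have := Dv_affine hk (-ContinuousLinearMap.id ℝ (EuT N)) p e q
  simp only [neg_apply, ContinuousLinearMap.id_apply, neg_add_eq_sub] at this
  rw [this, Dv_neg_dir]

theorem lapS_reflect {ι : Type*} [Fintype ι] {k : EuT N → ℝ} (hk : Sm k) (p q : EuT N)
    (e : ι → EuT N) : lapS e (fun q => k (p - q)) q = lapS e k (p - q) := by
  unfold lapS
  refine sum_congr rfl fun i _ => ?_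
  rw [show Dv (e i) (fun q => k (p - q)) = fun q => -1 * Dv (e i) k (p - q) from
    funext fun q => by rw [Dv_reflect hk]; ring,
    Dv_const_mul (reflect_smooth (hk.dv _) p), Dv_reflect (hk.dv _)]
  ring

theorem cv_pair {k : EuT N → ℝ} (hk : Sm k) (hc : HasCompactSupport k)
    (ha : LocallyIntegrable a) (hg : LocallyIntegrable g) (p : EuT N) :
    ∫ q, (a q * Dv eT (fun q => k (p - q)) q + g q * lapS eX (fun q => k (p - q)) q)
      = lapS eX (cv volume k g) p - Dv eT (cv volume k a) p := by
  have i1 : Integrable (fun q => a q * Dv eT k (p - q)) :=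
    (hc.dv eT).convolutionExists_right (ContinuousLinearMap.lsmul ℝ ℝ) ha (hk.dv eT).continuous p
  have i2 : Integrable (fun q => g q * lapS eX k (p - q)) :=
    (hc.lapS eX).convolutionExists_right (ContinuousLinearMap.lsmul ℝ ℝ) hg
      (hk.lapS eX).continuous p
  rw [lapS_cv hk hc hg, Dv_cv hk hc ha]
  simp only [Dv_reflect hk, lapS_reflect hk]
  change _ = (∫ q, g q * lapS eX k (p - q)) - ∫ q, a q * Dv eT k (p - q)
  rw [← integral_sub i2 i1]
  refine integral_congr_ae (of_forall fun q => ?_)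
  change a q * -Dv eT k (p - q) + g q * lapS eX k (p - q)
    = g q * lapS eX k (p - q) - a q * Dv eT k (p - q)
  ring

theorem eventually_reflect_subset {K : Set (EuT N)} (hK : IsCompact K) (hO : IsOpen O)
    (hKO : K ⊆ O) : ∀ᶠ n : ℕ in atTop, ∀ p ∈ K,
      tsupport (fun q => eta (volume : Measure (EuT N)) n (p - q)) ⊆ O := by
  obtain ⟨δ, hδ, hs⟩ := hK.exists_cthickening_subset_open hO hKO
  have := (tendsto_order.1 (tendsto_one_div_add_atTop_nhds_zero_nat (𝕜 := ℝ))).2 δ hδ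
  filter_upwards [this] with n hn p hp q hq
  rw [reflect_tsupport, eta_tsupport] at hq
  simp only [mem_preimage, mem_closedBall, dist_zero_right] at hq
  refine hs (mem_cthickening_of_dist_le q p δ K hp ?_)
  rw [dist_comm, dist_eq_norm]
  exact hq.trans hn.le

theorem SubPair.mo (h : SubPair O a g) (hO : IsOpen O) (ha : LocallyIntegrable a)
    (hg : LocallyIntegrable g) {K : Set (EuT N)} (hK : IsCompact K) (hKO : K ⊆ O) :
    ∀ᶠ n : ℕ in atTop, ∀ p ∈ K, Dv eT (mo volume n a) p ≤ lapS eX (mo volume n g) p := by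
  filter_upwards [eventually_reflect_subset hK hO hKO] with n hn p hp
  have := h _ (reflect_smooth (eta_smooth n) p) (reflect_compact (eta_compact n) p) (hn p hp)
    fun q => eta_nonneg n _
  rw [cv_pair (eta_smooth n) (eta_compact n) ha hg] at this
  linarith

theorem SolPair.mo (h : SolPair O a g) (hO : IsOpen O) (ha : LocallyIntegrable a)
    (hg : LocallyIntegrable g) {K : Set (EuT N)} (hK : IsCompact K) (hKO : K ⊆ O) :
    ∀ᶠ n : ℕ in atTop, ∀ p ∈ K, Dv eT (mo volume n a) p = lapS eX (mo volume n g) p := by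
  filter_upwards [eventually_reflect_subset hK hO hKO] with n hn p hp
  have := h _ (reflect_smooth (eta_smooth n) p) (reflect_compact (eta_compact n) p) (hn p hp)
  rw [cv_pair (eta_smooth n) (eta_compact n) ha hg] at this
  linarith

end Pairs

/-! ### A regularized Newtonian kernel with a strict superharmonicity reserve -/

/-- Standard basis vectors. -/
def eB {N : ℕ} (i : Fin N) : Eu N := EuclideanSpace.single i 1

/-- Regularized square of the norm. -/
def qr {N : ℕ} (r : ℝ) (z : Eu N) : ℝ := ‖z‖ ^ 2 + r ^ 2

/-- Regularized kernel. -/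
def Kr {N : ℕ} (r : ℝ) (z : Eu N) : ℝ :=
  qr r z ^ ((2 - N) / 2 : ℝ) + qr r z ^ ((5 / 2 - N) / 2 : ℝ)

/-- Minus the Laplacian of the regularized Newtonian kernel. -/
def mr {N : ℕ} (r : ℝ) (z : Eu N) : ℝ :=
  N * (N - 2) * r ^ 2 * qr r z ^ ((2 - N) / 2 - 2 : ℝ)

section Kernel

variable {N : ℕ} {r : ℝ}

theorem qr_pos (hr : 0 < r) (z : Eu N) : 0 < qr r z := by unfold qr; positivity

theorem qr_smooth (r : ℝ) : Sm (qr r : Eu N → ℝ) :=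
  (contDiff_norm_sq ℝ).add contDiff_const

theorem qr_eq (z : Eu N) : qr r z = ∑ i, z i ^ 2 + r ^ 2 := by
  simp [qr, EuclideanSpace.norm_sq_eq]

theorem Dv_qr (z : Eu N) (i : Fin N) : Dv (eB i) (qr r) z = 2 * z i := by
  have h : HasFDerivAt (qr r : Eu N → ℝ) (2 • (innerSL ℝ z)) z :=
    (HasStrictFDerivAt.hasFDerivAt (hasStrictFDerivAt_norm_sq z)).add_const _
  simp [Dv, h.fderiv, eB, EuclideanSpace.inner_single_right]

theorem Dv_rpow {F : Type*} [NormedAddCommGroup F] [NormedSpace ℝ F] {f : F → ℝ} (hf : Sm f)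
    (h0 : ∀ x, 0 < f x) (s : ℝ) (e p : F) :
    Dv e (fun x => f x ^ s) p = s * f p ^ (s - 1) * Dv e f p := by
  have h := (hf.diff p).hasFDerivAt.rpow_const (p := s) (Or.inl (h0 p).ne')
  simp [Dv, h.fderiv]

theorem Sm.rpow {F : Type*} [NormedAddCommGroup F] [NormedSpace ℝ F] {f : F → ℝ} (hf : Sm f)
    (h0 : ∀ x, 0 < f x) (s : ℝ) : Sm (fun x => f x ^ s) :=
  hf.rpow_const_of_ne fun x => (h0 x).ne'

theorem coord_smooth (i : Fin N) : Sm (fun z : Eu N => z i) :=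
  (EuclideanSpace.proj (𝕜 := ℝ) i).contDiff

theorem Dv_coord (z : Eu N) (i : Fin N) : Dv (eB i) (fun z : Eu N => z i) z = 1 := by
  have h : HasFDerivAt (fun z : Eu N => z i) (EuclideanSpace.proj (𝕜 := ℝ) i) z :=
    (EuclideanSpace.proj (𝕜 := ℝ) i).hasFDerivAt
  rw [Dv, h.fderiv]
  simp [eB]

theorem Dv_qr_rpow (hr : 0 < r) (s : ℝ) (z : Eu N) (i : Fin N) :
    Dv (eB i) (fun z => qr r z ^ s) z = 2 * s * qr r z ^ (s - 1) * z i := by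
  rw [Dv_rpow (qr_smooth r) (qr_pos hr), Dv_qr]; ring

theorem lapS_qr_rpow (hr : 0 < r) (s : ℝ) (z : Eu N) :
    lapS eB (fun z => qr r z ^ s) z
      = 2 * s * qr r z ^ (s - 2) * ((2 * s - 2 + N) * ‖z‖ ^ 2 + N * r ^ 2) := by
  have key : ∀ i : Fin N, Dv (eB i) (Dv (eB i) fun z => qr r z ^ s) z
      = 2 * s * (2 * (s - 1) * qr r z ^ (s - 2) * z i ^ 2 + qr r z ^ (s - 1)) := by
    intro i
    rw [show Dv (eB i) (fun z => qr r z ^ s) = fun z => 2 * s * qr r z ^ (s - 1) * z i from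
      funext fun z => Dv_qr_rpow hr s z i,
      Dv_mul (contDiff_const.mul ((qr_smooth r).rpow (qr_pos hr) _)) (coord_smooth i), Dv_coord,
      Dv_const_mul ((qr_smooth r).rpow (qr_pos hr) _), Dv_qr_rpow hr,
      show s - 1 - 1 = s - 2 by ring]
    ring
  have e1 : qr r z ^ (s - 1) = qr r z ^ (s - 2) * (‖z‖ ^ 2 + r ^ 2) := by
    rw [show s - 1 = s - 2 + 1 by ring, rpow_add_one (qr_pos hr z).ne']; rfl
  unfold lapS
  simp only [key]
  rw [← mul_sum, sum_add_distrib, ← mul_sum, Finset.sum_const,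
    ← show ‖z‖ ^ 2 = ∑ i, z i ^ 2 by simp [EuclideanSpace.norm_sq_eq], e1]
  simp only [Finset.card_univ, Fintype.card_fin, nsmul_eq_mul]
  ring

theorem Kr_smooth (hr : 0 < r) : Sm (Kr r : Eu N → ℝ) :=
  ((qr_smooth r).rpow (qr_pos hr) _).add ((qr_smooth r).rpow (qr_pos hr) _)

theorem Kr_pos (hr : 0 < r) (z : Eu N) : 0 < Kr r z :=
  add_pos (rpow_pos_of_pos (qr_pos hr z) _) (rpow_pos_of_pos (qr_pos hr z) _)

theorem mr_nonneg (hN : 3 ≤ N) (hr : 0 < r) (z : Eu N) : 0 ≤ mr r z := by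
  have : (3 : ℝ) ≤ N := by exact_mod_cast hN
  have h2 : 0 ≤ (N : ℝ) - 2 := by linarith
  have := (rpow_pos_of_pos (qr_pos hr z) ((2 - N) / 2 - 2 : ℝ)).le
  unfold mr; positivity

theorem lapS_Kr_le (hN : 3 ≤ N) (hr : 0 < r) (z : Eu N) :
    lapS eB (Kr r) z ≤ -mr r z - 1 / 4 * qr r z ^ ((5 / 2 - N) / 2 - 1 : ℝ) := by
  have h3 : (3 : ℝ) ≤ N := by exact_mod_cast hN
  have hs : lapS eB (Kr r) z = lapS eB (fun z => qr r z ^ ((2 - N) / 2 : ℝ)) z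
      + lapS eB (fun z => qr r z ^ ((5 / 2 - N) / 2 : ℝ)) z := by
    unfold lapS Kr
    rw [← sum_add_distrib]
    refine sum_congr rfl fun i _ => ?_
    rw [← Dv_add (Sm.dv ((qr_smooth r).rpow (qr_pos hr) _) _)
      (Sm.dv ((qr_smooth r).rpow (qr_pos hr) _) _)]
    congr 1
    exact funext fun z => Dv_add ((qr_smooth r).rpow (qr_pos hr) _)
      ((qr_smooth r).rpow (qr_pos hr) _) _ _
  rw [hs, lapS_qr_rpow hr, lapS_qr_rpow hr]
  have e1 : qr r z ^ ((5 / 2 - N) / 2 - 1 : ℝ)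
      = qr r z ^ ((5 / 2 - N) / 2 - 2 : ℝ) * (‖z‖ ^ 2 + r ^ 2) := by
    rw [show ((5 / 2 - N) / 2 - 1 : ℝ) = (5 / 2 - N) / 2 - 2 + 1 by ring,
      rpow_add_one (qr_pos hr z).ne']; rfl
  rw [e1]
  have hp := (rpow_pos_of_pos (qr_pos hr z) ((5 / 2 - N) / 2 - 2 : ℝ)).le
  set P := qr r z ^ ((5 / 2 - N) / 2 - 2 : ℝ)
  unfold mr
  set Q := qr r z ^ ((2 - N) / 2 - 2 : ℝ)
  have hz : 0 ≤ ‖z‖ ^ 2 := by positivity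
  have hr2 : 0 ≤ r ^ 2 := by positivity
  set a := ‖z‖ ^ 2
  set b := r ^ 2
  have : 0 ≤ P * ((N - 5 / 2) * (1 / 2 * a + N * b) - 1 / 4 * (a + b)) := by
    refine mul_nonneg hp ?_
    nlinarith [mul_nonneg (sub_nonneg.2 h3) hz, mul_nonneg (sub_nonneg.2 h3) hr2,
      mul_nonneg (sub_nonneg.2 h3) (mul_nonneg (sub_nonneg.2 h3) hr2)]
  nlinarith

theorem qr_sq_coord_le (z : Eu N) (i : Fin N) : z i ^ 2 ≤ qr r z := by
  rw [qr_eq]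
  have := Finset.single_le_sum (f := fun i => z i ^ 2) (fun i _ => sq_nonneg _) (Finset.mem_univ i)
  simp only at this
  nlinarith [sq_nonneg r]

theorem kernel_error_le {k n : ℕ} (hk : n = k + 2) {X Y P H : ℝ} (h0 : 0 ≤ X) (hY0 : 0 < Y)
    (hY2 : Y ≤ 2) (hP0 : 0 < P) (hYP : Y ^ n * P = 1) (hH1 : 1 ≤ H) :
    X ^ k * (Y * P) * (-(1 / 4) * X ^ 2 + H * X * Y + H ^ 2 * Y ^ 2) ≤ 34 * (16 * H) ^ n := by
  rcases le_total (16 * H * Y) X with h | h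
  · have hHY : 0 ≤ H * Y := by positivity
    have : -(1 / 4) * X ^ 2 + H * X * Y + H ^ 2 * Y ^ 2 ≤ 0 := by
      nlinarith [mul_le_mul_of_nonneg_left h h0, mul_le_mul_of_nonneg_left h hHY]
    calc _ ≤ 0 := mul_nonpos_of_nonneg_of_nonpos (by positivity) this
      _ ≤ _ := by positivity
  · have hHY : 0 ≤ H * Y := by positivity
    have b1 : -(1 / 4) * X ^ 2 + H * X * Y + H ^ 2 * Y ^ 2 ≤ 17 * (H ^ 2 * Y ^ 2) := by
      nlinarith [mul_le_mul_of_nonneg_left h hHY, sq_nonneg X]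
    have b2 : X ^ k ≤ (16 * H * Y) ^ k := pow_le_pow_left₀ h0 h k
    calc _ ≤ (16 * H * Y) ^ k * (Y * P) * (17 * (H ^ 2 * Y ^ 2)) := by
          refine (mul_le_mul_of_nonneg_left b1 (by positivity)).trans ?_
          gcongr
      _ = 17 / 256 * (16 * H) ^ (k + 2) * (Y ^ (k + 2) * P) * Y := by ring
      _ = 17 / 256 * (16 * H) ^ n * Y := by rw [← hk, hYP, mul_one]
      _ ≤ 17 / 256 * (16 * H) ^ n * 2 := by gcongr
      _ ≤ _ := by
        have : 0 ≤ (16 * H) ^ n := by positivity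
        linarith

set_option maxHeartbeats 1000000 in
/-- Localized strict superharmonicity of the kernel. -/
theorem kernel_cutoff (hN : 3 ≤ N) (hr : 0 < r) {c : ℝ} (hc : 1 ≤ c) {ξ : Eu N → ℝ}
    (hξ : Sm ξ) (x y : Eu N) (h0 : 0 ≤ ξ y) (h1 : ξ y ≤ 1)
    (hd : ∀ i, |Dv (eB i) ξ y| ≤ c) (hdd : ∀ i, |Dv (eB i) (Dv (eB i) ξ) y| ≤ c)
    (hq : qr r (y - x) ≤ 9) :
    lapS eB (fun y => ξ y ^ (2 * N) * Kr r (y - x)) y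
      ≤ -(ξ y ^ (2 * N) * mr r (y - x)) + 34 * (384 * N ^ 3) ^ (2 * N) * c ^ (2 * N) := by
  have h3 : (3 : ℝ) ≤ N := by exact_mod_cast hN
  obtain ⟨k, hk⟩ : ∃ k, 2 * N = k + 2 := ⟨2 * N - 2, by omega⟩
  have hkN : (k : ℝ) + 2 = 2 * N := by exact_mod_cast hk.symm
  set z := y - x with hz
  set q := qr r z with hqd
  have hq0 : 0 < q := qr_pos hr z
  set Y := q ^ (1 / 4 : ℝ) with hY
  set P := q ^ (-N / 2 : ℝ) with hP
  have hY0 : 0 < Y := rpow_pos_of_pos hq0 _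
  have hP0 : 0 < P := rpow_pos_of_pos hq0 _
  have hY4 : Y ^ 4 = q := by rw [hY, ← rpow_natCast, ← rpow_mul hq0.le]; norm_num
  have hY2 : Y ≤ 2 := by
    by_contra! h
    nlinarith [pow_lt_pow_left₀ h (by norm_num) (n := 4) (by norm_num)]
  have hYP : Y ^ (2 * N) * P = 1 := by
    rw [hY, hP, ← rpow_natCast, ← rpow_mul hq0.le, ← rpow_add hq0]
    push_cast
    rw [show (1 / 4 * (2 * N) + -N / 2 : ℝ) = 0 by ring, Real.rpow_zero]
  have es1 : q ^ ((2 - N) / 2 : ℝ) = Y ^ 4 * P := by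
    rw [hY4, hP, show ((2 - N) / 2 : ℝ) = 1 + -N / 2 by ring, rpow_add hq0, rpow_one]
  have es2 : q ^ ((5 / 2 - N) / 2 : ℝ) = Y ^ 5 * P := by
    rw [pow_succ, hY4, hP, show ((5 / 2 - N) / 2 : ℝ) = 1 + 1 / 4 + -N / 2 by ring,
      rpow_add hq0, rpow_add hq0, rpow_one]
  have es3 : q ^ ((2 - N) / 2 - 1 : ℝ) = P := by
    rw [hP]; congr 1; ring
  have es4 : q ^ ((5 / 2 - N) / 2 - 1 : ℝ) = Y * P := by
    rw [hP, hY, show ((5 / 2 - N) / 2 - 1 : ℝ) = 1 / 4 + -N / 2 by ring, rpow_add hq0]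
  have hKs : Sm (fun y => Kr r (y - x)) :=
    (Kr_smooth hr).comp (contDiff_id.sub contDiff_const)
  have hDK : ∀ i, Dv (eB i) (fun y => Kr r (y - x)) y
      = ((2 - N) * P + (5 / 2 - N) * (Y * P)) * z i := by
    intro i
    have h := Dv_affine (Kr_smooth (N := N) hr) (ContinuousLinearMap.id ℝ (Eu N)) (-x) (eB i) y
    simp only [ContinuousLinearMap.id_apply, ← sub_eq_add_neg] at h
    rw [h, ← hz]
    unfold Kr
    rw [Dv_add ((qr_smooth r).rpow (qr_pos hr) _) ((qr_smooth r).rpow (qr_pos hr) _),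
      Dv_qr_rpow hr, Dv_qr_rpow hr, ← hqd, es3, es4]
    ring
  have hLK : lapS eB (fun y => Kr r (y - x)) y ≤ -mr r z - 1 / 4 * (Y * P) := by
    have h := lapS_affine (Kr_smooth (N := N) hr) (ContinuousLinearMap.id ℝ (Eu N)) (-x) eB y
    simp only [ContinuousLinearMap.id_apply, ← sub_eq_add_neg] at h
    rw [h, ← hz, ← es4]
    exact lapS_Kr_le hN hr z
  set X := ξ y with hX
  have hDζ : ∀ i, Dv (eB i) (fun y => ξ y ^ (2 * N)) y
      = 2 * N * X ^ (k + 1) * Dv (eB i) ξ y := by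
    intro i
    rw [Dv_pow hξ, show 2 * N - 1 = k + 1 by omega]; push_cast; ring
  have hDDζ : ∀ i, Dv (eB i) (Dv (eB i) fun y => ξ y ^ (2 * N)) y
      = 2 * N * ((k + 1) * X ^ k * Dv (eB i) ξ y ^ 2 + X ^ (k + 1) * Dv (eB i) (Dv (eB i) ξ) y) := by
    intro i
    rw [show Dv (eB i) (fun y => ξ y ^ (2 * N)) = fun y => (2 * N * ξ y ^ (k + 1)) * Dv (eB i) ξ y
      from funext fun y => by rw [Dv_pow hξ, show 2 * N - 1 = k + 1 by omega]; push_cast; ring,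
      Dv_mul (contDiff_const.mul (hξ.pow _)) (hξ.dv _), Dv_const_mul (hξ.pow _), Dv_pow hξ]
    push_cast
    ring
  have hXk : 0 ≤ X ^ k := pow_nonneg h0 k
  have hXk1 : 0 ≤ X ^ (k + 1) := pow_nonneg h0 _
  have hXk1' : X ^ (k + 1) ≤ X ^ k := pow_le_pow_of_le_one h0 h1 (by omega)
  have hcc : c ≤ c ^ 2 := by nlinarith
  have hLζ : lapS eB (fun y => ξ y ^ (2 * N)) y ≤ 4 * N ^ 3 * c ^ 2 * X ^ k := by
    have hb : ∀ i : Fin N, Dv (eB i) (Dv (eB i) fun y => ξ y ^ (2 * N)) y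
        ≤ 4 * N ^ 2 * c ^ 2 * X ^ k := by
      intro i
      rw [hDDζ]
      have a1 : Dv (eB i) ξ y ^ 2 ≤ c ^ 2 := sq_le_sq' (abs_le.1 (hd i)).1 (abs_le.1 (hd i)).2
      have a2 : Dv (eB i) (Dv (eB i) ξ) y ≤ c ^ 2 := (abs_le.1 (hdd i)).2.trans hcc
      have a3 : X ^ k * Dv (eB i) ξ y ^ 2 ≤ X ^ k * c ^ 2 := mul_le_mul_of_nonneg_left a1 hXk
      have a4 : X ^ (k + 1) * Dv (eB i) (Dv (eB i) ξ) y ≤ X ^ k * c ^ 2 :=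
        (mul_le_mul_of_nonneg_left a2 hXk1).trans
          (mul_le_mul_of_nonneg_right hXk1' (by positivity))
      calc _ ≤ 2 * N * ((k + 1) * (X ^ k * c ^ 2) + X ^ k * c ^ 2) := by
            refine mul_le_mul_of_nonneg_left ?_ (by positivity)
            rw [mul_assoc]
            exact add_le_add (mul_le_mul_of_nonneg_left a3 (by positivity)) a4
        _ = 2 * N * (k + 2) * c ^ 2 * X ^ k := by ring
        _ = _ := by rw [hkN]; ring
    calc _ ≤ ∑ _i : Fin N, 4 * (N : ℝ) ^ 2 * c ^ 2 * X ^ k := sum_le_sum fun i _ => hb i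
      _ = _ := by simp; ring
  have hgrad : ∑ i, Dv (eB i) (fun y => ξ y ^ (2 * N)) y * Dv (eB i) (fun y => Kr r (y - x)) y
      ≤ 6 * N ^ 3 * c * X ^ (k + 1) * (P * Y ^ 2) := by
    have hb : ∀ i : Fin N, Dv (eB i) (fun y => ξ y ^ (2 * N)) y
        * Dv (eB i) (fun y => Kr r (y - x)) y ≤ 6 * N ^ 2 * c * X ^ (k + 1) * (P * Y ^ 2) := by
      intro i
      rw [hDζ, hDK]
      have a1 : |z i| ≤ Y ^ 2 := by
        refine abs_le_of_sq_le_sq ?_ (by positivity)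
        rw [← pow_mul, hY4]; exact qr_sq_coord_le z i
      have a2 : |(2 - N) * P + (5 / 2 - N) * (Y * P)| ≤ 3 * N * P := by
        rw [abs_le]; constructor <;> nlinarith [mul_pos hY0 hP0, mul_le_mul_of_nonneg_right hY2 hP0.le,
          mul_le_mul_of_nonneg_right h3 (mul_pos hY0 hP0).le, mul_le_mul_of_nonneg_right h3 hP0.le,
          mul_nonneg (show (0 : ℝ) ≤ N by linarith) (sub_nonneg.2 (mul_le_mul_of_nonneg_right hY2 hP0.le))]
      refine (le_abs_self _).trans ?_
      rw [abs_mul, abs_mul (2 * (N : ℝ) * X ^ (k + 1)), abs_mul (_ + _),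
        abs_of_nonneg (show 0 ≤ 2 * N * X ^ (k + 1) by positivity)]
      calc _ ≤ 2 * N * X ^ (k + 1) * c * (3 * N * P * Y ^ 2) := by
            gcongr
            exact hd i
        _ = _ := by ring
    calc _ ≤ ∑ _i : Fin N, 6 * (N : ℝ) ^ 2 * c * X ^ (k + 1) * (P * Y ^ 2) :=
          sum_le_sum fun i _ => hb i
      _ = _ := by simp; ring
  rw [lapS_mul (hξ.pow _) hKs]
  have hK : Kr r z = Y ^ 4 * P + Y ^ 5 * P := by unfold Kr; rw [← hqd, es1, es2]
  have hK0 : 0 ≤ Kr r z := (Kr_pos hr z).le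
  have hK' : Kr r z ≤ 6 * (Y ^ 3 * P) := by
    rw [hK]
    have : Y ^ 4 * P + Y ^ 5 * P = Y * (1 + Y) * (Y ^ 3 * P) := by ring
    rw [this]
    refine mul_le_mul_of_nonneg_right ?_ (by positivity)
    nlinarith
  set H : ℝ := 24 * N ^ 3 * c with hH
  have hN3 : (27 : ℝ) ≤ N ^ 3 := by
    have := pow_le_pow_left₀ (by norm_num) h3 3; norm_num at this; exact this
  have hH1 : 1 ≤ H := by rw [hH]; nlinarith
  have t1 : X ^ (2 * N) * lapS eB (fun y => Kr r (y - x)) y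
      ≤ X ^ (2 * N) * (-mr r z - 1 / 4 * (Y * P)) :=
    mul_le_mul_of_nonneg_left hLK (by positivity)
  have t2 : Kr r z * lapS eB (fun y => ξ y ^ (2 * N)) y
      ≤ 6 * (Y ^ 3 * P) * (4 * N ^ 3 * c ^ 2 * X ^ k) :=
    (mul_le_mul_of_nonneg_left hLζ hK0).trans (mul_le_mul_of_nonneg_right hK' (by positivity))
  have main := kernel_error_le hk h0 hY0 hY2 hP0 hYP hH1
  have hfin : 34 * (16 * H) ^ (2 * N) = 34 * (384 * N ^ 3) ^ (2 * N) * c ^ (2 * N) := by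
    rw [hH, show 16 * (24 * (N : ℝ) ^ 3 * c) = 384 * N ^ 3 * c by ring, mul_pow]; ring
  rw [← hfin]
  refine le_trans ?_ (add_le_add (le_refl _) main)
  have hX2 : X ^ (2 * N) = X ^ k * X ^ 2 := by rw [hk, pow_add]
  have hXs : X ^ (k + 1) = X ^ k * X := pow_succ _ _
  rw [hX2] at t1 ⊢
  rw [hXs] at hgrad
  have hHsq : 24 * N ^ 3 * c ^ 2 ≤ H ^ 2 := by
    rw [hH]
    nlinarith [mul_nonneg (sub_nonneg.2 hN3) (sq_nonneg c), mul_nonneg (mul_nonneg (sub_nonneg.2 hN3) (sq_nonneg c)) (show (0 : ℝ) ≤ N ^ 3 by positivity)]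
  have t3 : 24 * N ^ 3 * c ^ 2 * (X ^ k * (Y * P) * Y ^ 2) ≤ H ^ 2 * (X ^ k * (Y * P) * Y ^ 2) :=
    mul_le_mul_of_nonneg_right hHsq (by positivity)
  have t4 : 12 * N ^ 3 * c * (X ^ k * X * (P * Y ^ 2)) ≤ H * (X ^ k * X * (P * Y ^ 2)) := by
    refine mul_le_mul_of_nonneg_right ?_ (by positivity)
    rw [hH]; nlinarith [mul_nonneg (show (0:ℝ) ≤ N ^ 3 by positivity) (show 0 ≤ c by linarith)]
  linarith

end Kernel

section KernelBounds

variable {N : ℕ} {r : ℝ}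

theorem Kr_neg (z : Eu N) : Kr r (-z) = Kr r z := by simp [Kr, qr]

theorem Kr_le (hN : 3 ≤ N) (hr : 0 < r) {z : Eu N} {κ : ℝ} (hκ : 0 < κ) (hz : κ ≤ ‖z‖)
    (hq : qr r z ≤ 9) : Kr r z ≤ 3 * κ ^ (2 - N : ℝ) := by
  have h3 : (3 : ℝ) ≤ N := by exact_mod_cast hN
  have hq0 := qr_pos hr z
  have e : qr r z ^ ((5 / 2 - N) / 2 : ℝ) = qr r z ^ (1 / 4 : ℝ) * qr r z ^ ((2 - N) / 2 : ℝ) := by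
    rw [← rpow_add hq0]; congr 1; ring
  have h9 : qr r z ^ (1 / 4 : ℝ) ≤ 2 := by
    calc _ ≤ (16 : ℝ) ^ (1 / 4 : ℝ) := rpow_le_rpow hq0.le (by linarith) (by norm_num)
      _ = 2 := by
        rw [show (16 : ℝ) = 2 ^ (4 : ℝ) by norm_num, ← rpow_mul (by norm_num)]; norm_num
  have hle : qr r z ^ ((2 - N) / 2 : ℝ) ≤ κ ^ (2 - N : ℝ) := by
    have h1 : κ ^ 2 ≤ qr r z := by
      unfold qr; nlinarith [pow_le_pow_left₀ hκ.le hz 2, sq_nonneg r]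
    calc _ ≤ (κ ^ 2) ^ ((2 - N) / 2 : ℝ) :=
          rpow_le_rpow_of_nonpos (by positivity) h1 (by linarith)
      _ = _ := by rw [← rpow_natCast, ← rpow_mul hκ.le]; congr 1; push_cast; ring
  unfold Kr
  rw [e]
  nlinarith [rpow_pos_of_pos hq0 ((2 - N) / 2 : ℝ)]

theorem mr_ge (hN : 3 ≤ N) (hr : 0 < r) {z : Eu N} (hz : ‖z‖ ≤ r) :
    (2 : ℝ) ^ (-(N + 2) / 2 : ℝ) * (r ^ N)⁻¹ ≤ mr r z := by
  have h3 : (3 : ℝ) ≤ N := by exact_mod_cast hN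
  have hq0 := qr_pos hr z
  have h1 : qr r z ≤ 2 * r ^ 2 := by
    unfold qr; nlinarith [pow_le_pow_left₀ (norm_nonneg z) hz 2]
  have h2 : (2 * r ^ 2) ^ ((2 - N) / 2 - 2 : ℝ) ≤ qr r z ^ ((2 - N) / 2 - 2 : ℝ) :=
    rpow_le_rpow_of_nonpos hq0 h1 (by linarith)
  have h4 : (2 * r ^ 2) ^ ((2 - N) / 2 - 2 : ℝ) * r ^ 2 = (2 : ℝ) ^ (-(N + 2) / 2 : ℝ) * (r ^ N)⁻¹ := by
    rw [mul_rpow (by norm_num) (by positivity), ← rpow_natCast r 2,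
      ← rpow_mul hr.le, mul_assoc, ← rpow_add hr, ← rpow_natCast r N,
      ← Real.rpow_neg hr.le]
    congr 2 <;> (push_cast; ring)
  have hp := rpow_pos_of_pos hq0 ((2 - N) / 2 - 2 : ℝ)
  unfold mr
  rw [← h4]
  have : (1 : ℝ) ≤ N * (N - 2) := by nlinarith
  have hr2 : 0 < r ^ 2 := by positivity
  calc _ ≤ qr r z ^ ((2 - N) / 2 - 2 : ℝ) * r ^ 2 := mul_le_mul_of_nonneg_right h2 hr2.le
    _ ≤ N * (N - 2) * (qr r z ^ ((2 - N) / 2 - 2 : ℝ) * r ^ 2) :=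
      le_mul_of_one_le_left (by positivity) this
    _ = _ := by ring

end KernelBounds

/-- Uniform smallness of Newtonian potentials of a weight on small balls. -/
def PotBound {N : ℕ} (ρ : Eu N → ℝ) (C α : ℝ) : Prop :=
  ∀ (x : Eu N) (κ : ℝ), 0 < κ →
    IntegrableOn (fun y => ‖x - y‖ ^ (2 - N : ℝ) * ρ y) (ball x κ) ∧
      ∫ y in ball x κ, ‖x - y‖ ^ (2 - N : ℝ) * ρ y ≤ C * κ ^ α

theorem integrableOn_norm_rpow {N : ℕ} (hN : 3 ≤ N) {α : ℝ} (hα : 0 < α) (κ : ℝ) :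
    IntegrableOn (fun z : Eu N => ‖z‖ ^ (α - N)) (ball 0 κ) := by
  refine integrableOn_ball_of_norm_le_rpow (C := 1) (α := N - α) (by simp; omega) (by simp [hα])
    (of_forall fun x => ?_)
    (measurable_norm.pow_const _).aestronglyMeasurable
  rw [norm_of_nonneg (by positivity)]
  simp

theorem setIntegral_norm_rpow {N : ℕ} {α : ℝ} {κ : ℝ} (hκ : 0 < κ) :
    ∫ z in ball (0 : Eu N) κ, ‖z‖ ^ (α - N)
      = κ ^ α * ∫ z in ball (0 : Eu N) 1, ‖z‖ ^ (α - N) := by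
  have h := Measure.setIntegral_comp_smul_of_pos (volume : Measure (Eu N))
    (fun z => ‖z‖ ^ (α - N)) (ball 0 1) hκ
  rw [_root_.smul_ball hκ.ne'] at h
  simp only [smul_zero, norm_of_nonneg hκ.le, mul_one, finrank_euclideanSpace_fin,
    smul_eq_mul, norm_smul] at h
  have h2 : ∀ z : Eu N, (κ * ‖z‖) ^ (α - N) = κ ^ α * (κ ^ N)⁻¹ * ‖z‖ ^ (α - N) := fun z => by
    rw [mul_rpow hκ.le (norm_nonneg z), Real.rpow_sub hκ, rpow_natCast, div_eq_mul_inv]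
  simp only [h2, integral_const_mul] at h
  have hk : (κ ^ N)⁻¹ ≠ 0 := by positivity
  have := mul_left_cancel₀ hk ((show _ = _ by rw [← h]; ring :
    (κ ^ N)⁻¹ * (κ ^ α * ∫ z in ball (0 : Eu N) 1, ‖z‖ ^ (α - N)) = _))
  exact this.symm

theorem potBound_of_le {N : ℕ} (hN : 3 ≤ N) {γ Cu : ℝ} (h0 : 0 ≤ γ) (h2 : γ < 2) (hC : 0 ≤ Cu)
    {ρ : Eu N → ℝ} (hm : Measurable ρ) (hp : ∀ x, 0 ≤ ρ x)
    (hρ : ∀ᵐ x, ρ x ≤ Cu * ‖x‖ ^ (-γ)) : ∃ C, 0 < C ∧ PotBound ρ C (2 - γ) := by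
  have h3 : (3 : ℝ) ≤ N := by exact_mod_cast hN
  set α := 2 - γ with hαd
  have hα : 0 < α := by linarith
  have : Nonempty (Fin N) := ⟨⟨0, by omega⟩⟩
  set I := ∫ z in ball (0 : Eu N) 1, ‖z‖ ^ (α - N)
  have hI : 0 ≤ I := setIntegral_nonneg measurableSet_ball fun z _ => by positivity
  refine ⟨2 * Cu * I + 1, by positivity, fun x κ hκ => ?_⟩
  set G : Eu N → ℝ := fun y => Cu * ((ball x κ).indicator (fun y => ‖x - y‖ ^ (α - N)) y
    + (ball 0 κ).indicator (fun y => ‖y‖ ^ (α - N)) y) with hG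
  have i0 : Integrable ((ball 0 κ).indicator fun y : Eu N => ‖y‖ ^ (α - N)) :=
    (integrable_indicator_iff measurableSet_ball).2 (integrableOn_norm_rpow hN hα κ)
  have ee : ((ball x κ).indicator fun y : Eu N => ‖x - y‖ ^ (α - N))
      = fun y => (ball 0 κ).indicator (fun y : Eu N => ‖y‖ ^ (α - N)) (x - y) := by
    ext y
    simp only [indicator, mem_ball, dist_eq_norm, sub_zero, norm_sub_rev y x]
  have i1 : Integrable ((ball x κ).indicator fun y : Eu N => ‖x - y‖ ^ (α - N)) := by
    rw [ee]; exact i0.comp_sub_left x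
  have v0 : ∫ y, (ball 0 κ).indicator (fun y : Eu N => ‖y‖ ^ (α - N)) y = κ ^ α * I := by
    rw [integral_indicator measurableSet_ball, setIntegral_norm_rpow hκ]
  have v1 : ∫ y, (ball x κ).indicator (fun y : Eu N => ‖x - y‖ ^ (α - N)) y = κ ^ α * I := by
    rw [ee, integral_sub_left_eq_self (fun y => (ball 0 κ).indicator
      (fun y : Eu N => ‖y‖ ^ (α - N)) y), v0]
  have iG : Integrable G := (i1.add i0).const_mul Cu
  have vG : ∫ y, G y = 2 * Cu * I * κ ^ α := by
    rw [hG, integral_const_mul, integral_add i1 i0, v0, v1]; ring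
  have nG : ∀ y, 0 ≤ G y := fun y => mul_nonneg hC (add_nonneg
    (indicator_nonneg (fun _ _ => by positivity) _) (indicator_nonneg (fun _ _ => by positivity) _))
  have hle : ∀ᵐ y, (ball x κ).indicator (fun y => ‖x - y‖ ^ (2 - N : ℝ) * ρ y) y ≤ G y := by
    filter_upwards [hρ, Measure.ae_ne volume x, Measure.ae_ne volume 0] with y hy hyx hy0
    by_cases hb : y ∈ ball x κ
    swap
    · rw [indicator_of_notMem hb]; exact nG y
    have hxy : 0 < ‖x - y‖ := norm_sub_pos_iff.2 (Ne.symm hyx)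
    have hy0' : 0 < ‖y‖ := norm_pos_iff.2 hy0
    rw [indicator_of_mem hb]
    have a1 : ‖x - y‖ ^ (2 - N : ℝ) * ρ y ≤ Cu * (‖x - y‖ ^ (2 - N : ℝ) * ‖y‖ ^ (-γ)) := by
      calc _ ≤ ‖x - y‖ ^ (2 - N : ℝ) * (Cu * ‖y‖ ^ (-γ)) :=
            mul_le_mul_of_nonneg_left hy (by positivity)
        _ = _ := by ring
    refine a1.trans (mul_le_mul_of_nonneg_left ?_ hC)
    rw [indicator_of_mem hb]
    rcases le_total ‖x - y‖ ‖y‖ with h | h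
    · have : ‖y‖ ^ (-γ) ≤ ‖x - y‖ ^ (-γ) := rpow_le_rpow_of_nonpos hxy h (by linarith)
      calc _ ≤ ‖x - y‖ ^ (2 - N : ℝ) * ‖x - y‖ ^ (-γ) :=
            mul_le_mul_of_nonneg_left this (by positivity)
        _ = ‖x - y‖ ^ (α - N) := by rw [← rpow_add hxy, hαd]; congr 1; ring
        _ ≤ _ := le_add_of_nonneg_right (indicator_nonneg (fun _ _ => by positivity) _)
    · have hb0 : y ∈ ball (0 : Eu N) κ := by
        rw [mem_ball_zero_iff]
        rw [mem_ball, dist_eq_norm, norm_sub_rev] at hb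
        linarith
      have : ‖x - y‖ ^ (2 - N : ℝ) ≤ ‖y‖ ^ (2 - N : ℝ) :=
        rpow_le_rpow_of_nonpos hy0' h (by linarith)
      rw [indicator_of_mem hb0]
      calc _ ≤ ‖y‖ ^ (2 - N : ℝ) * ‖y‖ ^ (-γ) := mul_le_mul_of_nonneg_right this (by positivity)
        _ = ‖y‖ ^ (α - N) := by rw [← rpow_add hy0', hαd]; congr 1; ring
        _ ≤ _ := le_add_of_nonneg_left (by positivity)
  have hint : Integrable ((ball x κ).indicator fun y => ‖x - y‖ ^ (2 - N : ℝ) * ρ y) := by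
    refine iG.mono' ((Measurable.indicator (by fun_prop) measurableSet_ball).aestronglyMeasurable) ?_
    filter_upwards [hle] with y hy
    rwa [norm_of_nonneg (indicator_nonneg (fun y _ => mul_nonneg (by positivity) (hp y)) y)]
  refine ⟨(integrable_indicator_iff measurableSet_ball).1 hint, ?_⟩
  rw [← integral_indicator measurableSet_ball]
  refine (integral_mono_ae hint iG hle).trans ?_
  rw [vG]
  have : 0 ≤ κ ^ α := by positivity
  nlinarith

section Potential

variable {N : ℕ}

/-- Newtonian kernel with values in `ℝ≥0∞`. -/
def nk (x y : Eu N) : ℝ≥0∞ := ofReal (‖x - y‖ ^ (2 - N : ℝ))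

theorem nk_comm (x y : Eu N) : nk x y = nk y x := by rw [nk, nk, norm_sub_rev]

theorem measurable_nk : Measurable (fun p : Eu N × Eu N => nk p.1 p.2) :=
  ((measurable_fst.sub measurable_snd).norm.pow_const _).ennreal_ofReal

theorem measurable_nk_left (x : Eu N) : Measurable (nk x) :=
  ((measurable_const.sub measurable_id).norm.pow_const _).ennreal_ofReal

theorem PotBound.lintegral_le {ρ : Eu N → ℝ} {C α : ℝ} (h : PotBound ρ C α) (h0 : ∀ x, 0 ≤ ρ x)
    (x : Eu N) {κ : ℝ} (hκ : 0 < κ) :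
    ∫⁻ y in ball x κ, nk x y * ofReal (ρ y) ≤ ofReal (C * κ ^ α) := by
  obtain ⟨h1, h2⟩ := h x κ hκ
  have e : ∀ y, nk x y * ofReal (ρ y) = ofReal (‖x - y‖ ^ (2 - N : ℝ) * ρ y) :=
    fun y => (ofReal_mul (by positivity)).symm
  simp only [e]
  rw [← ofReal_integral_eq_lintegral_ofReal h1
    (of_forall fun y => mul_nonneg (by positivity) (h0 y))]
  exact ofReal_le_ofReal h2

set_option maxHeartbeats 800000 in
/-- A function dominated by its own weighted Newtonian potential has bounded potential. -/
theorem potential_bounded (hN : 3 ≤ N) {ρ : Eu N → ℝ} {C α : ℝ} (hα : 0 < α) (hC : 0 < C)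
    (hW : PotBound ρ C α) (hm : Measurable ρ) (hp : ∀ x, 0 < ρ x) {β : Eu N → ℝ≥0∞}
    (hβ : Measurable β) (hfin : ∫⁻ y, ofReal (ρ y) * β y ≠ ∞) (L C3 : ℝ) (hC3 : 0 < C3)
    (hb : ∀ᵐ x, β x ≤ ofReal L
      + ofReal C3 * ∫⁻ y, nk x y * (ofReal (ρ y) * β y)) :
    ∃ M : ℝ, ∀ᵐ x, ∫⁻ y, nk x y * (ofReal (ρ y) * β y) ≤ ofReal M := by
  have h3 : (3 : ℝ) ≤ N := by exact_mod_cast hN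
  set w : Eu N → ℝ≥0∞ := fun y => ofReal (ρ y) with hw
  have hwm : Measurable w := hm.ennreal_ofReal
  obtain ⟨κ, hκ, hκ2⟩ : ∃ κ : ℝ, 0 < κ ∧ C3 * (C * κ ^ α) ≤ 1 / 4 := by
    refine ⟨(1 / (4 * C3 * C)) ^ (1 / α), by positivity, ?_⟩
    rw [← rpow_mul (by positivity), one_div_mul_cancel hα.ne', rpow_one]
    apply le_of_eq; field_simp
  set I := ∫⁻ y, w y * β y with hI
  have hfar : ∀ (x : Eu N) (f : Eu N → ℝ≥0∞), Measurable f →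
      ∫⁻ y, nk x y * f y ≤ (∫⁻ y in ball x κ, nk x y * f y)
        + ofReal (κ ^ (2 - N : ℝ)) * ∫⁻ y, f y := by
    intro x f hf
    rw [← lintegral_add_compl _ (measurableSet_ball (x := x) (ε := κ))]
    refine add_le_add le_rfl ?_
    rw [← lintegral_const_mul _ hf]
    refine (setLIntegral_mono (hf.const_mul _) fun y hy => ?_).trans (setLIntegral_le_lintegral _ _)
    refine mul_le_mul_left (ofReal_le_ofReal ?_) _
    simp only [mem_compl_iff, mem_ball, not_lt, dist_eq_norm] at hy
    rw [norm_sub_rev]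
    exact rpow_le_rpow_of_nonpos hκ hy (by linarith)
  set T : (Eu N → ℝ≥0∞) → Eu N → ℝ≥0∞ := fun f x => ∫⁻ y in ball x κ, nk x y * (w y * f y) with hT
  set L' : ℝ≥0∞ := ofReal L
    + ofReal C3 * (ofReal (κ ^ (2 - N : ℝ)) * I) with hL'
  have hL'fin : L' ≠ ∞ := by
    rw [hL']
    exact ENNReal.add_ne_top.2 ⟨ofReal_ne_top,
      ENNReal.mul_ne_top ofReal_ne_top (ENNReal.mul_ne_top ofReal_ne_top hfin)⟩
  have hκ3 : ofReal C3 * ofReal (C * κ ^ α) ≤ 1 / 4 := by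
    rw [← ofReal_mul hC3.le]
    refine (ofReal_le_ofReal hκ2).trans (le_of_eq ?_)
    rw [ENNReal.ofReal_div_of_pos (by norm_num)]; norm_num
  set e : Eu N → ℝ≥0∞ := fun x => β x - 2 * L' with he
  have hem : Measurable e := hβ.sub_const _
  have hee : ∀ x, β x ≤ 2 * L' + e x := fun x => by simp only [he]; exact le_add_tsub
  have hee1 : ∀ x t, β x ≤ t + 2 * L' → e x ≤ t := fun x t h => by
    simp only [he]; exact tsub_le_iff_right.2 h
  have hee2 : ∀ x, e x ≤ β x := fun x => by simp only [he]; exact tsub_le_self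
  have hw0 : ∀ y, w y ≠ 0 := fun y => by simp [hw, hp y]
  have hWl : ∀ x, ∫⁻ y in ball x κ, nk x y * w y ≤ ofReal (C * κ ^ α) :=
    fun x => hW.lintegral_le (fun x => (hp x).le) x hκ
  have hTd : ∀ f x, T f x = ∫⁻ y in ball x κ, nk x y * (w y * f y) := fun _ _ => rfl
  have hwβ : Measurable (fun y => w y * β y) := hwm.mul hβ
  have hwe : Measurable (fun y => w y * e y) := hwm.mul hem
  have hb' : ∀ᵐ x, β x ≤ ofReal L + ofReal C3 * ∫⁻ y, nk x y * (w y * β y) := hb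
  have hgoal : (∃ M : ℝ, ∀ᵐ x, ∫⁻ y, nk x y * (w y * β y) ≤ ofReal M) →
    ∃ M : ℝ, ∀ᵐ x, ∫⁻ y, nk x y * (ofReal (ρ y) * β y) ≤ ofReal M := id
  refine hgoal ?_
  clear hgoal hb
  clear_value e T L' I w
  have hTβ : ∀ x, T β x ≤ 2 * L' * ofReal (C * κ ^ α) + T e x := by
    intro x
    have h1 : ∀ y, nk x y * (w y * β y) ≤ 2 * L' * (nk x y * w y) + nk x y * (w y * e y) := by
      intro y
      refine (mul_le_mul' le_rfl (mul_le_mul' le_rfl (hee y))).trans (le_of_eq ?_)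
      ring
    have hnx : Measurable (nk x) := measurable_nk_left x
    rw [hTd, hTd]
    calc ∫⁻ y in ball x κ, nk x y * (w y * β y) ≤ ∫⁻ y in ball x κ, (2 * L' * (nk x y * w y) + nk x y * (w y * e y)) :=
          lintegral_mono h1
      _ = 2 * L' * (∫⁻ y in ball x κ, nk x y * w y)
          + ∫⁻ y in ball x κ, nk x y * (w y * e y) := by
          have hnw : Measurable (fun y => nk x y * w y) := hnx.mul hwm
          rw [lintegral_add_left (hnw.const_mul _), lintegral_const_mul _ hnw]
      _ ≤ _ := by
          gcongr
          exact hWl x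
  have heT : ∀ᵐ x, e x ≤ ofReal C3 * T e x := by
    filter_upwards [hb'] with x hx
    refine hee1 _ _ ?_
    calc β x ≤ ofReal L + ofReal C3
          * (T β x + ofReal (κ ^ (2 - N : ℝ)) * I) := by
            refine hx.trans ?_
            gcongr
            rw [hTd, hI]
            exact hfar x _ hwβ
      _ = L' + ofReal C3 * T β x := by rw [hL']; ring
      _ ≤ L' + ofReal C3 * (2 * L' * ofReal (C * κ ^ α) + T e x) := by
            gcongr; exact hTβ x
      _ = L' + (ofReal C3 * ofReal (C * κ ^ α)) * (2 * L')
          + ofReal C3 * T e x := by ring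
      _ ≤ L' + (1 / 2) * (2 * L') + ofReal C3 * T e x := by
            gcongr
            refine hκ3.trans ?_
            gcongr; norm_num
      _ = ofReal C3 * T e x + 2 * L' := by
            rw [← mul_assoc, one_div, ENNReal.inv_mul_cancel (by norm_num) (by norm_num)]; ring
  have hzero : ∫⁻ x, w x * e x = 0 := by
    have hle : ∫⁻ x, w x * e x ≤ (1 / 4) * ∫⁻ x, w x * e x := by
      have hS : MeasurableSet {p : Eu N × Eu N | p.2 ∈ ball p.1 κ} :=
        (isOpen_lt (continuous_snd.dist continuous_fst) continuous_const).measurableSet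
      have hTi : ∀ x, T e x = ∫⁻ y, {p : Eu N × Eu N | p.2 ∈ ball p.1 κ}.indicator
          (fun p => nk p.1 p.2 * (w p.2 * e p.2)) (x, y) := by
        intro x
        rw [hTd, ← lintegral_indicator measurableSet_ball]
        rfl
      have hmeas : Measurable ({p : Eu N × Eu N | p.2 ∈ ball p.1 κ}.indicator
          (fun p => nk p.1 p.2 * (w p.2 * e p.2))) :=
        (measurable_nk.mul ((hwm.mul hem).comp measurable_snd)).indicator hS
      calc ∫⁻ x, w x * e x ≤ ∫⁻ x, w x * (ofReal C3 * T e x) := by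
            refine lintegral_mono_ae ?_
            filter_upwards [heT] with x hx
            gcongr
        _ = ∫⁻ x, ∫⁻ y, ofReal C3 * (w x * {p : Eu N × Eu N | p.2 ∈ ball p.1 κ}.indicator
          (fun p => nk p.1 p.2 * (w p.2 * e p.2)) (x, y)) := by
            refine lintegral_congr fun x => ?_
            have hmx := hmeas.comp (measurable_prodMk_left (x := x))
            simp only [Function.comp_def] at hmx
            rw [lintegral_const_mul _ (hmx.const_mul _), lintegral_const_mul _ hmx, hTi]
            ring
        _ = ∫⁻ y, ∫⁻ x, ofReal C3 * (w x * {p : Eu N × Eu N | p.2 ∈ ball p.1 κ}.indicator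
          (fun p => nk p.1 p.2 * (w p.2 * e p.2)) (x, y)) :=
            lintegral_lintegral_swap
              (((hwm.comp measurable_fst).mul hmeas).const_mul _).aemeasurable
        _ = ∫⁻ y, (w y * e y) * (ofReal C3 * ∫⁻ x in ball y κ, nk y x * w x) := by
            refine lintegral_congr fun y => ?_
            have hny : Measurable (fun x => nk y x * w x) :=
              (measurable_nk_left y).mul hwm
            rw [← lintegral_indicator measurableSet_ball,
              ← lintegral_const_mul _ (hny.indicator measurableSet_ball),
              ← lintegral_const_mul _ ((hny.indicator measurableSet_ball).const_mul _)]
            refine lintegral_congr fun x => ?_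
            simp only [indicator, mem_ofPred_eq, mem_ball, dist_comm y x]
            split_ifs
            · rw [nk_comm x y]; ring
            · simp
        _ ≤ ∫⁻ y, (w y * e y) * (1 / 4) := by
            refine lintegral_mono fun y => ?_
            gcongr
            refine le_trans ?_ hκ3
            gcongr
            exact hWl y
        _ = _ := by rw [lintegral_mul_const _ hwe, mul_comm]
    have hf : ∫⁻ x, w x * e x ≠ ∞ := by
      refine ne_top_of_le_ne_top hfin ?_
      rw [hI]
      refine lintegral_mono fun x => ?_
      gcongr
      exact hee2 x
    by_contra h0
    have h1 : (1 / 4 : ℝ≥0∞) * ∫⁻ x, w x * e x < 1 * ∫⁻ x, w x * e x := by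
      refine (ENNReal.mul_lt_mul_iff_left h0 hf).2 ?_
      rw [one_div, ENNReal.inv_lt_one]; norm_num
    rw [one_mul] at h1
    exact absurd hle (not_le.2 h1)
  have hβL : ∀ᵐ y, w y * β y ≤ 2 * L' * w y := by
    filter_upwards [(lintegral_eq_zero_iff (hwm.mul hem)).1 hzero] with y hy
    have he0 : e y = 0 := by simpa [hw0 y] using hy
    rw [mul_comm (2 * L')]
    gcongr
    simpa [he0] using hee y
  set M := 2 * L' * ofReal (C * κ ^ α) + ofReal (κ ^ (2 - N : ℝ)) * I with hM
  have hMfin : M ≠ ∞ := ENNReal.add_ne_top.2 ⟨ENNReal.mul_ne_top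
    (ENNReal.mul_ne_top (by norm_num) hL'fin) ofReal_ne_top,
    ENNReal.mul_ne_top ofReal_ne_top hfin⟩
  refine ⟨M.toReal, of_forall fun x => ?_⟩
  rw [ENNReal.ofReal_toReal hMfin]
  refine (hfar x _ hwβ).trans (add_le_add ?_ (by rw [hI]))
  have hnx : Measurable (nk x) := measurable_nk_left x
  calc _ ≤ ∫⁻ y in ball x κ, 2 * L' * (nk x y * w y) := by
        refine lintegral_mono_ae (ae_restrict_of_ae ?_)
        filter_upwards [hβL] with y hy
        refine (mul_le_mul' le_rfl hy).trans (le_of_eq ?_)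
        ring
    _ = 2 * L' * ∫⁻ y in ball x κ, nk x y * w y := lintegral_const_mul _ (hnx.mul hwm)
    _ ≤ _ := by gcongr; exact hWl x

end Potential

section Product

variable {N : ℕ} {θ : ℝ → ℝ} {Z : Eu N → ℝ}

theorem fst_smooth (hZ : Sm Z) : Sm (fun p : EuT N => Z p.1) :=
  hZ.lin (ContinuousLinearMap.fst ℝ (Eu N) ℝ)

theorem snd_smooth (hθ : Sm θ) : Sm (fun p : EuT N => θ p.2) :=
  hθ.lin (ContinuousLinearMap.snd ℝ (Eu N) ℝ)

theorem Dv_fst (hZ : Sm Z) (e p : EuT N) :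
    Dv e (fun p : EuT N => Z p.1) p = Dv e.1 Z p.1 :=
  Dv_lin hZ (ContinuousLinearMap.fst ℝ (Eu N) ℝ) e p

theorem Dv_snd (hθ : Sm θ) (e p : EuT N) :
    Dv e (fun p : EuT N => θ p.2) p = Dv e.2 θ p.2 :=
  Dv_lin hθ (ContinuousLinearMap.snd ℝ (Eu N) ℝ) e p

theorem Dv_zero_dir {F : Type*} [NormedAddCommGroup F] [NormedSpace ℝ F] (f : F → ℝ) (p : F) :
    Dv (0 : F) f p = 0 := by simp [Dv]

theorem prod_smooth (hθ : Sm θ) (hZ : Sm Z) : Sm (fun p : EuT N => θ p.2 * Z p.1) :=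
  (snd_smooth hθ).mul (fst_smooth hZ)

theorem Dv_eT_prod (hθ : Sm θ) (hZ : Sm Z) (p : EuT N) :
    Dv eT (fun p : EuT N => θ p.2 * Z p.1) p = Dv 1 θ p.2 * Z p.1 := by
  rw [Dv_mul (snd_smooth hθ) (fst_smooth hZ), Dv_fst hZ, Dv_snd hθ]
  simp [eT, Dv_zero_dir, mul_comm]

theorem lapS_eX_fst (hZ : Sm Z) (p : EuT N) :
    lapS eX (fun p : EuT N => Z p.1) p = lapS eB Z p.1 :=
  lapS_lin hZ (ContinuousLinearMap.fst ℝ (Eu N) ℝ) eX p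

theorem lapS_eX_prod (hθ : Sm θ) (hZ : Sm Z) (p : EuT N) :
    lapS eX (fun p : EuT N => θ p.2 * Z p.1) p = θ p.2 * lapS eB Z p.1 := by
  have h0 : ∀ (i : Fin N) (p : EuT N), Dv (eX i) (fun p : EuT N => θ p.2) p = 0 :=
    fun i p => by rw [Dv_snd hθ]; exact Dv_zero_dir _ _
  have h1 : lapS eX (fun p : EuT N => θ p.2) p = 0 := by
    refine Finset.sum_eq_zero fun i _ => ?_
    rw [show Dv (eX i) (fun p : EuT N => θ p.2) = fun _ => 0 from funext (h0 i)]
    simp [Dv]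
  rw [lapS_mul (snd_smooth hθ) (fst_smooth hZ), lapS_eX_fst hZ, h1]
  simp [h0]

theorem prod_tsupport (θ : ℝ → ℝ) (Z : Eu N → ℝ) :
    tsupport (fun p : EuT N => θ p.2 * Z p.1) ⊆ tsupport Z ×ˢ tsupport θ := by
  refine closure_minimal (fun p hp => ?_) ((isClosed_tsupport _).prod (isClosed_tsupport _))
  have h := Function.mem_support.1 hp
  exact ⟨subset_tsupport _ (right_ne_zero_of_mul h), subset_tsupport _ (left_ne_zero_of_mul h)⟩

theorem prod_compact (hθ : HasCompactSupport θ) (hZ : HasCompactSupport Z) :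
    HasCompactSupport (fun p : EuT N => θ p.2 * Z p.1) :=
  (hZ.isCompact.prod hθ.isCompact).of_isClosed_subset (isClosed_tsupport _) (prod_tsupport θ Z)

theorem exists_bound_of_compact {α : Type*} [TopologicalSpace α] {f : α → ℝ} (hf : Continuous f)
    (hc : HasCompactSupport f) : ∃ C, ∀ x, |f x| ≤ C := by
  simpa using hf.bounded_above_of_compact_support hc

theorem exists_deriv_bound {ξ : Eu N → ℝ} (hξ : Sm ξ) (hc : HasCompactSupport ξ) :
    ∃ c, 1 ≤ c ∧ ∀ y i, |Dv (eB i) ξ y| ≤ c ∧ |Dv (eB i) (Dv (eB i) ξ) y| ≤ c := by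
  choose C1 h1 using fun i : Fin N =>
    exists_bound_of_compact (hξ.dv (eB i)).cont (hc.dv (eB i))
  choose C2 h2 using fun i : Fin N =>
    exists_bound_of_compact ((hξ.dv (eB i)).dv (eB i)).cont ((hc.dv (eB i)).dv (eB i))
  have p1 : ∀ i, 0 ≤ C1 i := fun i => (abs_nonneg _).trans (h1 i 0)
  have p2 : ∀ i, 0 ≤ C2 i := fun i => (abs_nonneg _).trans (h2 i 0)
  refine ⟨1 + ∑ i, (C1 i + C2 i), ?_, fun y i => ?_⟩
  · have := sum_nonneg fun i (_ : i ∈ Finset.univ) => add_nonneg (p1 i) (p2 i)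
    linarith
  · have := Finset.single_le_sum (fun i _ => add_nonneg (p1 i) (p2 i)) (Finset.mem_univ i)
    constructor
    · linarith [h1 i y, p2 i]
    · linarith [h2 i y, p1 i]

theorem integrable_mul_of_compact {F : Type*} [TopologicalSpace F] [MeasurableSpace F]
    [OpensMeasurableSpace F] {μ : Measure F} {f k : F → ℝ}
    (hf : Integrable f μ) (hk : Continuous k) (hc : HasCompactSupport k) :
    Integrable (fun p => f p * k p) μ := by
  obtain ⟨C, hC⟩ := exists_bound_of_compact hk hc
  exact hf.mul_bdd (c := C) hk.aestronglyMeasurable (of_forall fun x => by simpa using hC x)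

/-- The dimensional constant in the cut-off kernel inequality. -/
def kerC (N : ℕ) (c : ℝ) : ℝ := 34 * (384 * N ^ 3) ^ (2 * N) * c ^ (2 * N)

theorem kerC_nonneg (N : ℕ) {c : ℝ} (hc : 1 ≤ c) : 0 ≤ kerC N c := by unfold kerC; positivity

theorem mr_smooth {r : ℝ} (hr : 0 < r) : Sm (mr (N := N) r) :=
  contDiff_const.mul (Sm.rpow (qr_smooth r) (fun z => qr_pos hr z) _)

theorem sub_smooth (hZ : Sm Z) (x : Eu N) : Sm (fun y => Z (y - x)) :=
  hZ.comp (contDiff_id.sub contDiff_const)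

theorem kernel_cutoff_all (hN : 3 ≤ N) {r : ℝ} (hr : 0 < r) {c : ℝ} (hc : 1 ≤ c) {ξ : Eu N → ℝ}
    (hξ : Sm ξ) (h01 : ∀ y, 0 ≤ ξ y ∧ ξ y ≤ 1)
    (hd : ∀ y i, |Dv (eB i) ξ y| ≤ c ∧ |Dv (eB i) (Dv (eB i) ξ) y| ≤ c) (x : Eu N)
    (hq : ∀ y ∈ tsupport ξ, qr r (y - x) ≤ 9) (y : Eu N) :
    lapS eB (fun y => ξ y ^ (2 * N) * Kr r (y - x)) y
      ≤ -(ξ y ^ (2 * N) * mr r (y - x)) + kerC N c := by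
  by_cases hy : y ∈ tsupport ξ
  · exact kernel_cutoff hN hr hc hξ x y (h01 y).1 (h01 y).2 (fun i => (hd y i).1)
      (fun i => (hd y i).2) (hq y hy)
  · have h1 : y ∉ tsupport (fun y => ξ y ^ (2 * N) * Kr r (y - x)) := fun h => hy <| by
      refine (closure_mono (fun z hz => ?_) : _ ⊆ closure (Function.support ξ)) h
      intro h0
      exact hz (by simp [show ξ z = 0 from h0, show N ≠ 0 by omega])
    rw [lapS_eq_zero h1, image_eq_zero_of_notMem_tsupport hy]
    simpa [show N ≠ 0 by omega] using kerC_nonneg N hc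

variable {O : Set (EuT N)} {a g : EuT N → ℝ}

set_option maxHeartbeats 1000000 in
/-- Testing a subsolution pair with the cut-off regularized Newtonian kernel. -/
theorem SubPair.kernel_ineq (hN : 3 ≤ N) (h : SubPair O a g) (ha : Integrable a)
    (hg : Integrable g) (hg0 : ∀ p, 0 ≤ g p) {r : ℝ} (hr : 0 < r) {c : ℝ} (hc : 1 ≤ c)
    {ξ : Eu N → ℝ} (hξ : Sm ξ) (hξc : HasCompactSupport ξ) (h01 : ∀ y, 0 ≤ ξ y ∧ ξ y ≤ 1)
    (hd : ∀ y i, |Dv (eB i) ξ y| ≤ c ∧ |Dv (eB i) (Dv (eB i) ξ) y| ≤ c)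
    (hθ : Sm θ) (hθc : HasCompactSupport θ) (hθ01 : ∀ t, 0 ≤ θ t ∧ θ t ≤ 1)
    (hO : tsupport ξ ×ˢ tsupport θ ⊆ O) (x : Eu N) (hq : ∀ y ∈ tsupport ξ, qr r (y - x) ≤ 9) :
    ∫ p, g p * (θ p.2 * (ξ p.1 ^ (2 * N) * mr r (p.1 - x)))
      ≤ kerC N c * (∫ p, g p) + ∫ p, a p * (Dv 1 θ p.2 * (ξ p.1 ^ (2 * N) * Kr r (p.1 - x))) := by
  have hN0 : 2 * N ≠ 0 := by omega
  have hζ : Sm (fun y => ξ y ^ (2 * N)) := hξ.pow _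
  have hζc : HasCompactSupport (fun y => ξ y ^ (2 * N)) :=
    hξc.comp_left (g := fun s : ℝ => s ^ (2 * N)) (by simp [show N ≠ 0 by omega])
  have hζs : tsupport (fun y => ξ y ^ (2 * N)) ⊆ tsupport ξ :=
    closure_mono fun z hz h0 => hz (by simp [show ξ z = 0 from h0, show N ≠ 0 by omega])
  have hK : Sm (fun y => ξ y ^ (2 * N) * Kr r (y - x)) := hζ.mul (sub_smooth (Kr_smooth hr) x)
  have hKc : HasCompactSupport (fun y => ξ y ^ (2 * N) * Kr r (y - x)) := hζc.mul_right
  have hM : Sm (fun y => ξ y ^ (2 * N) * mr r (y - x)) := hζ.mul (sub_smooth (mr_smooth hr) x)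
  have hMc : HasCompactSupport (fun y => ξ y ^ (2 * N) * mr r (y - x)) := hζc.mul_right
  have hKs : tsupport (fun y => ξ y ^ (2 * N) * Kr r (y - x)) ⊆ tsupport ξ :=
    (tsupport_mul_subset_left (f := fun y => ξ y ^ (2 * N))).trans hζs
  have key := h _ (prod_smooth hθ hK) (prod_compact hθc hKc)
    ((prod_tsupport _ _).trans ((prod_mono hKs subset_rfl).trans hO))
    (fun p => mul_nonneg (hθ01 _).1 (mul_nonneg (pow_nonneg (h01 _).1 _) (Kr_pos hr _).le))
  simp only [Dv_eT_prod hθ hK, lapS_eX_prod hθ hK] at key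
  have i1 : Integrable (fun p => a p * (Dv 1 θ p.2 * (ξ p.1 ^ (2 * N) * Kr r (p.1 - x)))) :=
    integrable_mul_of_compact ha (prod_smooth (hθ.dv 1) hK).cont
      (prod_compact (hθc.dv 1) hKc)
  have i2 : Integrable (fun p => g p * (θ p.2 * lapS eB (fun y => ξ y ^ (2 * N) * Kr r (y - x)) p.1)) :=
    integrable_mul_of_compact hg (prod_smooth hθ (Sm.lapS hK eB)).cont
      (prod_compact hθc (HasCompactSupport.lapS hKc eB))
  have i3 : Integrable (fun p => g p * (θ p.2 * (ξ p.1 ^ (2 * N) * mr r (p.1 - x)))) :=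
    integrable_mul_of_compact hg (prod_smooth hθ hM).cont (prod_compact hθc hMc)
  rw [integral_add i1 i2] at key
  have h2 : ∫ p, g p * (θ p.2 * lapS eB (fun y => ξ y ^ (2 * N) * Kr r (y - x)) p.1)
      ≤ ∫ p, (kerC N c * g p - g p * (θ p.2 * (ξ p.1 ^ (2 * N) * mr r (p.1 - x)))) := by
    refine integral_mono i2 ((hg.const_mul _).sub i3) fun p => ?_
    have := kernel_cutoff_all hN hr hc hξ h01 hd x hq p.1
    have h3 := mul_le_mul_of_nonneg_left this (mul_nonneg (hg0 p) (hθ01 p.2).1)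
    have h4 := mul_le_mul_of_nonneg_left (hθ01 p.2).2 (mul_nonneg (hg0 p) (kerC_nonneg N hc))
    linarith
  rw [integral_sub (hg.const_mul _) i3, integral_const_mul] at h2
  linarith

end Product

section TimeIntegral

variable {N : ℕ}

theorem exists_time_cutoff {m : ℝ} (hm : 1 < m) (t0 : ℝ) {δ : ℝ} (hδ : 0 < δ) :
    ∃ θ : ℝ → ℝ, Sm θ ∧ HasCompactSupport θ ∧ (∀ t, 0 ≤ θ t ∧ θ t ≤ 1) ∧
      (∀ t ∈ Ioo (t0 - δ) (t0 + δ), θ t = 1) ∧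
      tsupport θ ⊆ Ioo (t0 - 2 * δ) (t0 + 2 * δ) ∧
      ∃ C, 0 ≤ C ∧ ∀ t w, 0 ≤ w → |Dv 1 θ t| * w
        ≤ θ t * w ^ m + (Icc (t0 - 2 * δ) (t0 + 2 * δ)).indicator (fun _ => C) t := by
  let f : ContDiffBump t0 := ⟨δ, 3 / 2 * δ, hδ, by linarith⟩
  have hf : Sm f := f.contDiff
  obtain ⟨k, hk⟩ := exists_nat_ge (1 / (m - 1))
  have hk1 : 0 < 1 / (m - 1) := by apply one_div_pos.2; linarith
  obtain ⟨c, hc⟩ := exists_bound_of_compact (hf.dv 1).cont (f.hasCompactSupport.dv 1)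
  have hts : tsupport (fun t => f t ^ (k + 1)) ⊆ Ioo (t0 - 2 * δ) (t0 + 2 * δ) := by
    have h1 : tsupport (fun t => f t ^ (k + 1)) ⊆ tsupport f :=
      closure_mono fun z hz h0 => hz (by simp [show f z = 0 from h0])
    refine h1.trans ?_
    rw [f.tsupport_eq, Real.closedBall_eq_Icc]
    refine fun t ht => ⟨?_, ?_⟩
    · have := ht.1; simp only [f] at this; linarith
    · have := ht.2; simp only [f] at this; linarith
  have hc0 : 0 ≤ c := (abs_nonneg _).trans (hc t0)
  set A : ℝ := (k + 1) * c with hA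
  have hA0 : 0 ≤ A := by positivity
  refine ⟨fun t => f t ^ (k + 1), hf.pow _, ?_, fun t => ⟨pow_nonneg f.nonneg _,
    pow_le_one₀ f.nonneg f.le_one⟩, fun t ht => ?_, hts, A * A ^ (1 / (m - 1)), by positivity,
    fun t w hw => ?_⟩
  · exact f.hasCompactSupport.comp_left (g := fun s : ℝ => s ^ (k + 1)) (by simp)
  · show f t ^ (k + 1) = 1
    rw [f.one_of_mem_closedBall, one_pow]
    rw [Real.closedBall_eq_Icc]
    exact ⟨ht.1.le, ht.2.le⟩
  by_cases ht : t ∈ Icc (t0 - 2 * δ) (t0 + 2 * δ)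
  · rw [indicator_of_mem ht, Dv_pow hf]
    have hf0 : 0 ≤ f t := f.nonneg
    have e1 : |((k + 1 : ℕ) : ℝ) * f t ^ (k + 1 - 1) * Dv 1 f t| ≤ A * f t ^ k := by
      rw [abs_mul, abs_mul, Nat.abs_cast, abs_of_nonneg (pow_nonneg hf0 _), Nat.add_sub_cancel, hA]
      push_cast
      have := mul_le_mul_of_nonneg_left (hc t) (by positivity : 0 ≤ (k + 1 : ℝ) * f t ^ k)
      linarith
    refine (mul_le_mul_of_nonneg_right e1 hw).trans ?_
    have hwm : w ^ m = w ^ (m - 1) * w := by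
      rcases hw.eq_or_lt with h | h
      · rw [← h, zero_rpow (by linarith)]; simp
      · rw [← rpow_add_one h.ne']; congr 1; ring
    rcases le_total A (f t * w ^ (m - 1)) with h | h
    · have : A * f t ^ k * w ≤ f t ^ (k + 1) * w ^ m := by
        rw [hwm, pow_succ]
        have := mul_le_mul_of_nonneg_right h (by positivity : 0 ≤ f t ^ k * w)
        linarith
      have h2 : 0 ≤ A * A ^ (1 / (m - 1)) := by positivity
      linarith
    · have h1 : f t ^ k * w ≤ A ^ (1 / (m - 1)) := by
        have h3 : f t ^ k ≤ f t ^ (1 / (m - 1)) := by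
          rcases hf0.eq_or_lt with h0 | h0
          · have : k ≠ 0 := by
              rintro rfl; simp at hk; linarith
            rw [← h0, zero_rpow hk1.ne', zero_pow this]
          · rw [← rpow_natCast]
            exact Real.rpow_le_rpow_of_exponent_ge h0 f.le_one hk
        calc f t ^ k * w ≤ f t ^ (1 / (m - 1)) * w := by gcongr
          _ = (f t * w ^ (m - 1)) ^ (1 / (m - 1)) := by
            rw [mul_rpow hf0 (by positivity), ← rpow_mul hw, mul_one_div_cancel
              (by linarith), rpow_one]
          _ ≤ _ := by gcongr
      have h2 := mul_le_mul_of_nonneg_left h1 hA0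
      have h3 : 0 ≤ f t ^ (k + 1) * w ^ m := by positivity
      linarith
  · have h0 : t ∉ tsupport (fun t => f t ^ (k + 1)) := fun h => ht (Ioo_subset_Icc_self (hts h))
    have h00 : f t ^ (k + 1) = 0 :=
      image_eq_zero_of_notMem_tsupport (f := fun t => f t ^ (k + 1)) h0
    rw [dv_eq_zero h0, indicator_of_notMem ht]
    simp only [h00]
    simp

theorem exists_space_cutoff (x0 : Eu N) {R' R : ℝ} (hR' : 0 < R') (hR : R' < R) :
    ∃ ξ : Eu N → ℝ, Sm ξ ∧ HasCompactSupport ξ ∧ (∀ y, 0 ≤ ξ y ∧ ξ y ≤ 1) ∧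
      (∀ y ∈ ball x0 R', ξ y = 1) ∧ tsupport ξ ⊆ ball x0 R := by
  let f : ContDiffBump x0 := ⟨R', (R' + R) / 2, hR', by linarith⟩
  refine ⟨f, f.contDiff, f.hasCompactSupport, fun y => ⟨f.nonneg, f.le_one⟩, fun y hy =>
    f.one_of_mem_closedBall (ball_subset_closedBall hy), ?_⟩
  rw [f.tsupport_eq]
  exact closedBall_subset_ball (show (R' + R) / 2 < R by linarith)

theorem qr_le_nine {x0 : Eu N} {R r : ℝ} (hR : R ≤ 1) (hr : 0 < r) (hr1 : r ≤ 1) {x y : Eu N}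
    (hx : x ∈ ball x0 R) (hy : y ∈ ball x0 R) : qr r (y - x) ≤ 9 := by
  have h1 : ‖y - x‖ ≤ 2 := by
    rw [← dist_eq_norm]
    have := dist_triangle_right y x x0
    rw [mem_ball] at hx hy
    linarith
  unfold qr
  nlinarith [norm_nonneg (y - x)]

/-- The local averages against `mr r` control a function almost everywhere. -/
theorem ae_le_of_mr_integral_le (hN : 3 ≤ N) {F : Eu N → ℝ} (hF : Integrable F) (hF0 : ∀ x, 0 ≤ F x) :
    ∃ κ, 0 < κ ∧ ∀ᵐ x, ∀ T : ℝ, (∀ r, 0 < r → r ≤ 1 → Integrable (fun y => F y * mr r (y - x)) ∧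
      ∫ y, F y * mr r (y - x) ≤ T) → κ * F x ≤ T := by
  have hne : Nonempty (Fin N) := ⟨⟨0, by omega⟩⟩
  set V := (volume : Measure (Eu N)).real (ball 0 1) with hV
  have hV0 : 0 < V := ENNReal.toReal_pos (measure_ball_pos _ _ one_pos).ne' measure_ball_lt_top.ne
  refine ⟨(2 : ℝ) ^ (-(N + 2) / 2 : ℝ) * V, by positivity, ?_⟩
  have hLD := IsUnifLocDoublingMeasure.ae_tendsto_average (μ := (volume : Measure (Eu N)))
    hF.locallyIntegrable 1
  filter_upwards [hLD] with x hx T hT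
  have hδ : Tendsto (fun n : ℕ => 1 / ((n : ℝ) + 1)) atTop (𝓝[>] 0) :=
    tendsto_nhdsWithin_iff.2 ⟨tendsto_one_div_add_atTop_nhds_zero_nat,
      of_forall fun n => by simp only [mem_Ioi]; positivity⟩
  have h1 := hx (fun _ => x) (fun n : ℕ => 1 / ((n : ℝ) + 1)) hδ
    (of_forall fun n => mem_closedBall_self (by positivity))
  refine le_of_tendsto (h1.const_mul ((2 : ℝ) ^ (-(N + 2) / 2 : ℝ) * V))
    (of_forall fun n => ?_)
  set r : ℝ := 1 / ((n : ℝ) + 1) with hr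
  have hr0 : 0 < r := by positivity
  have hr1 : r ≤ 1 := by rw [hr, div_le_one (by positivity)]; linarith [n.cast_nonneg (α := ℝ)]
  obtain ⟨hi, hle⟩ := hT r hr0 hr1
  refine le_trans ?_ hle
  have hvol : (volume : Measure (Eu N)).real (closedBall x r) = r ^ N * V := by
    rw [Measure.real, Measure.addHaar_closedBall _ _ hr0.le, ENNReal.toReal_mul,
      toReal_ofReal (by positivity)]
    simp [hV, Measure.real]
  rw [setAverage_eq, hvol, smul_eq_mul]
  calc _ = ∫ y in closedBall x r, F y * ((2 : ℝ) ^ (-(N + 2) / 2 : ℝ) * (r ^ N)⁻¹) := by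
        rw [integral_mul_const]; field_simp
    _ ≤ ∫ y in closedBall x r, F y * mr r (y - x) := by
        refine setIntegral_mono_on (hF.mul_const _).integrableOn hi.integrableOn
          measurableSet_closedBall fun y hy => ?_
        exact mul_le_mul_of_nonneg_left (mr_ge hN hr0 (by rwa [← dist_eq_norm])) (hF0 y)
    _ ≤ _ := setIntegral_le_integral hi
        (of_forall fun y => mul_nonneg (hF0 y) (mr_nonneg hN hr0 _))

end TimeIntegral

section TimeIntegral

variable {N : ℕ}

theorem ae_slice_integrable {f : EuT N → ℝ} (hf : Integrable f) :
    ∀ᵐ x, Integrable (fun t => f (x, t)) := by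
  rw [Measure.volume_eq_prod] at hf
  exact hf.prod_right_ae

theorem slice_integrable {f : EuT N → ℝ} (hf : Integrable f) :
    Integrable (fun x => ∫ t, f (x, t)) := by
  rw [Measure.volume_eq_prod] at hf
  exact hf.integral_prod_left

theorem slice_integral {f : EuT N → ℝ} (hf : Integrable f) :
    ∫ p, f p = ∫ x, ∫ t, f (x, t) := by
  rw [Measure.volume_eq_prod] at hf ⊢
  exact integral_prod f hf

set_option maxHeartbeats 1000000 in
/-- Local bound of the time integrals of `u ^ m`. -/
theorem time_integral_bound (hN : 3 ≤ N) {m : ℝ} (hm : 1 < m) {ρ : Eu N → ℝ} {C α : ℝ}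
    (hα : 0 < α) (hC : 0 < C) (hW : PotBound ρ C α) (hρm : Measurable ρ) (hρ0 : ∀ x, 0 < ρ x)
    {U : EuT N → ℝ} (hU : Measurable U) (hU0 : ∀ p, 0 ≤ U p)
    (ha : Integrable (fun p => ρ p.1 * U p)) (hg : Integrable (fun p => U p ^ m))
    {x0 : Eu N} {t0 R δ : ℝ} (hR : 0 < R) (hR1 : R ≤ 1) (hδ : 0 < δ)
    (h : SubPair (ball x0 R ×ˢ Ioo (t0 - 2 * δ) (t0 + 2 * δ))
      (fun p => ρ p.1 * U p) (fun p => U p ^ m)) :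
    ∃ M, ∀ᵐ x, x ∈ ball x0 (R / 2) → ∫ t in Ioo (t0 - δ) (t0 + δ), U (x, t) ^ m ≤ M := by
  obtain ⟨θ, hθ, hθc, hθ01, hθ1, hθs, C0, hC0, hθC⟩ := exists_time_cutoff hm t0 hδ
  obtain ⟨ξ, hξ, hξc, hξ01, hξ1, hξs⟩ := exists_space_cutoff x0 (half_pos hR) (half_lt_self hR)
  obtain ⟨c, hc, hd⟩ := exists_deriv_bound hξ hξc
  have hN0 : 2 * N ≠ 0 := by omega
  set ζ : Eu N → ℝ := fun y => ξ y ^ (2 * N) with hζd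
  have hζ : Sm ζ := hξ.pow _
  have hζc : HasCompactSupport ζ := hξc.comp_left (g := fun s : ℝ => s ^ (2 * N)) (by simp [hN0])
  have hζ0 : ∀ y, 0 ≤ ζ y := fun y => pow_nonneg (hξ01 y).1 _
  have hζ1 : ∀ y, ζ y ≤ 1 := fun y => pow_le_one₀ (hξ01 y).1 (hξ01 y).2
  have hζb : ∀ y, ζ y ≠ 0 → y ∈ ball x0 R := fun y hy => hξs (subset_tsupport _ (fun h0 => hy (by
    simp [hζd, show ξ y = 0 from h0, show N ≠ 0 by omega])))
  set F : Eu N → ℝ := fun y => ζ y * ∫ s, θ s * U (y, s) ^ m with hF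
  set b : Eu N → ℝ := fun y => ζ y * ∫ s, |Dv 1 θ s| * U (y, s) with hb
  have hF0 : ∀ y, 0 ≤ F y := fun y => mul_nonneg (hζ0 y) (integral_nonneg fun s =>
    mul_nonneg (hθ01 s).1 (rpow_nonneg (hU0 _) _))
  have hb0 : ∀ y, 0 ≤ b y := fun y => mul_nonneg (hζ0 y) (integral_nonneg fun s =>
    mul_nonneg (abs_nonneg _) (hU0 _))
  have hθd : Continuous (Dv 1 θ) := (hθ.dv 1).cont
  have hθdc : HasCompactSupport (fun s => |Dv 1 θ s|) :=
    (hθc.dv 1).comp_left (g := fun s : ℝ => |s|) abs_zero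
  have iF : Integrable F := by
    have i1 := slice_integrable (integrable_mul_of_compact hg
      (prod_smooth hθ hζ).cont (prod_compact hθc hζc))
    refine i1.congr (of_forall fun y => ?_)
    simp only [hF]
    rw [← integral_const_mul]
    exact integral_congr_ae (of_forall fun s => by ring)
  have hprodc : HasCompactSupport (fun p : EuT N => |Dv 1 θ p.2| * ζ p.1) :=
    prod_compact hθdc hζc
  have hprod : Continuous (fun p : EuT N => |Dv 1 θ p.2| * ζ p.1) :=
    ((hθd.comp continuous_snd).abs).mul (hζ.cont.comp continuous_fst)
  have eb : ∀ y, ρ y * b y = ∫ s, (ρ y * U (y, s)) * (|Dv 1 θ s| * ζ y) := by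
    intro y
    simp only [hb]
    rw [← integral_const_mul, ← integral_const_mul]
    exact integral_congr_ae (of_forall fun s => by ring)
  have ib : Integrable (fun y => ρ y * b y) := by
    simp only [eb]
    exact slice_integrable (integrable_mul_of_compact ha hprod hprodc)
  have hbm : Measurable b := by
    refine hζ.cont.measurable.mul ?_
    have : StronglyMeasurable (fun p : EuT N => |Dv 1 θ p.2| * U p) :=
      ((hθd.comp continuous_snd).abs.measurable.mul hU).stronglyMeasurable
    exact this.integral_prod_right'.measurable
  have hbF : ∀ᵐ y, b y ≤ F y + 4 * δ * C0 := by
    filter_upwards [ae_slice_integrable ha, ae_slice_integrable hg] with y hya hyg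
    have hyU : Integrable (fun s => U (y, s)) := by
      refine (hya.const_mul (ρ y)⁻¹).congr (of_forall fun s => ?_)
      simp only
      rw [inv_mul_cancel_left₀ (hρ0 y).ne']
    have i1 : Integrable (fun s => |Dv 1 θ s| * U (y, s)) :=
      (integrable_mul_of_compact hyU hθd.abs hθdc).congr (of_forall fun s => mul_comm _ _)
    have i2 : Integrable (fun s => θ s * U (y, s) ^ m) :=
      (integrable_mul_of_compact hyg hθ.cont hθc).congr
        (of_forall fun s => mul_comm _ _)
    have i3 : Integrable ((Icc (t0 - 2 * δ) (t0 + 2 * δ)).indicator (fun _ : ℝ => C0)) :=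
      (integrableOn_const (by simp)).integrable_indicator measurableSet_Icc
    have h1 : ∫ s, |Dv 1 θ s| * U (y, s) ≤ (∫ s, θ s * U (y, s) ^ m) + 4 * δ * C0 := by
      refine (integral_mono i1 (i2.add i3) fun s => hθC s _ (hU0 _)).trans (le_of_eq ?_)
      rw [integral_add' i2 i3, integral_indicator measurableSet_Icc, setIntegral_const]
      simp only [Measure.real, Real.volume_Icc, smul_eq_mul]
      rw [toReal_ofReal (by linarith)]
      ring
    have h2 := mul_le_mul_of_nonneg_left h1 (hζ0 y)
    have h3 := mul_le_mul_of_nonneg_right (hζ1 y) (by positivity : 0 ≤ 4 * δ * C0)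
    simp only [hb, hF]
    linarith
  set G := ∫ p, U p ^ m with hG
  have hG0 : 0 ≤ G := integral_nonneg fun p => rpow_nonneg (hU0 _) _
  have hD := kerC_nonneg N hc
  set β : Eu N → ℝ≥0∞ := fun y => ofReal (b y) with hβ
  set Φ : Eu N → ℝ≥0∞ := fun x => ∫⁻ y, nk x y * (ofReal (ρ y) * β y) with hΦ
  have key : ∀ x ∈ ball x0 R, Φ x ≠ ∞ → ∀ r, 0 < r → r ≤ 1 →
      Integrable (fun y => F y * mr r (y - x)) ∧
      ∫ y, F y * mr r (y - x) ≤ kerC N c * G + 3 * (Φ x).toReal := by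
    intro x hx hΦx r hr hr1
    have hq : ∀ y ∈ ball x0 R, qr r (y - x) ≤ 9 := fun y hy => qr_le_nine hR1 hr hr1 hx hy
    have hk := h.kernel_ineq hN ha hg (fun p => rpow_nonneg (hU0 p) m) hr hc hξ hξc hξ01 hd hθ
      hθc hθ01 (prod_mono (hξs) hθs) x (fun y hy => hq y (hξs hy))
    have hMs : Sm (fun y => ζ y * mr r (y - x)) := hζ.mul (sub_smooth (mr_smooth hr) x)
    have hMc : HasCompactSupport (fun y => ζ y * mr r (y - x)) := hζc.mul_right
    have j1 := integrable_mul_of_compact hg (prod_smooth hθ hMs).cont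
      (prod_compact hθc hMc)
    have e1 : ∀ y, ∫ s, U (y, s) ^ m * (θ s * (ζ y * mr r (y - x))) = F y * mr r (y - x) := by
      intro y
      simp only [hF]
      rw [mul_assoc, mul_comm (∫ s, _), ← integral_const_mul, ← integral_const_mul]
      exact integral_congr_ae (of_forall fun s => by ring)
    have hKs : Continuous (fun y => Kr r (y - x)) :=
      (sub_smooth (Kr_smooth hr) x).cont
    have hK2 : Continuous (fun p : EuT N => |Dv 1 θ p.2| * (ζ p.1 * Kr r (p.1 - x))) :=
      ((hθd.comp continuous_snd).abs).mul
        ((hζ.cont.mul hKs).comp continuous_fst)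
    have hK2c : HasCompactSupport (fun p : EuT N => |Dv 1 θ p.2| * (ζ p.1 * Kr r (p.1 - x))) :=
      prod_compact hθdc (Z := fun y => ζ y * Kr r (y - x)) hζc.mul_right
    have hK3 : Continuous (fun p : EuT N => Dv 1 θ p.2 * (ζ p.1 * Kr r (p.1 - x))) :=
      (hθd.comp continuous_snd).mul ((hζ.cont.mul hKs).comp continuous_fst)
    have hK3c : HasCompactSupport (fun p : EuT N => Dv 1 θ p.2 * (ζ p.1 * Kr r (p.1 - x))) :=
      prod_compact (hθc.dv 1) (Z := fun y => ζ y * Kr r (y - x)) hζc.mul_right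
    have j2 := integrable_mul_of_compact ha hK2 hK2c
    have e2 : ∀ y, ∫ s, ρ y * U (y, s) * (|Dv 1 θ s| * (ζ y * Kr r (y - x)))
        = ρ y * b y * Kr r (y - x) := by
      intro y
      rw [eb, ← integral_mul_const]
      exact integral_congr_ae (of_forall fun s => by ring)
    have k1 : ∫ p : EuT N, ρ p.1 * U p * (Dv 1 θ p.2 * (ξ p.1 ^ (2 * N) * Kr r (p.1 - x)))
        ≤ ∫ y, ρ y * b y * Kr r (y - x) := by
      have : ∫ y, ρ y * b y * Kr r (y - x)
          = ∫ p : EuT N, ρ p.1 * U p * (|Dv 1 θ p.2| * (ζ p.1 * Kr r (p.1 - x))) := by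
        rw [slice_integral j2]; simp only [e2]
      rw [this]
      refine integral_mono (integrable_mul_of_compact ha hK3 hK3c) j2 fun p => ?_
      refine mul_le_mul_of_nonneg_left (mul_le_mul_of_nonneg_right (le_abs_self _) ?_)
        (mul_nonneg (hρ0 _).le (hU0 _))
      exact mul_nonneg (hζ0 _) (Kr_pos hr _).le
    have k2 : ∫ y, ρ y * b y * Kr r (y - x) ≤ 3 * (Φ x).toReal := by
      rw [integral_eq_lintegral_of_nonneg_ae (of_forall fun y =>
        mul_nonneg (mul_nonneg (hρ0 _).le (hb0 _)) (Kr_pos hr _).le)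
        (ib.aestronglyMeasurable.mul hKs.aestronglyMeasurable)]
      have : (3 : ℝ) = (3 : ℝ≥0∞).toReal := by norm_num
      rw [this, ← ENNReal.toReal_mul]
      refine ENNReal.toReal_mono (ENNReal.mul_ne_top (by norm_num) hΦx) ?_
      simp only [hΦ]
      have hmm : Measurable (fun y => nk x y * (ofReal (ρ y) * β y)) :=
        (measurable_nk_left x).mul (hρm.ennreal_ofReal.mul hbm.ennreal_ofReal)
      rw [← lintegral_const_mul _ hmm]
      have hneN : Nontrivial (Eu N) := by
        have : Nonempty (Fin N) := ⟨⟨0, by omega⟩⟩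
        infer_instance
      have hne : ∀ᵐ y, y ≠ x := by simp [ae_iff]
      refine lintegral_mono_ae ?_
      filter_upwards [hne] with y hy
      by_cases hζy : ζ y = 0
      · simp [hb, hζy]
      · have hp : 0 < ‖y - x‖ := norm_pos_iff.2 (sub_ne_zero.2 hy)
        have hKle := Kr_le hN hr hp le_rfl (hq y (hζb y hζy))
        have h3 : (3 : ℝ≥0∞) = ofReal 3 := by norm_num
        simp only [hβ, nk]
        rw [h3, ← ofReal_mul (hρ0 y).le, ← ofReal_mul (by positivity),
          ← ofReal_mul (by norm_num)]
        refine ofReal_le_ofReal ?_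
        rw [norm_sub_rev x y]
        have := mul_le_mul_of_nonneg_left hKle (mul_nonneg (hρ0 y).le (hb0 y))
        linarith
    refine ⟨?_, ?_⟩
    · have := slice_integrable j1
      simpa only [e1] using this
    · have e3 : ∫ p : EuT N, U p ^ m * (θ p.2 * (ξ p.1 ^ (2 * N) * mr r (p.1 - x)))
          = ∫ y, F y * mr r (y - x) := by
        have := slice_integral j1
        simp only [e1] at this
        exact this
      rw [e3] at hk
      linarith
  obtain ⟨κ, hκ, hFκ⟩ := ae_le_of_mr_integral_le hN iF hF0
  have hFb : ∀ᵐ x, x ∈ ball x0 R → Φ x ≠ ∞ → κ * F x ≤ kerC N c * G + 3 * (Φ x).toReal := by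
    filter_upwards [hFκ] with x hx hxb hΦx
    exact hx _ (key x hxb hΦx)
  obtain ⟨M, hM⟩ : ∃ M : ℝ, ∀ᵐ x, Φ x ≤ ofReal M := by
    refine potential_bounded hN hα hC hW hρm hρ0 hbm.ennreal_ofReal ?_
      (κ⁻¹ * (kerC N c * G) + 4 * δ * C0) (κ⁻¹ * 3) (by positivity) ?_
    · have : ∀ y, ofReal (ρ y) * β y = ofReal (ρ y * b y) :=
        fun y => (ofReal_mul (hρ0 y).le).symm
      rw [lintegral_congr this]
      exact ib.lintegral_lt_top.ne
    · filter_upwards [hFb, hbF] with x h1 h2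
      change β x ≤ _ + _ * Φ x
      by_cases hΦx : Φ x = ∞
      · rw [hΦx, ENNReal.mul_top (by simpa using by positivity)]
        simp
      by_cases hx : x ∈ ball x0 R
      · have h3 := h1 hx hΦx
        rw [← ENNReal.ofReal_toReal hΦx, ← ofReal_mul (by positivity),
          ← ofReal_add (by positivity) (by positivity)]
        refine ofReal_le_ofReal ?_
        have h4 := mul_le_mul_of_nonneg_left h3 (inv_pos.2 hκ).le
        rw [inv_mul_cancel_left₀ hκ.ne'] at h4
        linarith
      · have : ζ x = 0 := by by_contra h0; exact hx (hζb x h0)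
        simp [hβ, hb, this]
  refine ⟨κ⁻¹ * (kerC N c * G + 3 * max M 0), ?_⟩
  filter_upwards [hM, hFb, ae_slice_integrable hg] with x h1 h2 h3 hx
  have hxR : x ∈ ball x0 R := ball_subset_ball (half_le_self hR.le) hx
  have h4 := h2 hxR (ne_top_of_le_ne_top ofReal_ne_top h1)
  have h5 : (Φ x).toReal ≤ max M 0 := by
    have := ENNReal.toReal_mono ofReal_ne_top h1
    rwa [ENNReal.toReal_ofReal'] at this
  have hζx : ζ x = 1 := by simp [hζd, hξ1 x hx]
  have h6 : ∫ t in Ioo (t0 - δ) (t0 + δ), U (x, t) ^ m ≤ F x := by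
    simp only [hF, hζx, one_mul]
    have i2 : Integrable (fun s => θ s * U (x, s) ^ m) :=
      (integrable_mul_of_compact h3 hθ.cont hθc).congr
        (of_forall fun s => mul_comm _ _)
    have : ∫ t in Ioo (t0 - δ) (t0 + δ), U (x, t) ^ m
        = ∫ t in Ioo (t0 - δ) (t0 + δ), θ t * U (x, t) ^ m :=
      setIntegral_congr_fun measurableSet_Ioo fun t ht => by simp [hθ1 t ht]
    rw [this]
    exact setIntegral_le_integral i2 (of_forall fun s =>
      mul_nonneg (hθ01 s).1 (rpow_nonneg (hU0 _) _))
  refine h6.trans ?_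
  have h7 : κ * F x ≤ kerC N c * G + 3 * max M 0 := by linarith
  have h8 := mul_le_mul_of_nonneg_left h7 (inv_pos.2 hκ).le
  rwa [inv_mul_cancel_left₀ hκ.ne'] at h8

end TimeIntegral

section Slices

theorem hasDerivAt_integral_slice {Y : Type*} [TopologicalSpace Y] [MeasurableSpace Y] [T2Space Y]
    [OpensMeasurableSpace Y] [SecondCountableTopology Y] {μ : Measure Y}
    [IsFiniteMeasureOnCompacts μ] {G G' : Y → ℝ → ℝ} {K : Set Y} (hK : IsCompact K)
    (hG : Continuous (Function.uncurry G)) (hG' : Continuous (Function.uncurry G'))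
    (hd : ∀ y t, HasDerivAt (G y) (G' y t) t) (h0 : ∀ y ∉ K, ∀ t, G y t = 0) (t : ℝ) :
    HasDerivAt (fun t => ∫ y, G y t ∂μ) (∫ y, G' y t ∂μ) t := by
  have hG'0 : ∀ y ∉ K, ∀ t, G' y t = 0 := fun y hy s => by
    have h1 := hd y s
    have h2 : G y = fun _ => 0 := funext (h0 y hy)
    rw [h2] at h1
    exact h1.unique (hasDerivAt_const s 0)
  have hc : ∀ s, Continuous fun y => G y s := fun s =>
    hG.comp (continuous_id.prodMk continuous_const)
  have hc' : ∀ s, Continuous fun y => G' y s := fun s =>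
    hG'.comp (continuous_id.prodMk continuous_const)
  obtain ⟨C, hC⟩ := (hK.prod (isCompact_closedBall t 1)).exists_bound_of_continuousOn
    hG'.continuousOn
  have hcs : HasCompactSupport fun y => G y t := HasCompactSupport.intro hK fun y hy => h0 y hy t
  refine (hasDerivAt_integral_of_dominated_loc_of_deriv_le (bound := K.indicator fun _ => C)
    (s := ball t 1) (ball_mem_nhds t one_pos)
    (of_forall fun s => (hc s).aestronglyMeasurable)
    ((hc t).integrable_of_hasCompactSupport hcs) (hc' t).aestronglyMeasurable
    (of_forall fun y s hs => ?_) ?_ (of_forall fun y s _ => hd y s)).2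
  · by_cases hy : y ∈ K
    · rw [indicator_of_mem hy]
      exact hC (y, s) ⟨hy, ball_subset_closedBall hs⟩
    · rw [hG'0 y hy, indicator_of_notMem hy]; simp
  · exact (integrableOn_const hK.measure_lt_top.ne).integrable_indicator hK.measurableSet

variable {N : ℕ} {A V : EuT N → ℝ}

theorem hasDerivAt_time (hA : Sm A) (y : Eu N) (t : ℝ) :
    HasDerivAt (fun s => A (y, s)) (Dv eT A (y, t)) t := by
  have h1 : HasFDerivAt A (fderiv ℝ A (y, t)) (y, t) := (hA.diff (y, t)).hasFDerivAt
  have h2 : HasDerivAt (fun s : ℝ => (y, s)) ((0 : Eu N), (1 : ℝ)) t :=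
    (hasDerivAt_const t y).prodMk (hasDerivAt_id t)
  exact h1.comp_hasDerivAt t h2

theorem slice_smooth (hV : Sm V) (t : ℝ) : Sm (fun y => V (y, t)) :=
  hV.comp (contDiff_id.prodMk contDiff_const)

theorem lapS_slice (hV : Sm V) (y : Eu N) (t : ℝ) :
    lapS eB (fun y => V (y, t)) y = lapS eX V (y, t) := by
  have := lapS_affine hV (ContinuousLinearMap.inl ℝ (Eu N) ℝ) ((0 : Eu N), t) eB y
  simp only [ContinuousLinearMap.inl_apply, Prod.mk_add_mk, add_zero, zero_add] at this
  exact this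

/-- Testing the differential inequality `∂ₜA ≤ ΔV` at a fixed time. -/
theorem slice_test (hA : Sm A) (hV : Sm V) (hV0 : ∀ p, 0 ≤ V p) {T : Set (Eu N)} (hT : IsCompact T)
    {t : ℝ} (hAV : ∀ y ∈ T, Dv eT A (y, t) ≤ lapS eX V (y, t)) {ω β : Eu N → ℝ} (hω : Sm ω)
    (hω0 : ∀ y, 0 ≤ ω y) (hωT : tsupport ω ⊆ T) (hβ : Continuous β) (hβT : ∀ y ∉ T, β y = 0)
    {D : ℝ} (hl : ∀ y ∈ T, lapS eB ω y ≤ D - β y) :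
    ∫ y, ω y * Dv eT A (y, t) ≤ D * (∫ y in T, V (y, t)) - ∫ y, β y * V (y, t) := by
  have hωc : HasCompactSupport ω := hT.of_isClosed_subset (isClosed_tsupport ω) hωT
  have hVt := slice_smooth hV t
  have hVc : Continuous fun y => V (y, t) := hVt.cont
  have hAc : Continuous fun y => Dv eT A (y, t) := (slice_smooth (hA.dv eT) t).cont
  have hLc : Continuous (lapS eB fun y => V (y, t)) := (Sm.lapS hVt eB).cont
  have hωcont : Continuous ω := hω.cont
  have h1 : ∫ y, ω y * Dv eT A (y, t) ≤ ∫ y, ω y * lapS eB (fun y => V (y, t)) y := by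
    refine integral_mono ((hωcont.mul hAc).integrable_of_hasCompactSupport hωc.mul_right)
      ((hωcont.mul hLc).integrable_of_hasCompactSupport hωc.mul_right) fun y => ?_
    by_cases hy : y ∈ T
    · rw [lapS_slice hV]
      exact mul_le_mul_of_nonneg_left (hAV y hy) (hω0 y)
    · have : ω y = 0 := image_eq_zero_of_notMem_tsupport fun h => hy (hωT h)
      simp [this]
  have hβc : HasCompactSupport β := HasCompactSupport.intro hT hβT
  have i1 : Integrable fun y => β y * V (y, t) :=
    (hβ.mul hVc).integrable_of_hasCompactSupport hβc.mul_right
  have i2 : Integrable (T.indicator fun y => V (y, t)) :=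
    (hVc.continuousOn.integrableOn_compact hT).integrable_indicator hT.measurableSet
  rw [integral_mul_lapS hω hVt hωc] at h1
  refine h1.trans ?_
  rw [← integral_indicator hT.measurableSet, ← integral_const_mul,
    ← integral_sub (i2.const_mul D) i1]
  refine integral_mono ((Sm.lapS hω eB).cont.mul hVc
    |>.integrable_of_hasCompactSupport (HasCompactSupport.lapS hωc eB).mul_right)
    ((i2.const_mul D).sub i1) fun y => ?_
  by_cases hy : y ∈ T
  · simp only [indicator_of_mem hy]
    have := mul_le_mul_of_nonneg_right (hl y hy) (hV0 (y, t))
    linarith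
  · simp only [indicator_of_notMem hy, hβT y hy,
      lapS_eq_zero (fun h => hy (hωT h)) eB]
    simp

theorem integral_slab_le (hV0 : ∀ p, 0 ≤ V p) {k : Eu N → ℝ}
    (hk0 : ∀ y, 0 ≤ k y) {S : ℝ}
    (hkV : Integrable fun p : EuT N => k p.1 * V p) (hS : ∫ p : EuT N, k p.1 * V p ≤ S)
    {I : Set ℝ} : ∫ s in I, ∫ y, k y * V (y, s) ≤ S := by
  have h1 := integral_prod_symm _ hkV
  have i1 : Integrable fun s => ∫ y, k y * V (y, s) := hkV.integral_prod_right
  calc ∫ s in I, ∫ y, k y * V (y, s) ≤ ∫ s, ∫ y, k y * V (y, s) :=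
        setIntegral_le_integral i1 (of_forall fun s =>
          integral_nonneg fun y => mul_nonneg (hk0 y) (hV0 _))
    _ ≤ S := by rw [← h1]; exact hS

end Slices

section Bilinear

variable {N : ℕ} {A V : EuT N → ℝ}

theorem slice_integral_continuous (hV : Sm V) {T : Set (Eu N)} (hT : IsCompact T) :
    Continuous fun t => ∫ y in T, V (y, t) := by
  refine continuous_parametric_integral_of_continuous (f := fun t y => V (y, t)) ?_ hT
  exact hV.cont.comp (continuous_snd.prodMk continuous_fst)

theorem interval_slice_le (hVi : Integrable V) (hV0 : ∀ p, 0 ≤ V p) {T : Set (Eu N)}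
    (hT : IsCompact T) {X : ℝ} (hX : ∫ p, V p ≤ X) {s t : ℝ} (hst : s ≤ t) :
    ∫ τ in s..t, ∫ y in T, V (y, τ) ≤ X := by
  rw [intervalIntegral.integral_of_le hst]
  have h1 : Integrable (fun p : EuT N => T.indicator 1 p.1 * V p) := by
    refine (hVi.indicator (hT.measurableSet.prod MeasurableSet.univ)).congr
      (of_forall fun p => ?_)
    by_cases hp : p.1 ∈ T <;> simp [hp]
  have h2 := integral_slab_le (k := T.indicator 1) (S := X) (I := Ioc s t) hV0
    (fun y => indicator_nonneg (fun _ _ => zero_le_one) y) h1 ?_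
  · refine le_trans (le_of_eq ?_) h2
    refine integral_congr_ae (of_forall fun τ => ?_)
    simp only
    rw [← integral_indicator hT.measurableSet]
    refine integral_congr_ae (of_forall fun y => ?_)
    by_cases hp : y ∈ T <;> simp [hp]
  · refine (integral_mono h1 hVi fun p => ?_).trans hX
    by_cases hp : p.1 ∈ T <;> simp [hp, hV0 p]

theorem slice_hasDeriv (hA : Sm A) {ω : Eu N → ℝ} (hω : Continuous ω) (hωc : HasCompactSupport ω)
    (t : ℝ) : HasDerivAt (fun t => ∫ y, ω y * A (y, t)) (∫ y, ω y * Dv eT A (y, t)) t := by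
  refine hasDerivAt_integral_slice (G := fun y t => ω y * A (y, t))
    (G' := fun y t => ω y * Dv eT A (y, t)) (K := tsupport ω) hωc ?_ ?_ ?_ ?_ t
  · exact (hω.comp continuous_fst).mul hA.cont
  · exact (hω.comp continuous_fst).mul (hA.dv eT).cont
  · exact fun y t => (hasDerivAt_time hA y t).const_mul _
  · intro y hy t
    rw [image_eq_zero_of_notMem_tsupport hy, zero_mul]

/-- Pointwise in time bound for weighted averages of a smooth subsolution. -/
theorem slice_sup (hA : Sm A) (hAi : Integrable A) (hA0 : ∀ p, 0 ≤ A p) (hV : Sm V)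
    (hVi : Integrable V) (hV0 : ∀ p, 0 ≤ V p)
    {T : Set (Eu N)} (hT : IsCompact T) {t0 t2 d : ℝ} (hd : 0 < d)
    (hAV : ∀ t ∈ Icc t0 t2, ∀ y ∈ T, Dv eT A (y, t) ≤ lapS eX V (y, t)) {ω : Eu N → ℝ}
    (hω : Sm ω) (hω0 : ∀ y, 0 ≤ ω y) (hωT : tsupport ω ⊆ T) {D : ℝ} (hD : 0 ≤ D)
    (hl : ∀ y ∈ T, lapS eB ω y ≤ D) {S X : ℝ} (hS : ∫ p : EuT N, ω p.1 * A p ≤ S)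
    (hX : ∫ p, V p ≤ X) {t : ℝ} (ht0 : t0 + d ≤ t) (ht2 : t ≤ t2) :
    ∫ y, ω y * A (y, t) ≤ S / d + D * X := by
  have hωc : HasCompactSupport ω := hT.of_isClosed_subset (isClosed_tsupport ω) hωT
  have hωcont : Continuous ω := hω.cont
  set P : ℝ → ℝ := fun t => ∫ y, ω y * A (y, t) with hP
  have hPd := slice_hasDeriv hA hωcont hωc
  have hPc : Continuous P := continuous_iff_continuousAt.2 fun t => (hPd t).continuousAt
  have hvc := slice_integral_continuous hV hT
  have h1 : ∀ s ∈ Icc (t - d) t, P t ≤ P s + D * X := by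
    intro s hs
    have h2 := intervalIntegral.sub_le_integral_of_hasDeriv_right_of_le (g := P)
      (g' := fun t => ∫ y, ω y * Dv eT A (y, t)) (φ := fun t => D * ∫ y in T, V (y, t)) hs.2
      hPc.continuousOn (fun x _ => (hPd x).hasDerivWithinAt)
      ((continuous_const.mul hvc).continuousOn.integrableOn_compact isCompact_Icc) ?_
    · rw [intervalIntegral.integral_const_mul] at h2
      have h3 := mul_le_mul_of_nonneg_left (interval_slice_le hVi hV0 hT hX hs.2) hD
      linarith
    · intro x hx
      have h3 := slice_test hA hV hV0 hT (hAV x ⟨by linarith [hs.1, hx.1], by linarith [hx.2]⟩) hω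
        hω0 hωT (β := fun _ => 0) continuous_const (fun _ _ => rfl) (D := D) (by simpa using hl)
      simpa using h3
  obtain ⟨C, hC⟩ := exists_bound_of_compact hωcont hωc
  have i1 : Integrable fun p : EuT N => ω p.1 * A p :=
    (hAi.mul_bdd (c := C) (hωcont.comp continuous_fst).aestronglyMeasurable
      (of_forall fun p => hC p.1)).congr (of_forall fun p => mul_comm _ _)
  have h4 := integral_slab_le hA0 hω0 i1 hS (I := Icc (t - d) t)
  have h5 : d * P t ≤ S + d * (D * X) := by
    have h6 : ∫ s in Icc (t - d) t, P t ≤ ∫ s in Icc (t - d) t, (P s + D * X) :=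
      setIntegral_mono_on (integrableOn_const (by simp))
        ((hPc.add continuous_const).continuousOn.integrableOn_compact isCompact_Icc)
        measurableSet_Icc h1
    rw [integral_add (hPc.continuousOn.integrableOn_compact isCompact_Icc)
      (integrableOn_const (by simp)), setIntegral_const, setIntegral_const] at h6
    simp only [Measure.real, Real.volume_Icc, smul_eq_mul] at h6
    rw [toReal_ofReal (by linarith)] at h6
    have : t - (t - d) = d := by ring
    rw [this] at h6
    linarith
  rw [div_add' _ _ _ hd.ne', le_div_iff₀ hd]
  linarith

end Bilinear

section Bilinear

variable {N : ℕ} {A V : EuT N → ℝ}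

/-- The bilinear form `∬ ζ(x) ζ(y) k(x,y) B(x,t) A(y,t)`. -/
theorem bilinear_eq {ζ : Eu N → ℝ} (hζ : Continuous ζ) (hζc : HasCompactSupport ζ)
    {k : Eu N → ℝ} (hk : Continuous k) {A B : Eu N → ℝ} (hA : Continuous A) (hB : Continuous B) :
    Integrable (fun z : Eu N × Eu N => ζ z.1 * ζ z.2 * k (z.1 - z.2) * (B z.1 * A z.2)) ∧
    Integrable (fun y => ζ y * A y * ∫ x, ζ x * k (x - y) * B x) ∧
    ∫ z : Eu N × Eu N, ζ z.1 * ζ z.2 * k (z.1 - z.2) * (B z.1 * A z.2)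
      = ∫ y, ζ y * A y * ∫ x, ζ x * k (x - y) * B x := by
  have hi : Integrable (fun z : Eu N × Eu N =>
      ζ z.1 * ζ z.2 * k (z.1 - z.2) * (B z.1 * A z.2)) := by
    refine Continuous.integrable_of_hasCompactSupport ?_ ?_
    · exact (((hζ.comp continuous_fst).mul (hζ.comp continuous_snd)).mul
        (hk.comp (continuous_fst.sub continuous_snd))).mul
        ((hB.comp continuous_fst).mul (hA.comp continuous_snd))
    · refine HasCompactSupport.intro (hζc.isCompact.prod hζc.isCompact) fun z hz => ?_
      have : ζ z.1 * ζ z.2 = 0 := by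
        by_contra h
        refine hz ⟨subset_tsupport _ (left_ne_zero_of_mul h),
          subset_tsupport _ (right_ne_zero_of_mul h)⟩
      simp [this]
  have e : ∀ y, ∫ x, ζ x * ζ y * k (x - y) * (B x * A y)
      = ζ y * A y * ∫ x, ζ x * k (x - y) * B x := by
    intro y
    rw [← integral_const_mul]
    exact integral_congr_ae (of_forall fun x => by ring)
  refine ⟨hi, ?_, ?_⟩
  · have := hi.integral_prod_right
    simpa only [e] using this
  · have := integral_prod_symm _ hi
    simp only [e] at this
    exact this

theorem bilinear_swap {ζ : Eu N → ℝ} {k : Eu N → ℝ} (hk : ∀ z, k (-z) = k z) {A B : Eu N → ℝ} :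
    ∫ z : Eu N × Eu N, ζ z.1 * ζ z.2 * k (z.1 - z.2) * (A z.1 * B z.2)
      = ∫ z : Eu N × Eu N, ζ z.1 * ζ z.2 * k (z.1 - z.2) * (B z.1 * A z.2) := by
  have := integral_prod_swap (μ := (volume : Measure (Eu N))) (ν := (volume : Measure (Eu N)))
    (fun z : Eu N × Eu N => ζ z.1 * ζ z.2 * k (z.1 - z.2) * (B z.1 * A z.2))
  refine Eq.trans ?_ this
  refine integral_congr_ae (of_forall fun z => ?_)
  simp only [Prod.fst_swap, Prod.snd_swap]
  rw [← neg_sub z.1 z.2, hk]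
  ring

theorem bilinear_hasDeriv (hA : Sm A) {ζ : Eu N → ℝ} (hζ : Continuous ζ)
    (hζc : HasCompactSupport ζ) {k : Eu N → ℝ} (hk : Continuous k) (hke : ∀ z, k (-z) = k z)
    (t : ℝ) :
    HasDerivAt (fun t => ∫ z : Eu N × Eu N,
        ζ z.1 * ζ z.2 * k (z.1 - z.2) * (A (z.1, t) * A (z.2, t)))
      (2 * ∫ y, ζ y * A (y, t) * ∫ x, ζ x * k (x - y) * Dv eT A (x, t)) t := by
  have hAc := hA.cont
  have hBc := (hA.dv eT).cont
  have hs : ∀ {f : EuT N → ℝ}, Continuous f → Continuous fun y => f (y, t) :=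
    fun h => h.comp (continuous_id.prodMk continuous_const)
  have h1 := hasDerivAt_integral_slice (μ := (volume : Measure (Eu N × Eu N)))
    (G := fun z t => ζ z.1 * ζ z.2 * k (z.1 - z.2) * (A (z.1, t) * A (z.2, t)))
    (G' := fun z t => ζ z.1 * ζ z.2 * k (z.1 - z.2) *
      (Dv eT A (z.1, t) * A (z.2, t) + A (z.1, t) * Dv eT A (z.2, t)))
    (K := tsupport ζ ×ˢ tsupport ζ) (hζc.isCompact.prod hζc.isCompact) ?_ ?_
    (fun z t => ((hasDerivAt_time hA z.1 t).mul (hasDerivAt_time hA z.2 t)).const_mul _) ?_ t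
  · convert h1 using 1
    obtain ⟨i1, -, e1⟩ := bilinear_eq hζ hζc hk (hs hAc) (hs hBc)
    obtain ⟨i2, -, -⟩ := bilinear_eq hζ hζc hk (hs hBc) (hs hAc)
    have e2 := bilinear_swap (ζ := ζ) hke (A := fun y => A (y, t)) (B := fun y => Dv eT A (y, t))
    simp only [mul_add]
    rw [integral_add i1 i2, e2, e1]
    ring
  · have c1 : Continuous fun p : (Eu N × Eu N) × ℝ => ((p.1.1, p.2) : EuT N) := by fun_prop
    have c2 : Continuous fun p : (Eu N × Eu N) × ℝ => ((p.1.2, p.2) : EuT N) := by fun_prop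
    have c3 : Continuous fun p : (Eu N × Eu N) × ℝ => ζ p.1.1 * ζ p.1.2 * k (p.1.1 - p.1.2) := by
      fun_prop
    exact c3.mul ((hAc.comp c1).mul (hAc.comp c2))
  · have c1 : Continuous fun p : (Eu N × Eu N) × ℝ => ((p.1.1, p.2) : EuT N) := by fun_prop
    have c2 : Continuous fun p : (Eu N × Eu N) × ℝ => ((p.1.2, p.2) : EuT N) := by fun_prop
    have c3 : Continuous fun p : (Eu N × Eu N) × ℝ => ζ p.1.1 * ζ p.1.2 * k (p.1.1 - p.1.2) := by
      fun_prop
    exact c3.mul (((hBc.comp c1).mul (hAc.comp c2)).add ((hAc.comp c1).mul (hBc.comp c2)))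
  · intro z hz t
    have : ζ z.1 * ζ z.2 = 0 := by
      by_contra h
      exact hz ⟨subset_tsupport _ (left_ne_zero_of_mul h),
        subset_tsupport _ (right_ne_zero_of_mul h)⟩
    simp [this]

/-- Data of a cut-off function adapted to the regularized Newtonian kernel. -/
structure Cut (N : ℕ) (ζ : Eu N → ℝ) (D : ℝ) : Prop where
  smooth : Sm ζ
  compact : HasCompactSupport ζ
  nonneg : ∀ y, 0 ≤ ζ y
  le_one : ∀ y, ζ y ≤ 1
  D_nonneg : 0 ≤ D
  lap : ∀ y, lapS eB ζ y ≤ D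
  kernel : ∀ r, 0 < r → r ≤ 1 → ∀ x ∈ tsupport ζ, ∀ y ∈ tsupport ζ,
    lapS eB (fun y => ζ y * Kr r (y - x)) y ≤ D - ζ y * mr r (y - x)

theorem bilinear_bound (hN : 3 ≤ N) (hA : Sm A) (hAi : Integrable A) (hA0 : ∀ p, 0 ≤ A p) (hV : Sm V)
    (hVi : Integrable V) (hV0 : ∀ p, 0 ≤ V p) {ζ : Eu N → ℝ} {D : ℝ} (hζ : Cut N ζ D)
    {t0 t2 d : ℝ} (hd : 0 < d) (ht : t0 + d ≤ t2)
    (hAV : ∀ t ∈ Icc t0 t2, ∀ y ∈ tsupport ζ, Dv eT A (y, t) ≤ lapS eX V (y, t))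
    {S X : ℝ} (hS0 : 0 ≤ S) {r : ℝ} (hr : 0 < r) (hr1 : r ≤ 1)
    (hS : ∀ x ∈ tsupport ζ, ∫ p : EuT N, ζ p.1 * Kr r (p.1 - x) * A p ≤ S)
    (hXA : ∫ p, A p ≤ X) (hXV : ∫ p, V p ≤ X) {κ ε : ℝ}
    (hlow : ∀ t ∈ Icc (t0 + d) t2, ∀ y ∈ tsupport ζ,
      κ * (ζ y * V (y, t) - ε) ≤ ∫ x, ζ x * mr r (x - y) * V (x, t)) :
    2 * κ * ∫ t in (t0 + d)..t2, ∫ y in tsupport ζ, ζ y * A (y, t) * (ζ y * V (y, t) - ε)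
      ≤ (S / d + D * X) * (X / d + D * X) + 2 * D * (X / d + D * X) * X := by
  have hT : IsCompact (tsupport ζ) := hζ.compact
  set T := tsupport ζ with hTd
  have hζc : Continuous ζ := hζ.smooth.cont
  have hKc : Continuous (Kr (N := N) r) := (Kr_smooth hr).cont
  have hAc := hA.cont
  have hBc := (hA.dv eT).cont
  have hVc := hV.cont
  have hs : ∀ {f : EuT N → ℝ}, Continuous f → ∀ t, Continuous fun y => f (y, t) :=
    fun h t => h.comp (continuous_id.prodMk continuous_const)
  have hX0 : 0 ≤ X := (integral_nonneg hA0).trans hXA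
  have hD := hζ.D_nonneg
  set S' := S / d + D * X
  set X' := X / d + D * X
  have hX' : 0 ≤ X' := by positivity
  have hP : ∀ t ∈ Icc (t0 + d) t2, ∀ y ∈ T, ∫ x, ζ x * Kr r (x - y) * A (x, t) ≤ S' := by
    intro t ht' y hy
    refine slice_sup hA hAi hA0 hV hVi hV0 hT hd hAV (hζ.smooth.mul (sub_smooth (Kr_smooth hr) y))
      (fun x => mul_nonneg (hζ.nonneg x) (Kr_pos hr _).le)
      (closure_mono (Function.support_mul_subset_left ζ (fun x => Kr r (x - y)))) hD
      (fun x hx => ?_) (hS y hy) hXV ht'.1 ht'.2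
    have h1 := hζ.kernel r hr hr1 y hy x hx
    have h2 := mul_nonneg (hζ.nonneg x) (mr_nonneg hN hr (x - y))
    linarith
  have hab : ∀ t ∈ Icc (t0 + d) t2, ∫ x, ζ x * A (x, t) ≤ X' := by
    intro t ht'
    refine slice_sup hA hAi hA0 hV hVi hV0 hT hd hAV hζ.smooth hζ.nonneg subset_rfl hD
      (fun x _ => hζ.lap x) ?_ hXV ht'.1 ht'.2
    refine (integral_mono_of_nonneg (of_forall fun p => ?_) hAi
      (of_forall fun p => ?_)).trans hXA
    · exact mul_nonneg (hζ.nonneg _) (hA0 p)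
    · exact mul_le_of_le_one_left (hA0 p) (hζ.le_one _)
  have iζA : ∀ t, Integrable fun y => ζ y * A (y, t) := fun t =>
    (hζc.mul (hs hAc t)).integrable_of_hasCompactSupport hζ.compact.mul_right
  set F : ℝ → ℝ := fun t => ∫ z : Eu N × Eu N,
    ζ z.1 * ζ z.2 * Kr r (z.1 - z.2) * (A (z.1, t) * A (z.2, t)) with hF
  have hFd := bilinear_hasDeriv hA hζc hζ.compact hKc (Kr_neg (r := r))
  have hFc : Continuous F := continuous_iff_continuousAt.2 fun t => (hFd t).continuousAt
  have hF0 : ∀ t, 0 ≤ F t := fun t => integral_nonneg fun z =>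
    mul_nonneg (mul_nonneg (mul_nonneg (hζ.nonneg _) (hζ.nonneg _)) (Kr_pos hr _).le)
      (mul_nonneg (hA0 _) (hA0 _))
  have hFs : F (t0 + d) ≤ S' * X' := by
    have hm : t0 + d ∈ Icc (t0 + d) t2 := ⟨le_rfl, ht⟩
    obtain ⟨-, i2, e2⟩ := bilinear_eq hζc hζ.compact hKc (hs hAc (t0 + d)) (hs hAc (t0 + d))
    have hS' : 0 ≤ S' := by positivity
    have h0 : ∀ y ∉ T, ζ y = 0 := fun y hy => image_eq_zero_of_notMem_tsupport hy
    have h1 : F (t0 + d) ≤ ∫ y, ζ y * A (y, t0 + d) * S' := by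
      rw [hF]
      simp only
      rw [e2]
      refine integral_mono i2 ((iζA _).mul_const _) fun y => ?_
      by_cases hy : y ∈ T
      · exact mul_le_mul_of_nonneg_left (hP _ hm y hy) (mul_nonneg (hζ.nonneg y) (hA0 _))
      · simp [h0 y hy]
    rw [integral_mul_const] at h1
    have := mul_le_mul_of_nonneg_right (hab _ hm) hS'
    linarith
  set W : EuT N → ℝ := fun p => ζ p.1 * A p * (ζ p.1 * V p - ε) with hW
  have hWc : Continuous fun t => ∫ y in T, W (y, t) := by
    refine continuous_parametric_integral_of_continuous (f := fun t y => W (y, t)) ?_ hT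
    have : Continuous W := by fun_prop
    exact this.comp (continuous_snd.prodMk continuous_fst)
  have hvc := slice_integral_continuous hV hT
  have key := intervalIntegral.sub_le_integral_of_hasDeriv_right_of_le (g := F)
    (g' := fun t => 2 * ∫ y, ζ y * A (y, t) * ∫ x, ζ x * Kr r (x - y) * Dv eT A (x, t))
    (φ := fun t => 2 * D * X' * (∫ y in T, V (y, t)) - 2 * κ * ∫ y in T, W (y, t)) ht
    hFc.continuousOn (fun x _ => (hFd x).hasDerivWithinAt)
    (((continuous_const.mul hvc).sub (continuous_const.mul hWc)).continuousOn.integrableOn_compact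
      isCompact_Icc) ?_
  · have c1 : Continuous fun t => 2 * D * X' * (∫ y in T, V (y, t)) := continuous_const.mul hvc
    have c2 : Continuous fun t => 2 * κ * ∫ y in T, W (y, t) := continuous_const.mul hWc
    rw [intervalIntegral.integral_sub (c1.intervalIntegrable _ _) (c2.intervalIntegrable _ _),
      intervalIntegral.integral_const_mul,
      intervalIntegral.integral_const_mul] at key
    have h3 := mul_le_mul_of_nonneg_left (interval_slice_le hVi hV0 hT hXV ht)
      (by positivity : 0 ≤ 2 * D * X')
    have h4 := hF0 t2
    linarith
  · intro t ht'
    have htI : t ∈ Icc (t0 + d) t2 := Ioo_subset_Icc_self ht'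
    have htI' : t ∈ Icc t0 t2 := ⟨by linarith [htI.1], htI.2⟩
    obtain ⟨-, i2, -⟩ := bilinear_eq hζc hζ.compact hKc (hs hAc t) (hs hBc t)
    set vb := ∫ y in T, V (y, t) with hvb
    have hvb0 : 0 ≤ vb := integral_nonneg fun y => hV0 _
    have hQ : ∀ y ∈ T, ∫ x, ζ x * Kr r (x - y) * Dv eT A (x, t)
        ≤ D * vb - κ * (ζ y * V (y, t) - ε) := by
      intro y hy
      have h1 := slice_test hA hV hV0 hT (hAV t htI')
        (hζ.smooth.mul (sub_smooth (Kr_smooth hr) y))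
        (fun x => mul_nonneg (hζ.nonneg x) (Kr_pos hr _).le)
        (closure_mono (Function.support_mul_subset_left ζ (fun x => Kr r (x - y))))
        (β := fun x => ζ x * mr r (x - y))
        (hζc.mul (sub_smooth (mr_smooth hr) y).cont)
        (fun x hx => by rw [image_eq_zero_of_notMem_tsupport hx, zero_mul])
        (fun x hx => hζ.kernel r hr hr1 y hy x hx)
      have h2 := hlow t htI y hy
      linarith
    have iW : Integrable fun y => W (y, t) :=
      (((hζc.mul (hs hAc t)).mul ((hζc.mul (hs hVc t)).sub continuous_const))
        |>.integrable_of_hasCompactSupport hζ.compact.mul_right.mul_right)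
    have eW : ∫ y in T, W (y, t) = ∫ y, W (y, t) := by
      refine setIntegral_eq_integral_of_forall_compl_eq_zero fun y hy => ?_
      simp [hW, image_eq_zero_of_notMem_tsupport hy]
    have h1 : ∫ y, ζ y * A (y, t) * ∫ x, ζ x * Kr r (x - y) * Dv eT A (x, t)
        ≤ ∫ y, (ζ y * A (y, t) * (D * vb) - κ * W (y, t)) := by
      refine integral_mono i2 (((iζA t).mul_const _).sub (iW.const_mul κ)) fun y => ?_
      by_cases hy : y ∈ T
      · have := mul_le_mul_of_nonneg_left (hQ y hy) (mul_nonneg (hζ.nonneg y) (hA0 (y, t)))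
        simp only [hW]
        linarith
      · simp [hW, image_eq_zero_of_notMem_tsupport hy]
    rw [integral_sub ((iζA t).mul_const _) (iW.const_mul κ), integral_mul_const,
      integral_const_mul] at h1
    have h2 := mul_le_mul_of_nonneg_right (hab t htI) (mul_nonneg hD hvb0)
    rw [eW]
    linarith

end Bilinear

section Bilinear

variable {N : ℕ} {A V : EuT N → ℝ}

/-- Lower bound for the mass of the kernels `mr`. -/
def kapN (N : ℕ) : ℝ := (2 : ℝ) ^ (-(N + 2) / 2 : ℝ) * (volume : Measure (Eu N)).real (ball 0 1)

theorem kapN_pos (N : ℕ) : 0 < kapN N :=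
  mul_pos (by positivity)
    (ENNReal.toReal_pos (measure_ball_pos _ _ one_pos).ne' measure_ball_lt_top.ne)

theorem mr_low (hN : 3 ≤ N) {f : Eu N → ℝ} (hf : Continuous f) (hfc : HasCompactSupport f)
    (hf0 : ∀ x, 0 ≤ f x) {r : ℝ} (hr : 0 < r) {c : ℝ} {y : Eu N}
    (hc : ∀ x ∈ closedBall y r, c ≤ f x) : kapN N * c ≤ ∫ x, f x * mr r (x - y) := by
  have hpos : ∀ x, 0 ≤ f x * mr r (x - y) := fun x => mul_nonneg (hf0 x) (mr_nonneg hN hr _)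
  rcases le_or_gt c 0 with h | h
  · exact (mul_nonpos_of_nonneg_of_nonpos (kapN_pos N).le h).trans (integral_nonneg hpos)
  have hne : Nonempty (Fin N) := ⟨⟨0, by omega⟩⟩
  have hvol : (volume : Measure (Eu N)).real (closedBall y r)
      = r ^ N * (volume : Measure (Eu N)).real (ball 0 1) := by
    rw [Measure.real, Measure.addHaar_closedBall _ _ hr.le, ENNReal.toReal_mul,
      toReal_ofReal (by positivity)]
    simp [Measure.real]
  have hi : Integrable fun x => f x * mr r (x - y) :=
    (hf.mul (sub_smooth (mr_smooth hr) y).cont).integrable_of_hasCompactSupport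
      hfc.mul_right
  calc kapN N * c = ∫ x in closedBall y r, c * ((2 : ℝ) ^ (-(N + 2) / 2 : ℝ) * (r ^ N)⁻¹) := by
        rw [setIntegral_const, hvol, smul_eq_mul, kapN]; field_simp
    _ ≤ ∫ x in closedBall y r, f x * mr r (x - y) := by
        refine setIntegral_mono_on (integrableOn_const measure_closedBall_lt_top.ne)
          hi.integrableOn measurableSet_closedBall fun x hx => ?_
        exact mul_le_mul (hc x hx) (mr_ge hN hr (by rwa [← dist_eq_norm])) (by positivity) (hf0 x)
    _ ≤ _ := setIntegral_le_integral hi (of_forall hpos)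

theorem exists_unif {W : EuT N → ℝ} (hW : Continuous W) {T : Set (Eu N)} (hT : IsCompact T)
    {I : Set ℝ} (hI : IsCompact I) {ε : ℝ} (hε : 0 < ε) :
    ∃ r, 0 < r ∧ r ≤ 1 ∧ ∀ t ∈ I, ∀ y ∈ T, ∀ x ∈ closedBall y r, W (y, t) - ε ≤ W (x, t) := by
  have hK : IsCompact (cthickening 1 T ×ˢ I) := hT.cthickening.prod hI
  have hu := hK.uniformContinuousOn_of_continuous hW.continuousOn
  rw [Metric.uniformContinuousOn_iff] at hu
  obtain ⟨δ, hδ, h⟩ := hu ε hε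
  refine ⟨min 1 (δ / 2), by positivity, min_le_left _ _, fun t ht y hy x hx => ?_⟩
  rw [mem_closedBall] at hx
  have h1 : dist (x, t) (y, t) < δ := by
    rw [Prod.dist_eq]
    simp only [dist_self]
    have := hx.trans (min_le_right _ _)
    rw [max_lt_iff]; constructor <;> linarith
  have hx1 : x ∈ cthickening 1 T :=
    mem_cthickening_of_dist_le x y 1 T hy (hx.trans (min_le_left _ _))
  have h2 := h (x, t) ⟨hx1, ht⟩ (y, t) ⟨self_subset_cthickening T hy, ht⟩ h1
  rw [Real.dist_eq, abs_lt] at h2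
  linarith

theorem bilinear_bound_limit (hN : 3 ≤ N) (hA : Sm A) (hAi : Integrable A) (hA0 : ∀ p, 0 ≤ A p)
    (hV : Sm V) (hVi : Integrable V) (hV0 : ∀ p, 0 ≤ V p) {ζ : Eu N → ℝ} {D : ℝ} (hζ : Cut N ζ D)
    {t0 t2 d : ℝ} (hd : 0 < d) (ht : t0 + d ≤ t2)
    (hAV : ∀ t ∈ Icc t0 t2, ∀ y ∈ tsupport ζ, Dv eT A (y, t) ≤ lapS eX V (y, t))
    {S X : ℝ} (hS0 : 0 ≤ S)
    (hS : ∀ r, 0 < r → r ≤ 1 → ∀ x ∈ tsupport ζ,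
      ∫ p : EuT N, ζ p.1 * Kr r (p.1 - x) * A p ≤ S)
    (hXA : ∫ p, A p ≤ X) (hXV : ∫ p, V p ≤ X) :
    2 * kapN N * ∫ t in (t0 + d)..t2, ∫ y in tsupport ζ, ζ y * A (y, t) * (ζ y * V (y, t))
      ≤ (S / d + D * X) * (X / d + D * X) + 2 * D * (X / d + D * X) * X := by
  have hT : IsCompact (tsupport ζ) := hζ.compact
  have hζc : Continuous ζ := hζ.smooth.cont
  have hAc := hA.cont
  have hVc := hV.cont
  have hcont : ∀ {W : EuT N → ℝ}, Continuous W →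
      Continuous fun t => ∫ y in tsupport ζ, W (y, t) := fun {W} h =>
    continuous_parametric_integral_of_continuous (f := fun t y => W (y, t))
      (h.comp (continuous_snd.prodMk continuous_fst)) hT
  have c1 := hcont (W := fun p => ζ p.1 * A p * (ζ p.1 * V p)) (by fun_prop)
  have c2 := hcont (W := fun p => ζ p.1 * A p) (by fun_prop)
  have iT : ∀ {W : EuT N → ℝ}, Continuous W → ∀ t,
      IntegrableOn (fun y => W (y, t)) (tsupport ζ) := fun h t =>
    ((h.comp (continuous_id.prodMk continuous_const)).continuousOn.integrableOn_compact hT)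
  set B := ∫ t in (t0 + d)..t2, ∫ y in tsupport ζ, ζ y * A (y, t)
  refine le_of_forall_pos_le_add fun η hη => ?_
  obtain ⟨ε, hε, hεη⟩ : ∃ ε, 0 < ε ∧ 2 * kapN N * (ε * B) ≤ η := by
    refine ⟨η / (2 * kapN N * |B| + 1), ?_, ?_⟩
    · have := kapN_pos N; positivity
    · have hk := kapN_pos N
      have h1 : 2 * kapN N * (η / (2 * kapN N * |B| + 1) * B)
          = η * (2 * kapN N * B / (2 * kapN N * |B| + 1)) := by ring
      rw [h1]
      refine mul_le_of_le_one_right hη.le ?_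
      rw [div_le_one (by positivity)]
      have := mul_le_mul_of_nonneg_left (le_abs_self B) (by positivity : 0 ≤ 2 * kapN N)
      linarith
  obtain ⟨r, hr, hr1, hu⟩ := exists_unif (W := fun p => ζ p.1 * V p) (by fun_prop) hT
    (isCompact_Icc (a := t0 + d) (b := t2)) hε
  have h1 := bilinear_bound hN hA hAi hA0 hV hVi hV0 hζ hd ht hAV hS0 hr hr1 (hS r hr hr1) hXA hXV
    (κ := kapN N) (ε := ε) (fun t ht' y hy => by
      refine (mr_low hN (f := fun x => ζ x * V (x, t)) ?_ hζ.compact.mul_right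
        (fun x => mul_nonneg (hζ.nonneg x) (hV0 _)) hr (hu t ht' y hy)).trans (le_of_eq ?_)
      · exact hζc.mul (hVc.comp (continuous_id.prodMk continuous_const))
      · exact integral_congr_ae (of_forall fun x => by ring))
  have e1 : ∀ t, ∫ y in tsupport ζ, ζ y * A (y, t) * (ζ y * V (y, t) - ε)
      = (∫ y in tsupport ζ, ζ y * A (y, t) * (ζ y * V (y, t)))
        - ε * ∫ y in tsupport ζ, ζ y * A (y, t) := by
    intro t
    rw [← integral_const_mul, ← integral_sub
      (iT (W := fun p => ζ p.1 * A p * (ζ p.1 * V p)) (by fun_prop) t)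
      ((iT (W := fun p => ζ p.1 * A p) (by fun_prop) t).const_mul ε)]
    exact integral_congr_ae (of_forall fun x => by ring)
  simp only [e1] at h1
  have c3 : Continuous fun t => ε * ∫ y in tsupport ζ, ζ y * A (y, t) := continuous_const.mul c2
  rw [intervalIntegral.integral_sub (c1.intervalIntegrable _ _) (c3.intervalIntegrable _ _),
    intervalIntegral.integral_const_mul] at h1
  linarith

end Bilinear

section MollifiedPairing

variable {F : Type*} [NormedAddCommGroup F] [NormedSpace ℝ F] [MeasurableSpace F] [BorelSpace F]
  [FiniteDimensional ℝ F] {μ : Measure F} [μ.IsAddHaarMeasure]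

theorem integral_mul_mo_le (n : ℕ) {k a : F → ℝ} (hk : Continuous k) {C S : ℝ}
    (hkb : ∀ p, |k p| ≤ C) (ha : Integrable a μ)
    (h : ∀ z ∈ tsupport (eta μ n), ∫ q, k (q + z) * a q ∂μ ≤ S) :
    ∫ p, k p * mo μ n a p ∂μ ≤ S := by
  have hη := eta_integrable (μ := μ) n
  have hηc := (eta_smooth (μ := μ) n).cont
  have i1 : Integrable (fun w : F × F => a w.2 * eta μ n (w.1 - w.2)) (μ.prod μ) :=
    ha.convolution_integrand (ContinuousLinearMap.lsmul ℝ ℝ) hη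
  have i2 : Integrable (Function.uncurry fun p q => k p * (a q * eta μ n (p - q))) (μ.prod μ) := by
    refine (i1.mul_bdd (c := C) (g := fun w => k w.1) ?_ ?_).congr ?_
    · exact (hk.comp continuous_fst).aestronglyMeasurable
    · exact of_forall fun w => hkb w.1
    · exact of_forall fun w => mul_comm _ _
  have i3 : Integrable (Function.uncurry fun q z => a q * (k (q + z) * eta μ n z)) (μ.prod μ) := by
    refine ((ha.mul_prod hη).mul_bdd (c := C) (g := fun w : F × F => k (w.1 + w.2)) ?_ ?_).congr ?_
    · exact (hk.comp (continuous_fst.add continuous_snd)).aestronglyMeasurable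
    · exact of_forall fun w => hkb _
    · refine of_forall fun w => ?_
      simp only [Function.uncurry]; ring
  have e : ∫ p, k p * mo μ n a p ∂μ = ∫ z, eta μ n z * ∫ q, k (q + z) * a q ∂μ ∂μ := by
    calc ∫ p, k p * mo μ n a p ∂μ = ∫ p, ∫ q, k p * (a q * eta μ n (p - q)) ∂μ ∂μ := by
          simp only [mo, cv, integral_const_mul]
      _ = ∫ q, ∫ p, k p * (a q * eta μ n (p - q)) ∂μ ∂μ := integral_integral_swap i2
      _ = ∫ q, ∫ z, a q * (k (q + z) * eta μ n z) ∂μ ∂μ := by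
          congr 1; ext q
          rw [← integral_add_left_eq_self _ q]
          congr 1; ext z
          rw [add_sub_cancel_left]; ring
      _ = ∫ z, ∫ q, a q * (k (q + z) * eta μ n z) ∂μ ∂μ := integral_integral_swap i3
      _ = _ := by
          congr 1; ext z
          rw [← integral_const_mul]
          congr 1; ext q; ring
  rw [e]
  have i4 : Integrable (fun z => eta μ n z * ∫ q, k (q + z) * a q ∂μ) μ := by
    refine i3.integral_prod_right.congr (of_forall fun z => ?_)
    simp only [Function.uncurry]
    rw [← integral_const_mul]
    congr 1; ext q; ring
  calc ∫ z, eta μ n z * ∫ q, k (q + z) * a q ∂μ ∂μ ≤ ∫ z, eta μ n z * S ∂μ := by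
        refine integral_mono i4 (hη.mul_const S) fun z => ?_
        by_cases hz : z ∈ tsupport (eta μ n)
        · exact mul_le_mul_of_nonneg_left (h z hz) (eta_nonneg n z)
        · simp [image_eq_zero_of_notMem_tsupport hz]
    _ = S := by rw [integral_mul_const, eta_int, one_mul]

end MollifiedPairing

section LocalBilinear

variable {N : ℕ} {O : Set (EuT N)} {a g : EuT N → ℝ}

theorem Kr_le_zero (hN : 3 ≤ N) {r : ℝ} (hr : 0 < r) (z : Eu N) : Kr r z ≤ Kr r (0 : Eu N) := by
  have h3 : (3 : ℝ) ≤ N := by exact_mod_cast hN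
  have h0 := qr_pos hr (0 : Eu N)
  have h1 : qr r (0 : Eu N) ≤ qr r z := by simp only [qr, norm_zero]; nlinarith [norm_nonneg z]
  exact add_le_add (rpow_le_rpow_of_nonpos h0 h1 (by linarith))
    (rpow_le_rpow_of_nonpos h0 h1 (by linarith))

theorem bilinear_lintegral_le (hN : 3 ≤ N) (h : SubPair O a g) (hO : IsOpen O)
    (ha : Integrable a) (hg : Integrable g) (ha0 : ∀ p, 0 ≤ a p) (hg0 : ∀ p, 0 ≤ g p)
    {ζ : Eu N → ℝ} {D : ℝ} (hζ : Cut N ζ D) {t0 t2 d : ℝ} (hd : 0 < d) (ht : t0 + d ≤ t2)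
    (hKO : tsupport ζ ×ˢ Icc t0 t2 ⊆ O) {B : Set (Eu N)} (hB : IsOpen B) (hζB : tsupport ζ ⊆ B)
    {S X : ℝ} (hS0 : 0 ≤ S)
    (hS : ∀ r, 0 < r → r ≤ 1 → ∀ x ∈ B, ∫ p : EuT N, Kr r (p.1 - x) * a p ≤ S)
    (hXa : ∫ p, a p ≤ X) (hXg : ∫ p, g p ≤ X) :
    ∫⁻ p in tsupport ζ ×ˢ Ioc (t0 + d) t2, ofReal (ζ p.1 * a p * (ζ p.1 * g p))
      ≤ ofReal (((S / d + D * X) * (X / d + D * X) + 2 * D * (X / d + D * X) * X)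
        / (2 * kapN N)) := by
  set R := ((S / d + D * X) * (X / d + D * X) + 2 * D * (X / d + D * X) * X) with hR
  have hT : IsCompact (tsupport ζ) := hζ.compact
  have hζc : Continuous ζ := hζ.smooth.cont
  have hal := ha.locallyIntegrable
  have hgl := hg.locallyIntegrable
  have hK : IsCompact (tsupport ζ ×ˢ Icc t0 t2) := hT.prod isCompact_Icc
  have hnear : ∀ᶠ n : ℕ in atTop, ∀ x ∈ tsupport ζ, ∀ z ∈ tsupport (eta (volume : Measure (EuT N)) n),
      x - z.1 ∈ B := by
    obtain ⟨δ, hδ, hδB⟩ := hT.exists_thickening_subset_open hB hζB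
    have := tendsto_one_div_add_atTop_nhds_zero_nat (𝕜 := ℝ)
    filter_upwards [this.eventually (gt_mem_nhds hδ)] with n hn x hx z hz
    refine hδB (mem_thickening_iff.2 ⟨x, hx, ?_⟩)
    rw [eta_tsupport, mem_closedBall_zero_iff] at hz
    rw [dist_eq_norm, sub_sub_cancel_left, norm_neg]
    exact ((norm_fst_le z).trans hz).trans_lt hn
  have hmain : ∀ᶠ n : ℕ in atTop,
      ∫⁻ p in tsupport ζ ×ˢ Ioc (t0 + d) t2,
        ofReal (ζ p.1 * mo volume n a p * (ζ p.1 * mo volume n g p))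
      ≤ ofReal (R / (2 * kapN N)) := by
    filter_upwards [h.mo hO hal hgl hK hKO, hnear] with n hn hnz
    have hA := mo_smooth (μ := (volume : Measure (EuT N))) n hal
    have hV := mo_smooth (μ := (volume : Measure (EuT N))) n hgl
    have hA0 := mo_nonneg (μ := (volume : Measure (EuT N))) n ha0
    have hV0 := mo_nonneg (μ := (volume : Measure (EuT N))) n hg0
    have hAi := mo_integrable (μ := (volume : Measure (EuT N))) n ha
    have hb := bilinear_bound_limit hN hA hAi hA0 hV
      (mo_integrable n hg) hV0 hζ hd ht (fun t ht y hy => hn (y, t) ⟨hy, ht⟩) hS0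
      (X := X) (fun r hr hr1 x hx => ?_) ((mo_integral n ha).trans_le hXa)
      ((mo_integral n hg).trans_le hXg)
    · have hAc := hA.cont
      have hVc := hV.cont
      have hc : Continuous fun p : EuT N =>
          ζ p.1 * mo volume n a p * (ζ p.1 * mo volume n g p) := by fun_prop
      have hi : IntegrableOn (fun p : EuT N =>
          ζ p.1 * mo volume n a p * (ζ p.1 * mo volume n g p))
          (tsupport ζ ×ˢ Ioc (t0 + d) t2) :=
        (hc.continuousOn.integrableOn_compact (hT.prod isCompact_Icc)).mono_set
          (prod_mono_right Ioc_subset_Icc_self)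
      rw [← ofReal_integral_eq_lintegral_ofReal hi (of_forall fun p =>
        mul_nonneg (mul_nonneg (hζ.nonneg _) (hA0 _)) (mul_nonneg (hζ.nonneg _) (hV0 _)))]
      refine ofReal_le_ofReal ?_
      rw [le_div_iff₀ (by have := kapN_pos N; positivity), mul_comm]
      refine le_trans (le_of_eq ?_) hb
      congr 1
      rw [intervalIntegral.integral_of_le ht]
      rw [IntegrableOn, Measure.volume_eq_prod, ← Measure.prod_restrict] at hi
      rw [Measure.volume_eq_prod, ← Measure.prod_restrict, integral_prod_symm _ hi]
    · have hKc : Continuous fun p : EuT N => Kr r (p.1 - x) :=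
        (sub_smooth (Kr_smooth hr) x).cont.comp continuous_fst
      have hKb : ∀ p : EuT N, |Kr r (p.1 - x)| ≤ Kr r (0 : Eu N) := fun p => by
        rw [abs_of_pos (Kr_pos hr _)]; exact Kr_le_zero hN hr _
      have hζb : ∀ p : EuT N, |ζ p.1 * Kr r (p.1 - x)| ≤ Kr r (0 : Eu N) := fun p => by
        rw [abs_mul, abs_of_nonneg (hζ.nonneg _)]
        exact (mul_le_of_le_one_left (abs_nonneg _) (hζ.le_one _)).trans (hKb p)
      have j1 : Integrable fun p : EuT N => Kr r (p.1 - x) * mo volume n a p := by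
        refine (hAi.mul_bdd hKc.aestronglyMeasurable (of_forall hKb)).congr ?_
        exact of_forall fun p => mul_comm _ _
      have hζK : Continuous fun p : EuT N => ζ p.1 * Kr r (p.1 - x) :=
        (hζc.comp continuous_fst).mul hKc
      have j2 : Integrable fun p : EuT N => ζ p.1 * Kr r (p.1 - x) * mo volume n a p := by
        refine (hAi.mul_bdd hζK.aestronglyMeasurable (of_forall hζb)).congr ?_
        exact of_forall fun p => mul_comm _ _
      refine (integral_mono j2 j1 fun p => ?_).trans (integral_mul_mo_le n hKc hKb ha fun z hz => ?_)
      · exact mul_le_mul_of_nonneg_right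
          (mul_le_of_le_one_left (Kr_pos hr _).le (hζ.le_one _)) (hA0 p)
      · refine le_trans (le_of_eq ?_) (hS r hr hr1 _ (hnz x hx z hz))
        congr 1; ext p
        rw [Prod.fst_add, show p.1 + z.1 - x = p.1 - (x - z.1) by abel]
  have hlim : ∀ᵐ p : EuT N ∂(volume.restrict (tsupport ζ ×ˢ Ioc (t0 + d) t2)),
      ofReal (ζ p.1 * a p * (ζ p.1 * g p)) ≤ liminf (fun n =>
        ofReal (ζ p.1 * mo volume n a p * (ζ p.1 * mo volume n g p))) atTop := by
    refine ae_restrict_of_ae ?_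
    filter_upwards [mo_ae hal, mo_ae hgl] with p h1 h2
    refine le_of_eq (Tendsto.liminf_eq ?_).symm
    exact (ENNReal.continuous_ofReal.tendsto _).comp
      ((h1.const_mul _).mul (h2.const_mul _))
  refine (lintegral_mono_ae hlim).trans ((lintegral_liminf_le' fun n => ?_).trans ?_)
  · have hAc := (mo_smooth (μ := (volume : Measure (EuT N))) n hal).cont
    have hVc := (mo_smooth (μ := (volume : Measure (EuT N))) n hgl).cont
    have hc : Continuous fun p : EuT N =>
        ζ p.1 * mo volume n a p * (ζ p.1 * mo volume n g p) := by fun_prop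
    exact (ENNReal.continuous_ofReal.comp hc).measurable.aemeasurable
  · exact liminf_le_of_frequently_le' hmain.frequently

end LocalBilinear

section Cuts

variable {N : ℕ}

theorem cut_of_bounds (hN : 3 ≤ N) {x0 : Eu N} {R : ℝ} (hR : R ≤ 1) {ξ : Eu N → ℝ} (hξ : Sm ξ)
    (hc : HasCompactSupport ξ) (h01 : ∀ y, 0 ≤ ξ y ∧ ξ y ≤ 1) (hs : tsupport ξ ⊆ ball x0 R)
    {c : ℝ} (h1 : 1 ≤ c)
    (hd : ∀ y i, |Dv (eB i) ξ y| ≤ c ∧ |Dv (eB i) (Dv (eB i) ξ) y| ≤ c) :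
    Cut N (fun y => ξ y ^ (2 * N)) (kerC N c) ∧ tsupport (fun y => ξ y ^ (2 * N)) ⊆ tsupport ξ := by
  have hN0 : N ≠ 0 := by omega
  have hsub : tsupport (fun y => ξ y ^ (2 * N)) ⊆ tsupport ξ := closure_mono fun z hz h0 =>
    hz (by simp [show ξ z = 0 from h0, hN0])
  refine ⟨⟨hξ.pow _, ?_, fun y => pow_nonneg (h01 y).1 _, fun y => pow_le_one₀ (h01 y).1 (h01 y).2,
    kerC_nonneg N h1, fun y => ?_, fun r hr hr1 x hx y hy => ?_⟩, hsub⟩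
  · exact HasCompactSupport.of_support_subset_isCompact hc (subset_closure.trans hsub)
  · have hφ : Sm (fun s : ℝ => s ^ (2 * N)) := contDiff_id.pow _
    have hdd : deriv (fun s : ℝ => s ^ (2 * N)) = fun s : ℝ => ((2 * N : ℕ) : ℝ) * s ^ (2 * N - 1) := by
      ext s; exact deriv_pow_field _
    have hddd : deriv (deriv fun s : ℝ => s ^ (2 * N))
        = fun s : ℝ => ((2 * N : ℕ) : ℝ) * (((2 * N - 1 : ℕ) : ℝ) * s ^ (2 * N - 1 - 1)) := by
      rw [hdd]; ext s; rw [deriv_const_mul_field, deriv_pow_field]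
    rw [lapS_scomp hξ hφ eB y, hddd, hdd]
    have b1 : |lapS eB ξ y| ≤ N * c := by
      refine (Finset.abs_sum_le_sum_abs _ _).trans ((sum_le_sum fun i _ => (hd y i).2).trans ?_)
      simp
    have b2 : ∑ i, Dv (eB i) ξ y ^ 2 ≤ N * c ^ 2 := by
      refine (sum_le_sum (g := fun _ => c ^ 2) fun i _ => ?_).trans (by simp)
      rw [← sq_abs]; exact pow_le_pow_left₀ (abs_nonneg _) (hd y i).1 2
    have p1 : ξ y ^ (2 * N - 1) ≤ 1 := pow_le_one₀ (h01 y).1 (h01 y).2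
    have p1' : 0 ≤ ξ y ^ (2 * N - 1) := pow_nonneg (h01 y).1 _
    have p2 : ξ y ^ (2 * N - 1 - 1) ≤ 1 := pow_le_one₀ (h01 y).1 (h01 y).2
    have p2' : 0 ≤ ξ y ^ (2 * N - 1 - 1) := pow_nonneg (h01 y).1 _
    have hn : (3 : ℝ) ≤ N := by exact_mod_cast hN
    have hs1 : (((2 * N - 1 : ℕ) : ℝ)) ≤ 2 * N := by
      rw [Nat.cast_sub (by omega)]; push_cast; linarith
    have q1 : ((2 * N : ℕ) : ℝ) * ξ y ^ (2 * N - 1) * lapS eB ξ y ≤ 2 * N * 1 * (N * c) := by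
      push_cast
      refine (mul_le_mul_of_nonneg_left ((le_abs_self _).trans b1) (by positivity)).trans ?_
      gcongr
    have q2 : ((2 * N : ℕ) : ℝ) * (((2 * N - 1 : ℕ) : ℝ) * ξ y ^ (2 * N - 1 - 1))
        * ∑ i, Dv (eB i) ξ y ^ 2 ≤ 2 * N * (2 * N * 1) * (N * c ^ 2) := by
      have : 0 ≤ ∑ i, Dv (eB i) ξ y ^ 2 := sum_nonneg fun _ _ => sq_nonneg _
      push_cast
      gcongr
    refine (add_le_add q1 q2).trans ?_
    have c2 : c ^ 2 ≤ c ^ (2 * N) := pow_le_pow_right₀ h1 (by omega)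
    have c1 : c ≤ c ^ 2 := by nlinarith
    have big : (384 * (N : ℝ) ^ 3) ≤ (384 * (N : ℝ) ^ 3) ^ (2 * N) :=
      le_self_pow₀ (by nlinarith [pow_le_pow_left₀ (by norm_num) hn 3]) (by omega)
    unfold kerC
    have n2 : (N : ℝ) ^ 2 ≤ N ^ 3 := pow_le_pow_right₀ (by linarith) (by norm_num)
    have c0 : 0 ≤ c ^ 2 := sq_nonneg c
    calc 2 * (N : ℝ) * 1 * (N * c) + 2 * N * (2 * N * 1) * (N * c ^ 2)
        = 2 * N ^ 2 * c + 4 * N ^ 3 * c ^ 2 := by ring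
      _ ≤ 2 * N ^ 3 * c ^ 2 + 4 * N ^ 3 * c ^ 2 := by gcongr
      _ ≤ 34 * (384 * (N : ℝ) ^ 3) * c ^ 2 := by
        have : 0 ≤ (N : ℝ) ^ 3 * c ^ 2 := by positivity
        nlinarith
      _ ≤ _ := by gcongr
  · have := kernel_cutoff_all hN hr h1 hξ h01 hd x
      (fun z hz => qr_le_nine hR hr hr1 (hs (hsub hx)) (hs hz)) y
    linarith

theorem integral_kernel_le (hN : 3 ≤ N) {ρ : Eu N → ℝ} {C α : ℝ} (hW : PotBound ρ C α)
    (hρm : Measurable ρ) (hρ0 : ∀ x, 0 ≤ ρ x) {f : EuT N → ℝ} (hf : Measurable f)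
    (hf0 : ∀ p, 0 ≤ f p) (ha : Integrable fun p : EuT N => ρ p.1 * f p) {x0 : Eu N} {R : ℝ}
    (hR : R ≤ 1) (hs : ∀ p : EuT N, p.1 ∉ ball x0 R → f p = 0) {M : ℝ} (hM : 0 ≤ M) (hC : 0 ≤ C)
    (hfM : ∀ᵐ x, ∫⁻ t, ofReal (f (x, t)) ≤ ofReal M) {X : ℝ}
    (hX : ∫ p : EuT N, ρ p.1 * f p ≤ X) {κ : ℝ} (hκ : 0 < κ) {r : ℝ} (hr : 0 < r) (hr1 : r ≤ 1)
    {x : Eu N} (hx : x ∈ ball x0 R) :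
    ∫ p : EuT N, Kr r (p.1 - x) * (ρ p.1 * f p)
      ≤ 3 * (M * (C * κ ^ α)) + 3 * κ ^ (2 - N : ℝ) * X := by
  have hKc : Continuous fun p : EuT N => Kr r (p.1 - x) :=
    (sub_smooth (Kr_smooth hr) x).cont.comp continuous_fst
  have hKi : Integrable fun p : EuT N => Kr r (p.1 - x) * (ρ p.1 * f p) := by
    refine (ha.mul_bdd hKc.aestronglyMeasurable (c := Kr r (0 : Eu N))
      (of_forall fun p => ?_)).congr (of_forall fun p => mul_comm _ _)
    rw [norm_eq_abs, abs_of_pos (Kr_pos hr _)]; exact Kr_le_zero hN hr _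
  have ha0 : ∀ p : EuT N, 0 ≤ ρ p.1 * f p := fun p => mul_nonneg (hρ0 _) (hf0 _)
  have hms : MeasurableSet (ball x κ ×ˢ (univ : Set ℝ)) := measurableSet_ball.prod MeasurableSet.univ
  rw [← integral_add_compl hms hKi]
  refine add_le_add ?_ ?_
  · have hne : ∀ᵐ p : EuT N, p.1 ≠ x := by
      have : ∀ᵐ y : Eu N, y ≠ x := by
        have : Nonempty (Fin N) := ⟨⟨0, by omega⟩⟩
        simp [ae_iff, measure_singleton]
      exact Measure.quasiMeasurePreserving_fst.ae this
    rw [integral_eq_lintegral_of_nonneg_ae (of_forall fun p =>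
      mul_nonneg (Kr_pos hr _).le (ha0 p)) hKi.aestronglyMeasurable.restrict]
    refine ENNReal.toReal_le_of_le_ofReal
      (by have := rpow_nonneg hκ.le α; positivity) ?_
    calc ∫⁻ p in ball x κ ×ˢ (univ : Set ℝ), ofReal (Kr r (p.1 - x) * (ρ p.1 * f p))
        ≤ ∫⁻ p in ball x κ ×ˢ (univ : Set ℝ), ofReal 3 *
          ((nk x p.1 * ofReal (ρ p.1)) * ofReal (f p)) := by
          refine lintegral_mono_ae (ae_restrict_of_ae ?_)
          filter_upwards [hne] with p hp
          by_cases hb : p.1 ∈ ball x0 R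
          · rw [nk, ← ofReal_mul (by positivity), ← ofReal_mul (mul_nonneg
              (by positivity) (hρ0 _)), ← ofReal_mul (by norm_num)]
            refine ofReal_le_ofReal ?_
            have := Kr_le hN hr (z := p.1 - x) (norm_pos_iff.2 (sub_ne_zero.2 hp)) le_rfl
              (qr_le_nine hR hr hr1 hx hb)
            rw [norm_sub_rev] at this
            have h2 := mul_le_mul_of_nonneg_right this (ha0 p)
            linarith
          · simp [hs p hb]
      _ = ofReal 3 * ∫⁻ y in ball x κ, ∫⁻ t, (nk x y * ofReal (ρ y)) *
            ofReal (f (y, t)) := by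
          have hm1 : Measurable fun p : EuT N =>
              (nk x p.1 * ofReal (ρ p.1)) * ofReal (f p) :=
            (((measurable_nk_left x).comp measurable_fst).mul
              (hρm.comp measurable_fst).ennreal_ofReal).mul hf.ennreal_ofReal
          rw [lintegral_const_mul _ hm1, Measure.volume_eq_prod, ← Measure.prod_restrict,
            Measure.restrict_univ, lintegral_prod _ hm1.aemeasurable]
      _ ≤ ofReal 3 * ∫⁻ y in ball x κ, (nk x y * ofReal (ρ y)) *
            ofReal M := by
          refine mul_le_mul' le_rfl (lintegral_mono_ae (ae_restrict_of_ae ?_))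
          filter_upwards [hfM] with y hy
          have hm2 : Measurable fun t => ofReal (f (y, t)) :=
            (hf.comp measurable_prodMk_left).ennreal_ofReal
          rw [lintegral_const_mul _ hm2]
          exact mul_le_mul' le_rfl hy
      _ ≤ ofReal 3 * (ofReal (C * κ ^ α) * ofReal M) := by
          have hm3 : Measurable fun y => nk x y * ofReal (ρ y) :=
            (measurable_nk_left x).mul hρm.ennreal_ofReal
          rw [lintegral_mul_const _ hm3]
          exact mul_le_mul' le_rfl (mul_le_mul' (hW.lintegral_le hρ0 x hκ) le_rfl)
      _ = ofReal (3 * (M * (C * κ ^ α))) := by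
          have := rpow_nonneg hκ.le α
          rw [← ofReal_mul (by positivity), ← ofReal_mul (by norm_num),
            mul_comm M]
  · calc ∫ p in (ball x κ ×ˢ (univ : Set ℝ))ᶜ, Kr r (p.1 - x) * (ρ p.1 * f p)
        ≤ ∫ p in (ball x κ ×ˢ (univ : Set ℝ))ᶜ, 3 * κ ^ (2 - N : ℝ) * (ρ p.1 * f p) := by
          refine setIntegral_mono_on hKi.integrableOn (ha.const_mul _).integrableOn hms.compl
            fun p hp => ?_
          by_cases hb : p.1 ∈ ball x0 R
          · refine mul_le_mul_of_nonneg_right (Kr_le hN hr hκ ?_ (qr_le_nine hR hr hr1 hx hb)) (ha0 p)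
            simpa [dist_eq_norm] using hp
          · simp [hs p hb]
      _ ≤ ∫ p : EuT N, 3 * κ ^ (2 - N : ℝ) * (ρ p.1 * f p) :=
          setIntegral_le_integral (ha.const_mul _) (of_forall fun p =>
            mul_nonneg (by positivity) (ha0 p))
      _ ≤ _ := by
          rw [integral_const_mul]
          exact mul_le_mul_of_nonneg_left hX (by positivity)

end Cuts

section LocalIntegrability

variable {N : ℕ} {ρ : Eu N → ℝ} {m C α : ℝ} {U : EuT N → ℝ} {O : Set (EuT N)}

/-- Admissible weights. -/
structure Wt (N : ℕ) (ρ : Eu N → ℝ) (C α : ℝ) : Prop where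
  meas : Measurable ρ
  pos : ∀ x, 0 < ρ x
  α_pos : 0 < α
  C_pos : 0 < C
  pot : PotBound ρ C α
  lower : ∀ R : ℝ, ∃ c, 0 < c ∧ ∀ x ∈ ball (0 : Eu N) R, c ≤ ρ x
  upper : ∀ r : ℝ, 0 < r → ∃ c, ∀ x : Eu N, r ≤ ‖x‖ → ρ x ≤ c

/-- Nonnegative very weak solutions on an open set of space-time. -/
structure Sol (ρ : Eu N → ℝ) (m : ℝ) (O : Set (EuT N)) (U : EuT N → ℝ) : Prop where
  meas : Measurable U
  nonneg : ∀ p, 0 ≤ U p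
  isOpen : IsOpen O
  intA : ∀ K, IsCompact K → K ⊆ O → IntegrableOn (fun p => ρ p.1 * U p) K
  intV : ∀ K, IsCompact K → K ⊆ O → IntegrableOn (fun p => U p ^ m) K
  pair : SolPair O (fun p => ρ p.1 * U p) (fun p => U p ^ m)

/-- Space-time boxes. -/
def box (p : EuT N) (R δ : ℝ) : Set (EuT N) := ball p.1 R ×ˢ Ioo (p.2 - δ) (p.2 + δ)

theorem isOpen_box (p : EuT N) (R δ : ℝ) : IsOpen (box p R δ) := isOpen_ball.prod isOpen_Ioo

theorem exists_box (hO : IsOpen O) {p : EuT N} (hp : p ∈ O) :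
    ∃ R, 0 < R ∧ R ≤ 1 ∧ closedBall p.1 R ×ˢ Icc (p.2 - 2 * R) (p.2 + 2 * R) ⊆ O := by
  obtain ⟨ε, hε, h⟩ := Metric.isOpen_iff.1 hO p hp
  refine ⟨min 1 (ε / 3), by positivity, min_le_left _ _, fun q hq => h ?_⟩
  have h3 : min 1 (ε / 3) ≤ ε / 3 := min_le_right _ _
  rw [mem_ball, Prod.dist_eq, max_lt_iff]
  refine ⟨(mem_closedBall.1 hq.1).trans_lt (by linarith), ?_⟩
  rw [Real.dist_eq, abs_lt]
  have := hq.2.1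
  have := hq.2.2
  constructor <;> linarith

theorem box_subset {p : EuT N} {R R' δ δ' : ℝ} (hR : R ≤ R') (hδ : δ ≤ δ') :
    box p R δ ⊆ closedBall p.1 R' ×ˢ Icc (p.2 - δ') (p.2 + δ') :=
  Set.prod_mono ((ball_subset_ball hR).trans ball_subset_closedBall)
    fun t ht => ⟨by linarith [ht.1], by linarith [ht.2]⟩

/-- Restriction of a solution to a relatively compact open subset. -/
theorem Sol.restrict (h : Sol ρ m O U) (hm : 1 < m) {O' K : Set (EuT N)} (hO' : IsOpen O')
    (hK : IsCompact K) (hO'K : O' ⊆ K) (hKO : K ⊆ O) :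
    Sol ρ m O' (O'.indicator U) ∧ Integrable (fun p => ρ p.1 * O'.indicator U p) ∧
      Integrable (fun p => O'.indicator U p ^ m) := by
  have e1 : (fun p => ρ p.1 * O'.indicator U p) = O'.indicator fun p => ρ p.1 * U p := by
    ext p; by_cases hp : p ∈ O' <;> simp [hp]
  have e2 : (fun p => O'.indicator U p ^ m) = O'.indicator fun p => U p ^ m := by
    ext p; by_cases hp : p ∈ O' <;> simp [hp, (by linarith : m ≠ 0)]
  have i1 : Integrable (fun p => ρ p.1 * O'.indicator U p) := by
    rw [e1, integrable_indicator_iff hO'.measurableSet]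
    exact (h.intA K hK hKO).mono_set hO'K
  have i2 : Integrable (fun p => O'.indicator U p ^ m) := by
    rw [e2, integrable_indicator_iff hO'.measurableSet]
    exact (h.intV K hK hKO).mono_set hO'K
  refine ⟨⟨h.meas.indicator hO'.measurableSet, fun p => indicator_nonneg (fun q _ => h.nonneg q) p,
    hO', fun _ _ _ => i1.integrableOn, fun _ _ _ => i2.integrableOn, ?_⟩, i1, i2⟩
  rw [e1, e2]
  exact (h.pair.mono (hO'K.trans hKO)).congr
    (of_forall fun p hp => (indicator_of_mem hp (fun p => ρ p.1 * U p)).symm)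
    (of_forall fun p hp => (indicator_of_mem hp (fun p => U p ^ m)).symm)

theorem Sol.exists_time_bound (hN : 3 ≤ N) (hm : 1 < m) (hW : Wt N ρ C α) (h : Sol ρ m O U)
    {p : EuT N} (hp : p ∈ O) : ∃ R, 0 < R ∧ R ≤ 1 ∧
      closedBall p.1 R ×ˢ Icc (p.2 - 2 * R) (p.2 + 2 * R) ⊆ O ∧ ∃ M, 0 ≤ M ∧ ∀ᵐ x, x ∈ ball p.1 R →
        ∫⁻ t in Ioo (p.2 - 2 * R) (p.2 + 2 * R), ofReal (U (x, t) ^ m)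
          ≤ ofReal M := by
  obtain ⟨R, hR, hR1, hRO⟩ := exists_box h.isOpen hp
  have hb := box_subset (p := p) (le_refl R) (le_refl (2 * R))
  obtain ⟨hs, i1, i2⟩ := h.restrict hm (isOpen_box p R (2 * R))
    ((isCompact_closedBall _ _).prod isCompact_Icc) hb hRO
  obtain ⟨M, hM⟩ := time_integral_bound hN hm hW.α_pos hW.C_pos hW.pot hW.meas hW.pos hs.meas
    hs.nonneg i1 i2 hR hR1 hR hs.pair.subPair
  refine ⟨R / 2, by positivity, by linarith, (Set.prod_mono (closedBall_subset_closedBall (by linarith))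
    (Icc_subset_Icc (by linarith) (by linarith))).trans hRO, max M 0, le_max_right _ _, ?_⟩
  rw [Measure.volume_eq_prod] at i2
  filter_upwards [hM, i2.prod_right_ae] with x hx hi hxb
  rw [show 2 * (R / 2) = R by ring]
  have e : ∀ t ∈ Ioo (p.2 - R) (p.2 + R), (box p R (2 * R)).indicator U (x, t) = U (x, t) :=
    fun t ht => indicator_of_mem (by
      exact ⟨ball_subset_ball (by linarith) hxb, by linarith [ht.1], by linarith [ht.2]⟩) _
  calc ∫⁻ t in Ioo (p.2 - R) (p.2 + R), ofReal (U (x, t) ^ m)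
      = ∫⁻ t in Ioo (p.2 - R) (p.2 + R),
          ofReal ((box p R (2 * R)).indicator U (x, t) ^ m) :=
        setLIntegral_congr_fun measurableSet_Ioo fun t ht => by simp only [e t ht]
    _ = ofReal (∫ t in Ioo (p.2 - R) (p.2 + R), (box p R (2 * R)).indicator U (x, t) ^ m) :=
        (ofReal_integral_eq_lintegral_ofReal hi.integrableOn (of_forall fun t =>
          rpow_nonneg (hs.nonneg _) _)).symm
    _ ≤ _ := ofReal_le_ofReal ((hx hxb).trans (le_max_left _ _))

theorem le_one_add_rpow {m : ℝ} (hm : 1 < m) {x : ℝ} (hx : 0 ≤ x) : x ≤ 1 + x ^ m := by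
  rcases le_or_gt x 1 with h | h
  · linarith [rpow_nonneg hx m]
  · linarith [Real.self_le_rpow_of_one_le h.le hm.le]

theorem Sol.exists_energy_bound (hN : 3 ≤ N) (hm : 1 < m) (hW : Wt N ρ C α) (h : Sol ρ m O U)
    {p : EuT N} (hp : p ∈ O) : ∃ R, 0 < R ∧
      IntegrableOn (fun q => U q ^ (m + 1)) (box p R R) := by
  obtain ⟨R, hR, hR1, hRO, M, hM0, hM⟩ := h.exists_time_bound hN hm hW hp
  have hb := box_subset (p := p) (le_refl R) (le_refl (2 * R))
  obtain ⟨hs, i1, i2⟩ := h.restrict hm (isOpen_box p R (2 * R))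
    ((isCompact_closedBall _ _).prod isCompact_Icc) hb hRO
  set V := (box p R (2 * R)).indicator U with hV
  have hVm : ∀ᵐ x, ∫⁻ t, ofReal (V (x, t)) ≤ ofReal (4 * R + M) := by
    filter_upwards [hM] with x hx
    by_cases hxb : x ∈ ball p.1 R
    · have e : (fun t => ofReal (V (x, t)))
          = (Ioo (p.2 - 2 * R) (p.2 + 2 * R)).indicator fun t => ofReal (U (x, t)) := by
        ext t
        by_cases ht : t ∈ Ioo (p.2 - 2 * R) (p.2 + 2 * R)
        · rw [indicator_of_mem ht, hV, indicator_of_mem (by exact ⟨hxb, ht⟩)]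
        · rw [indicator_of_notMem ht, hV, indicator_of_notMem (fun h => ht h.2)]; simp
      rw [e, lintegral_indicator measurableSet_Ioo]
      calc ∫⁻ t in Ioo (p.2 - 2 * R) (p.2 + 2 * R), ofReal (U (x, t))
          ≤ ∫⁻ t in Ioo (p.2 - 2 * R) (p.2 + 2 * R), (1 + ofReal (U (x, t) ^ m)) := by
            refine lintegral_mono fun t => ?_
            rw [← ENNReal.ofReal_one, ← ofReal_add zero_le_one
              (rpow_nonneg (h.nonneg _) _)]
            exact ofReal_le_ofReal (le_one_add_rpow hm (h.nonneg _))
        _ = ofReal (4 * R) + ∫⁻ t in Ioo (p.2 - 2 * R) (p.2 + 2 * R),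
              ofReal (U (x, t) ^ m) := by
            rw [lintegral_add_left measurable_const]
            simp only [lintegral_const, one_mul, Measure.restrict_apply_univ, Real.volume_Ioo]
            congr 2; ring
        _ ≤ _ := by
            rw [ofReal_add (by positivity) hM0]
            exact add_le_add le_rfl (hx hxb)
    · have : (fun t => ofReal (V (x, t))) = fun _ => 0 := by
        ext t; rw [hV, indicator_of_notMem (fun h => hxb h.1)]; simp
      rw [this]; simp
  obtain ⟨ξ, hξ, hξc, h01, hξ1, hξs⟩ := exists_space_cutoff p.1 (R' := R / 4) (R := R / 2)
    (by positivity) (by linarith)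
  obtain ⟨c, hc1, hcd⟩ := exists_deriv_bound hξ hξc
  obtain ⟨hcut, hsub⟩ := cut_of_bounds hN (by linarith) hξ hξc h01 hξs hc1 hcd
  have hζR : tsupport (fun y => ξ y ^ (2 * N)) ⊆ ball p.1 R :=
    (hsub.trans hξs).trans (ball_subset_ball (by linarith))
  have hV0 : ∀ q : EuT N, q.1 ∉ ball p.1 R → V q = 0 := fun q hq =>
    indicator_of_notMem (fun h => hq h.1) _
  have ha0 : ∀ q : EuT N, 0 ≤ ρ q.1 * V q := fun q => mul_nonneg (hW.pos _).le (hs.nonneg _)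
  have hg0 : ∀ q : EuT N, 0 ≤ V q ^ m := fun q => rpow_nonneg (hs.nonneg _) _
  set X := max (∫ q : EuT N, ρ q.1 * V q) (∫ q : EuT N, V q ^ m) with hX
  have hX0 : 0 ≤ X := (integral_nonneg ha0).trans (le_max_left _ _)
  have hB := bilinear_lintegral_le hN hs.pair.subPair hs.isOpen i1 i2 ha0 hg0 hcut
    (t0 := p.2 - 3 / 2 * R) (t2 := p.2 + 3 / 2 * R) (d := R / 2) (by positivity) (by linarith)
    (Set.prod_mono hζR fun t ht => ⟨by linarith [ht.1], by linarith [ht.2]⟩) isOpen_ball hζR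
    (S := 3 * ((4 * R + M) * (C * 1 ^ α)) + 3 * 1 ^ (2 - N : ℝ) * X)
    (by have := hW.C_pos; positivity)
    (fun r hr hr1 x hx => integral_kernel_le hN hW.pot hW.meas (fun x => (hW.pos x).le) hs.meas
      hs.nonneg i1 hR1 hV0 (by positivity) hW.C_pos.le hVm (le_max_left _ _) one_pos hr hr1 hx)
    (le_max_left _ _) (le_max_right _ _)
  obtain ⟨c0, hc0, hcρ⟩ := hW.lower (‖p.1‖ + R)
  refine ⟨R / 4, by positivity, ?_⟩
  refine ⟨(h.meas.pow_const _).aestronglyMeasurable, ?_⟩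
  rw [hasFiniteIntegral_iff_ofReal (of_forall fun q => rpow_nonneg (h.nonneg q) _)]
  calc ∫⁻ q in box p (R / 4) (R / 4), ofReal (U q ^ (m + 1))
      ≤ ∫⁻ q in box p (R / 4) (R / 4), ofReal c0⁻¹ * ofReal
          (ξ q.1 ^ (2 * N) * (ρ q.1 * V q) * (ξ q.1 ^ (2 * N) * V q ^ m)) := by
        refine setLIntegral_mono' (isOpen_box _ _ _).measurableSet fun q hq => ?_
        rw [← ofReal_mul (by positivity)]
        refine ofReal_le_ofReal ?_
        have hq1 : ‖q.1 - p.1‖ < R / 4 := by rw [← dist_eq_norm]; exact hq.1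
        have hqV : V q = U q := indicator_of_mem (by
          exact ⟨ball_subset_ball (by linarith) hq.1, by linarith [hq.2.1], by linarith [hq.2.2]⟩) _
        have hρ := hcρ q.1 (by
          rw [mem_ball_zero_iff]
          calc ‖q.1‖ = ‖p.1 + (q.1 - p.1)‖ := by abel_nf
            _ ≤ ‖p.1‖ + ‖q.1 - p.1‖ := norm_add_le _ _
            _ < _ := by linarith)
        rw [hξ1 q.1 hq.1, hqV, Real.rpow_add_one' (h.nonneg q) (by linarith)]
        have := rpow_nonneg (h.nonneg q) m
        have := mul_nonneg this (h.nonneg q)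
        rw [inv_mul_eq_div, le_div_iff₀ hc0]
        simp only [one_pow, one_mul]
        nlinarith
    _ ≤ ∫⁻ q in tsupport (fun y => ξ y ^ (2 * N)) ×ˢ Ioc (p.2 - 3 / 2 * R + R / 2) (p.2 + 3 / 2 * R),
          ofReal c0⁻¹ * ofReal
          (ξ q.1 ^ (2 * N) * (ρ q.1 * V q) * (ξ q.1 ^ (2 * N) * V q ^ m)) := by
        refine lintegral_mono_set fun q hq => ⟨subset_tsupport _ ?_, ?_, ?_⟩
        · rw [Function.mem_support, hξ1 q.1 hq.1]; simp
        · linarith [hq.2.1]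
        · linarith [hq.2.2]
    _ < ∞ := by
        rw [lintegral_const_mul' _ _ ofReal_ne_top]
        exact ENNReal.mul_lt_top ENNReal.ofReal_lt_top (hB.trans_lt ENNReal.ofReal_lt_top)

end LocalIntegrability

section Averages

open ProbabilityTheory

theorem integral_expMeasure {l : ℝ} (hl : 0 < l) (f : ℝ → ℝ) :
    ∫ r, f r ∂(expMeasure l) = ∫ r in Ioi 0, l * Real.exp (-(l * r)) * f r := by
  have h1 : expMeasure l = volume.withDensity fun r => ofReal (exponentialPDFReal l r) := rfl
  rw [h1, integral_withDensity_eq_integral_toReal_smul₀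
    ((measurable_exponentialPDFReal l).ennreal_ofReal.aemeasurable)
    (of_forall fun _ => ENNReal.ofReal_lt_top)]
  rw [← integral_Ici_eq_integral_Ioi, ← integral_indicator measurableSet_Ici]
  congr 1
  ext r
  rw [toReal_ofReal (exponentialPDFReal_nonneg hl r), exponentialPDFReal, gammaPDFReal]
  by_cases hr : 0 ≤ r
  · rw [indicator_of_mem (by exact hr)]
    simp [hr]
  · rw [indicator_of_notMem (by exact hr)]
    simp [hr]

theorem lintegral_expMeasure {l : ℝ} (hl : 0 < l) {f : ℝ → ℝ≥0∞} (hf : Measurable f) :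
    ∫⁻ r, f r ∂(expMeasure l) ≤ ofReal l * ∫⁻ r, f r := by
  have h1 : expMeasure l = volume.withDensity fun r => ofReal (exponentialPDFReal l r) := rfl
  rw [h1, lintegral_withDensity_eq_lintegral_mul _
    ((measurable_exponentialPDFReal l).ennreal_ofReal) hf, ← lintegral_const_mul _ hf]
  refine lintegral_mono fun r => ?_
  refine mul_le_mul' (ofReal_le_ofReal ?_) le_rfl
  rw [exponentialPDFReal, gammaPDFReal]
  split_ifs with hr
  · simp only [rpow_one, Real.Gamma_one, div_one, sub_self, Real.rpow_zero, mul_one]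
    exact mul_le_of_le_one_right hl.le (Real.exp_le_one_iff.2 (by nlinarith))
  · exact hl.le

variable {N : ℕ} {l : ℝ}

/-- Exponentially weighted average over the past. -/
def avg (l : ℝ) (F : EuT N → ℝ) (p : EuT N) : ℝ := ∫ r, F (p.1, p.2 - r) ∂(expMeasure l)

/-- Exponentially weighted average over the future. -/
def fut (l : ℝ) (F : EuT N → ℝ) (p : EuT N) : ℝ := ∫ r, F (p.1, p.2 + r) ∂(expMeasure l)

theorem shear_measurePreserving (hl : 0 < l) :
    MeasurePreserving (fun z : ℝ × (EuT N) => (z.1, (z.2.1, z.2.2 - z.1)))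
      ((expMeasure l).prod volume) ((expMeasure l).prod volume) := by
  have := isProbabilityMeasure_expMeasure hl
  refine (MeasurePreserving.id (expMeasure l)).skew_product
    (g := fun r (q : EuT N) => (q.1, q.2 - r)) (by fun_prop) (of_forall fun r => ?_)
  have := measurePreserving_sub_right (volume : Measure (EuT N)) ((0, r) : EuT N)
  have e : (fun q : EuT N => (q.1, q.2 - r)) = fun q => q - (0, r) := by
    ext q <;> simp
  rw [e]
  exact this.map_eq

theorem shear_integrable (hl : 0 < l) {F : EuT N → ℝ} (hF : Integrable F) :
    Integrable (fun z : ℝ × (EuT N) => F (z.2.1, z.2.2 - z.1)) ((expMeasure l).prod volume) := by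
  have := isProbabilityMeasure_expMeasure hl
  exact (shear_measurePreserving hl).integrable_comp_of_integrable (hF.comp_snd (expMeasure l))

theorem avg_integrable (hl : 0 < l) {F : EuT N → ℝ} (hF : Integrable F) :
    Integrable (avg l F) := by
  have := isProbabilityMeasure_expMeasure hl
  exact (shear_integrable hl hF).integral_prod_right

theorem avg_slice (hl : 0 < l) {F : EuT N → ℝ} (hF : Integrable F) :
    ∀ᵐ p : EuT N, Integrable (fun r => F (p.1, p.2 - r)) (expMeasure l) := by
  have := isProbabilityMeasure_expMeasure hl
  exact (shear_integrable hl hF).prod_left_ae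

theorem avg_nonneg {F : EuT N → ℝ} (hF : ∀ p, 0 ≤ F p) (p : EuT N) : 0 ≤ avg l F p :=
  integral_nonneg fun _ => hF _

theorem avg_weight (w : Eu N → ℝ) (F : EuT N → ℝ) (p : EuT N) :
    avg l (fun q => w q.1 * F q) p = w p.1 * avg l F p := by
  simp only [avg]
  rw [integral_const_mul]

theorem integral_avg_mul (hl : 0 < l) {F ψ : EuT N → ℝ} (hF : Integrable F) (hψ : Continuous ψ)
    (hc : HasCompactSupport ψ) : ∫ p, avg l F p * ψ p = ∫ p, F p * fut l ψ p := by
  have := isProbabilityMeasure_expMeasure hl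
  obtain ⟨C, hC⟩ := hc.exists_bound_of_continuous hψ
  have i1 : Integrable (fun z : ℝ × (EuT N) => F (z.2.1, z.2.2 - z.1) * ψ z.2)
      ((expMeasure l).prod volume) := by
    refine ((shear_integrable hl hF).mul_bdd (c := C) (g := fun z => ψ z.2)
      (hψ.comp continuous_snd).aestronglyMeasurable
      (of_forall fun z => hC _))
  have i2 : Integrable (fun z : ℝ × (EuT N) => F z.2 * ψ (z.2.1, z.2.2 + z.1))
      ((expMeasure l).prod volume) := by
    have c1 : Continuous fun z : ℝ × (EuT N) => ψ (z.2.1, z.2.2 + z.1) := by fun_prop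
    refine ((hF.comp_snd (expMeasure l)).mul_bdd (c := C) (g := fun z => ψ (z.2.1, z.2.2 + z.1))
      c1.aestronglyMeasurable
      (of_forall fun z => hC _))
  calc ∫ p, avg l F p * ψ p
      = ∫ p, ∫ r, F (p.1, p.2 - r) * ψ p ∂(expMeasure l) := by
        refine integral_congr_ae (of_forall fun p => ?_)
        simp only [avg]
        rw [← integral_mul_const]
    _ = ∫ z : ℝ × (EuT N), F (z.2.1, z.2.2 - z.1) * ψ z.2 ∂((expMeasure l).prod volume) := by
        rw [integral_prod_symm _ i1]
    _ = ∫ z : ℝ × (EuT N), F z.2 * ψ (z.2.1, z.2.2 + z.1) ∂((expMeasure l).prod volume) := by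
        have h := integral_map (f := fun z : ℝ × (EuT N) => F z.2 * ψ (z.2.1, z.2.2 + z.1))
          (shear_measurePreserving (N := N) hl).measurable.aemeasurable
          (by rw [(shear_measurePreserving hl).map_eq]; exact i2.aestronglyMeasurable)
        rw [(shear_measurePreserving (N := N) hl).map_eq] at h
        rw [h]
        simp
    _ = ∫ p, F p * fut l ψ p := by
        rw [integral_prod_symm _ i2]
        refine integral_congr_ae (of_forall fun p => ?_)
        simp only [fut]
        rw [← integral_const_mul]

theorem fut_eq_convolution (ψ : EuT N → ℝ) :
    fut l ψ = convolution (fun _ : EuT N => (1 : ℝ)) ψ (ContinuousLinearMap.lsmul ℝ ℝ)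
      ((expMeasure l).map fun r => ((0, -r) : EuT N)) := by
  ext p
  have hm : MeasurableEmbedding fun r : ℝ => ((0, -r) : EuT N) :=
    (measurableEmbedding_prodMk_left (0 : Eu N)).comp (MeasurableEquiv.neg ℝ).measurableEmbedding
  rw [convolution, hm.integral_map]
  simp only [fut, ContinuousLinearMap.lsmul_apply, smul_eq_mul, one_mul]
  congr 1
  ext r
  congr 1
  ext <;> simp

theorem fut_locallyIntegrable (hl : 0 < l) : LocallyIntegrable (fun _ : EuT N => (1 : ℝ))
    ((expMeasure l).map fun r => ((0, -r) : EuT N)) := by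
  have := isProbabilityMeasure_expMeasure hl
  have : IsFiniteMeasure ((expMeasure l).map fun r => ((0, -r) : EuT N)) :=
    Measure.isFiniteMeasure_map _ _
  exact (integrable_const 1).locallyIntegrable

theorem fut_smooth (hl : 0 < l) {ψ : EuT N → ℝ} (hψ : Sm ψ) (hc : HasCompactSupport ψ) :
    Sm (fut l ψ) := by
  rw [fut_eq_convolution]
  exact hc.contDiff_convolution_right (ContinuousLinearMap.lsmul ℝ ℝ) (fut_locallyIntegrable hl) hψ

theorem fut_integrable (hl : 0 < l) {ψ : EuT N → ℝ} (hψ : Continuous ψ)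
    (hc : HasCompactSupport ψ) (p : EuT N) :
    Integrable (fun r => ψ (p.1, p.2 + r)) (expMeasure l) := by
  have := isProbabilityMeasure_expMeasure hl
  obtain ⟨C, hC⟩ := hc.exists_bound_of_continuous hψ
  have c1 : Continuous fun r : ℝ => ψ (p.1, p.2 + r) := by fun_prop
  exact Integrable.of_bound c1.aestronglyMeasurable C (of_forall fun r => hC _)

theorem Dv_fut (hl : 0 < l) {ψ : EuT N → ℝ} (hψ : Sm ψ) (hc : HasCompactSupport ψ)
    (e : EuT N) : Dv e (fut l ψ) = fut l (Dv e ψ) := by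
  ext p
  have := isProbabilityMeasure_expMeasure hl
  have c2 : Continuous (Dv e ψ) := (hψ.dv _).cont
  obtain ⟨C, hC⟩ := (hc.dv e).exists_bound_of_continuous c2
  have hline : ∀ (f : EuT N → ℝ), Sm f → ∀ (q : EuT N) (s : ℝ),
      HasDerivAt (fun s : ℝ => f (q + s • e)) (Dv e f (q + s • e)) s := by
    intro f hf q s
    have h2 : HasDerivAt (fun s : ℝ => q + s • e) e s := by
      simpa using ((hasDerivAt_id s).smul_const e).const_add q
    exact (hf.diff (q + s • e)).hasFDerivAt.comp_hasDerivAt s h2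
  have h1 := hasDerivAt_integral_of_dominated_loc_of_deriv_le (μ := expMeasure l)
    (F := fun (s : ℝ) r => ψ ((p.1, p.2 + r) + s • e))
    (F' := fun (s : ℝ) r => Dv e ψ ((p.1, p.2 + r) + s • e)) (x₀ := (0 : ℝ)) (s := univ)
    (bound := fun _ => C) Filter.univ_mem
    (of_forall fun s => by
      have c1 : Continuous fun r : ℝ => ψ ((p.1, p.2 + r) + s • e) := by
        have := hψ.cont
        fun_prop
      exact c1.aestronglyMeasurable)
    (by simpa using fut_integrable hl hψ.cont hc p)
    (by
      have c1 : Continuous fun r : ℝ => Dv e ψ ((p.1, p.2 + r) + (0 : ℝ) • e) := by fun_prop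
      exact c1.aestronglyMeasurable)
    (of_forall fun r s _ => hC _) (integrable_const _)
    (of_forall fun r s _ => hline ψ hψ _ s)
  have h3 := hline _ (fut_smooth hl hψ hc) p 0
  have e1 : (fun s : ℝ => ∫ r, ψ ((p.1, p.2 + r) + s • e) ∂(expMeasure l))
      = fun s : ℝ => fut l ψ (p + s • e) := by
    ext s
    simp only [fut]
    congr 1
    ext r
    congr 1
    ext <;> simp <;> ring
  have h4 := h1.2
  rw [e1] at h4
  have h5 := h3.unique h4
  simpa [fut] using h5

theorem lapS_fut (hl : 0 < l) {ψ : EuT N → ℝ} (hψ : Sm ψ) (hc : HasCompactSupport ψ)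
    {ι : Type*} [Fintype ι] (e : ι → EuT N) : lapS e (fut l ψ) = fut l (lapS e ψ) := by
  ext p
  unfold lapS
  simp only [Dv_fut hl hψ hc, Dv_fut hl (hψ.dv _) (hc.dv _)]
  simp only [fut]
  rw [integral_finsetSum]
  exact fun i _ => fut_integrable hl ((hψ.dv _).dv _).continuous ((hc.dv _).dv _) p

theorem Dv_eT_fut (hl : 0 < l) {ψ : EuT N → ℝ} (hψ : Sm ψ) (hc : HasCompactSupport ψ)
    (p : EuT N) : Dv eT (fut l ψ) p = l * (fut l ψ p - ψ p) := by
  rw [Dv_fut hl hψ hc]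
  simp only [fut]
  rw [integral_expMeasure hl, integral_expMeasure hl]
  have c0 : Continuous ψ := hψ.cont
  have c2 : Continuous (Dv eT ψ) := (hψ.dv _).cont
  obtain ⟨C, hC⟩ := hc.exists_bound_of_continuous c0
  obtain ⟨C', hC'⟩ := (hc.dv eT).exists_bound_of_continuous c2
  have he : IntegrableOn (fun r => l * Real.exp (-(l * r))) (Ioi 0) := by
    have := (exp_neg_integrableOn_Ioi 0 hl).const_mul l
    simpa only [neg_mul, IntegrableOn] using this
  have i1 : IntegrableOn (fun r => l * Real.exp (-(l * r)) * Dv eT ψ (p.1, p.2 + r)) (Ioi 0) := by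
    have c1 : Continuous fun r : ℝ => Dv eT ψ (p.1, p.2 + r) := by fun_prop
    exact Integrable.mul_bdd (c := C') he c1.aestronglyMeasurable
      (of_forall fun r => hC' _)
  have i2 : IntegrableOn (fun r => l * Real.exp (-(l * r)) * ψ (p.1, p.2 + r)) (Ioi 0) := by
    have c1 : Continuous fun r : ℝ => ψ (p.1, p.2 + r) := by fun_prop
    exact Integrable.mul_bdd (c := C) he c1.aestronglyMeasurable
      (of_forall fun r => hC _)
  have key := integral_Ioi_of_hasDerivAt_of_tendsto
    (f := fun r => l * Real.exp (-(l * r)) * ψ (p.1, p.2 + r))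
    (f' := fun r => l * Real.exp (-(l * r)) * Dv eT ψ (p.1, p.2 + r)
      - l * (l * Real.exp (-(l * r)) * ψ (p.1, p.2 + r))) (a := 0) (m := 0) ?_ ?_
    (i1.sub (i2.const_mul l)) ?_
  · rw [integral_sub i1 (i2.const_mul l), integral_const_mul] at key
    simp only [mul_zero, neg_zero, Real.exp_zero, mul_one, add_zero, zero_sub] at key
    linarith
  · have c1 : Continuous fun r : ℝ => l * Real.exp (-(l * r)) * ψ (p.1, p.2 + r) := by fun_prop
    exact c1.continuousWithinAt
  · intro r _
    have h1 : HasDerivAt (fun r => l * Real.exp (-(l * r))) (l * (Real.exp (-(l * r)) * (-(l * 1)))) r :=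
      (((hasDerivAt_id r).const_mul l).neg.exp).const_mul l
    have h2 : HasDerivAt (fun r => ψ (p.1, p.2 + r)) (Dv eT ψ (p.1, p.2 + r)) r := by
      have := (hasDerivAt_time hψ p.1 (p.2 + r)).comp r ((hasDerivAt_id r).const_add p.2)
      simpa [Function.comp_def] using this
    exact (h1.mul h2).congr_deriv (by ring)
  · have h1 : Tendsto (fun r : ℝ => C * l * Real.exp (-(l * r))) atTop (𝓝 (C * l * 0)) :=
      ((Real.tendsto_exp_neg_atTop_nhds_zero.comp (tendsto_id.const_mul_atTop hl))).const_mul _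
    rw [mul_zero] at h1
    refine squeeze_zero_norm (fun r => ?_) h1
    rw [norm_mul, norm_eq_abs, abs_of_nonneg (by positivity)]
    have := hC (p.1, p.2 + r)
    have := Real.exp_pos (-(l * r))
    nlinarith [mul_pos hl this]

/-- The time average solves a linear relaxation equation. -/
theorem avg_dt (hl : 0 < l) {F ψ : EuT N → ℝ} (hF : Integrable F) (hψ : Sm ψ)
    (hc : HasCompactSupport ψ) : ∫ p, avg l F p * Dv eT ψ p
      = l * (∫ p, avg l F p * ψ p) - l * ∫ p, F p * ψ p := by
  have c0 : Continuous ψ := hψ.cont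
  obtain ⟨C, hC⟩ := hc.exists_bound_of_continuous c0
  have i1 : Integrable fun p => F p * ψ p :=
    hF.mul_bdd (c := C) c0.aestronglyMeasurable (of_forall fun r => hC _)
  have := isProbabilityMeasure_expMeasure hl
  have i2 : Integrable fun p => F p * fut l ψ p := by
    refine hF.mul_bdd (c := C) (fut_smooth hl hψ hc).cont.aestronglyMeasurable
      (of_forall fun p => ?_)
    have := norm_integral_le_of_norm_le_const (μ := expMeasure l)
      (f := fun r => ψ (p.1, p.2 + r)) (of_forall fun r => hC _)
    simpa [fut] using this
  rw [integral_avg_mul hl hF (hψ.dv _).cont (hc.dv _), ← Dv_fut hl hψ hc,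
    integral_avg_mul hl hF c0 hc, ← mul_sub, ← integral_sub i2 i1, ← integral_const_mul]
  refine integral_congr_ae (of_forall fun p => ?_)
  simp only [Dv_eT_fut hl hψ hc]
  ring

end Averages

section Elementary

variable {m u y : ℝ}

theorem mul_sub_rpow_nonneg (hm : 1 < m) (hu : 0 ≤ u) (hy : 0 ≤ y) :
    0 ≤ (u - y) * (u ^ m - y ^ m) := by
  rcases le_total u y with h | h
  · have := rpow_le_rpow hu h (by linarith : 0 ≤ m)
    nlinarith
  · have := rpow_le_rpow hy h (by linarith : 0 ≤ m)
    nlinarith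

theorem tangent_rpow {e : ℝ} (he : 1 ≤ e) (hu : 0 ≤ u) (hy : 0 ≤ y) :
    y ^ e + e * y ^ (e - 1) * (u - y) ≤ u ^ e := by
  rcases hy.eq_or_lt with h0 | hy
  · subst h0
    rcases he.eq_or_lt with h1 | h1
    · subst h1; simp
    · rw [zero_rpow (by linarith), zero_rpow (by linarith)]
      simpa using rpow_nonneg hu e
  · have h := one_add_mul_self_le_rpow_one_add (s := u / y - 1)
      (by linarith [div_nonneg hu hy.le]) he
    have h2 : (1 + (u / y - 1)) ^ e = u ^ e / y ^ e := by
      rw [show 1 + (u / y - 1) = u / y by ring, Real.div_rpow hu hy.le]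
    rw [h2, le_div_iff₀ (by positivity)] at h
    have h3 : y ^ e = y * y ^ (e - 1) := by
      rw [← Real.rpow_one_add' hy.le (by linarith)]; congr 1; ring
    have h4 : (1 + e * (u / y - 1)) * y ^ e = y ^ e + e * y ^ (e - 1) * (u - y) := by
      rw [h3]; field_simp
    linarith

theorem rpow_sub_sq_le (hm : 1 < m) (hu : 0 ≤ u) (hy : 0 ≤ y) :
    (u ^ m - y ^ m) ^ 2 ≤ m * (u ^ (m - 1) + y ^ (m - 1)) * ((u - y) * (u ^ m - y ^ m)) := by
  have key : ∀ {u y : ℝ}, 0 ≤ u → 0 ≤ y → y ≤ u →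
      (u ^ m - y ^ m) ^ 2 ≤ m * (u ^ (m - 1) + y ^ (m - 1)) * ((u - y) * (u ^ m - y ^ m)) := by
    intro u y hu hy h
    have h1 := tangent_rpow (u := y) (y := u) hm.le hy hu
    have h2 := rpow_le_rpow hy h (by linarith : 0 ≤ m)
    have h3 : 0 ≤ m * y ^ (m - 1) := by have := rpow_nonneg hy (m - 1); positivity
    have h4 : u ^ m - y ^ m ≤ m * (u ^ (m - 1) + y ^ (m - 1)) * (u - y) := by
      nlinarith [mul_nonneg h3 (sub_nonneg.2 h)]
    nlinarith [mul_le_mul_of_nonneg_right h4 (sub_nonneg.2 h2)]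
  rcases le_total y u with h | h
  · exact key hu hy h
  · have := key hy hu h
    nlinarith

theorem rpow_pred_le (hm : 1 < m) (hu : 0 ≤ u) {s : ℝ} (hs : 0 < s) :
    u ^ (m - 1) ≤ s * u ^ m + s ^ (1 - m) := by
  have h1 : 0 ≤ s * u ^ m := mul_nonneg hs.le (rpow_nonneg hu m)
  have h2 : 0 ≤ s ^ (1 - m) := rpow_nonneg hs.le _
  rcases le_total (s * u) 1 with h | h
  · have h3 : u ≤ s⁻¹ := by
      rw [← one_div, le_div_iff₀ hs]; linarith
    have h4 := rpow_le_rpow hu h3 (by linarith : 0 ≤ m - 1)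
    rw [Real.inv_rpow hs.le, ← Real.rpow_neg hs.le, neg_sub] at h4
    linarith
  · have h0 : 0 < u := by
      rcases hu.eq_or_lt with h0 | h0
      · subst h0; simp at h; linarith
      · exact h0
    have h3 : u ^ m = u * u ^ (m - 1) := by
      rw [← Real.rpow_one_add' hu (by linarith)]; congr 1; ring
    have h4 := rpow_nonneg hu (m - 1)
    rw [h3]
    nlinarith

theorem abs_sub_rpow_le (hm : 1 < m) (hu : 0 ≤ u) (hy : 0 ≤ y) :
    |u - y| * |u - y| ^ m ≤ (u - y) * (u ^ m - y ^ m) := by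
  have key : ∀ {u y : ℝ}, 0 ≤ u → 0 ≤ y → y ≤ u →
      |u - y| * |u - y| ^ m ≤ (u - y) * (u ^ m - y ^ m) := by
    intro u y hu hy h
    rw [abs_of_nonneg (sub_nonneg.2 h)]
    have h1 := Real.add_rpow_le_rpow_add (sub_nonneg.2 h) hy hm.le
    rw [sub_add_cancel] at h1
    exact mul_le_mul_of_nonneg_left (by linarith) (sub_nonneg.2 h)
  rcases le_total y u with h | h
  · exact key hu hy h
  · have := key hy hu h
    rw [abs_sub_comm]
    linarith

theorem flux_young (hm : 1 < m) (hu : 0 ≤ u) (hy : 0 ≤ y) {s τ : ℝ} (hs : 0 < s)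
    (hτ : 0 < τ) (b : ℝ) : 2 * b * (u ^ m - y ^ m) ≤ τ * ((u - y) * (u ^ m - y ^ m))
      + 2 * m * b ^ 2 / τ * (s * u ^ m + s * y ^ m + s ^ (1 - m)) := by
  have h1 := rpow_sub_sq_le hm hu hy
  have h2 := rpow_pred_le hm hu hs
  have h3 := rpow_pred_le hm hy hs
  have h4 := mul_sub_rpow_nonneg hm hu hy
  have h5 := rpow_nonneg hu (m - 1)
  have h6 := rpow_nonneg hy (m - 1)
  have h7 := rpow_nonneg hs.le (1 - m)
  have h8 := mul_nonneg hs.le (rpow_nonneg hu m)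
  have h9 := mul_nonneg hs.le (rpow_nonneg hy m)
  set w := u ^ (m - 1) + y ^ (m - 1)
  set E := (u - y) * (u ^ m - y ^ m)
  set z := u ^ m - y ^ m
  have hw : w ≤ 2 * (s * u ^ m + s * y ^ m + s ^ (1 - m)) := by linarith
  have hb : m * b ^ 2 / τ * w ≤ m * b ^ 2 / τ * (2 * (s * u ^ m + s * y ^ m + s ^ (1 - m))) :=
    mul_le_mul_of_nonneg_left hw (by positivity)
  have h10 : 2 * b * z ≤ τ * E + m * b ^ 2 / τ * w := by
    have hw0 : 0 ≤ w := by positivity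
    have hp : 0 ≤ τ * E := by positivity
    have hq : 0 ≤ m * b ^ 2 / τ * w := by positivity
    have h11 : (b * z) ^ 2 ≤ (τ * E) * (m * b ^ 2 / τ * w) := by
      have : (τ * E) * (m * b ^ 2 / τ * w) = b ^ 2 * (m * w * E) := by field_simp
      rw [this, mul_pow]
      exact mul_le_mul_of_nonneg_left h1 (sq_nonneg b)
    by_contra! hc
    nlinarith [sq_nonneg (τ * E - m * b ^ 2 / τ * w)]
  calc _ ≤ _ := h10
    _ ≤ _ := by linarith [hb, show 2 * m * b ^ 2 / τ * (s * u ^ m + s * y ^ m + s ^ (1 - m))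
      = m * b ^ 2 / τ * (2 * (s * u ^ m + s * y ^ m + s ^ (1 - m))) by ring]

theorem mul_abs_sub_young (hm : 1 < m) (hu : 0 ≤ u) (hy : 0 ≤ y) {c ε : ℝ} (hc : 0 ≤ c)
    (hε : 0 < ε) : c * |u - y| ≤ ε * c ^ ((m + 1) / m)
      + ε ^ (-m) * ((u - y) * (u ^ m - y ^ m)) := by
  have h1 := abs_sub_rpow_le hm hu hy
  set d := |u - y| with hd
  have hd0 : 0 ≤ d := abs_nonneg _
  have h2 : 0 ≤ ε ^ (-m) := rpow_nonneg hε.le _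
  have h3 : 0 ≤ ε * c ^ ((m + 1) / m) := mul_nonneg hε.le (rpow_nonneg hc _)
  have h5 : c ^ ((m + 1) / m) = c * c ^ (1 / m) := by
    rw [← Real.rpow_one_add' hc (by positivity)]; congr 1; field_simp
  have h6 := mul_le_mul_of_nonneg_left h1 h2
  rcases le_total d (ε * c ^ (1 / m)) with h | h
  · have h7 := mul_le_mul_of_nonneg_left h hc
    have h8 := mul_nonneg h2 (mul_sub_rpow_nonneg hm hu hy)
    rw [h5]; linarith
  · have h7 : c ^ (1 / m) ≤ d / ε := by rw [le_div_iff₀ hε]; linarith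
    have h8 := rpow_le_rpow (rpow_nonneg hc _) h7 (by linarith : 0 ≤ m)
    rw [← rpow_mul hc, one_div_mul_cancel (by linarith), rpow_one,
      Real.div_rpow hd0 hε.le, div_eq_mul_inv, ← Real.rpow_neg hε.le] at h8
    have h9 := mul_le_mul_of_nonneg_right h8 hd0
    linarith

end Elementary

section Mixture

open ProbabilityTheory

variable {N : ℕ} {l m : ℝ} {θ : ℝ → ℝ} {U : EuT N → ℝ} {p : EuT N}

/-- Weighted time average with a cutoff in time. -/
abbrev av (l : ℝ) (θ : ℝ → ℝ) (F : EuT N → ℝ) : EuT N → ℝ := avg l fun q => θ q.2 * F q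

/-- Oscillation of a function with respect to its time averages. -/
def osc (l : ℝ) (θ : ℝ → ℝ) (m : ℝ) (U : EuT N → ℝ) (p : EuT N) : ℝ :=
  U p * U p ^ m - U p * av l θ (fun q => U q ^ m) p - av l θ U p * U p ^ m
    + av l θ (fun q => U q * U q ^ m) p

/-- Integrability along the past of a point. -/
def PastInt (l : ℝ) (θ : ℝ → ℝ) (F : EuT N → ℝ) (p : EuT N) : Prop :=
  Integrable (fun r => θ (p.2 - r) * F (p.1, p.2 - r)) (expMeasure l)

/-- Conditions under which time averages may be compared at a point. -/
structure Mix (l : ℝ) (θ : ℝ → ℝ) (m : ℝ) (U : EuT N → ℝ) (p : EuT N) : Prop where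
  hl : 0 < l
  hm : 1 < m
  θ_nonneg : ∀ t, 0 ≤ θ t
  θ_le : ∀ t, θ t ≤ 1
  nonneg : ∀ q, 0 ≤ U q
  int₁ : PastInt l θ U p
  int₂ : PastInt l θ (fun q => U q ^ m) p
  int₃ : PastInt l θ (fun q => U q * U q ^ m) p

theorem integral_sum_five {β : Type*} [MeasurableSpace β] {μ : Measure β} {f₀ f₁ f₂ f₃ f₄ : β → ℝ}
    (h₀ : Integrable f₀ μ) (h₁ : Integrable f₁ μ) (h₂ : Integrable f₂ μ) (h₃ : Integrable f₃ μ)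
    (h₄ : Integrable f₄ μ) : ∫ r, (f₀ r + f₁ r + f₂ r + f₃ r + f₄ r) ∂μ
      = ∫ r, f₀ r ∂μ + ∫ r, f₁ r ∂μ + ∫ r, f₂ r ∂μ + ∫ r, f₃ r ∂μ + ∫ r, f₄ r ∂μ := by
  rw [← integral_add' h₀ h₁, ← integral_add' (h₀.add h₁) h₂,
    ← integral_add' ((h₀.add h₁).add h₂) h₃, ← integral_add' (((h₀.add h₁).add h₂).add h₃) h₄]
  rfl

theorem Mix.mix_with (h : Mix l θ m U p) {k : ℝ → ℝ} (hk : k 0 = 0)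
    (hi : PastInt l θ (fun q => k (U q)) p) (c0 c1 c2 c3 c4 : ℝ)
    (H : ∀ y, 0 ≤ y → 0 ≤ c0 + c1 * y + c2 * y ^ m + c3 * (y * y ^ m) + c4 * k y) :
    0 ≤ c0 + c1 * av l θ U p + c2 * av l θ (fun q => U q ^ m) p
      + c3 * av l θ (fun q => U q * U q ^ m) p + c4 * av l θ (fun q => k (U q)) p := by
  have := isProbabilityMeasure_expMeasure h.hl
  have hm0 : m ≠ 0 := by linarith [h.hm]
  have hc0 : 0 ≤ c0 := by simpa [hk, zero_rpow hm0] using H 0 le_rfl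
  have j1 := h.int₁.const_mul c1
  have j2 := h.int₂.const_mul c2
  have j3 := h.int₃.const_mul c3
  have j4 := hi.const_mul c4
  have j0 : Integrable (fun _ : ℝ => c0) (expMeasure l) := integrable_const _
  simp only [av, avg]
  rw [← integral_const_mul, ← integral_const_mul, ← integral_const_mul, ← integral_const_mul]
  have e0 : c0 = ∫ _, c0 ∂(expMeasure l) := by simp
  nth_rewrite 1 [e0]
  rw [← integral_sum_five j0 j1 j2 j3 j4]
  refine integral_nonneg fun r => ?_
  have h1 := h.θ_nonneg (p.2 - r)
  have h2 := h.θ_le (p.2 - r)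
  have h3 := H _ (h.nonneg (p.1, p.2 - r))
  simp only [Pi.zero_apply]
  nlinarith [mul_nonneg h1 h3, mul_nonneg (sub_nonneg.2 h2) hc0]

theorem Mix.mix (h : Mix l θ m U p) (c0 c1 c2 c3 : ℝ)
    (H : ∀ y, 0 ≤ y → 0 ≤ c0 + c1 * y + c2 * y ^ m + c3 * (y * y ^ m)) :
    0 ≤ c0 + c1 * av l θ U p + c2 * av l θ (fun q => U q ^ m) p
      + c3 * av l θ (fun q => U q * U q ^ m) p := by
  have hi : PastInt l θ (fun q => (fun _ => (0 : ℝ)) (U q)) p := by simp [PastInt]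
  have := h.mix_with (k := fun _ => 0) rfl hi c0 c1 c2 c3 0 (fun y hy => by
    simpa using H y hy)
  simpa using this

theorem Mix.osc_nonneg (h : Mix l θ m U p) : 0 ≤ osc l θ m U p := by
  have := h.mix (U p * U p ^ m) (-(U p ^ m)) (-(U p)) 1 fun y hy => by
    have := mul_sub_rpow_nonneg h.hm (h.nonneg p) hy
    linarith
  unfold osc
  linarith

theorem Mix.flux (h : Mix l θ m U p) {s τ : ℝ} (hs : 0 < s) (hτ : 0 < τ) (b : ℝ) :
    2 * b * (U p ^ m - av l θ (fun q => U q ^ m) p) ≤ τ * osc l θ m U p + 2 * m * b ^ 2 / τ *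
      (s * U p ^ m + s * av l θ (fun q => U q ^ m) p + s ^ (1 - m)) := by
  have := h.mix (τ * (U p * U p ^ m) - 2 * b * U p ^ m
      + 2 * m * b ^ 2 / τ * (s * U p ^ m + s ^ (1 - m))) (-(τ * U p ^ m))
      (-(τ * U p) + 2 * b + 2 * m * b ^ 2 / τ * s) τ fun y hy => by
    have := flux_young h.hm (h.nonneg p) hy hs hτ b
    linarith
  unfold osc
  linarith

theorem Mix.mul_abs_sub (h : Mix l θ m U p) {c ε : ℝ} (hc : 0 ≤ c) (hε : 0 < ε) :
    c * |U p - av l θ U p| ≤ ε * c ^ ((m + 1) / m) + ε ^ (-m) * osc l θ m U p := by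
  have key : ∀ σ : ℝ, |σ| = 1 → c * (σ * (U p - av l θ U p))
      ≤ ε * c ^ ((m + 1) / m) + ε ^ (-m) * osc l θ m U p := by
    intro σ hσ
    have := h.mix (ε * c ^ ((m + 1) / m) + ε ^ (-m) * (U p * U p ^ m) - c * (σ * U p))
      (-(ε ^ (-m) * U p ^ m) + c * σ) (-(ε ^ (-m) * U p)) (ε ^ (-m)) fun y hy => by
      have h1 := mul_abs_sub_young h.hm (h.nonneg p) hy hc hε
      have h2 : σ * (U p - y) ≤ |U p - y| := by
        have := le_abs_self (σ * (U p - y))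
        rwa [abs_mul, hσ, one_mul] at this
      have h3 := mul_le_mul_of_nonneg_left h2 hc
      linarith
    unfold osc
    linarith
  rcases abs_choice (U p - av l θ U p) with h1 | h1
  · rw [h1]; simpa using key 1 (by simp)
  · rw [h1]; simpa using key (-1) (by simp)

theorem Mix.abs_cross (h : Mix l θ m U p) {ε : ℝ} (hε : 0 < ε) :
    |av l θ (fun q => U q * U q ^ m) p - U p * av l θ (fun q => U q ^ m) p|
      ≤ ε * av l θ (fun q => U q * U q ^ m) p + ε ^ (-m) * osc l θ m U p := by
  have key : ∀ σ : ℝ, |σ| = 1 →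
      σ * (av l θ (fun q => U q * U q ^ m) p - U p * av l θ (fun q => U q ^ m) p)
      ≤ ε * av l θ (fun q => U q * U q ^ m) p + ε ^ (-m) * osc l θ m U p := by
    intro σ hσ
    have := h.mix (ε ^ (-m) * (U p * U p ^ m)) (-(ε ^ (-m) * U p ^ m))
      (-(ε ^ (-m) * U p) + σ * U p) (ε ^ (-m) + ε - σ) fun y hy => by
      have hym := rpow_nonneg hy m
      have h1 := mul_abs_sub_young h.hm (h.nonneg p) hy hym hε
      have h2 : -σ * (U p - y) ≤ |U p - y| := by
        have := le_abs_self (-σ * (U p - y))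
        rwa [abs_mul, abs_neg, hσ, one_mul] at this
      have h3 := mul_le_mul_of_nonneg_left h2 hym
      have h4 : (y ^ m) ^ ((m + 1) / m) = y * y ^ m := by
        have := h.hm
        rw [← rpow_mul hy, mul_div_cancel₀ _ (by linarith), add_comm,
          Real.rpow_one_add' hy (by linarith)]
      rw [h4] at h1
      linarith
    unfold osc
    linarith
  rcases abs_choice (av l θ (fun q => U q * U q ^ m) p - U p * av l θ (fun q => U q ^ m) p)
    with h1 | h1
  · rw [h1]; simpa using key 1 (by simp)
  · rw [h1]; simpa using key (-1) (by simp)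

theorem av_nonneg (h0 : ∀ t, 0 ≤ θ t) {F : EuT N → ℝ} (hF : ∀ q, 0 ≤ F q) (p : EuT N) :
    0 ≤ av l θ F p := avg_nonneg (fun q => mul_nonneg (h0 _) (hF q)) p

theorem Mix.mul_sub_le_osc (h : Mix l θ m U p) :
    (U p - av l θ U p) * (U p ^ m - av l θ (fun q => U q ^ m) p) ≤ osc l θ m U p := by
  have h0 : 0 ≤ av l θ U p := av_nonneg h.θ_nonneg h.nonneg p
  set z := av l θ U p with hz
  have := h.mix (z * z ^ m) (-(z ^ m)) (-z) 1 fun y hy => by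
    have := mul_sub_rpow_nonneg h.hm h0 hy
    linarith
  unfold osc
  rw [← hz] at this ⊢
  linarith

theorem Mix.jensen (h : Mix l θ m U p) {e : ℝ} (he : 1 ≤ e)
    (hi : PastInt l θ (fun q => U q ^ e) p) :
    av l θ U p ^ e ≤ av l θ (fun q => U q ^ e) p := by
  have h0 : 0 ≤ av l θ U p := av_nonneg h.θ_nonneg h.nonneg p
  set z := av l θ U p with hz
  have e1 : z ^ e = z * z ^ (e - 1) := by
    rw [← Real.rpow_one_add' h0 (by linarith)]; congr 1; ring
  have := h.mix_with (k := fun y => y ^ e) (zero_rpow (by linarith)) hi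
    ((e - 1) * z ^ e) (-(e * z ^ (e - 1))) 0 0 1 fun y hy => by
    have := tangent_rpow he hy h0
    rw [e1] at this ⊢
    linarith
  rw [← hz] at this
  rw [e1] at this ⊢
  linarith

theorem Mix.jensen_rpow (h : Mix l θ m U p) {e : ℝ} (he : 1 ≤ e)
    (hi : PastInt l θ (fun q => (U q ^ m) ^ e) p) :
    av l θ (fun q => U q ^ m) p ^ e ≤ av l θ (fun q => (U q ^ m) ^ e) p := by
  have h0 : 0 ≤ av l θ (fun q => U q ^ m) p :=
    av_nonneg h.θ_nonneg (fun q => rpow_nonneg (h.nonneg q) m) p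
  set z := av l θ (fun q => U q ^ m) p with hz
  have e1 : z ^ e = z * z ^ (e - 1) := by
    rw [← Real.rpow_one_add' h0 (by linarith)]; congr 1; ring
  have hm := h.hm
  have := h.mix_with (k := fun y => (y ^ m) ^ e)
    (by rw [zero_rpow (by linarith), zero_rpow (by linarith)]) hi
    ((e - 1) * z ^ e) 0 (-(e * z ^ (e - 1))) 0 1 fun y hy => by
    have := tangent_rpow he (rpow_nonneg hy m) h0
    rw [e1] at this ⊢
    linarith
  rw [← hz] at this
  rw [e1] at this ⊢
  linarith

end Mixture

section Energy

variable {N : ℕ}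

/-- Inner product of spatial gradients. -/
def Gr (f g : EuT N → ℝ) (p : EuT N) : ℝ := ∑ i, Dv (eX i) f p * Dv (eX i) g p

theorem Gr_self_nonneg (f : EuT N → ℝ) (p : EuT N) : 0 ≤ Gr f f p :=
  sum_nonneg fun _ _ => mul_self_nonneg _

theorem Gr_comm (f g : EuT N → ℝ) (p : EuT N) : Gr f g p = Gr g f p :=
  sum_congr rfl fun _ _ => mul_comm _ _

theorem Gr_sq_le (f g : EuT N → ℝ) (p : EuT N) : Gr f g p ^ 2 ≤ Gr f f p * Gr g g p := by
  have := Finset.sum_mul_sq_le_sq_mul_sq Finset.univ (fun i => Dv (eX i) f p)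
    (fun i => Dv (eX i) g p)
  simpa [Gr, sq] using this

theorem Gr_smooth {f g : EuT N → ℝ} (hf : Sm f) (hg : Sm g) : Sm (Gr f g) :=
  ContDiff.sum fun _ _ => (hf.dv _).mul (hg.dv _)

theorem Gr_mul_left {f g : EuT N → ℝ} (hf : Sm f) (hg : Sm g) (k : EuT N → ℝ)
    (p : EuT N) : Gr (fun q => f q * g q) k p = f p * Gr g k p + g p * Gr f k p := by
  simp only [Gr, mul_sum, ← sum_add_distrib]
  refine sum_congr rfl fun i _ => ?_
  rw [Dv_mul hf hg]
  ring

theorem lapX_mul {f g : EuT N → ℝ} (hf : Sm f) (hg : Sm g) (p : EuT N) :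
    lapS eX (fun q => f q * g q) p = f p * lapS eX g p + 2 * Gr f g p + g p * lapS eX f p := by
  rw [lapS_mul hf hg]
  rfl

theorem lapX_sq {f : EuT N → ℝ} (hf : Sm f) (p : EuT N) :
    lapS eX (fun q => f q * f q) p = 2 * f p * lapS eX f p + 2 * Gr f f p := by
  rw [lapX_mul hf hf]; ring

theorem integral_lapX_symm {f g : EuT N → ℝ} (hf : Sm f) (hg : Sm g)
    (hc : HasCompactSupport f) : ∫ p, (f p * lapS eX g p - g p * lapS eX f p) = 0 := by
  have i1 : Integrable fun p => f p * lapS eX g p :=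
    Sm.integrable (ContDiff.mul hf (Sm.lapS hg eX)) hc.mul_right
  have i2 : Integrable fun p => g p * lapS eX f p :=
    Sm.integrable (ContDiff.mul hg (Sm.lapS hf eX)) (HasCompactSupport.lapS hc eX).mul_left
  rw [integral_sub i1 i2, integral_mul_lapS hf hg hc, sub_eq_zero]
  exact integral_congr_ae (of_forall fun p => mul_comm _ _)

theorem integral_lapX {f : EuT N → ℝ} (hf : Sm f) (hc : HasCompactSupport f) :
    ∫ p, lapS eX f p = 0 := by
  have := integral_lapX_symm hf (contDiff_const (c := (1 : ℝ))) hc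
  have h0 : ∀ e x, Dv e (fun _ : EuT N => (1 : ℝ)) x = 0 := fun e x => by simp [Dv]
  have h1 : ∀ x, lapS eX (fun _ : EuT N => (1 : ℝ)) x = 0 := fun x => by
    unfold lapS
    refine Finset.sum_eq_zero fun i _ => ?_
    rw [show Dv (eX i) (fun _ : EuT N => (1 : ℝ)) = fun _ => 0 from funext (h0 _)]
    simp [Dv]
  simp only [h1, mul_zero, zero_sub, one_mul, integral_neg, neg_eq_zero] at this
  exact this

/-- Two functions with the same integral up to a vanishing term. -/
theorem integral_eq_of_sub {X Y Z : EuT N → ℝ} (hX : Integrable X) (hY : Integrable Y)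
    (h : ∀ p, X p - Y p = Z p) (hZ : ∫ p, Z p = 0) : ∫ p, X p = ∫ p, Y p := by
  rw [← sub_eq_zero, ← integral_sub hX hY, ← hZ]
  exact integral_congr_ae (of_forall h)

theorem integrable_of_zero_off {f ω : EuT N → ℝ} (hf : Continuous f)
    (hc : HasCompactSupport ω) (h : ∀ p, p ∉ tsupport ω → f p = 0) : Integrable f :=
  hf.integrable_of_hasCompactSupport (HasCompactSupport.intro hc h)

/-- Smooth solutions of the relaxed system on the support of a cutoff. -/
structure Relax (l : ℝ) (ω A Ab V Vb G : EuT N → ℝ) : Prop where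
  ω_smooth : Sm ω
  ω_compact : HasCompactSupport ω
  A_smooth : Sm A
  Ab_smooth : Sm Ab
  V_smooth : Sm V
  Vb_smooth : Sm Vb
  G_smooth : Sm G
  dt_Vb : ∀ p ∈ tsupport ω, Dv eT Vb p = l * (V p - Vb p)
  lap_Vb : ∀ p ∈ tsupport ω, lapS eX Vb p = l * (A p - Ab p) - G p
  dt_A : ∀ p ∈ tsupport ω, Dv eT A p = lapS eX V p

variable {l : ℝ} {ω A Ab V Vb G : EuT N → ℝ}

theorem Relax.continuity (h : Relax l ω A Ab V Vb G) : Continuous ω ∧ Continuous A ∧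
    Continuous Ab ∧ Continuous V ∧ Continuous Vb ∧ Continuous G ∧ Continuous (Gr Vb Vb) ∧
    Continuous (Gr ω Vb) ∧ Continuous (lapS eX ω) ∧ Continuous (Dv eT ω) :=
  ⟨h.ω_smooth.cont, h.A_smooth.cont,
    h.Ab_smooth.cont, h.V_smooth.cont,
    h.Vb_smooth.cont, h.G_smooth.cont,
    (Gr_smooth h.Vb_smooth h.Vb_smooth).cont,
    (Gr_smooth h.ω_smooth h.Vb_smooth).cont,
    (Sm.lapS h.ω_smooth eX).cont, (h.ω_smooth.dv eT).cont⟩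

theorem zero_off {ω : EuT N → ℝ} {p : EuT N} (hp : p ∉ tsupport ω) :
    ω p = 0 ∧ (∀ g, Gr ω g p = 0) ∧ lapS eX ω p = 0 ∧ Dv eT ω p = 0 :=
  ⟨image_eq_zero_of_notMem_tsupport hp, fun g => by
    simp only [Gr, dv_eq_zero hp, zero_mul, Finset.sum_const_zero], lapS_eq_zero hp eX,
    dv_eq_zero hp eT⟩

theorem Relax.duality (h : Relax l ω A Ab V Vb G) :
    ∫ p, l * ω p * (A p * (V p - Vb p) + V p * (A p - Ab p)) = ∫ p, (ω p * V p * G p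
      - Dv eT ω p * A p * Vb p - (V p - Vb p) * (2 * Gr ω Vb p + Vb p * lapS eX ω p)) := by
  obtain ⟨c1, c2, c3, c4, c5, c6, c7, c8, c9, c10⟩ := h.continuity
  have sB : Sm fun p => Vb p * Vb p := ContDiff.mul h.Vb_smooth h.Vb_smooth
  have s1 : Sm fun p => ω p * A p := ContDiff.mul h.ω_smooth h.A_smooth
  have s2 : Sm fun p => ω p * A p * Vb p := ContDiff.mul s1 h.Vb_smooth
  have s3 : Sm fun p => ω p * Vb p := ContDiff.mul h.ω_smooth h.Vb_smooth
  have s4 : Sm fun p => ω p * (Vb p * Vb p) := ContDiff.mul h.ω_smooth sB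
  have k2 : HasCompactSupport fun p => ω p * A p * Vb p := (h.ω_compact.mul_right).mul_right
  have k3 : HasCompactSupport fun p => ω p * Vb p := h.ω_compact.mul_right
  have k4 : HasCompactSupport fun p => ω p * (Vb p * Vb p) := h.ω_compact.mul_right
  have z1 := integral_dv (μ := volume) s2 k2 eT
  have z2 := integral_lapX_symm s3 h.V_smooth k3
  have z3 := integral_lapX s4 k4
  have z4 := integral_lapX_symm h.ω_smooth sB h.ω_compact
  have hB := (Sm.lapS sB eX).cont
  have i1 : Integrable (Dv eT fun p => ω p * A p * Vb p) := Sm.integrable (s2.dv eT) (k2.dv eT)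
  have i2 : Integrable fun p => ω p * Vb p * lapS eX V p
      - V p * lapS eX (fun q => ω q * Vb q) p := by
    refine integrable_of_zero_off ?_ k3 fun p hp => ?_
    · have := (Sm.lapS h.V_smooth eX).cont
      have := (Sm.lapS s3 eX).cont
      fun_prop
    · have := image_eq_zero_of_notMem_tsupport hp
      rw [lapS_eq_zero hp, this]; ring
  have i3 : Integrable (lapS eX fun p => ω p * (Vb p * Vb p)) :=
    Sm.integrable (Sm.lapS s4 eX) (HasCompactSupport.lapS k4 eX)
  have i4 : Integrable fun p => ω p * lapS eX (fun q => Vb q * Vb q) p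
      - Vb p * Vb p * lapS eX ω p := by
    refine integrable_of_zero_off (by fun_prop) h.ω_compact fun p hp => ?_
    obtain ⟨o1, o2, o3, o4⟩ := zero_off hp
    rw [o1, o3]; ring
  refine integral_eq_of_sub (Z := fun p => (Dv eT (fun p => ω p * A p * Vb p) p
    - (ω p * Vb p * lapS eX V p - V p * lapS eX (fun q => ω q * Vb q) p))
    + ((1 / 2) * (ω p * lapS eX (fun q => Vb q * Vb q) p - Vb p * Vb p * lapS eX ω p)
    - (1 / 2) * lapS eX (fun p => ω p * (Vb p * Vb p)) p)) ?_ ?_ (fun p => ?_) ?_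
  · refine integrable_of_zero_off (by fun_prop) h.ω_compact fun p hp => ?_
    obtain ⟨o1, o2, o3, o4⟩ := zero_off hp
    rw [o1]; ring
  · refine integrable_of_zero_off (by fun_prop) h.ω_compact fun p hp => ?_
    obtain ⟨o1, o2, o3, o4⟩ := zero_off hp
    rw [o1, o2, o3, o4]; ring
  · rw [Dv_mul s1 h.Vb_smooth, Dv_mul h.ω_smooth h.A_smooth, lapX_mul h.ω_smooth h.Vb_smooth,
      lapX_mul h.ω_smooth sB, Gr_comm ω (fun q => Vb q * Vb q), Gr_mul_left h.Vb_smooth h.Vb_smooth,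
      Gr_comm Vb ω]
    by_cases hp : p ∈ tsupport ω
    · rw [h.dt_A p hp, h.dt_Vb p hp, h.lap_Vb p hp]; ring
    · obtain ⟨o1, o2, o3, o4⟩ := zero_off hp
      rw [o1, o2, o3, o4]; ring
  · have i12 : Integrable fun p => Dv eT (fun p => ω p * A p * Vb p) p
        - (ω p * Vb p * lapS eX V p - V p * lapS eX (fun q => ω q * Vb q) p) := i1.sub i2
    have i43 : Integrable fun p =>
        (1 / 2) * (ω p * lapS eX (fun q => Vb q * Vb q) p - Vb p * Vb p * lapS eX ω p)
          - (1 / 2) * lapS eX (fun p => ω p * (Vb p * Vb p)) p :=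
      (i4.const_mul _).sub (i3.const_mul _)
    rw [integral_add i12 i43, integral_sub i1 i2,
      integral_sub (i4.const_mul _) (i3.const_mul _), integral_const_mul, integral_const_mul,
      z1, z2, z3, z4]
    ring

theorem Relax.energy_V (h : Relax l ω A Ab V Vb G) :
    ∫ p, ω p * V p * Gr Vb Vb p = ∫ p, (-(ω p * V p * (l * (A p - Ab p) - G p) * Vb p)
      - 2 * V p * Vb p * Gr ω Vb p - 1 / 2 * V p * Vb p ^ 2 * lapS eX ω p
      - 1 / 2 * Dv eT ω p * Vb p ^ 2 * A p - ω p * Vb p * (l * (V p - Vb p)) * A p) := by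
  obtain ⟨c1, c2, c3, c4, c5, c6, c7, c8, c9, c10⟩ := h.continuity
  have sB : Sm fun p => Vb p * Vb p := ContDiff.mul h.Vb_smooth h.Vb_smooth
  have s1 : Sm fun p => ω p * (Vb p * Vb p) := ContDiff.mul h.ω_smooth sB
  have s2 : Sm fun p => ω p * (Vb p * Vb p) * A p := ContDiff.mul s1 h.A_smooth
  have k1 : HasCompactSupport fun p => ω p * (Vb p * Vb p) := h.ω_compact.mul_right
  have k2 : HasCompactSupport fun p => ω p * (Vb p * Vb p) * A p := k1.mul_right
  have z1 := integral_dv (μ := volume) s2 k2 eT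
  have z2 := integral_lapX_symm s1 h.V_smooth k1
  have i1 : Integrable (Dv eT fun p => ω p * (Vb p * Vb p) * A p) :=
    Sm.integrable (s2.dv eT) (k2.dv eT)
  have i2 : Integrable fun p => ω p * (Vb p * Vb p) * lapS eX V p
      - V p * lapS eX (fun q => ω q * (Vb q * Vb q)) p := by
    refine integrable_of_zero_off ?_ k1 fun p hp => ?_
    · have := (Sm.lapS h.V_smooth eX).cont
      have := (Sm.lapS s1 eX).cont
      fun_prop
    · have := image_eq_zero_of_notMem_tsupport hp
      rw [lapS_eq_zero hp, this]; ring
  refine integral_eq_of_sub (Z := fun p => (1 / 2) * Dv eT (fun p => ω p * (Vb p * Vb p) * A p) p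
    - (1 / 2) * (ω p * (Vb p * Vb p) * lapS eX V p
      - V p * lapS eX (fun q => ω q * (Vb q * Vb q)) p)) ?_ ?_ (fun p => ?_) ?_
  · refine integrable_of_zero_off (by fun_prop) h.ω_compact fun p hp => ?_
    obtain ⟨o1, o2, o3, o4⟩ := zero_off hp
    rw [o1]; ring
  · refine integrable_of_zero_off (by fun_prop) h.ω_compact fun p hp => ?_
    obtain ⟨o1, o2, o3, o4⟩ := zero_off hp
    rw [o1, o2, o3, o4]; ring
  · rw [Dv_mul s1 h.A_smooth, Dv_mul h.ω_smooth sB, Dv_mul h.Vb_smooth h.Vb_smooth,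
      lapX_mul h.ω_smooth sB, Gr_comm ω (fun q => Vb q * Vb q), Gr_mul_left h.Vb_smooth h.Vb_smooth,
      Gr_comm Vb ω, lapX_sq h.Vb_smooth]
    by_cases hp : p ∈ tsupport ω
    · rw [h.dt_A p hp, h.dt_Vb p hp, h.lap_Vb p hp]; ring
    · obtain ⟨o1, o2, o3, o4⟩ := zero_off hp
      rw [o1, o2, o3, o4]; ring
  · rw [integral_sub (i1.const_mul _) (i2.const_mul _), integral_const_mul, integral_const_mul,
      z1, z2]
    ring

theorem Relax.energy_Vb (h : Relax l ω A Ab V Vb G) :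
    ∫ p, ω p * Vb p * Gr Vb Vb p = ∫ p, (1 / 6 * Vb p ^ 3 * lapS eX ω p
      - 1 / 2 * ω p * Vb p ^ 2 * (l * (A p - Ab p) - G p)) := by
  obtain ⟨c1, c2, c3, c4, c5, c6, c7, c8, c9, c10⟩ := h.continuity
  have sB : Sm fun p => Vb p * Vb p := ContDiff.mul h.Vb_smooth h.Vb_smooth
  have sC : Sm fun p => Vb p * Vb p * Vb p := ContDiff.mul sB h.Vb_smooth
  have z := integral_lapX_symm h.ω_smooth sC h.ω_compact
  refine integral_eq_of_sub (Z := fun p => (1 / 6) * (ω p * lapS eX (fun q => Vb q * Vb q * Vb q) p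
    - Vb p * Vb p * Vb p * lapS eX ω p)) ?_ ?_ (fun p => ?_) ?_
  · refine integrable_of_zero_off (by fun_prop) h.ω_compact fun p hp => ?_
    obtain ⟨o1, o2, o3, o4⟩ := zero_off hp
    rw [o1]; ring
  · refine integrable_of_zero_off (by fun_prop) h.ω_compact fun p hp => ?_
    obtain ⟨o1, o2, o3, o4⟩ := zero_off hp
    rw [o1, o3]; ring
  · rw [lapX_mul sB h.Vb_smooth, Gr_mul_left h.Vb_smooth h.Vb_smooth, lapX_sq h.Vb_smooth]
    by_cases hp : p ∈ tsupport ω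
    · rw [h.lap_Vb p hp]; ring
    · obtain ⟨o1, o2, o3, o4⟩ := zero_off hp
      rw [o1, o3]; ring
  · rw [integral_const_mul, z, mul_zero]

theorem Relax.energy (h : Relax l ω A Ab V Vb G) :
    ∫ p, ω p * Gr Vb Vb p = ∫ p, (1 / 2 * Vb p ^ 2 * lapS eX ω p
      - ω p * Vb p * (l * (A p - Ab p) - G p)) := by
  obtain ⟨c1, c2, c3, c4, c5, c6, c7, c8, c9, c10⟩ := h.continuity
  have sB : Sm fun p => Vb p * Vb p := ContDiff.mul h.Vb_smooth h.Vb_smooth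
  have z := integral_lapX_symm h.ω_smooth sB h.ω_compact
  refine integral_eq_of_sub (Z := fun p => (1 / 2) * (ω p * lapS eX (fun q => Vb q * Vb q) p
    - Vb p * Vb p * lapS eX ω p)) ?_ ?_ (fun p => ?_) ?_
  · refine integrable_of_zero_off (by fun_prop) h.ω_compact fun p hp => ?_
    obtain ⟨o1, o2, o3, o4⟩ := zero_off hp
    rw [o1]; ring
  · refine integrable_of_zero_off (by fun_prop) h.ω_compact fun p hp => ?_
    obtain ⟨o1, o2, o3, o4⟩ := zero_off hp
    rw [o1, o3]; ring
  · rw [lapX_sq h.Vb_smooth]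
    by_cases hp : p ∈ tsupport ω
    · rw [h.lap_Vb p hp]; ring
    · obtain ⟨o1, o2, o3, o4⟩ := zero_off hp
      rw [o1, o3]; ring
  · rw [integral_const_mul, z, mul_zero]

end Energy

section RelaxEstimate

variable {N : ℕ}

theorem cross_young {P Q g x w : ℝ} (hP : 0 ≤ P) (hQ : 0 ≤ Q) (hg : g ^ 2 ≤ P * Q) :
    -(4 * (x * w * g)) ≤ 1 / 2 * (x ^ 2 * Q) + 8 * (w ^ 2 * P) := by
  refine (neg_le_abs _).trans (abs_le_of_sq_le_sq ?_ (by positivity))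
  have h1 := mul_le_mul_of_nonneg_left hg (show 0 ≤ 16 * (x ^ 2 * w ^ 2) by positivity)
  nlinarith [sq_nonneg (1 / 2 * (x ^ 2 * Q) - 8 * (w ^ 2 * P))]

/-- Hypotheses for estimating smooth solutions of the relaxed system. -/
structure RelaxBd (l s ε m B L g c : ℝ) (χ ω η A Ab V Vb G D J : EuT N → ℝ) : Prop where
  l_ge : 1 ≤ l
  s_pos : 0 < s
  m_pos : 0 < m
  ε_pos : 0 < ε
  B_nonneg : 0 ≤ B
  L_ge : 1 ≤ L
  c_nonneg : 0 ≤ c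
  χ_smooth : Sm χ
  χ_sq_le : ∀ p, χ p ^ 2 ≤ 1
  ω_eq : ω = fun p => χ p * χ p
  η_eq : η = fun p => ω p * ω p
  rω : Relax l ω A Ab V Vb G
  rη : Relax l η A Ab V Vb G
  η_supp : tsupport η ⊆ tsupport ω
  dt_le : ∀ p, |Dv eT ω p| ≤ B
  lap_le : ∀ p, |lapS eX ω p| ≤ B
  gr_le : ∀ p, Gr χ χ p ≤ B
  lap_gr_le : ∀ p, |lapS eX ω p + 4 * Gr χ χ p| ≤ B
  A_nonneg : ∀ p, 0 ≤ A p
  Ab_nonneg : ∀ p, 0 ≤ Ab p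
  V_nonneg : ∀ p, 0 ≤ V p
  Vb_nonneg : ∀ p, 0 ≤ Vb p
  G_nonneg : ∀ p ∈ tsupport ω, 0 ≤ G p
  D_nonneg : ∀ p, 0 ≤ D p
  D_cont : Continuous D
  J_nonneg : ∀ p, 0 ≤ J p
  J_int : Integrable J
  flux : ∀ p ∈ tsupport ω, ∀ T, 0 < T → ∀ b, 2 * b * (V p - Vb p)
    ≤ T * D p + 2 * m * b ^ 2 / T * (s * V p + s * Vb p + s ^ (1 - m))
  diff : ∀ p ∈ tsupport ω, Vb p * |A p - Ab p| ≤ c * (ε * J p + ε ^ (-m) * D p)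
  j1 : ∀ p ∈ tsupport ω, Vb p ^ 2 * V p ≤ l * L * J p
  j2 : ∀ p ∈ tsupport ω, Vb p ^ 2 * Vb p ≤ l * L * J p
  j3 : ∀ p ∈ tsupport ω, Vb p ^ 2 ≤ L * J p
  j4 : ∀ p ∈ tsupport ω, Vb p * V p * Ab p ≤ L * J p
  j5 : ∀ p ∈ tsupport ω, Vb p ^ 2 * A p ≤ L * J p
  j6 : ∀ p ∈ tsupport ω, Vb p ^ 2 * Ab p ≤ L * J p
  j7 : ∀ p ∈ tsupport ω, Vb p * V p * G p ≤ L * J p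
  j8 : ∀ p ∈ tsupport ω, Vb p ^ 2 * G p ≤ L * J p
  j9 : ∀ p ∈ tsupport ω, Vb p * G p ≤ L * J p
  j10 : ∀ p ∈ tsupport ω, V p * G p ≤ g / l * J p

variable {l s ε m B L g c : ℝ} {χ ω η A Ab V Vb G D J : EuT N → ℝ}

theorem RelaxBd.ω_bd (h : RelaxBd l s ε m B L g c χ ω η A Ab V Vb G D J) (p : EuT N) :
    0 ≤ ω p ∧ ω p ≤ 1 := by
  have := h.χ_sq_le p
  rw [h.ω_eq]
  exact ⟨mul_self_nonneg _, by nlinarith⟩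

theorem RelaxBd.gr_ω (h : RelaxBd l s ε m B L g c χ ω η A Ab V Vb G D J) (k : EuT N → ℝ)
    (p : EuT N) : Gr ω k p = 2 * χ p * Gr χ k p := by
  rw [h.ω_eq, Gr_mul_left h.χ_smooth h.χ_smooth]; ring

theorem RelaxBd.energy_V_le (h : RelaxBd l s ε m B L g c χ ω η A Ab V Vb G D J) :
    ∫ p, ω p * V p * Gr Vb Vb p ≤ (6 + 18 * B) * (l * L) * ∫ p, J p := by
  obtain ⟨c1, c2, c3, c4, c5, c6, c7, c8, c9, c10⟩ := h.rω.continuity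
  have i0 : Integrable fun p => ω p * V p * Gr Vb Vb p := by
    refine integrable_of_zero_off (by fun_prop) h.rω.ω_compact fun p hp => ?_
    rw [(zero_off hp).1]; ring
  have key : ∫ p, ω p * V p * Gr Vb Vb p
      ≤ ∫ p, (1 / 2 * (ω p * V p * Gr Vb Vb p) + (3 + 9 * B) * (l * L) * J p) := by
    rw [h.rω.energy_V]
    refine integral_mono ?_ ((i0.const_mul _).add (h.J_int.const_mul _)) fun p => ?_
    · refine integrable_of_zero_off (by fun_prop) h.rω.ω_compact fun p hp => ?_
      obtain ⟨o1, o2, o3, o4⟩ := zero_off hp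
      rw [o1, o2, o3, o4]; ring
    have hJ := h.J_nonneg p
    have hl := h.l_ge
    have hL := h.L_ge
    have hB := h.B_nonneg
    by_cases hp : p ∈ tsupport ω
    · obtain ⟨w0, w1⟩ := h.ω_bd p
      have a0 := h.A_nonneg p
      have ab0 := h.Ab_nonneg p
      have v0 := h.V_nonneg p
      have vb0 := h.Vb_nonneg p
      have g0 := h.G_nonneg p hp
      have hLJ : L * J p ≤ l * L * J p := by
        nlinarith [mul_nonneg (zero_le_one.trans hL) hJ]
      have e1 := cross_young (x := χ p) (w := Vb p) (Gr_self_nonneg χ p) (Gr_self_nonneg Vb p)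
        (Gr_sq_le χ Vb p)
      have e1' := mul_le_mul_of_nonneg_left e1 v0
      have e2 : ω p * (l * (Vb p * V p * Ab p)) ≤ 1 * (l * (L * J p)) :=
        mul_le_mul w1 (mul_le_mul_of_nonneg_left (h.j4 p hp) (by linarith)) (by positivity)
          zero_le_one
      have e3 : ω p * (l * (Vb p ^ 2 * A p)) ≤ 1 * (l * (L * J p)) :=
        mul_le_mul w1 (mul_le_mul_of_nonneg_left (h.j5 p hp) (by linarith)) (by positivity)
          zero_le_one
      have e4 : ω p * (Vb p * V p * G p) ≤ 1 * (L * J p) :=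
        mul_le_mul w1 (h.j7 p hp) (by positivity) zero_le_one
      have e5 : -(lapS eX ω p) * (Vb p ^ 2 * V p) ≤ B * (l * L * J p) :=
        mul_le_mul ((neg_le_abs _).trans (h.lap_le p)) (h.j1 p hp) (by positivity) hB
      have e6 : -(Dv eT ω p) * (Vb p ^ 2 * A p) ≤ B * (L * J p) :=
        mul_le_mul ((neg_le_abs _).trans (h.dt_le p)) (h.j5 p hp) (by positivity) hB
      have e7 : Gr χ χ p * (Vb p ^ 2 * V p) ≤ B * (l * L * J p) :=
        mul_le_mul (h.gr_le p) (h.j1 p hp) (by positivity) hB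
      have e8 : B * (L * J p) ≤ B * (l * L * J p) := mul_le_mul_of_nonneg_left hLJ hB
      have e9 : 0 ≤ ω p * l * (Vb p * V p * A p) := by positivity
      have hω : ω p = χ p ^ 2 := by rw [h.ω_eq, sq]
      have e10 : V p * (1 / 2 * (χ p ^ 2 * Gr Vb Vb p)) = 1 / 2 * (ω p * V p * Gr Vb Vb p) := by
        rw [hω]; ring
      rw [h.gr_ω]
      have e11 : 0 ≤ l * L * J p := by positivity
      have e12 : 0 ≤ B * (l * L * J p) := by positivity
      nlinarith
    · obtain ⟨o1, o2, o3, o4⟩ := zero_off hp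
      rw [o1, o2, o3, o4]
      have : 0 ≤ (3 + 9 * B) * (l * L) * J p := by positivity
      linarith
  rw [integral_add (i0.const_mul _) (h.J_int.const_mul _), integral_const_mul,
    integral_const_mul] at key
  linarith

theorem RelaxBd.energy_Vb_le (h : RelaxBd l s ε m B L g c χ ω η A Ab V Vb G D J) :
    ∫ p, ω p * Vb p * Gr Vb Vb p ≤ (1 + B) * (l * L) * ∫ p, J p := by
  obtain ⟨c1, c2, c3, c4, c5, c6, c7, c8, c9, c10⟩ := h.rω.continuity
  rw [h.rω.energy_Vb, ← integral_const_mul]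
  refine integral_mono ?_ (h.J_int.const_mul _) fun p => ?_
  · refine integrable_of_zero_off (by fun_prop) h.rω.ω_compact fun p hp => ?_
    obtain ⟨o1, o2, o3, o4⟩ := zero_off hp
    rw [o1, o3]; ring
  have hJ := h.J_nonneg p
  have hl := h.l_ge
  have hL := h.L_ge
  have hB := h.B_nonneg
  by_cases hp : p ∈ tsupport ω
  · obtain ⟨w0, w1⟩ := h.ω_bd p
    have a0 := h.A_nonneg p
    have ab0 := h.Ab_nonneg p
    have vb0 := h.Vb_nonneg p
    have g0 := h.G_nonneg p hp
    have hLJ : L * J p ≤ l * L * J p := by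
      nlinarith [mul_nonneg (zero_le_one.trans hL) hJ]
    have e2 : ω p * (l * (Vb p ^ 2 * Ab p)) ≤ 1 * (l * (L * J p)) :=
      mul_le_mul w1 (mul_le_mul_of_nonneg_left (h.j6 p hp) (by linarith)) (by positivity)
        zero_le_one
    have e4 : ω p * (Vb p ^ 2 * G p) ≤ 1 * (L * J p) :=
      mul_le_mul w1 (h.j8 p hp) (by positivity) zero_le_one
    have e5 : (lapS eX ω p) * (Vb p ^ 2 * Vb p) ≤ B * (l * L * J p) :=
      mul_le_mul ((le_abs_self _).trans (h.lap_le p)) (h.j2 p hp) (by positivity) hB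
    have e9 : 0 ≤ ω p * l * (Vb p ^ 2 * A p) := by positivity
    have e12 : 0 ≤ B * (l * L * J p) := by positivity
    nlinarith
  · obtain ⟨o1, o2, o3, o4⟩ := zero_off hp
    rw [o1, o3]
    have : 0 ≤ (1 + B) * (l * L) * J p := by positivity
    linarith

theorem RelaxBd.energy_le (h : RelaxBd l s ε m B L g c χ ω η A Ab V Vb G D J) :
    ∫ p, ω p * Gr Vb Vb p ≤ (1 + B) * L * (∫ p, J p)
      + l * c * (ε * (∫ p, J p) + ε ^ (-m) * ∫ p, ω p * D p) := by
  obtain ⟨c1, c2, c3, c4, c5, c6, c7, c8, c9, c10⟩ := h.rω.continuity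
  have cD := h.D_cont
  have iD : Integrable fun p => ω p * D p := by
    refine integrable_of_zero_off (by fun_prop) h.rω.ω_compact fun p hp => ?_
    rw [(zero_off hp).1]; ring
  have key : ∫ p, ω p * Gr Vb Vb p ≤ ∫ p, (((1 + B) * L + l * c * ε) * J p
      + l * c * ε ^ (-m) * (ω p * D p)) := by
    rw [h.rω.energy]
    refine integral_mono ?_ ((h.J_int.const_mul _).add (iD.const_mul _)) fun p => ?_
    · refine integrable_of_zero_off (by fun_prop) h.rω.ω_compact fun p hp => ?_
      obtain ⟨o1, o2, o3, o4⟩ := zero_off hp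
      rw [o1, o3]; ring
    have hJ := h.J_nonneg p
    have hl := h.l_ge
    have hL := h.L_ge
    have hB := h.B_nonneg
    have hc := h.c_nonneg
    have hε := h.ε_pos
    by_cases hp : p ∈ tsupport ω
    · obtain ⟨w0, w1⟩ := h.ω_bd p
      have vb0 := h.Vb_nonneg p
      have g0 := h.G_nonneg p hp
      have e4 : ω p * (Vb p * G p) ≤ 1 * (L * J p) :=
        mul_le_mul w1 (h.j9 p hp) (by positivity) zero_le_one
      have e5 : (lapS eX ω p) * Vb p ^ 2 ≤ B * (L * J p) :=
        mul_le_mul ((le_abs_self _).trans (h.lap_le p)) (h.j3 p hp) (by positivity) hB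
      have e6 : -(Vb p * (A p - Ab p)) ≤ c * (ε * J p + ε ^ (-m) * D p) := by
        have := mul_le_mul_of_nonneg_left (neg_le_abs (A p - Ab p)) vb0
        linarith [h.diff p hp]
      have e7 := mul_le_mul_of_nonneg_left e6 (show 0 ≤ l * ω p by positivity)
      have e8 : ω p * (l * c * ε * J p) ≤ 1 * (l * c * ε * J p) :=
        mul_le_mul_of_nonneg_right w1 (by positivity)
      have e12 : 0 ≤ B * (L * J p) := by positivity
      nlinarith
    · obtain ⟨o1, o2, o3, o4⟩ := zero_off hp
      rw [o1, o3]
      have : 0 ≤ ((1 + B) * L + l * c * ε) * J p := by positivity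
      linarith
  rw [integral_add (h.J_int.const_mul _) (iD.const_mul _), integral_const_mul,
    integral_const_mul] at key
  exact key.trans (le_of_eq (by ring))

theorem RelaxBd.b_sq_le (h : RelaxBd l s ε m B L g c χ ω η A Ab V Vb G D J) (p : EuT N) :
    (2 * Gr ω Vb p + Vb p * (lapS eX ω p + 4 * Gr χ χ p)) ^ 2
      ≤ 32 * B * (ω p * Gr Vb Vb p) + 2 * B ^ 2 * Vb p ^ 2 := by
  have e1 := Gr_sq_le χ Vb p
  have e2 : Gr χ χ p * Gr Vb Vb p ≤ B * Gr Vb Vb p :=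
    mul_le_mul_of_nonneg_right (h.gr_le p) (Gr_self_nonneg _ _)
  have e3 := mul_le_mul_of_nonneg_left (e1.trans e2) (sq_nonneg (χ p))
  have e4 := mul_le_mul_of_nonneg_left (sq_le_sq.2 ((h.lap_gr_le p).trans (le_abs_self B)))
    (sq_nonneg (Vb p))
  have hω : ω p = χ p ^ 2 := by rw [h.ω_eq, sq]
  rw [h.gr_ω, hω]
  nlinarith [sq_nonneg (2 * (2 * χ p * Gr χ Vb p) - Vb p * (lapS eX ω p + 4 * Gr χ χ p))]

theorem RelaxBd.flux_le (h : RelaxBd l s ε m B L g c χ ω η A Ab V Vb G D J) {τ : ℝ} (hτ : 0 < τ)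
    (p : EuT N) : -((V p - Vb p) * (2 * Gr η Vb p + Vb p * lapS eX η p))
      ≤ τ * l * (η p * D p) + 2 * m / (τ * l) * (32 * B * (s * (ω p * V p * Gr Vb Vb p)
        + s * (ω p * Vb p * Gr Vb Vb p) + s ^ (1 - m) * (ω p * Gr Vb Vb p))
        + 2 * B ^ 2 * ((2 * s * l * L + s ^ (1 - m) * L) * J p)) := by
  have hl : 0 < l := zero_lt_one.trans_le h.l_ge
  have hs := h.s_pos
  have hL := h.L_ge
  have hB := h.B_nonneg
  have hJ := h.J_nonneg p
  have v0 := h.V_nonneg p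
  have vb0 := h.Vb_nonneg p
  have gr0 := Gr_self_nonneg Vb p
  have hd := h.D_nonneg p
  have hm := h.m_pos
  have s1 : 0 < s ^ (1 - m) := rpow_pos_of_pos hs _
  obtain ⟨w0, w1⟩ := h.ω_bd p
  have hη : η p = ω p * ω p := by rw [h.η_eq]
  by_cases hp : p ∈ tsupport ω
  · set b := 2 * Gr ω Vb p + Vb p * (lapS eX ω p + 4 * Gr χ χ p) with hb
    have e1 : 2 * Gr η Vb p + Vb p * lapS eX η p = 2 * ω p * b := by
      have hgg : Gr ω ω p = 4 * ω p * Gr χ χ p := by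
        rw [h.gr_ω, Gr_comm, h.gr_ω, h.ω_eq]; ring
      rw [h.η_eq, Gr_mul_left h.rω.ω_smooth h.rω.ω_smooth, lapX_sq h.rω.ω_smooth, hgg, hb]
      ring
    have e2 : -((V p - Vb p) * (2 * ω p * b)) ≤ τ * l * (η p * D p)
        + 2 * m * b ^ 2 / (τ * l) * (s * V p + s * Vb p + s ^ (1 - m)) := by
      rcases w0.eq_or_lt with h0 | h0
      · rw [hη, ← h0]
        have : 0 ≤ 2 * m * b ^ 2 / (τ * l) * (s * V p + s * Vb p + s ^ (1 - m)) := by positivity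
        linarith
      · have := mul_le_mul_of_nonneg_left (h.flux p hp (τ * l * ω p) (by positivity) (-b)) w0
        have e3 : ω p * (2 * m * (-b) ^ 2 / (τ * l * ω p)) = 2 * m * b ^ 2 / (τ * l) := by
          field_simp
        rw [← e3, hη]
        linarith
    have e4 := h.b_sq_le p
    rw [← hb] at e4
    have e5 : b ^ 2 * (s * V p + s * Vb p + s ^ (1 - m))
        ≤ (32 * B * (ω p * Gr Vb Vb p) + 2 * B ^ 2 * Vb p ^ 2)
          * (s * V p + s * Vb p + s ^ (1 - m)) :=
      mul_le_mul_of_nonneg_right e4 (by positivity)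
    have e6 : Vb p ^ 2 * (s * V p + s * Vb p + s ^ (1 - m))
        ≤ (2 * s * l * L + s ^ (1 - m) * L) * J p := by
      have := mul_le_mul_of_nonneg_left (h.j1 p hp) hs.le
      have := mul_le_mul_of_nonneg_left (h.j2 p hp) hs.le
      have := mul_le_mul_of_nonneg_left (h.j3 p hp) s1.le
      linarith
    have e7 := mul_le_mul_of_nonneg_left e6 (show 0 ≤ 2 * B ^ 2 by positivity)
    have e8 : 2 * m * b ^ 2 / (τ * l) * (s * V p + s * Vb p + s ^ (1 - m))
        = 2 * m / (τ * l) * (b ^ 2 * (s * V p + s * Vb p + s ^ (1 - m))) := by ring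
    rw [e1]
    refine e2.trans ?_
    rw [e8]
    gcongr
    linarith
  · obtain ⟨o1, o2, o3, o4⟩ := zero_off (fun hx => hp (h.η_supp hx))
    rw [o2, o3, o1]
    have : 0 ≤ 2 * m / (τ * l) * (32 * B * (s * (ω p * V p * Gr Vb Vb p)
        + s * (ω p * Vb p * Gr Vb Vb p) + s ^ (1 - m) * (ω p * Gr Vb Vb p))
        + 2 * B ^ 2 * ((2 * s * l * L + s ^ (1 - m) * L) * J p)) := by positivity
    linarith

theorem estimate_arith {B c l s L I t Y : ℝ} (hB : 0 ≤ B) (hc : 0 ≤ c) (hl : 0 < l)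
    (h1 : 0 ≤ s * (l * L * I)) (h2 : 0 ≤ t * (L * I)) (h3 : 0 ≤ t * (l * Y)) :
    32 * B * (s * ((6 + 18 * B) * (l * L) * I) + s * ((1 + B) * (l * L) * I)
      + t * ((1 + B) * L * I + l * c * Y)) + 2 * B ^ 2 * ((2 * s * l * L + t * L) * I)
      ≤ l * (1000 * (1 + B) ^ 2 * (1 + c) * (s * L * I + t * (L / l * I + Y))) := by
  have hlL : l * (L / l * I) = L * I := by field_simp
  have r0 : (1 + B) ^ 2 ≤ (1 + B) ^ 2 * (1 + c) := by nlinarith [mul_nonneg (sq_nonneg (1 + B)) hc]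
  have hB2 := sq_nonneg B
  have r1 : 32 * B * (7 + 19 * B) + 4 * B ^ 2 ≤ 1000 * (1 + B) ^ 2 * (1 + c) := by linarith
  have r2 : 32 * B * (1 + B) + 2 * B ^ 2 ≤ 1000 * (1 + B) ^ 2 * (1 + c) := by linarith
  have r3 : 32 * B * c ≤ 1000 * (1 + B) ^ 2 * (1 + c) := by
    have := mul_nonneg hB hc
    have := mul_nonneg hc hB2
    linarith
  have t1 := mul_le_mul_of_nonneg_right r1 h1
  have t2 := mul_le_mul_of_nonneg_right r2 h2
  have t3 := mul_le_mul_of_nonneg_right r3 h3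
  have : l * (1000 * (1 + B) ^ 2 * (1 + c) * (s * L * I + t * (L / l * I + Y)))
      = 1000 * (1 + B) ^ 2 * (1 + c) * (s * (l * L * I)
        + t * (l * (L / l * I)) + t * (l * Y)) := by ring
  rw [this, hlL]
  linarith

theorem RelaxBd.estimate (h : RelaxBd l s ε m B L g c χ ω η A Ab V Vb G D J) {τ : ℝ}
    (hτ : 0 < τ) (hg : 0 ≤ g) :
    (∫ p, l * η p * (A p * (V p - Vb p) + V p * (A p - Ab p))) + ∫ p, Dv eT η p * A p * Vb p
      ≤ τ * l * (∫ p, η p * D p) + g / l * (∫ p, J p) + 2 * m / τ * (1000 * (1 + B) ^ 2 * (1 + c)) *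
        (s * L * (∫ p, J p) + s ^ (1 - m) * (L / l * (∫ p, J p)
          + (ε * (∫ p, J p) + ε ^ (-m) * ∫ p, ω p * D p))) := by
  obtain ⟨c1, c2, c3, c4, c5, c6, c7, c8, c9, c10⟩ := h.rη.continuity
  obtain ⟨cω, -, -, -, -, -, -, -, -, -⟩ := h.rω.continuity
  have cD := h.D_cont
  have hl : 0 < l := zero_lt_one.trans_le h.l_ge
  have hs := h.s_pos
  have hL := h.L_ge
  have hB := h.B_nonneg
  have hm := h.m_pos
  have hc := h.c_nonneg
  have hε := h.ε_pos
  have s1 : 0 < s ^ (1 - m) := rpow_pos_of_pos hs _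
  have s2 : 0 < ε ^ (-m) := rpow_pos_of_pos hε _
  have iη : ∀ f : EuT N → ℝ, Continuous f → Integrable fun p => η p * f p := fun f hf =>
    integrable_of_zero_off (c1.mul hf) h.rη.ω_compact fun p hp => by rw [(zero_off hp).1, zero_mul]
  have iω : ∀ f : EuT N → ℝ, Continuous f → Integrable fun p => ω p * f p := fun f hf =>
    integrable_of_zero_off (cω.mul hf) h.rω.ω_compact fun p hp => by
      rw [(zero_off hp).1, zero_mul]
  have iD := iη D cD
  have iE1 : Integrable fun p => ω p * V p * Gr Vb Vb p := by
    simpa only [mul_assoc] using iω (fun p => V p * Gr Vb Vb p) (c4.mul c7)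
  have iE2 : Integrable fun p => ω p * Vb p * Gr Vb Vb p := by
    simpa only [mul_assoc] using iω (fun p => Vb p * Gr Vb Vb p) (c5.mul c7)
  have iE3 := iω _ c7
  have i1 : Integrable fun p => η p * V p * G p := by
    simpa only [mul_assoc] using iη (fun p => V p * G p) (c4.mul c6)
  have i2 : Integrable fun p => Dv eT η p * A p * Vb p := by
    refine integrable_of_zero_off (by fun_prop) h.rη.ω_compact fun p hp => ?_
    rw [(zero_off hp).2.2.2]; ring
  have i3 : Integrable fun p => (V p - Vb p) * (2 * Gr η Vb p + Vb p * lapS eX η p) := by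
    refine integrable_of_zero_off (by fun_prop) h.rη.ω_compact fun p hp => ?_
    rw [(zero_off hp).2.1, (zero_off hp).2.2.1]; ring
  have iEs : Integrable fun p => s * (ω p * V p * Gr Vb Vb p)
      + s * (ω p * Vb p * Gr Vb Vb p) + s ^ (1 - m) * (ω p * Gr Vb Vb p) :=
    ((iE1.const_mul s).add (iE2.const_mul s)).add (iE3.const_mul _)
  have vEs : ∫ p, (s * (ω p * V p * Gr Vb Vb p) + s * (ω p * Vb p * Gr Vb Vb p)
      + s ^ (1 - m) * (ω p * Gr Vb Vb p)) = s * (∫ p, ω p * V p * Gr Vb Vb p)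
      + s * (∫ p, ω p * Vb p * Gr Vb Vb p) + s ^ (1 - m) * ∫ p, ω p * Gr Vb Vb p := by
    have i12 : Integrable fun p => s * (ω p * V p * Gr Vb Vb p) + s * (ω p * Vb p * Gr Vb Vb p) :=
      (iE1.const_mul s).add (iE2.const_mul s)
    rw [integral_add i12 (iE3.const_mul _), integral_add (iE1.const_mul s) (iE2.const_mul s)]
    simp only [integral_const_mul]
  have iJ := h.J_int.const_mul (2 * s * l * L + s ^ (1 - m) * L)
  have iF : Integrable fun p => 32 * B * (s * (ω p * V p * Gr Vb Vb p)
        + s * (ω p * Vb p * Gr Vb Vb p) + s ^ (1 - m) * (ω p * Gr Vb Vb p))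
        + 2 * B ^ 2 * ((2 * s * l * L + s ^ (1 - m) * L) * J p) :=
    (iEs.const_mul _).add (iJ.const_mul _)
  have iR1 : Integrable fun p => g / l * J p + τ * l * (η p * D p) :=
    (h.J_int.const_mul _).add (iD.const_mul _)
  have key : (∫ p, l * η p * (A p * (V p - Vb p) + V p * (A p - Ab p)))
      + ∫ p, Dv eT η p * A p * Vb p ≤ ∫ p, (g / l * J p + τ * l * (η p * D p)
      + 2 * m / (τ * l) * (32 * B * (s * (ω p * V p * Gr Vb Vb p)
        + s * (ω p * Vb p * Gr Vb Vb p) + s ^ (1 - m) * (ω p * Gr Vb Vb p))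
        + 2 * B ^ 2 * ((2 * s * l * L + s ^ (1 - m) * L) * J p))) := by
    have i12 : Integrable fun p => η p * V p * G p - Dv eT η p * A p * Vb p
      - (V p - Vb p) * (2 * Gr η Vb p + Vb p * lapS eX η p) := (i1.sub i2).sub i3
    rw [h.rη.duality, ← integral_add i12 i2]
    refine integral_mono (i12.add i2) (iR1.add (iF.const_mul _)) fun p => ?_
    have e1 := h.flux_le hτ p
    have e2 : η p * V p * G p ≤ g / l * J p := by
      have hJ := h.J_nonneg p
      have v0 := h.V_nonneg p
      obtain ⟨w0, w1⟩ := h.ω_bd p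
      have hη : η p = ω p * ω p := by rw [h.η_eq]
      by_cases hp : p ∈ tsupport ω
      · have h1 : ω p * ω p ≤ 1 := by nlinarith
        have h2 := h.j10 p hp
        have h3 := h.G_nonneg p hp
        have h4 : ω p * ω p * (V p * G p) ≤ 1 * (V p * G p) :=
          mul_le_mul_of_nonneg_right h1 (by positivity)
        rw [hη]
        linarith
      · rw [hη, (zero_off hp).1]
        have : 0 ≤ g / l * J p := by positivity
        linarith
    linarith
  refine key.trans ?_
  rw [integral_add iR1 (iF.const_mul _), integral_add (h.J_int.const_mul _) (iD.const_mul _),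
    integral_const_mul (2 * m / (τ * l)), integral_add (iEs.const_mul _) (iJ.const_mul _)]
  simp only [integral_const_mul]
  rw [vEs]
  have e1 := h.energy_V_le
  have e2 := h.energy_Vb_le
  have e3 := h.energy_le
  have hI : 0 ≤ ∫ p, J p := integral_nonneg h.J_nonneg
  have hX : 0 ≤ ∫ p, ω p * D p := integral_nonneg fun p => mul_nonneg (h.ω_bd p).1 (h.D_nonneg p)
  set I := ∫ p, J p
  set X := ∫ p, ω p * D p
  have f1 := mul_le_mul_of_nonneg_left e1 hs.le
  have f2 := mul_le_mul_of_nonneg_left e2 hs.le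
  have f3 := mul_le_mul_of_nonneg_left e3 s1.le
  have e4 : 32 * B * (s * (∫ p, ω p * V p * Gr Vb Vb p) + s * (∫ p, ω p * Vb p * Gr Vb Vb p)
      + s ^ (1 - m) * ∫ p, ω p * Gr Vb Vb p)
      + 2 * B ^ 2 * ((2 * s * l * L + s ^ (1 - m) * L) * I)
      ≤ 32 * B * (s * ((6 + 18 * B) * (l * L) * I) + s * ((1 + B) * (l * L) * I)
      + s ^ (1 - m) * ((1 + B) * L * I + l * c * (ε * I + ε ^ (-m) * X)))
      + 2 * B ^ 2 * ((2 * s * l * L + s ^ (1 - m) * L) * I) := by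
    gcongr
  have e5 : 32 * B * (s * ((6 + 18 * B) * (l * L) * I) + s * ((1 + B) * (l * L) * I)
      + s ^ (1 - m) * ((1 + B) * L * I + l * c * (ε * I + ε ^ (-m) * X)))
      + 2 * B ^ 2 * ((2 * s * l * L + s ^ (1 - m) * L) * I)
      ≤ l * (1000 * (1 + B) ^ 2 * (1 + c) * (s * L * I + s ^ (1 - m) * (L / l * I
          + (ε * I + ε ^ (-m) * X)))) := by
    exact estimate_arith hB hc hl (by positivity) (by positivity) (by positivity)
  have e6 := mul_le_mul_of_nonneg_left (e4.trans e5) (show 0 ≤ 2 * m / (τ * l) by positivity)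
  have e7 : 2 * m / (τ * l) * (l * (1000 * (1 + B) ^ 2 * (1 + c) * (s * L * I
      + s ^ (1 - m) * (L / l * I + (ε * I + ε ^ (-m) * X))))) = 2 * m / τ *
      (1000 * (1 + B) ^ 2 * (1 + c)) * (s * L * I + s ^ (1 - m) * (L / l * I
          + (ε * I + ε ^ (-m) * X))) := by field_simp
  rw [e7] at e6
  linarith

end RelaxEstimate

open ProbabilityTheory

variable {N : ℕ} {l : ℝ}

theorem mo_combination {F : Type*} [NormedAddCommGroup F] [NormedSpace ℝ F] [MeasurableSpace F]
    [BorelSpace F] [FiniteDimensional ℝ F] {μ : Measure F} [μ.IsAddHaarMeasure] (n : ℕ)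
    {f g h : F → ℝ} (hf : LocallyIntegrable f μ) (hg : LocallyIntegrable g μ)
    (hh : LocallyIntegrable h μ) (c₀ c₁ c₂ c₃ : ℝ)
    (H : ∀ᵐ x ∂μ, 0 ≤ c₀ + c₁ * f x + c₂ * g x + c₃ * h x) (p : F) :
    0 ≤ c₀ + c₁ * mo μ n f p + c₂ * mo μ n g p + c₃ * mo μ n h p := by
  have i0 : LocallyIntegrable (fun _ : F => c₀) μ := locallyIntegrable_const c₀
  have i1 := locallyIntegrable_const_mul hf c₁
  have i2 := locallyIntegrable_const_mul hg c₂
  have i3 := locallyIntegrable_const_mul hh c₃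
  have i01 : LocallyIntegrable (fun x => c₀ + c₁ * f x) μ := i0.add i1
  have i02 : LocallyIntegrable (fun x => c₀ + c₁ * f x + c₂ * g x) μ := i01.add i2
  have i03 : LocallyIntegrable (fun x => c₀ + c₁ * f x + c₂ * g x + c₃ * h x) μ := i02.add i3
  have h1 := mo_mono n (locallyIntegrable_const 0) i03 H p
  rwa [mo_const, mo_add n i02 i3, mo_add n i01 i2, mo_add n i0 i1, mo_const, mo_const_mul,
    mo_const_mul, mo_const_mul] at h1

/-- A smooth switch from `0` before `a + δ` to `1` after `a + 2δ`. -/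
def ramp (a δ s : ℝ) : ℝ := Real.smoothTransition ((s - a - δ) / δ)

variable {a δ : ℝ}

theorem ramp_smooth : Sm (ramp a δ) :=
  Real.smoothTransition.contDiff.comp (by fun_prop)

theorem ramp_nonneg (s : ℝ) : 0 ≤ ramp a δ s := Real.smoothTransition.nonneg _

theorem ramp_le_one (s : ℝ) : ramp a δ s ≤ 1 := Real.smoothTransition.le_one _

theorem ramp_eq_zero (hδ : 0 < δ) {s : ℝ} (h : s ≤ a + δ) : ramp a δ s = 0 :=
  Real.smoothTransition.zero_of_nonpos (div_nonpos_of_nonpos_of_nonneg (by linarith) hδ.le)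

theorem ramp_eq_one (hδ : 0 < δ) {s : ℝ} (h : a + 2 * δ ≤ s) : ramp a δ s = 1 :=
  Real.smoothTransition.one_of_one_le (by rw [le_div_iff₀ hδ]; linarith)

theorem ramp_deriv_nonneg (hδ : 0 < δ) (s : ℝ) : 0 ≤ deriv (ramp a δ) s := by
  refine Monotone.deriv_nonneg (fun x y h => Real.smoothTransition.monotone ?_)
  gcongr

theorem ramp_deriv_eq_zero (hδ : 0 < δ) {s : ℝ} (h : s < a + δ ∨ a + 2 * δ < s) :
    deriv (ramp a δ) s = 0 := by
  rcases h with h | h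
  · have e : ramp a δ =ᶠ[𝓝 s] fun _ => 0 :=
      (eventually_lt_nhds h).mono fun x hx => ramp_eq_zero hδ hx.le
    rw [e.deriv_eq, deriv_const]
  · have e : ramp a δ =ᶠ[𝓝 s] fun _ => 1 :=
      (eventually_gt_nhds h).mono fun x hx => ramp_eq_one hδ (le_of_lt hx)
    rw [e.deriv_eq, deriv_const]

theorem exists_ramp_deriv_le (hδ : 0 < δ) : ∃ κ, 0 ≤ κ ∧ ∀ s, deriv (ramp a δ) s ≤ κ := by
  have c1 : Continuous (deriv (ramp a δ)) :=
    (ramp_smooth (a := a) (δ := δ)).continuous_deriv (by simp)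
  obtain ⟨κ, hκ⟩ := (isCompact_Icc (a := a + δ) (b := a + 2 * δ)).exists_bound_of_continuousOn
    c1.continuousOn
  refine ⟨|κ|, abs_nonneg _, fun s => ?_⟩
  by_cases hs : s ∈ Icc (a + δ) (a + 2 * δ)
  · exact (le_abs_self _).trans ((hκ s hs).trans (le_abs_self _))
  · rw [ramp_deriv_eq_zero hδ]
    · exact abs_nonneg _
    · rw [mem_Icc, not_and_or, not_le, not_le] at hs
      exact hs

theorem integral_avg (hl : 0 < l) {F : EuT N → ℝ} (hF : Integrable F) :
    ∫ p, avg l F p = ∫ p, F p := by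
  have := isProbabilityMeasure_expMeasure hl
  have h1 : ∫ z : ℝ × (EuT N), F (z.2.1, z.2.2 - z.1) ∂((expMeasure l).prod volume)
      = ∫ p, avg l F p := by
    rw [integral_prod_symm _ (shear_integrable hl hF)]
    rfl
  rw [← h1, integral_prod _ (shear_integrable hl hF)]
  have h2 : ∀ r : ℝ, ∫ p : EuT N, F (p.1, p.2 - r) = ∫ p, F p := fun r => by
    have := integral_sub_right_eq_self (μ := (volume : Measure (EuT N))) F ((0, r) : EuT N)
    simpa [Prod.sub_def] using this
  simp only [h2, integral_const, probReal_univ, one_smul]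

theorem lintegral_expMeasure_of_zero (hl : 0 < l) (hδ : 0 < δ) {f : ℝ → ℝ≥0∞} (hf : Measurable f)
    (h0 : ∀ r < δ, f r = 0) :
    ∫⁻ r, f r ∂(expMeasure l) ≤ ofReal (2 / (δ ^ 2 * l)) * ∫⁻ r, f r := by
  have h1 : expMeasure l = volume.withDensity fun r => ofReal (exponentialPDFReal l r) := rfl
  rw [h1, lintegral_withDensity_eq_lintegral_mul _
    ((measurable_exponentialPDFReal l).ennreal_ofReal) hf, ← lintegral_const_mul _ hf]
  refine lintegral_mono fun r => ?_
  by_cases hr : r < δ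
  · simp [h0 r hr]
  push Not at hr
  refine mul_le_mul' (ofReal_le_ofReal ?_) le_rfl
  rw [exponentialPDFReal, gammaPDFReal, if_pos (hδ.le.trans hr)]
  have h3 : (l * r) ^ 2 / 2 ≤ Real.exp (l * r) := by
    have := Real.quadratic_le_exp_of_nonneg (x := l * r) (by nlinarith)
    nlinarith
  have h4 : (l * δ) ^ 2 / 2 ≤ (l * r) ^ 2 / 2 := by
    have : l * δ ≤ l * r := by gcongr
    have : 0 < l * δ := by positivity
    gcongr
  have h5 : 0 < (l * δ) ^ 2 / 2 := by positivity
  have h6 : Real.exp (-(l * r)) ≤ 2 / (l * δ) ^ 2 := by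
    rw [Real.exp_neg, inv_le_comm₀ (Real.exp_pos _) (by positivity), inv_div]
    linarith
  have h7 : 2 / (δ ^ 2 * l) = l * (2 / (l * δ) ^ 2) := by field_simp
  rw [h7]
  simpa using mul_le_mul_of_nonneg_left h6 hl.le

theorem ae_fst {P : Eu N → Prop} (h : ∀ᵐ x, P x) : ∀ᵐ p : EuT N, P p.1 :=
  Measure.quasiMeasurePreserving_fst.ae h

theorem avg_le_of_lintegral_le {F : EuT N → ℝ} {M K : ℝ} (hF : Measurable F) (hF0 : ∀ p, 0 ≤ F p)
    (hM : 0 ≤ M) (hK : 0 ≤ K) {p : EuT N}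
    (hs : ∫⁻ t, ofReal (F (p.1, t)) ≤ ofReal M)
    (h : ∫⁻ r, ofReal (F (p.1, p.2 - r)) ∂(expMeasure l)
      ≤ ofReal K * ∫⁻ r, ofReal (F (p.1, p.2 - r))) :
    avg l F p ≤ K * M := by
  have m1 : Measurable fun r : ℝ => F (p.1, p.2 - r) :=
    hF.comp (measurable_const.prodMk (measurable_const.sub measurable_id))
  rw [avg, integral_eq_lintegral_of_nonneg_ae (of_forall fun _ => hF0 _)
    m1.aestronglyMeasurable]
  refine ENNReal.toReal_le_of_le_ofReal (by positivity) (h.trans ?_)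
  rw [ofReal_mul hK, lintegral_sub_left_eq_self (fun t => ofReal (F (p.1, t))) p.2]
  exact mul_le_mul' le_rfl hs

/-- A bounded weight and a solution cut off to a cylinder away from the origin. -/
structure Loc (ρ : Eu N → ℝ) (m σ : ℝ) (U : EuT N → ℝ) (G : Set (Eu N)) (a b c C M : ℝ) :
    Prop where
  hm : 1 < m
  σ_nonneg : 0 ≤ σ
  σ_le : σ ≤ 1
  ρ_meas : Measurable ρ
  c_pos : 0 < c
  le_ρ : ∀ x, c ≤ ρ x
  ρ_le : ∀ x, ρ x ≤ C
  C_ge : 1 ≤ C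
  M_ge : 1 ≤ M
  hab : a < b
  isOpen : IsOpen G
  vol : volume (G ×ˢ Ioo a b) < ∞
  meas : Measurable U
  nonneg : ∀ p, 0 ≤ U p
  off : ∀ p ∉ G ×ˢ Ioo a b, U p = 0
  pair : SolPair (G ×ˢ Ioo a b) (fun p => ρ p.1 * U p) (fun p => U p ^ m)
  slab : ∀ᵐ x, ∫⁻ t, ofReal (U (x, t) ^ m) ≤ ofReal M
  intW : Integrable fun p => (U p ^ m) ^ (1 + 1 / m + σ)

variable {ρ : Eu N → ℝ} {m σ : ℝ} {U : EuT N → ℝ} {G : Set (Eu N)} {a b c C M δ : ℝ}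

/-- Majorant of the moderate powers of a localised solution. -/
def maj (m σ : ℝ) (U : EuT N → ℝ) (O : Set (EuT N)) (p : EuT N) : ℝ :=
  O.indicator (fun _ => 1) p + (U p ^ m) ^ (1 + 1 / m + σ)

theorem Loc.exp_eq (h : Loc ρ m σ U G a b c C M) : m * (1 + 1 / m + σ) = m + 1 + m * σ := by
  have := h.hm
  field_simp

theorem Loc.maj_nonneg (h : Loc ρ m σ U G a b c C M) (p : EuT N) :
    0 ≤ maj m σ U (G ×ˢ Ioo a b) p :=
  add_nonneg (indicator_nonneg (fun _ _ => zero_le_one) _)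
    (rpow_nonneg (rpow_nonneg (h.nonneg p) _) _)

theorem Loc.maj_integrable (h : Loc ρ m σ U G a b c C M) :
    Integrable (maj m σ U (G ×ˢ Ioo a b)) := by
  have h1 : Integrable ((G ×ˢ Ioo a b).indicator fun _ : EuT N => (1 : ℝ)) :=
    (integrableOn_const h.vol.ne).integrable_indicator (h.isOpen.measurableSet.prod measurableSet_Ioo)
  exact h1.add h.intW

theorem Loc.rpow_le (h : Loc ρ m σ U G a b c C M) {q : ℝ} (hq : 0 < q) (hq' : q ≤ m + 1 + m * σ)
    (p : EuT N) : U p ^ q ≤ maj m σ U (G ×ˢ Ioo a b) p := by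
  have h0 := h.nonneg p
  rw [maj, ← rpow_mul h0, h.exp_eq]
  by_cases hp : p ∈ G ×ˢ Ioo a b
  · rw [indicator_of_mem hp]
    rcases le_total (U p) 1 with h1 | h1
    · exact (Real.rpow_le_one h0 h1 hq.le).trans (le_add_of_nonneg_right (rpow_nonneg h0 _))
    · exact (rpow_le_rpow_of_exponent_le h1 hq').trans (le_add_of_nonneg_left zero_le_one)
  · rw [h.off p hp, zero_rpow hq.ne', indicator_of_notMem hp, zero_add]
    exact rpow_nonneg le_rfl _

theorem Loc.int_rpow (h : Loc ρ m σ U G a b c C M) {q : ℝ} (hq : 0 < q)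
    (hq' : q ≤ m + 1 + m * σ) : Integrable fun p => U p ^ q := by
  refine h.maj_integrable.mono' (h.meas.pow_const q).aestronglyMeasurable
    (of_forall fun p => ?_)
  rw [norm_eq_abs, abs_of_nonneg (rpow_nonneg (h.nonneg p) _)]
  exact h.rpow_le hq hq' p

theorem Loc.intU (h : Loc ρ m σ U G a b c C M) : Integrable U := by
  have h1 := h.int_rpow one_pos (by nlinarith [h.hm, h.σ_nonneg])
  simpa only [rpow_one] using h1

theorem Loc.intV (h : Loc ρ m σ U G a b c C M) : Integrable fun p => U p ^ m :=
  h.int_rpow (by linarith [h.hm]) (by nlinarith [h.hm, h.σ_nonneg])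

theorem Loc.mul_eq (h : Loc ρ m σ U G a b c C M) (p : EuT N) :
    U p * U p ^ m = U p ^ (m + 1) := by
  rw [Real.rpow_add_one' (h.nonneg p) (by linarith [h.hm]), mul_comm]

theorem Loc.intQ (h : Loc ρ m σ U G a b c C M) : Integrable fun p => U p * U p ^ m := by
  simp only [h.mul_eq]
  exact h.int_rpow (by linarith [h.hm]) (by nlinarith [h.hm, h.σ_nonneg])

theorem Loc.weight (h : Loc ρ m σ U G a b c C M) {F : EuT N → ℝ} (hF : Integrable F) :
    Integrable fun p => ρ p.1 * F p := by
  refine hF.bdd_mul (c := C) (h.ρ_meas.comp measurable_fst).aestronglyMeasurable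
    (of_forall fun p => ?_)
  rw [norm_eq_abs, abs_of_nonneg (h.c_pos.le.trans (h.le_ρ _))]
  exact h.ρ_le _

theorem ramp_integrable {F : EuT N → ℝ} (hF : Integrable F) :
    Integrable fun p => ramp a δ p.2 * F p := by
  have c1 : Continuous fun p : EuT N => ramp a δ p.2 :=
    (ramp_smooth (a := a) (δ := δ)).cont.comp continuous_snd
  refine hF.bdd_mul (c := 1) c1.aestronglyMeasurable (of_forall fun p => ?_)
  rw [norm_eq_abs, abs_of_nonneg (ramp_nonneg _)]
  exact ramp_le_one _

theorem dramp_integrable (hδ : 0 < δ) {F : EuT N → ℝ} (hF : Integrable F) :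
    Integrable fun p => deriv (ramp a δ) p.2 * F p := by
  obtain ⟨κ, -, hκ⟩ := exists_ramp_deriv_le (a := a) hδ
  refine hF.bdd_mul (c := κ) ((measurable_deriv _).comp measurable_snd).aestronglyMeasurable
    (of_forall fun p => ?_)
  rw [norm_eq_abs, abs_of_nonneg (ramp_deriv_nonneg hδ _)]
  exact hκ _

theorem av_integrable (hl : 0 < l) {F : EuT N → ℝ} (hF : Integrable F) :
    Integrable (av l (ramp a δ) F) := avg_integrable hl (ramp_integrable hF)

theorem integral_av_le (hl : 0 < l) {F : EuT N → ℝ} (hF : Integrable F) (h0 : ∀ p, 0 ≤ F p) :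
    ∫ p, av l (ramp a δ) F p ≤ ∫ p, F p := by
  rw [integral_avg hl (ramp_integrable hF)]
  exact integral_mono (ramp_integrable hF) hF fun p =>
    mul_le_of_le_one_left (h0 p) (ramp_le_one _)

theorem Loc.mix (h : Loc ρ m σ U G a b c C M) (hl : 0 < l) :
    ∀ᵐ p, Mix l (ramp a δ) m U p := by
  filter_upwards [avg_slice hl (ramp_integrable (a := a) (δ := δ) h.intU),
    avg_slice hl (ramp_integrable (a := a) (δ := δ) h.intV),
    avg_slice hl (ramp_integrable (a := a) (δ := δ) h.intQ)] with p h1 h2 h3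
  exact ⟨hl, h.hm, ramp_nonneg, ramp_le_one, h.nonneg, h1, h2, h3⟩

theorem Loc.avV_le (h : Loc ρ m σ U G a b c C M) (hl : 0 < l) :
    ∀ᵐ p, av l (ramp a δ) (fun q => U q ^ m) p ≤ l * M := by
  filter_upwards [ae_fst h.slab] with p hp
  have m1 : Measurable fun q : EuT N => ramp a δ q.2 * U q ^ m :=
    ((ramp_smooth (a := a) (δ := δ)).cont.measurable.comp measurable_snd).mul
      (h.meas.pow_const m)
  have h0 : ∀ q, 0 ≤ U q ^ m := fun q => rpow_nonneg (h.nonneg q) _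
  refine avg_le_of_lintegral_le m1 (fun q => mul_nonneg (ramp_nonneg _) (h0 q))
    (by linarith [h.M_ge]) hl.le ?_ (lintegral_expMeasure hl ?_)
  · exact (lintegral_mono fun t => ofReal_le_ofReal
      (mul_le_of_le_one_left (h0 _) (ramp_le_one _))).trans hp
  · exact (m1.comp (measurable_const.prodMk (measurable_const.sub measurable_id))).ennreal_ofReal

theorem Loc.osc_integrable (h : Loc ρ m σ U G a b c C M) (hl : 0 < l) :
    Integrable (osc l (ramp a δ) m U) := by
  have i1 := av_integrable (a := a) (δ := δ) hl h.intU
  have i2 := av_integrable (a := a) (δ := δ) hl h.intV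
  have i3 := av_integrable (a := a) (δ := δ) hl h.intQ
  have j2 : Integrable fun p => U p * av l (ramp a δ) (fun q => U q ^ m) p := by
    refine h.intU.mul_bdd (c := l * M) i2.aestronglyMeasurable ?_
    filter_upwards [h.avV_le (δ := δ) hl] with p hp
    rwa [norm_eq_abs, abs_of_nonneg (av_nonneg ramp_nonneg
      (fun q => rpow_nonneg (h.nonneg q) _) p)]
  have j1 : Integrable fun p => av l (ramp a δ) U p * U p ^ m := by
    refine h.intV.bdd_mul (c := 1 + l * M) i1.aestronglyMeasurable ?_
    filter_upwards [h.avV_le (δ := δ) hl, h.mix (δ := δ) hl] with p hp hx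
    rw [norm_eq_abs, abs_of_nonneg (av_nonneg ramp_nonneg h.nonneg p)]
    have := hx.mix 1 (-1) 1 0 fun y hy => by
      rcases le_total y 1 with h1 | h1
      · nlinarith [rpow_nonneg hy m]
      · nlinarith [Real.self_le_rpow_of_one_le h1 h.hm.le]
    linarith
  exact ((h.intQ.sub j2).sub j1).add i3

/-- The contribution of the initial layer. -/
def layer (l a δ : ℝ) (U : EuT N → ℝ) : EuT N → ℝ :=
  {p : EuT N | a + 3 * δ < p.2}.indicator (avg l fun q => deriv (ramp a δ) q.2 * U q)

theorem layer_nonneg (hδ : 0 < δ) (h0 : ∀ p, 0 ≤ U p) (p : EuT N) : 0 ≤ layer l a δ U p :=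
  indicator_nonneg (fun p _ => avg_nonneg (fun q => mul_nonneg (ramp_deriv_nonneg hδ _) (h0 q)) p) _

theorem Loc.layer_integrable (h : Loc ρ m σ U G a b c C M) (hl : 0 < l) (hδ : 0 < δ) :
    Integrable (layer l a δ U) :=
  (avg_integrable hl (dramp_integrable hδ h.intU)).indicator
    (measurableSet_lt measurable_const measurable_snd)

theorem Loc.layer_le (h : Loc ρ m σ U G a b c C M) (hδ : 0 < δ) :
    ∃ g, 0 ≤ g ∧ ∀ l, 0 < l → ∀ᵐ p, layer l a δ U p ≤ g / l := by
  obtain ⟨κ, hκ0, hκ⟩ := exists_ramp_deriv_le (a := a) hδ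
  have hb := h.hab
  have hM := h.M_ge
  have hS : 0 ≤ κ * ((b - a) + M) := mul_nonneg hκ0 (by linarith)
  refine ⟨2 / δ ^ 2 * (κ * ((b - a) + M)), by positivity, fun l hl => ?_⟩
  filter_upwards [ae_fst h.slab] with p hp
  by_cases ht : a + 3 * δ < p.2
  swap
  · rw [layer, indicator_of_notMem (by exact ht)]
    positivity
  rw [layer, indicator_of_mem (by exact ht)]
  have m0 : Measurable fun t : ℝ => U (p.1, t) := h.meas.comp measurable_prodMk_left
  have m1 : Measurable fun q : EuT N => deriv (ramp a δ) q.2 * U q :=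
    ((measurable_deriv _).comp measurable_snd).mul h.meas
  have h4 : 2 / δ ^ 2 * (κ * ((b - a) + M)) / l = 2 / (δ ^ 2 * l) * (κ * ((b - a) + M)) := by
    field_simp
  rw [h4]
  refine avg_le_of_lintegral_le m1 (fun q => mul_nonneg (ramp_deriv_nonneg hδ _) (h.nonneg q))
    hS (by positivity) ?_ (lintegral_expMeasure_of_zero hl hδ ?_ ?_)
  · calc ∫⁻ t, ofReal (deriv (ramp a δ) t * U (p.1, t))
        ≤ ∫⁻ t, ofReal κ * ((Ioo a b).indicator 1 t + ofReal (U (p.1, t) ^ m)) := by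
          refine lintegral_mono fun t => ?_
          rw [ofReal_mul (ramp_deriv_nonneg hδ _)]
          refine mul_le_mul' (ofReal_le_ofReal (hκ _)) ?_
          by_cases htt : t ∈ Ioo a b
          · rw [indicator_of_mem htt, Pi.one_apply, ← ENNReal.ofReal_one, ← ofReal_add
              zero_le_one (rpow_nonneg (h.nonneg _) _)]
            refine ofReal_le_ofReal ?_
            rcases le_total (U (p.1, t)) 1 with h1 | h1
            · linarith [rpow_nonneg (h.nonneg (p.1, t)) m]
            · linarith [Real.self_le_rpow_of_one_le h1 h.hm.le]
          · rw [h.off (p.1, t) fun hh => htt hh.2]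
            simp
      _ = ofReal κ * (ofReal (b - a)
            + ∫⁻ t, ofReal (U (p.1, t) ^ m)) := by
          rw [lintegral_const_mul' _ _ ofReal_ne_top, lintegral_add_right _ (m0.pow_const m).ennreal_ofReal,
            lintegral_indicator_one measurableSet_Ioo, Real.volume_Ioo]
      _ ≤ ofReal (κ * ((b - a) + M)) := by
          rw [ofReal_mul hκ0, ofReal_add (by linarith) (by linarith)]
          exact mul_le_mul' le_rfl (add_le_add le_rfl hp)
  · exact (m1.comp (measurable_const.prodMk (measurable_const.sub measurable_id))).ennreal_ofReal
  · intro r hr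
    simp only
    rw [ramp_deriv_eq_zero hδ (Or.inr (by linarith)), zero_mul, ENNReal.ofReal_zero]

theorem integrable_mul_fut (hl : 0 < l) {F ψ : EuT N → ℝ} (hF : Integrable F) (hψ : Sm ψ)
    (hc : HasCompactSupport ψ) : Integrable fun p => F p * fut l ψ p := by
  have := isProbabilityMeasure_expMeasure hl
  have c0 : Continuous ψ := hψ.cont
  have c1 : Continuous (fut l ψ) := (fut_smooth hl hψ hc).cont
  obtain ⟨C, hC⟩ := hc.exists_bound_of_continuous c0
  refine hF.mul_bdd (c := C) c1.aestronglyMeasurable (of_forall fun p => ?_)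
  simpa [fut] using norm_integral_le_of_norm_le_const (μ := expMeasure l)
    (of_forall fun r => hC (p.1, p.2 + r))

theorem exists_lt_of_compact {T : Set (EuT N)} {b : ℝ} (hT : IsCompact T)
    (h : ∀ p ∈ T, p.2 < b) : ∃ b' < b, ∀ p ∈ T, p.2 ≤ b' := by
  rcases T.eq_empty_or_nonempty with h0 | h0
  · exact ⟨b - 1, by linarith, by simp [h0]⟩
  · obtain ⟨q, hq, hq'⟩ := hT.exists_isMaxOn h0 continuous_snd.continuousOn
    exact ⟨q.2, h q hq, fun p hp => hq' hp⟩

theorem ramp_fut_support (hl : 0 < l) (hδ : 0 < δ) {ψ : EuT N → ℝ} (hc : HasCompactSupport ψ)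
    (hs : tsupport ψ ⊆ G ×ˢ Ioo (a + 3 * δ) b) :
    HasCompactSupport (fun p => ramp a δ p.2 * fut l ψ p) ∧
      tsupport (fun p => ramp a δ p.2 * fut l ψ p) ⊆ G ×ˢ Ioo a b := by
  have hT : IsCompact (tsupport ψ) := hc
  obtain ⟨b', hb', hb2⟩ := exists_lt_of_compact hT fun p hp => (hs hp).2.2
  have hK : IsCompact ((Prod.fst '' tsupport ψ) ×ˢ Icc (a + δ) b') :=
    (hT.image continuous_fst).prod isCompact_Icc
  have h0 : ∀ p ∉ (Prod.fst '' tsupport ψ) ×ˢ Icc (a + δ) b',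
      ramp a δ p.2 * fut l ψ p = 0 := by
    intro p hp
    rcases le_total p.2 (a + δ) with h1 | h1
    · rw [ramp_eq_zero hδ h1, zero_mul]
    have : fut l ψ p = 0 := by
      rw [fut, integral_expMeasure hl]
      refine setIntegral_eq_zero_of_forall_eq_zero fun r hr => ?_
      have : ψ (p.1, p.2 + r) = 0 := by
        by_contra hne
        have hm := subset_tsupport ψ hne
        have h3 := hb2 _ hm
        simp only [mem_Ioi] at hr h3
        exact hp ⟨⟨_, hm, rfl⟩, h1, by linarith⟩
      rw [this, mul_zero]
    rw [this, mul_zero]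
  refine ⟨HasCompactSupport.intro hK h0, (closure_minimal (fun p hp => ?_) hK.isClosed).trans ?_⟩
  · by_contra hne
    exact hp (h0 p hne)
  · rintro ⟨x, t⟩ ⟨⟨q, hq, rfl⟩, ht⟩
    exact ⟨(hs hq).1, by linarith [ht.1], by linarith [ht.2]⟩

theorem Loc.lap_avV (h : Loc ρ m σ U G a b c C M) (hl : 0 < l) (hδ : 0 < δ) {ψ : EuT N → ℝ}
    (hψ : Sm ψ) (hc : HasCompactSupport ψ) (hs : tsupport ψ ⊆ G ×ˢ Ioo (a + 3 * δ) b) :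
    ∫ p, av l (ramp a δ) (fun q => U q ^ m) p * lapS eX ψ p
      = l * (∫ p, ρ p.1 * U p * ψ p) - l * (∫ p, ρ p.1 * av l (ramp a δ) U p * ψ p)
        - ∫ p, ρ p.1 * layer l a δ U p * ψ p := by
  have c0 : Continuous ψ := hψ.cont
  have sθ := ramp_smooth (a := a) (δ := δ)
  have sf := fut_smooth hl hψ hc
  have hlap : Sm (lapS eX ψ) := Sm.lapS hψ eX
  have clap : HasCompactSupport (lapS eX ψ) := HasCompactSupport.lapS hc eX
  obtain ⟨hc1, hs1⟩ := ramp_fut_support (l := l) hl hδ hc hs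
  have key := h.pair _ ((snd_smooth sθ).mul sf) hc1 hs1
  have e1 : ∀ p, Dv eT (fun p : EuT N => ramp a δ p.2 * fut l ψ p) p
      = deriv (ramp a δ) p.2 * fut l ψ p + l * (ramp a δ p.2 * fut l ψ p)
        - l * (ramp a δ p.2 * ψ p) := fun p => by
    rw [Dv_mul (snd_smooth sθ) sf, Dv_eT_fut hl hψ hc, Dv_snd sθ]
    have : Dv (eT (N := N)).2 (ramp a δ) p.2 = deriv (ramp a δ) p.2 := by simp [Dv, eT]
    rw [this]
    ring
  have e2 : ∀ p, lapS eX (fun p : EuT N => ramp a δ p.2 * fut l ψ p) p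
      = ramp a δ p.2 * fut l (lapS eX ψ) p := fun p => by
    have z0 : ∀ (i : Fin N) (p : EuT N), Dv (eX i) (fun p : EuT N => ramp a δ p.2) p = 0 :=
      fun i p => by rw [Dv_snd sθ]; exact Dv_zero_dir _ _
    have z1 : lapS eX (fun p : EuT N => ramp a δ p.2) p = 0 := by
      refine Finset.sum_eq_zero fun i _ => ?_
      rw [funext (z0 i)]
      simp [Dv]
    rw [lapS_mul (snd_smooth sθ) sf, z1, lapS_fut hl hψ hc]
    simp [z0]
  simp only [e1, e2] at key
  have iA := h.weight (dramp_integrable (a := a) hδ h.intU)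
  have iB := h.weight (ramp_integrable (a := a) (δ := δ) h.intU)
  have iV := ramp_integrable (a := a) (δ := δ) h.intV
  have t1 := integrable_mul_fut hl iA hψ hc
  have t2 := (integrable_mul_fut hl iB hψ hc).const_mul l
  have t3 := (integrable_mul_of_compact iB c0 hc).const_mul l
  have t4 := integrable_mul_fut hl iV hlap clap
  have t12 : Integrable fun p => ρ p.1 * (deriv (ramp a δ) p.2 * U p) * fut l ψ p
    + l * (ρ p.1 * (ramp a δ p.2 * U p) * fut l ψ p) := t1.add t2
  have t13 : Integrable fun p => ρ p.1 * (deriv (ramp a δ) p.2 * U p) * fut l ψ p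
    + l * (ρ p.1 * (ramp a δ p.2 * U p) * fut l ψ p)
    - l * (ρ p.1 * (ramp a δ p.2 * U p) * ψ p) := t12.sub t3
  have key2 : (∫ p, ρ p.1 * (deriv (ramp a δ) p.2 * U p) * fut l ψ p)
      + l * (∫ p, ρ p.1 * (ramp a δ p.2 * U p) * fut l ψ p)
      - l * (∫ p, ρ p.1 * (ramp a δ p.2 * U p) * ψ p)
      + (∫ p, ramp a δ p.2 * U p ^ m * fut l (lapS eX ψ) p) = 0 := by
    rw [← key, ← integral_const_mul, ← integral_const_mul, ← integral_add t1 t2,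
      ← integral_sub t12 t3, ← integral_add t13 t4]
    exact integral_congr_ae (of_forall fun p => by ring)
  rw [← integral_avg_mul hl iA c0 hc, ← integral_avg_mul hl iB c0 hc,
    ← integral_avg_mul hl iV hlap.cont clap] at key2
  simp only [avg_weight ρ (fun q => deriv (ramp a δ) q.2 * U q),
    avg_weight ρ (fun q => ramp a δ q.2 * U q)] at key2
  have r1 : ∫ p, ρ p.1 * (ramp a δ p.2 * U p) * ψ p = ∫ p, ρ p.1 * U p * ψ p := by
    refine integral_congr_ae (of_forall fun p => ?_)
    by_cases hp : p ∈ tsupport ψ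
    · simp only [ramp_eq_one hδ (by linarith [(hs hp).2.1] : a + 2 * δ ≤ p.2), one_mul]
    · simp only [image_eq_zero_of_notMem_tsupport hp, mul_zero]
  have r2 : ∫ p, ρ p.1 * layer l a δ U p * ψ p
      = ∫ p, ρ p.1 * avg l (fun q => deriv (ramp a δ) q.2 * U q) p * ψ p := by
    refine integral_congr_ae (of_forall fun p => ?_)
    by_cases hp : p ∈ tsupport ψ
    · simp only [layer, indicator_of_mem (show p ∈ {p : EuT N | a + 3 * δ < p.2} from (hs hp).2.1)]
    · simp only [image_eq_zero_of_notMem_tsupport hp, mul_zero]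
  rw [r1] at key2
  rw [r2]
  linarith

/-- The mollified quantities satisfy the relaxation system on compact sets. -/
theorem Loc.relax (h : Loc ρ m σ U G a b c C M) (hl : 0 < l) (hδ : 0 < δ) {K : Set (EuT N)}
    (hK : IsCompact K) (hKO : K ⊆ G ×ˢ Ioo (a + 3 * δ) b) :
    ∀ᶠ n in atTop, ∀ ω : EuT N → ℝ, Sm ω → HasCompactSupport ω → tsupport ω ⊆ K →
      Relax l ω (mo volume n fun p => ρ p.1 * U p)
        (mo volume n fun p => ρ p.1 * av l (ramp a δ) U p) (mo volume n fun p => U p ^ m)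
        (mo volume n (av l (ramp a δ) fun p => U p ^ m))
        (mo volume n fun p => ρ p.1 * layer l a δ U p) := by
  have hO1 : IsOpen (G ×ˢ Ioo (a + 3 * δ) b) := h.isOpen.prod isOpen_Ioo
  have iA := (h.weight h.intU).locallyIntegrable
  have iAb := (h.weight (av_integrable (a := a) (δ := δ) hl h.intU)).locallyIntegrable
  have iV := h.intV.locallyIntegrable
  have iVb := (av_integrable (a := a) (δ := δ) hl h.intV).locallyIntegrable
  have iG := (h.weight (h.layer_integrable hl hδ)).locallyIntegrable
  have hsub : G ×ˢ Ioo (a + 3 * δ) b ⊆ G ×ˢ Ioo a b :=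
    Set.prod_mono le_rfl (Ioo_subset_Ioo_left (by linarith))
  filter_upwards [h.pair.mo (h.isOpen.prod isOpen_Ioo) iA iV hK (hKO.trans hsub),
    eventually_reflect_subset hK hO1 hKO] with n h1 h2 ω sω cω hω
  have sη := eta_smooth (μ := (volume : Measure (EuT N))) n
  have cη := eta_compact (μ := (volume : Measure (EuT N))) n
  refine ⟨sω, cω, mo_smooth n iA, mo_smooth n iAb, mo_smooth n iV, mo_smooth n iVb, mo_smooth n iG,
    fun p hp => ?_, fun p hp => ?_, fun p hp => h1 p (hω hp)⟩
  · have e1 := avg_dt hl (ramp_integrable (a := a) (δ := δ) h.intV) (reflect_smooth sη p)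
      (reflect_compact cη p)
    simp only [Dv_reflect sη, mul_neg, integral_neg] at e1
    have r1 : ∫ q, ramp a δ q.2 * U q ^ m * eta volume n (p - q)
        = ∫ q, U q ^ m * eta volume n (p - q) := by
      refine integral_congr_ae (of_forall fun q => ?_)
      by_cases hq : q ∈ tsupport fun q => eta (volume : Measure (EuT N)) n (p - q)
      · simp only [ramp_eq_one hδ (by linarith [(h2 p (hω hp) hq).2.1] : a + 2 * δ ≤ q.2), one_mul]
      · simp only [image_eq_zero_of_notMem_tsupport
          (f := fun q => eta (volume : Measure (EuT N)) n (p - q)) hq, mul_zero]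
    rw [r1] at e1
    rw [mo, Dv_cv sη cη iVb]
    simp only [mo, cv]
    linarith
  · have e1 := h.lap_avV hl hδ (reflect_smooth sη p) (reflect_compact cη p) (h2 p (hω hp))
    simp only [lapS_reflect sη] at e1
    rw [mo, lapS_cv sη cη iVb]
    simp only [mo, cv]
    linarith

theorem product_bounds {l e M C g q z r t V A Ab H : ℝ} (hl : 1 ≤ l) (he : 1 ≤ e) (hM : 1 ≤ M)
    (hC : 1 ≤ C) (hg : 0 ≤ g) (hq : 1 ≤ q) (hz : 1 ≤ z) (hr : 1 ≤ r) (ht0 : 0 ≤ t) (htq : t ≤ q)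
    (htl : t ≤ l * M) (hte : t ≤ M * e * r) (hV0 : 0 ≤ V) (hV : V ≤ q) (hA0 : 0 ≤ A)
    (hA : A ≤ C * z) (hAb0 : 0 ≤ Ab) (hAb : Ab ≤ C * z) (hH0 : 0 ≤ H) (hH : H ≤ C * (g / l)) :
    t ^ 2 * V ≤ l * (M ^ 2 * C * (1 + g) * e) * (q * z * r) ∧
    t ^ 2 * t ≤ l * (M ^ 2 * C * (1 + g) * e) * (q * z * r) ∧
    t ^ 2 ≤ M ^ 2 * C * (1 + g) * e * (q * z * r) ∧
    t * V * Ab ≤ M ^ 2 * C * (1 + g) * e * (q * z * r) ∧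
    t ^ 2 * A ≤ M ^ 2 * C * (1 + g) * e * (q * z * r) ∧
    t ^ 2 * Ab ≤ M ^ 2 * C * (1 + g) * e * (q * z * r) ∧
    t * V * H ≤ M ^ 2 * C * (1 + g) * e * (q * z * r) ∧
    t ^ 2 * H ≤ M ^ 2 * C * (1 + g) * e * (q * z * r) ∧
    t * H ≤ M ^ 2 * C * (1 + g) * e * (q * z * r) ∧
    V * H ≤ C * g / l * (q * z * r) := by
  have hgl : g / l ≤ g := div_le_self hg hl
  have hgl0 : 0 ≤ g / l := by positivity
  have hH1 : H ≤ C * (1 + g) * z := by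
    calc H ≤ C * (1 + g) * 1 := by nlinarith
      _ ≤ _ := by gcongr
  have hA1 : A ≤ C * (1 + g) * z := hA.trans (by gcongr; nlinarith)
  have hAb1 : Ab ≤ C * (1 + g) * z := hAb.trans (by gcongr; nlinarith)
  have hX : 1 ≤ C * (1 + g) * z := one_le_mul_of_one_le_of_one_le
    (one_le_mul_of_one_le_of_one_le hC (by linarith)) hz
  have key : ∀ x y w, 0 ≤ x → x ≤ M * e * r → 0 ≤ y → y ≤ q → 0 ≤ w → w ≤ C * (1 + g) * z →
      x * y * w ≤ M ^ 2 * C * (1 + g) * e * (q * z * r) := by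
    intro x y w hx hx' hy hy' hw hw'
    calc x * y * w ≤ (M * e * r) * q * (C * (1 + g) * z) := by gcongr
      _ = 1 * (M * (C * (1 + g) * e * (q * z * r))) := by ring
      _ ≤ M * (M * (C * (1 + g) * e * (q * z * r))) := by gcongr
      _ = _ := by ring
  have key2 : ∀ y, 0 ≤ y → y ≤ q → t ^ 2 * y ≤ l * (M ^ 2 * C * (1 + g) * e) * (q * z * r) := by
    intro y hy hy'
    calc t ^ 2 * y = t * t * y := by ring
      _ ≤ (l * M) * (M * e * r) * q := by gcongr
      _ = l * M ^ 2 * e * (q * r) * 1 := by ring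
      _ ≤ l * M ^ 2 * e * (q * r) * (C * (1 + g) * z) := by gcongr
      _ = _ := by ring
  refine ⟨key2 V hV0 hV, key2 t ht0 htq, ?_, key t V Ab ht0 hte hV0 hV hAb0 hAb1, ?_, ?_,
    key t V H ht0 hte hV0 hV hH0 hH1, ?_, ?_, ?_⟩
  · simpa [sq] using key t t 1 ht0 hte ht0 htq zero_le_one hX
  · simpa [sq] using key t t A ht0 hte ht0 htq hA0 hA1
  · simpa [sq] using key t t Ab ht0 hte ht0 htq hAb0 hAb1
  · simpa [sq] using key t t H ht0 hte ht0 htq hH0 hH1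
  · simpa using key t 1 H ht0 hte zero_le_one hq hH0 hH1
  · calc V * H ≤ q * (C * (g / l)) := by gcongr
      _ = C * g / l * (q * 1 * 1) := by ring
      _ ≤ _ := by gcongr

theorem mo_indicator_eq_one {O K : Set (EuT N)} (hK : IsCompact K) (hO : IsOpen O)
    (hKO : K ⊆ O) : ∀ᶠ n in atTop, ∀ p ∈ K, mo volume n (O.indicator fun _ => (1 : ℝ)) p = 1 := by
  filter_upwards [eventually_reflect_subset hK hO hKO] with n hn p hp
  refine Eq.trans ?_ (mo_const (μ := (volume : Measure (EuT N))) n 1 p)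
  refine integral_congr_ae (of_forall fun q => ?_)
  by_cases hq : q ∈ tsupport fun q => eta (volume : Measure (EuT N)) n (p - q)
  · simp only [indicator_of_mem (hn p hp hq)]
  · simp only [image_eq_zero_of_notMem_tsupport
      (f := fun q => eta (volume : Measure (EuT N)) n (p - q)) hq, mul_zero]

/-- Majorant of the products of moderate powers and of their time averages. -/
def majAv (l m σ : ℝ) (U : EuT N → ℝ) (G : Set (Eu N)) (a b δ : ℝ) (p : EuT N) : ℝ :=
  maj m σ U (G ×ˢ Ioo a b) p + av l (ramp a δ) (fun q => (U q ^ m) ^ (1 + 1 / m + σ)) p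

theorem Loc.W_nonneg (h : Loc ρ m σ U G a b c C M) (p : EuT N) :
    0 ≤ (U p ^ m) ^ (1 + 1 / m + σ) := rpow_nonneg (rpow_nonneg (h.nonneg p) _) _

theorem Loc.majAv_nonneg (h : Loc ρ m σ U G a b c C M) (p : EuT N) :
    0 ≤ majAv l m σ U G a b δ p :=
  add_nonneg (h.maj_nonneg p) (av_nonneg ramp_nonneg h.W_nonneg p)

theorem Loc.majAv_integrable (h : Loc ρ m σ U G a b c C M) (hl : 0 < l) :
    Integrable (majAv l m σ U G a b δ) := h.maj_integrable.add (av_integrable hl h.intW)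

theorem Loc.majAv_integral_le (h : Loc ρ m σ U G a b c C M) (hl : 0 < l) :
    ∫ p, majAv l m σ U G a b δ p ≤ (∫ p, maj m σ U (G ×ˢ Ioo a b) p)
      + ∫ p, (U p ^ m) ^ (1 + 1 / m + σ) := by
  unfold majAv
  rw [integral_add h.maj_integrable (av_integrable hl h.intW)]
  exact add_le_add le_rfl (integral_av_le hl h.intW h.W_nonneg)

theorem Loc.mo_bounds (h : Loc ρ m σ U G a b c C M) (hl : 1 ≤ l) (n : ℕ) {p : EuT N} {y : ℝ}
    (hy : mo volume n (majAv l m σ U G a b δ) p ≤ y) (hy1 : 1 ≤ y) :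
    ∃ z q r, 1 ≤ z ∧ 1 ≤ q ∧ 1 ≤ r ∧ y = q * z * r ∧ q ^ ((m + 1) / m) = q * z ∧
      mo volume n (fun p => U p ^ m) p ≤ q ∧
      mo volume n (av l (ramp a δ) fun p => U p ^ m) p ≤ q ∧
      mo volume n (av l (ramp a δ) fun p => U p ^ m) p ≤ l * M ∧
      mo volume n (av l (ramp a δ) fun p => U p ^ m) p ≤ M * l ^ (1 - σ) * r ∧
      mo volume n (fun p => ρ p.1 * U p) p ≤ C * z ∧
      mo volume n (fun p => ρ p.1 * av l (ramp a δ) U p) p ≤ C * z := by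
  have hl0 : 0 < l := by linarith
  have hm := h.hm
  have hm0 : 0 < m := by linarith
  have hσ := h.σ_nonneg
  have hσ1 := h.σ_le
  have hM := h.M_ge
  have hy0 : 0 < y := by linarith
  set e := 1 + 1 / m + σ with he
  have hme : m * e = m + 1 + m * σ := h.exp_eq
  have he1 : 1 < e := by
    have : 0 < 1 / m := by positivity
    linarith
  have hme1 : 1 < m * e := by nlinarith
  have v0 : ∀ p, 0 ≤ U p ^ m := fun p => rpow_nonneg (h.nonneg p) _
  have avV0 := av_nonneg (l := l) (ramp_nonneg (a := a) (δ := δ)) v0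
  have avU0 := av_nonneg (l := l) (ramp_nonneg (a := a) (δ := δ)) h.nonneg
  have hUW : ∀ p, U p ^ (m * e) = (U p ^ m) ^ e := fun p => rpow_mul (h.nonneg p) _ _
  have iH := (h.majAv_integrable (δ := δ) hl0).locallyIntegrable
  have iavW := av_integrable (a := a) (δ := δ) hl0 h.intW
  have iavV := av_integrable (a := a) (δ := δ) hl0 h.intV
  have iavU := av_integrable (a := a) (δ := δ) hl0 h.intU
  have jV : ∀ᵐ p, av l (ramp a δ) (fun p => U p ^ m) p ^ e
      ≤ av l (ramp a δ) (fun q => (U q ^ m) ^ e) p := by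
    filter_upwards [h.mix (δ := δ) hl0, avg_slice hl0 (ramp_integrable (a := a) (δ := δ) h.intW)]
      with p h1 h2 using h1.jensen_rpow he1.le h2
  have jU : ∀ᵐ p, av l (ramp a δ) U p ^ (m * e)
      ≤ av l (ramp a δ) (fun q => (U q ^ m) ^ e) p := by
    filter_upwards [h.mix (δ := δ) hl0, avg_slice hl0 (ramp_integrable (a := a) (δ := δ) h.intW)]
      with p h1 h2
    have := h1.jensen hme1.le (by simpa only [PastInt, hUW] using h2)
    simpa only [hUW] using this
  have avW0 := av_nonneg (l := l) (ramp_nonneg (a := a) (δ := δ)) h.W_nonneg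
  have leH1 : ∀ p, (U p ^ m) ^ e ≤ majAv l m σ U G a b δ p := fun p =>
    le_add_of_le_of_nonneg (le_add_of_nonneg_left (indicator_nonneg (fun _ _ => zero_le_one) _))
      (avW0 p)
  have leH2 : ∀ p, av l (ramp a δ) (fun q => (U q ^ m) ^ e) p ≤ majAv l m σ U G a b δ p :=
    fun p => le_add_of_nonneg_left (h.maj_nonneg p)
  have root : ∀ {f : EuT N → ℝ} {s : ℝ}, 1 < s → (∀ p, 0 ≤ f p) → Integrable f →
      (∀ᵐ p, f p ^ s ≤ majAv l m σ U G a b δ p) → mo volume n f p ^ s ≤ y := by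
    intro f s hs f0 hf hle
    have i1 : Integrable fun p => f p ^ s := by
      refine (h.majAv_integrable (δ := δ) hl0).mono'
        (hf.aestronglyMeasurable.aemeasurable.pow_const s).aestronglyMeasurable ?_
      filter_upwards [hle] with p hp
      rwa [norm_eq_abs, abs_of_nonneg (rpow_nonneg (f0 p) _)]
    exact ((mo_rpow_le n hs f0 hf.locallyIntegrable i1.locallyIntegrable p).trans
      (mo_mono n i1.locallyIntegrable iH hle p)).trans hy
  have k1 := root he1 v0 h.intV (of_forall leH1)
  have k2 := root he1 avV0 iavV (jV.mono fun p hp => hp.trans (leH2 p))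
  have k3 := root hme1 h.nonneg h.intU (of_forall fun p => (hUW p).trans_le (leH1 p))
  have k4 := root hme1 avU0 iavU (jU.mono fun p hp => hp.trans (leH2 p))
  have n2 := mo_nonneg (μ := (volume : Measure (EuT N))) n avV0 p
  have rt : ∀ {x s : ℝ}, 0 < s → 0 ≤ x → x ^ s ≤ y → x ≤ y ^ (1 / s) := fun {x s} hs hx hh => by
    rw [one_div, Real.le_rpow_inv_iff_of_pos hx hy0.le hs]
    exact hh
  have eq1 : (y ^ (1 / (m * e))) ^ m = y ^ (1 / e) := by
    rw [← rpow_mul hy0.le]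
    congr 1
    field_simp
  have hz0 : 0 < y ^ (1 / (m * e)) := rpow_pos_of_pos hy0 _
  have g1 := mo_nonneg (μ := (volume : Measure (EuT N))) n v0 p
  have t1 := rt (by linarith) g1 k1
  have t2 := rt (by linarith) n2 k2
  have t3 := rt (by linarith) (mo_nonneg (μ := (volume : Measure (EuT N))) n h.nonneg p) k3
  have t4 := rt (by linarith) (mo_nonneg (μ := (volume : Measure (EuT N))) n avU0 p) k4
  rw [← eq1] at t1 t2
  have hz1 : 1 ≤ y ^ (1 / (m * e)) := one_le_rpow hy1 (by positivity)
  have hyz : (y ^ (1 / (m * e))) ^ (m + 1 + m * σ) = y := by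
    rw [← hme, ← rpow_mul hy0.le, one_div_mul_cancel (by linarith), rpow_one]
  set z := y ^ (1 / (m * e)) with hz
  have hq1 : 1 ≤ z ^ m := one_le_rpow hz1 hm0.le
  have lM : mo volume n (av l (ramp a δ) fun p => U p ^ m) p ≤ l * M := by
    have := mo_mono (μ := (volume : Measure (EuT N))) n iavV.locallyIntegrable
      (locallyIntegrable_const (l * M)) (h.avV_le hl0) p
    rwa [mo_const] at this
  have wt : ∀ {f : EuT N → ℝ}, (∀ p, 0 ≤ f p) → Integrable f → mo volume n f p ≤ z →
      mo volume n (fun p => ρ p.1 * f p) p ≤ C * z := fun {f} f0 hf hh => by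
    have := mo_mono n (h.weight hf).locallyIntegrable
      (locallyIntegrable_const_mul hf.locallyIntegrable C)
      (of_forall fun p => mul_le_mul_of_nonneg_right (h.ρ_le p.1) (f0 p)) p
    rw [mo_const_mul] at this
    exact this.trans (mul_le_mul_of_nonneg_left hh (by linarith [h.C_ge]))
  refine ⟨z, z ^ m, (z ^ m) ^ σ, hz1, hq1, one_le_rpow hq1 hσ, ?_, ?_, t1, t2, lM, ?_,
    wt h.nonneg h.intU t3, wt avU0 iavU t4⟩
  · rw [← rpow_mul hz0.le, rpow_add hz0, rpow_add hz0, rpow_one] at *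
    exact hyz.symm
  · rw [← rpow_mul hz0.le, mul_div_cancel₀ _ hm0.ne', rpow_add hz0, rpow_one]
  · set t := mo volume n (av l (ramp a δ) fun p => U p ^ m) p with ht
    rcases n2.eq_or_lt with h0 | h0
    · rw [← h0]
      positivity
    calc t = t ^ (1 - σ) * t ^ σ := by
          rw [← rpow_add h0, sub_add_cancel, rpow_one]
      _ ≤ (l * M) ^ (1 - σ) * (z ^ m) ^ σ := by
          gcongr
      _ ≤ (M * l ^ (1 - σ)) * (z ^ m) ^ σ := by
          gcongr
          rw [mul_rpow hl0.le (by linarith), mul_comm]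
          gcongr
          exact Real.rpow_le_self_of_one_le hM (by linarith)
      _ = _ := rfl

theorem Loc.mo_flux (h : Loc ρ m σ U G a b c C M) (hl : 0 < l) (n : ℕ) {s T : ℝ} (hs : 0 < s)
    (hT : 0 < T) (b' : ℝ) (p : EuT N) :
    2 * b' * (mo volume n (fun p => U p ^ m) p
        - mo volume n (av l (ramp a δ) fun p => U p ^ m) p)
      ≤ T * mo volume n (osc l (ramp a δ) m U) p + 2 * m * b' ^ 2 / T *
        (s * mo volume n (fun p => U p ^ m) p
          + s * mo volume n (av l (ramp a δ) fun p => U p ^ m) p + s ^ (1 - m)) := by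
  have := mo_combination n (h.osc_integrable (δ := δ) hl).locallyIntegrable
    h.intV.locallyIntegrable (av_integrable (a := a) (δ := δ) hl h.intV).locallyIntegrable
    (2 * m * b' ^ 2 / T * s ^ (1 - m)) T (2 * m * b' ^ 2 / T * s - 2 * b')
    (2 * m * b' ^ 2 / T * s + 2 * b') (by
      filter_upwards [h.mix (δ := δ) hl] with x hx
      have := hx.flux hs hT b'
      linarith) p
  linarith

theorem Loc.mo_diff (h : Loc ρ m σ U G a b c C M) (hl : 0 < l) (n : ℕ) {ε k : ℝ} (hε : 0 < ε)
    (hk : 0 ≤ k) (p : EuT N) :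
    k * |mo volume n (fun p => ρ p.1 * U p) p
        - mo volume n (fun p => ρ p.1 * av l (ramp a δ) U p) p|
      ≤ C * (ε * k ^ ((m + 1) / m) + ε ^ (-m) * mo volume n (osc l (ramp a δ) m U) p) := by
  have key : ∀ x, ∀ hx : Mix l (ramp a δ) m U x,
      |k * (ρ x.1 * U x - ρ x.1 * av l (ramp a δ) U x)|
        ≤ C * ε * k ^ ((m + 1) / m) + C * ε ^ (-m) * osc l (ramp a δ) m U x := by
    intro x hx
    have h1 := hx.mul_abs_sub hk hε
    have h2 : 0 ≤ ρ x.1 := h.c_pos.le.trans (h.le_ρ _)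
    rw [← mul_sub, abs_mul, abs_mul, abs_of_nonneg hk, abs_of_nonneg h2]
    have h3 : 0 ≤ k * |U x - av l (ramp a δ) U x| := mul_nonneg hk (abs_nonneg _)
    calc k * (ρ x.1 * |U x - av l (ramp a δ) U x|)
        = ρ x.1 * (k * |U x - av l (ramp a δ) U x|) := by ring
      _ ≤ C * (k * |U x - av l (ramp a δ) U x|) := mul_le_mul_of_nonneg_right (h.ρ_le _) h3
      _ ≤ C * (ε * k ^ ((m + 1) / m) + ε ^ (-m) * osc l (ramp a δ) m U x) :=
          mul_le_mul_of_nonneg_left h1 (by linarith [h.C_ge])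
      _ = _ := by ring
  have io := (h.osc_integrable (δ := δ) hl).locallyIntegrable
  have iA := (h.weight h.intU).locallyIntegrable
  have iB := (h.weight (av_integrable (a := a) (δ := δ) hl h.intU)).locallyIntegrable
  have k1 := mo_combination n io iA iB (C * ε * k ^ ((m + 1) / m)) (C * ε ^ (-m)) k (-k) (by
    filter_upwards [h.mix (δ := δ) hl] with x hx
    linarith [neg_le_of_abs_le (key x hx)]) p
  have k2 := mo_combination n io iA iB (C * ε * k ^ ((m + 1) / m)) (C * ε ^ (-m)) (-k) k (by
    filter_upwards [h.mix (δ := δ) hl] with x hx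
    linarith [le_of_abs_le (key x hx)]) p
  rw [← abs_of_nonneg hk, ← abs_mul, abs_of_nonneg hk]
  exact abs_le.2 ⟨by linarith, by linarith⟩

theorem Loc.relaxBd (h : Loc ρ m σ U G a b c C M) (hδ : 0 < δ) {χ : EuT N → ℝ} (hχ : Sm χ)
    (hc : HasCompactSupport χ) (h1 : ∀ p, χ p ^ 2 ≤ 1)
    (hs : tsupport χ ⊆ G ×ˢ Ioo (a + 3 * δ) b) :
    ∃ B g, 0 ≤ B ∧ 0 ≤ g ∧ ∀ l s ε : ℝ, 1 ≤ l → 0 < s → 0 < ε → ∀ᶠ n in atTop,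
      RelaxBd l s ε m B (M ^ 2 * C * (1 + g) * l ^ (1 - σ)) (C * g) C χ
        (fun p => χ p * χ p) (fun p => χ p * χ p * (χ p * χ p))
        (mo volume n fun p => ρ p.1 * U p)
        (mo volume n fun p => ρ p.1 * av l (ramp a δ) U p) (mo volume n fun p => U p ^ m)
        (mo volume n (av l (ramp a δ) fun p => U p ^ m))
        (mo volume n fun p => ρ p.1 * layer l a δ U p)
        (mo volume n (osc l (ramp a δ) m U))
        ((tsupport χ).indicator (mo volume n (majAv l m σ U G a b δ))) := by
  have sω : Sm fun p => χ p * χ p := ContDiff.mul hχ hχ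
  have cω : HasCompactSupport fun p => χ p * χ p := hc.mul_right
  have sη : Sm fun p => χ p * χ p * (χ p * χ p) := ContDiff.mul sω sω
  have cη : HasCompactSupport fun p => χ p * χ p * (χ p * χ p) := cω.mul_right
  have ω_supp : tsupport (fun p => χ p * χ p) ⊆ tsupport χ := tsupport_mul_subset_left
  have η_supp : tsupport (fun p => χ p * χ p * (χ p * χ p)) ⊆ tsupport fun p => χ p * χ p :=
    tsupport_mul_subset_left
  have sG : Sm (Gr χ χ) := Gr_smooth hχ hχ
  have cG : HasCompactSupport (Gr χ χ) := by
    refine HasCompactSupport.intro hc fun p hp => Finset.sum_eq_zero fun i _ => ?_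
    rw [dv_eq_zero hp, zero_mul]
  have sL := Sm.lapS sω (eX (N := N))
  have cL := HasCompactSupport.lapS cω (eX (N := N))
  obtain ⟨B1, hB1⟩ := exists_bound_of_compact (Sm.dv sω eT).cont (cω.dv eT)
  obtain ⟨B2, hB2⟩ := exists_bound_of_compact sL.cont cL
  obtain ⟨B3, hB3⟩ := exists_bound_of_compact sG.cont cG
  have b1 := (abs_nonneg _).trans (hB1 0)
  have b2 := (abs_nonneg _).trans (hB2 0)
  have b3 := (abs_nonneg _).trans (hB3 0)
  obtain ⟨g, hg, hg'⟩ := h.layer_le hδ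
  refine ⟨B1 + B2 + 4 * B3, g, by positivity, hg, fun l s ε hl hs0 hε => ?_⟩
  have hl0 : 0 < l := by linarith
  have hK : IsCompact (tsupport χ) := hc
  have hKO : tsupport χ ⊆ G ×ˢ Ioo a b :=
    hs.trans (prod_mono le_rfl (Ioo_subset_Ioo (by linarith) le_rfl))
  have hM := h.M_ge
  have hC := h.C_ge
  have hm0 : 0 < m := by linarith [h.hm]
  have hle : 1 ≤ l ^ (1 - σ) := one_le_rpow hl (by linarith [h.σ_le])
  have v0 : ∀ p, 0 ≤ U p ^ m := fun p => rpow_nonneg (h.nonneg p) _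
  have w0 : ∀ {f : EuT N → ℝ}, (∀ p, 0 ≤ f p) → ∀ p, 0 ≤ ρ p.1 * f p := fun hf p =>
    mul_nonneg (h.c_pos.le.trans (h.le_ρ _)) (hf p)
  have avV0 := av_nonneg (l := l) (ramp_nonneg (a := a) (δ := δ)) v0
  have avU0 := av_nonneg (l := l) (ramp_nonneg (a := a) (δ := δ)) h.nonneg
  have H0 := layer_nonneg (l := l) (a := a) hδ h.nonneg
  have io := (h.osc_integrable (δ := δ) hl0).locallyIntegrable
  have iJ := (h.majAv_integrable (δ := δ) hl0).locallyIntegrable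
  have hD0 : ∀ n p, 0 ≤ mo volume n (osc l (ramp a δ) m U) p := fun n p => by
    have := mo_combination n io io io 0 1 0 0 (by
      filter_upwards [h.mix (δ := δ) hl0] with x hx
      linarith [hx.osc_nonneg]) p
    linarith
  have hO := h.isOpen.prod (isOpen_Ioo (a := a) (b := b))
  filter_upwards [h.relax hl0 hδ hK hs, mo_indicator_eq_one hK hO hKO] with n hn hn1
  have hω := hn _ sω cω ω_supp
  have y1 : ∀ p ∈ tsupport χ, 1 ≤ mo volume n (majAv l m σ U G a b δ) p := fun p hp => by
    rw [← hn1 p hp]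
    refine mo_mono n ?_ iJ (of_forall fun q => ?_) p
    · exact ((integrableOn_const h.vol.ne).integrable_indicator hO.measurableSet).locallyIntegrable
    · exact le_add_of_le_of_nonneg (le_add_of_nonneg_right (h.W_nonneg q))
        (av_nonneg ramp_nonneg h.W_nonneg q)
  have hH : ∀ p, mo volume n (fun p => ρ p.1 * layer l a δ U p) p ≤ C * (g / l) := fun p => by
    have := mo_mono (μ := (volume : Measure (EuT N))) n
      (h.weight (h.layer_integrable hl0 hδ)).locallyIntegrable
      (locallyIntegrable_const (C * (g / l))) (by
        filter_upwards [hg' l hl0] with x hx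
        exact mul_le_mul (h.ρ_le _) hx (H0 x) (by linarith)) p
    rwa [mo_const] at this
  have nA := mo_nonneg (μ := (volume : Measure (EuT N))) n (w0 h.nonneg)
  have nAb := mo_nonneg (μ := (volume : Measure (EuT N))) n (w0 avU0)
  have nV := mo_nonneg (μ := (volume : Measure (EuT N))) n v0
  have nVb := mo_nonneg (μ := (volume : Measure (EuT N))) n avV0
  have nH := mo_nonneg (μ := (volume : Measure (EuT N))) n (w0 H0)
  have mb := fun p (hp : p ∈ tsupport fun p => χ p * χ p) =>
    h.mo_bounds (δ := δ) hl n le_rfl (y1 p (ω_supp hp))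
  choose z q r hz hq hr hy hqz k1 k2 k3 k4 k5 k6 using mb
  have eJ : ∀ p hp, q p hp * z p hp * r p hp
      = (tsupport χ).indicator (mo volume n (majAv l m σ U G a b δ)) p := fun p hp => by
    rw [indicator_of_mem (ω_supp hp), hy p hp]
  have pb := fun p hp => product_bounds hl hle hM hC hg (hq p hp) (hz p hp) (hr p hp) (nVb p)
    (k2 p hp) (k3 p hp) (k4 p hp) (nV p) (k1 p hp) (nA p) (k5 p hp) (nAb p) (k6 p hp) (nH p) (hH p)
  refine
    { l_ge := hl
      s_pos := hs0
      m_pos := hm0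
      ε_pos := hε
      B_nonneg := by positivity
      L_ge := ?_
      c_nonneg := by linarith
      χ_smooth := hχ
      χ_sq_le := h1
      ω_eq := rfl
      η_eq := rfl
      rω := hω
      rη := hn _ sη cη (η_supp.trans ω_supp)
      η_supp := η_supp
      dt_le := fun p => (hB1 p).trans (by linarith)
      lap_le := fun p => (hB2 p).trans (by linarith)
      gr_le := fun p => (le_of_abs_le (hB3 p)).trans (by linarith)
      lap_gr_le := fun p => (abs_add_le _ _).trans (by
        rw [abs_mul, abs_of_pos (by norm_num : (0:ℝ) < 4)]
        linarith [hB2 p, hB3 p])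
      A_nonneg := nA
      Ab_nonneg := nAb
      V_nonneg := nV
      Vb_nonneg := nVb
      G_nonneg := fun p _ => nH p
      D_nonneg := hD0 n
      D_cont := (mo_smooth n io).cont
      J_nonneg := fun p => indicator_nonneg (fun p _ =>
        mo_nonneg n h.majAv_nonneg p) p
      J_int := ((mo_smooth n iJ).cont.continuousOn.integrableOn_compact
        hK).integrable_indicator hK.measurableSet
      flux := fun p _ T hT b' => h.mo_flux hl0 n hs0 hT b' p
      diff := fun p hp => ?_
      j1 := fun p hp => by rw [← eJ p hp]; exact (pb p hp).1
      j2 := fun p hp => by rw [← eJ p hp]; exact (pb p hp).2.1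
      j3 := fun p hp => by rw [← eJ p hp]; exact (pb p hp).2.2.1
      j4 := fun p hp => by rw [← eJ p hp]; exact (pb p hp).2.2.2.1
      j5 := fun p hp => by rw [← eJ p hp]; exact (pb p hp).2.2.2.2.1
      j6 := fun p hp => by rw [← eJ p hp]; exact (pb p hp).2.2.2.2.2.1
      j7 := fun p hp => by rw [← eJ p hp]; exact (pb p hp).2.2.2.2.2.2.1
      j8 := fun p hp => by rw [← eJ p hp]; exact (pb p hp).2.2.2.2.2.2.2.1
      j9 := fun p hp => by rw [← eJ p hp]; exact (pb p hp).2.2.2.2.2.2.2.2.1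
      j10 := fun p hp => by rw [← eJ p hp]; exact (pb p hp).2.2.2.2.2.2.2.2.2 }
  · have := one_le_mul_of_one_le_of_one_le (one_le_mul_of_one_le_of_one_le
      (one_le_mul_of_one_le_of_one_le (one_le_pow₀ (n := 2) hM) hC)
      (by linarith : 1 ≤ 1 + g)) hle
    exact this
  · refine (h.mo_diff hl0 n hε (nVb p) p).trans ?_
    rw [← eJ p hp]
    have : mo volume n (av l (ramp a δ) fun p => U p ^ m) p ^ ((m + 1) / m)
        ≤ q p hp * z p hp * r p hp := by
      calc _ ≤ q p hp ^ ((m + 1) / m) :=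
            rpow_le_rpow (nVb p) (k2 p hp) (by positivity)
        _ = q p hp * z p hp * 1 := by rw [hqz, mul_one]
        _ ≤ _ := mul_le_mul_of_nonneg_left (hr p hp)
          (mul_nonneg (by linarith [hq p hp]) (by linarith [hz p hp]))
    have hC0 : 0 ≤ C := by linarith
    gcongr

theorem tendsto_integral_mul_mo {k f : EuT N → ℝ} (hk : Continuous k)
    (h1 : ∀ p, |k p| ≤ 1) (hf : Integrable f) :
    Tendsto (fun n => ∫ p, k p * mo volume n f p) atTop (𝓝 (∫ p, k p * f p)) := by
  refine (tendsto_integral_of_le_mo (H := fun p => |f p|) (fun n => ?_) ?_ hf.abs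
    (fun p => abs_nonneg _) (of_forall fun n p => ?_) ?_).2
  · exact (hk.mul (mo_smooth n hf.locallyIntegrable).cont).aestronglyMeasurable
  · exact hk.aestronglyMeasurable.mul hf.aestronglyMeasurable
  · rw [abs_mul]
    exact (mul_le_of_le_one_left (abs_nonneg _) (h1 p)).trans (mo_abs_le n p)
  · filter_upwards [mo_ae hf.locallyIntegrable] with p hp using hp.const_mul _

theorem Loc.tendsto_bilinear (h : Loc ρ m σ U G a b c C M) (hl : 1 ≤ l) {k : EuT N → ℝ}
    (hk : Continuous k) (hc : HasCompactSupport k) (hs : tsupport k ⊆ G ×ˢ Ioo a b)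
    (x₁ x₂ x₃ : ℝ) :
    Tendsto (fun n => ∫ p, k p * (x₁ * (mo volume n (fun p => ρ p.1 * U p) p
          * mo volume n (fun p => U p ^ m) p)
        + x₂ * (mo volume n (fun p => ρ p.1 * U p) p
          * mo volume n (av l (ramp a δ) fun p => U p ^ m) p)
        + x₃ * (mo volume n (fun p => U p ^ m) p
          * mo volume n (fun p => ρ p.1 * av l (ramp a δ) U p) p))) atTop
      (𝓝 (∫ p, k p * (x₁ * (ρ p.1 * U p * U p ^ m)
        + x₂ * (ρ p.1 * U p * av l (ramp a δ) (fun p => U p ^ m) p)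
        + x₃ * (U p ^ m * (ρ p.1 * av l (ramp a δ) U p))))) := by
  have hl0 : 0 < l := by linarith
  have hK : IsCompact (tsupport k) := hc
  have hC := h.C_ge
  obtain ⟨κ, hκ⟩ := exists_bound_of_compact hk hc
  have κ0 : 0 ≤ κ := (abs_nonneg _).trans (hκ 0)
  have v0 : ∀ p, 0 ≤ U p ^ m := fun p => rpow_nonneg (h.nonneg p) _
  have w0 : ∀ {f : EuT N → ℝ}, (∀ p, 0 ≤ f p) → ∀ p, 0 ≤ ρ p.1 * f p := fun hf p =>
    mul_nonneg (h.c_pos.le.trans (h.le_ρ _)) (hf p)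
  have avV0 := av_nonneg (l := l) (ramp_nonneg (a := a) (δ := δ)) v0
  have avU0 := av_nonneg (l := l) (ramp_nonneg (a := a) (δ := δ)) h.nonneg
  have iA := (h.weight h.intU).locallyIntegrable
  have iB := (h.weight (av_integrable (a := a) (δ := δ) hl0 h.intU)).locallyIntegrable
  have iV := h.intV.locallyIntegrable
  have iW := (av_integrable (a := a) (δ := δ) hl0 h.intV).locallyIntegrable
  have iH := h.majAv_integrable (δ := δ) hl0
  have cA : ∀ n, Continuous (mo volume n fun p => ρ p.1 * U p) := fun n =>
    (mo_smooth n iA).cont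
  have cB : ∀ n, Continuous (mo volume n fun p => ρ p.1 * av l (ramp a δ) U p) := fun n =>
    (mo_smooth n iB).cont
  have cV : ∀ n, Continuous (mo volume n fun p => U p ^ m) := fun n =>
    (mo_smooth n iV).cont
  have cW : ∀ n, Continuous (mo volume n (av l (ramp a δ) fun p => U p ^ m)) := fun n =>
    (mo_smooth n iW).cont
  set S := κ * ((|x₁| + |x₂| + |x₃|) * C) with hS
  have hS0 : 0 ≤ S := by positivity
  have hO := h.isOpen.prod (isOpen_Ioo (a := a) (b := b))
  refine (tendsto_integral_of_le_mo (H := fun p => S * majAv l m σ U G a b δ p) (fun n => ?_) ?_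
    (iH.const_mul S) (fun p => mul_nonneg hS0 (h.majAv_nonneg p)) ?_ ?_).2
  · exact (hk.mul (((continuous_const.mul ((cA n).mul (cV n))).add
      (continuous_const.mul ((cA n).mul (cW n)))).add
      (continuous_const.mul ((cV n).mul (cB n))))).aestronglyMeasurable
  · have mA := iA.aestronglyMeasurable
    have mB := iB.aestronglyMeasurable
    have mV := iV.aestronglyMeasurable
    have mW := iW.aestronglyMeasurable
    exact hk.aestronglyMeasurable.mul ((((mA.mul mV).const_mul x₁).add
      ((mA.mul mW).const_mul x₂)).add ((mV.mul mB).const_mul x₃))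
  · filter_upwards [mo_indicator_eq_one hK hO hs] with n hn p
    rw [mo_const_mul]
    by_cases hp : p ∈ tsupport k
    swap
    · rw [image_eq_zero_of_notMem_tsupport hp, zero_mul, abs_zero]
      exact mul_nonneg hS0 (mo_nonneg n h.majAv_nonneg p)
    have y1 : 1 ≤ mo volume n (majAv l m σ U G a b δ) p := by
      rw [← hn p hp]
      refine mo_mono n ?_ iH.locallyIntegrable (of_forall fun q => ?_) p
      · exact ((integrableOn_const h.vol.ne).integrable_indicator
          hO.measurableSet).locallyIntegrable
      · exact le_add_of_le_of_nonneg (le_add_of_nonneg_right (h.W_nonneg q))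
          (av_nonneg ramp_nonneg h.W_nonneg q)
    obtain ⟨z, q, r, hz, hq, hr, hy, -, k1, k2, -, -, k5, k6⟩ := h.mo_bounds (δ := δ) hl n le_rfl y1
    have nA := mo_nonneg (μ := (volume : Measure (EuT N))) n (w0 h.nonneg) p
    have nAb := mo_nonneg (μ := (volume : Measure (EuT N))) n (w0 avU0) p
    have nV := mo_nonneg (μ := (volume : Measure (EuT N))) n v0 p
    have nVb := mo_nonneg (μ := (volume : Measure (EuT N))) n avV0 p
    have hq0 : 0 ≤ q := by linarith
    have hz0 : 0 ≤ z := by linarith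
    have hC0 : 0 ≤ C := by linarith
    have fin : ∀ {x y : ℝ}, 0 ≤ x → x ≤ C * z → 0 ≤ y → y ≤ q → |x * y| ≤ C * (q * z * r) := by
      intro x y hx hx' hy hy'
      rw [abs_of_nonneg (mul_nonneg hx hy)]
      calc x * y ≤ C * z * q := mul_le_mul hx' hy' hy (by positivity)
        _ = C * (q * z * 1) := by ring
        _ ≤ _ := by gcongr
    have f1 := fin nA k5 nV k1
    have f2 := fin nA k5 nVb k2
    have f3 := fin nAb k6 nV k1
    rw [mul_comm (mo _ _ _ _) (mo _ _ (fun p => U p ^ m) p)] at f3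
    rw [abs_mul, hS, hy, mul_assoc κ]
    refine mul_le_mul (hκ p) ?_ (abs_nonneg _) κ0
    refine (abs_add_three _ _ _).trans ?_
    rw [abs_mul x₁, abs_mul x₂, abs_mul x₃]
    calc _ ≤ |x₁| * (C * (q * z * r)) + |x₂| * (C * (q * z * r)) + |x₃| * (C * (q * z * r)) := by
          gcongr
      _ = _ := by ring
  · filter_upwards [mo_ae iA, mo_ae iB, mo_ae iV, mo_ae iW] with p h1 h2 h3 h4
    exact ((((h1.mul h3).const_mul x₁).add ((h1.mul h4).const_mul x₂)).add
      ((h3.mul h2).const_mul x₃)).const_mul _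

theorem relax_limit_arith {m B C E L Y CY s P S ε T D l τ : ℝ}
    (hE : E = 2 * m * (1000 * (1 + B) ^ 2 * (1 + C))) (hE0 : 0 ≤ E) (hL : 0 ≤ L) (hY : 0 ≤ Y)
    (hCY : 0 ≤ CY) (hs : 0 ≤ s) (hP : 0 ≤ P) (hS : 0 ≤ S) (hT : 0 ≤ T) (hl : 0 < l) (hε : 0 ≤ ε)
    (hτ : 0 < τ) (hD : 0 ≤ D) :
    2 * m / τ * (1000 * (1 + B) ^ 2 * (1 + C)) * (s * (L * P) * Y
      + S * (L * P / l * Y + (ε * Y + T * D)))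
      ≤ (CY + E * ((L + 1) * (Y + 1))) / τ * (s * P + S * (P / l + (ε + T * D))) := by
  have k1 : L * Y ≤ (L + 1) * (Y + 1) := by nlinarith
  have k2 : Y ≤ (L + 1) * (Y + 1) := by nlinarith
  have k3 : 1 ≤ (L + 1) * (Y + 1) := by nlinarith [mul_nonneg hL hY]
  generalize (L + 1) * (Y + 1) = Z at *
  have hZ : 0 ≤ Z := by linarith
  calc _ = E / τ * (s * P * (L * Y) + S * (P / l * (L * Y) + (ε * Y + T * D * 1))) := by
        rw [hE]
        ring
    _ ≤ E / τ * (s * P * Z + S * (P / l * Z + (ε * Z + T * D * Z))) := by gcongr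
    _ = E * Z / τ * (s * P + S * (P / l + (ε + T * D))) := by ring
    _ ≤ _ := by
        gcongr
        exact le_add_of_nonneg_left hCY

theorem Loc.relax_limit (h : Loc ρ m σ U G a b c C M) (hδ : 0 < δ) {χ : EuT N → ℝ} (hχ : Sm χ)
    (hc : HasCompactSupport χ) (h1 : ∀ p, χ p ^ 2 ≤ 1)
    (hs : tsupport χ ⊆ G ×ˢ Ioo (a + 3 * δ) b) :
    ∃ B g, 0 ≤ B ∧ 0 ≤ g ∧ (∀ p, |Dv eT (fun p => χ p * χ p) p| ≤ B) ∧
      ∀ l s ε τ : ℝ, 1 ≤ l → 0 < s → 0 < ε → 0 < τ →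
      (∫ p, l * (χ p * χ p * (χ p * χ p)) * (2 * (ρ p.1 * U p * U p ^ m)
        + (-1) * (ρ p.1 * U p * av l (ramp a δ) (fun p => U p ^ m) p)
        + (-1) * (U p ^ m * (ρ p.1 * av l (ramp a δ) U p))))
      + (∫ p, Dv eT (fun p => χ p * χ p * (χ p * χ p)) p
        * (ρ p.1 * U p * av l (ramp a δ) (fun p => U p ^ m) p))
      ≤ τ * l * (∫ p, χ p * χ p * (χ p * χ p) * osc l (ramp a δ) m U p) + g / l
        + g / τ * (s * l ^ (1 - σ) + s ^ (1 - m) * (l ^ (1 - σ) / l + (ε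
          + ε ^ (-m) * ∫ p, χ p * χ p * osc l (ramp a δ) m U p))) := by
  obtain ⟨B, g, hB, hg, hbd⟩ := h.relaxBd hδ hχ hc h1 hs
  have hm0 : 0 < m := by linarith [h.hm]
  have hM := h.M_ge
  have hC := h.C_ge
  have hKO : tsupport χ ⊆ G ×ˢ Ioo a b :=
    hs.trans (prod_mono le_rfl (Ioo_subset_Ioo (by linarith) le_rfl))
  have sω : Sm fun p => χ p * χ p := ContDiff.mul hχ hχ
  have cω : HasCompactSupport fun p => χ p * χ p := hc.mul_right
  have sη : Sm fun p => χ p * χ p * (χ p * χ p) := ContDiff.mul sω sω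
  have cη : HasCompactSupport fun p => χ p * χ p * (χ p * χ p) := cω.mul_right
  have ω_supp : tsupport (fun p => χ p * χ p) ⊆ tsupport χ := tsupport_mul_subset_left
  have η_supp : tsupport (fun p => χ p * χ p * (χ p * χ p)) ⊆ tsupport χ :=
    tsupport_mul_subset_left.trans ω_supp
  set Y := (∫ p, maj m σ U (G ×ˢ Ioo a b) p) + ∫ p, (U p ^ m) ^ (1 + 1 / m + σ) with hY
  have hY0 : 0 ≤ Y := add_nonneg (integral_nonneg h.maj_nonneg) (integral_nonneg h.W_nonneg)
  set E := 2 * m * (1000 * (1 + B) ^ 2 * (1 + C)) with hE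
  have hE0 : 0 ≤ E := by positivity
  set L := M ^ 2 * C * (1 + g) with hL
  have hL0 : 0 ≤ L := by positivity
  set g' := C * g * Y + E * ((L + 1) * (Y + 1)) with hg'
  have hg0 : 0 ≤ g' := by positivity
  have hdt : ∀ p, |Dv eT (fun p => χ p * χ p) p| ≤ B := by
    obtain ⟨n, hn⟩ := (hbd 1 1 1 le_rfl one_pos one_pos).exists
    exact hn.dt_le
  refine ⟨B, g', hB, hg0, hdt, fun l s ε τ hl hs0 hε hτ => ?_⟩
  have hl0 : 0 < l := by linarith
  have hω1 : ∀ p, |χ p * χ p| ≤ 1 := fun p => by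
    rw [abs_of_nonneg (mul_self_nonneg _), ← sq]; exact h1 p
  have hη1 : ∀ p, |χ p * χ p * (χ p * χ p)| ≤ 1 := fun p => by
    rw [abs_mul]; exact mul_le_one₀ (hω1 p) (abs_nonneg _) (hω1 p)
  have io := h.osc_integrable (δ := δ) hl0
  have cdη := (Sm.dv sη (eT (N := N))).cont
  have L1 := h.tendsto_bilinear (δ := δ) hl (k := fun p => l * (χ p * χ p * (χ p * χ p)))
    (continuous_const.mul sη.cont) cη.mul_left
    (tsupport_mul_subset_right.trans (η_supp.trans hKO)) 2 (-1) (-1)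
  have L2 := h.tendsto_bilinear (δ := δ) hl cdη (cη.dv eT)
    ((tsupport_dv_subset _ _).trans (η_supp.trans hKO)) 0 1 0
  have R1 := tendsto_integral_mul_mo sη.cont hη1 io
  have R2 := tendsto_integral_mul_mo sω.cont hω1 io
  have osc0 : ∀ᵐ p, 0 ≤ osc l (ramp a δ) m U p := (h.mix hl0).mono fun p hp => hp.osc_nonneg
  have D0 : 0 ≤ ∫ p, χ p * χ p * osc l (ramp a δ) m U p :=
    integral_nonneg_of_ae (osc0.mono fun p hp => mul_nonneg (mul_self_nonneg _) hp)
  have RR := ((R1.const_mul (τ * l)).add_const (C * g / l * Y)).add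
    ((((R2.const_mul (ε ^ (-m))).const_add (ε * Y)).const_add
      (L * l ^ (1 - σ) / l * Y)).const_mul (s ^ (1 - m)) |>.const_add
      (s * (L * l ^ (1 - σ)) * Y) |>.const_mul (2 * m / τ * (1000 * (1 + B) ^ 2 * (1 + C))))
  have main := le_of_tendsto_of_tendsto (L1.add L2) RR (by
    filter_upwards [hbd l s ε hl hs0 hε] with n hn
    have e := hn.estimate hτ (mul_nonneg (by linarith) hg)
    have hJ : ∫ p, (tsupport χ).indicator (mo volume n (majAv l m σ U G a b δ)) p ≤ Y := by
      have iH := h.majAv_integrable (δ := δ) hl0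
      refine le_trans (integral_mono hn.J_int (mo_integrable n iH) fun p =>
        indicator_le_self' (fun _ _ => mo_nonneg n h.majAv_nonneg p) p) ?_
      rw [mo_integral n iH]
      exact h.majAv_integral_le hl0
    refine le_trans (le_of_eq ?_) (e.trans ?_)
    · congr 1 <;> exact integral_congr_ae (of_forall fun p => by ring)
    · have := hn.L_ge
      have : 0 ≤ L * l ^ (1 - σ) := by linarith
      gcongr)
  simp only [zero_mul, zero_add, one_mul, add_zero] at main
  refine main.trans ?_
  have q0 : 0 < l ^ (1 - σ) := rpow_pos_of_pos hl0 _
  have s0 : 0 < s ^ (1 - m) := rpow_pos_of_pos hs0 _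
  have ε0 : 0 < ε ^ (-m) := rpow_pos_of_pos hε _
  refine add_le_add (add_le_add le_rfl ?_) ?_
  · rw [div_mul_eq_mul_div]
    gcongr
    exact le_add_of_nonneg_right (by positivity)
  · exact relax_limit_arith hE hE0 hL0 hY0 (by positivity) hs0.le q0.le s0.le ε0.le hl0 hε.le hτ D0

theorem Loc.int_cross (h : Loc ρ m σ U G a b c C M) (hl : 0 < l) :
    Integrable fun p => U p * av l (ramp a δ) (fun q => U q ^ m) p := by
  refine h.intU.mul_bdd (c := l * M) (av_integrable hl h.intV).aestronglyMeasurable ?_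
  filter_upwards [h.avV_le (δ := δ) hl] with p hp
  rwa [norm_eq_abs, abs_of_nonneg (av_nonneg ramp_nonneg
    (fun q => rpow_nonneg (h.nonneg q) _) p)]

theorem Loc.avg_weight_dt (h : Loc ρ m σ U G a b c C M) (hl : 0 < l) (hδ : 0 < δ)
    {F ψ : EuT N → ℝ} (hF : Integrable F) (hψ : Sm ψ) (hc : HasCompactSupport ψ)
    (hs : ∀ p ∈ tsupport ψ, a + 2 * δ ≤ p.2) :
    ∫ p, ρ p.1 * av l (ramp a δ) F p * Dv eT ψ p
      = l * (∫ p, ρ p.1 * av l (ramp a δ) F p * ψ p) - l * ∫ p, ρ p.1 * F p * ψ p := by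
  have := avg_dt hl (h.weight (ramp_integrable (a := a) (δ := δ) hF)) hψ hc
  simp only [avg_weight] at this
  rw [this]
  congr 2
  refine integral_congr_ae (of_forall fun p => ?_)
  by_cases hp : p ∈ tsupport ψ
  · simp only [ramp_eq_one hδ (hs p hp), one_mul]
  · simp only [image_eq_zero_of_notMem_tsupport hp, mul_zero]

theorem osc_estimate_arith {l s ε m σ c g B C Y X D : ℝ} (hl : 1 ≤ l) (hs : 0 < s) (hs1 : s ≤ 1)
    (hε : 0 < ε) (hm : 1 < m) (hσ : σ ≤ 1) (hc : 0 < c) (hg : 0 ≤ g) (hB : 0 ≤ B) (hC : 0 ≤ C)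
    (hY : 0 ≤ Y) (hD : 0 ≤ D)
    (H : l * (c * X) ≤ c / 2 * l * X + g / l + g / (c / 2) * (s * l ^ (1 - σ) + s ^ (1 - m) *
      (l ^ (1 - σ) / l + (ε + ε ^ (-m) * D))) + 2 * B * C * (ε * Y + ε ^ (-m) * D)) :
    X ≤ 2 / c * (g + g / (c / 2) + 2 * B * C * (Y + 1)) * (s * l ^ (-σ) + s ^ (1 - m) / l *
      (l ^ (-σ) + ε + ε ^ (-m) * D)) := by
  have hl0 : 0 < l := by linarith
  have e1 : l ^ (1 - σ) = l * l ^ (-σ) := by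
    rw [sub_eq_add_neg, rpow_add hl0, rpow_one]
  have e2 : 1 / l ≤ l ^ (-σ) := by
    rw [one_div, ← Real.rpow_neg_one]
    exact rpow_le_rpow_of_exponent_le hl (by linarith)
  have e3 : 1 ≤ s ^ (1 - m) := Real.one_le_rpow_of_pos_of_le_one_of_nonpos hs hs1 (by linarith)
  have e4 : 0 < ε ^ (-m) := rpow_pos_of_pos hε _
  rw [e1, mul_div_assoc] at H
  have e5 : l * (l ^ (-σ) / l) = l ^ (-σ) := by field_simp
  rw [e5] at H
  have hP : 0 < l ^ (-σ) := rpow_pos_of_pos hl0 _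
  generalize l ^ (-σ) = P at *
  generalize s ^ (1 - m) = S at *
  generalize ε ^ (-m) = T at *
  set Z := s * P + S / l * (P + ε + T * D) with hZ
  have eZ : l * Z = s * (l * P) + S * (P + (ε + T * D)) := by
    rw [hZ]; field_simp; ring
  have eS : P + (ε + T * D) ≤ S * (P + (ε + T * D)) := le_mul_of_one_le_left (by positivity) e3
  have h0 : 0 ≤ s * (l * P) := by positivity
  have hTD : 0 ≤ T * D := by positivity
  have f1 : g / l ≤ g * (l * Z) := by
    rw [div_eq_mul_one_div]
    exact mul_le_mul_of_nonneg_left (by linarith) hg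
  have f2 : ε * Y + T * D ≤ (Y + 1) * (l * Z) := by nlinarith
  have f3 : 2 * B * C * (ε * Y + T * D) ≤ 2 * B * C * ((Y + 1) * (l * Z)) := by gcongr
  rw [← eZ] at H
  have f4 : l * (c / 2 * X) ≤ l * ((g + g / (c / 2) + 2 * B * C * (Y + 1)) * Z) := by linarith
  have f5 := le_of_mul_le_mul_left f4 hl0
  calc X = 2 / c * (c / 2 * X) := by field_simp
    _ ≤ 2 / c * ((g + g / (c / 2) + 2 * B * C * (Y + 1)) * Z) := by gcongr
    _ = _ := by ring

theorem Loc.osc_estimate (h : Loc ρ m σ U G a b c C M) (hδ : 0 < δ) {χ : EuT N → ℝ}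
    (hχ : Sm χ) (hc : HasCompactSupport χ) (h1 : ∀ p, χ p ^ 2 ≤ 1)
    (hs : tsupport χ ⊆ G ×ˢ Ioo (a + 3 * δ) b) :
    ∃ C₁, 0 ≤ C₁ ∧ ∀ l s ε : ℝ, 1 ≤ l → 0 < s → s ≤ 1 → 0 < ε →
      ∫ p, χ p * χ p * (χ p * χ p) * osc l (ramp a δ) m U p
        ≤ C₁ * (s * l ^ (-σ) + s ^ (1 - m) / l *
          (l ^ (-σ) + ε + ε ^ (-m) * ∫ p, χ p * χ p * osc l (ramp a δ) m U p)) := by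
  obtain ⟨B, g, hB, hg, hdt, H⟩ := h.relax_limit hδ hχ hc h1 hs
  have hC : 0 ≤ C := by linarith [h.C_ge]
  have hcp := h.c_pos
  have sω : Sm fun p => χ p * χ p := ContDiff.mul hχ hχ
  have cω : HasCompactSupport fun p => χ p * χ p := hc.mul_right
  have sη : Sm fun p => χ p * χ p * (χ p * χ p) := ContDiff.mul sω sω
  have cη : HasCompactSupport fun p => χ p * χ p * (χ p * χ p) := cω.mul_right
  have ω_supp : tsupport (fun p => χ p * χ p) ⊆ tsupport χ := tsupport_mul_subset_left
  have η_supp : tsupport (fun p => χ p * χ p * (χ p * χ p)) ⊆ tsupport χ :=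
    tsupport_mul_subset_left.trans ω_supp
  have cη0 := sη.cont
  have cω0 := sω.cont
  have cdη := (Sm.dv sη (eT (N := N))).cont
  have hq0 : ∀ p, 0 ≤ U p * U p ^ m := fun p =>
    mul_nonneg (h.nonneg p) (rpow_nonneg (h.nonneg p) _)
  set Y := ∫ p, U p * U p ^ m with hY
  have hY0 : 0 ≤ Y := integral_nonneg hq0
  refine ⟨2 / c * (g + g / (c / 2) + 2 * B * C * (Y + 1)), by positivity,
    fun l s ε hl hs0 hs1 hε => ?_⟩
  have hl0 : 0 < l := by linarith
  have io := h.osc_integrable (δ := δ) hl0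
  have iQ := av_integrable (a := a) (δ := δ) hl0 h.intQ
  have iX := h.int_cross (δ := δ) hl0
  have osc0 : ∀ᵐ p, 0 ≤ osc l (ramp a δ) m U p := (h.mix hl0).mono fun p hp => hp.osc_nonneg
  have D0 : 0 ≤ ∫ p, χ p * χ p * osc l (ramp a δ) m U p :=
    integral_nonneg_of_ae (osc0.mono fun p hp => mul_nonneg (mul_self_nonneg _) hp)
  have main := H l s ε (c / 2) hl hs0 hε (by positivity)
  have hdtQ := h.avg_weight_dt hl0 hδ h.intQ sη cη fun p hp => by
    linarith [((hs (η_supp hp)).2).1]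
  set η := fun p => χ p * χ p * (χ p * χ p) with hη
  have j1 := integrable_mul_of_compact (h.weight io) cη0 cη
  have j2 := integrable_mul_of_compact (h.weight h.intQ) cη0 cη
  have j3 := integrable_mul_of_compact (h.weight iQ) cη0 cη
  have j4 := integrable_mul_of_compact (h.weight iQ) cdη (cη.dv eT)
  have j5 := integrable_mul_of_compact (h.weight iX) cdη (cη.dv eT)
  have j6 := integrable_mul_of_compact iQ cω0 cω
  have j7 := integrable_mul_of_compact io cω0 cω
  have j8 := integrable_mul_of_compact io cη0 cη
  have E1 : (∫ p, l * η p * (2 * (ρ p.1 * U p * U p ^ m)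
        + (-1) * (ρ p.1 * U p * av l (ramp a δ) (fun p => U p ^ m) p)
        + (-1) * (U p ^ m * (ρ p.1 * av l (ramp a δ) U p))))
      = l * (∫ p, ρ p.1 * osc l (ramp a δ) m U p * η p) + l * (∫ p, ρ p.1 * (U p * U p ^ m) * η p)
        - l * (∫ p, ρ p.1 * av l (ramp a δ) (fun q => U q * U q ^ m) p * η p) := by
    have j12 : Integrable fun p => ρ p.1 * osc l (ramp a δ) m U p * η p
      + ρ p.1 * (U p * U p ^ m) * η p := j1.add j2
    rw [← mul_add, ← mul_sub, ← integral_add j1 j2, ← integral_sub j12 j3, ← integral_const_mul]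
    refine integral_congr_ae (of_forall fun p => ?_)
    simp only [osc]
    ring
  have E2 : (∫ p, ρ p.1 * av l (ramp a δ) (fun q => U q * U q ^ m) p * Dv eT η p)
      - (∫ p, Dv eT η p * (ρ p.1 * U p * av l (ramp a δ) (fun p => U p ^ m) p))
      ≤ 2 * B * C * (ε * Y + ε ^ (-m) * ∫ p, χ p * χ p * osc l (ramp a δ) m U p) := by
    have e0 : ∫ p, Dv eT η p * (ρ p.1 * U p * av l (ramp a δ) (fun p => U p ^ m) p)
        = ∫ p, ρ p.1 * (U p * av l (ramp a δ) (fun p => U p ^ m) p) * Dv eT η p :=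
      integral_congr_ae (of_forall fun p => by ring)
    have e2 : ∫ p, χ p * χ p * osc l (ramp a δ) m U p = ∫ p, osc l (ramp a δ) m U p * (χ p * χ p) :=
      integral_congr_ae (of_forall fun p => mul_comm _ _)
    have e1 : ∫ p, av l (ramp a δ) (fun q => U q * U q ^ m) p * (χ p * χ p) ≤ Y := by
      refine (integral_mono j6 iQ fun p => ?_).trans (integral_av_le hl0 h.intQ hq0)
      refine mul_le_of_le_one_right (av_nonneg ramp_nonneg hq0 p) ?_
      rw [← sq]
      exact h1 p
    have step : (∫ p, ρ p.1 * av l (ramp a δ) (fun q => U q * U q ^ m) p * Dv eT η p)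
        - (∫ p, ρ p.1 * (U p * av l (ramp a δ) (fun p => U p ^ m) p) * Dv eT η p)
        ≤ 2 * B * C * (ε * (∫ p, av l (ramp a δ) (fun q => U q * U q ^ m) p * (χ p * χ p))
          + ε ^ (-m) * ∫ p, osc l (ramp a δ) m U p * (χ p * χ p)) := by
      rw [← integral_sub j4 j5, ← integral_const_mul, ← integral_const_mul,
        ← integral_add (j6.const_mul _) (j7.const_mul _), ← integral_const_mul]
      refine integral_mono_ae (j4.sub j5) (((j6.const_mul _).add (j7.const_mul _)).const_mul _) ?_
      filter_upwards [h.mix (δ := δ) hl0] with p hp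
      have k1 := hp.abs_cross hε
      have k2 : Dv eT η p = 2 * (χ p * χ p) * Dv eT (fun p => χ p * χ p) p := by
        rw [hη, Dv_mul sω sω]
        ring
      have k3 := hdt p
      have k0 : 0 ≤ χ p * χ p := mul_self_nonneg _
      have hr0 : 0 ≤ ρ p.1 := h.c_pos.le.trans (h.le_ρ _)
      rw [k2]
      generalize av l (ramp a δ) (fun q => U q * U q ^ m) p = x at *
      generalize av l (ramp a δ) (fun q => U q ^ m) p = y at *
      generalize Dv eT (fun p => χ p * χ p) p = d at *
      calc _ ≤ |ρ p.1 * x * (2 * (χ p * χ p) * d) - ρ p.1 * (U p * y) * (2 * (χ p * χ p) * d)| :=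
            le_abs_self _
        _ = |ρ p.1 * (2 * (χ p * χ p)) * d * (x - U p * y)| := by
            congr 1
            ring
        _ = ρ p.1 * (2 * (χ p * χ p)) * |d| * |x - U p * y| := by
            rw [abs_mul, abs_mul, abs_of_nonneg (mul_nonneg hr0 (mul_nonneg zero_le_two k0))]
        _ ≤ C * (2 * (χ p * χ p)) * B * (ε * x + ε ^ (-m) * osc l (ramp a δ) m U p) := by
            have := h.ρ_le p.1
            gcongr
        _ = _ := by ring
    rw [e0, e2]
    refine step.trans ?_
    gcongr
  have E3 : c * (∫ p, η p * osc l (ramp a δ) m U p) ≤ ∫ p, ρ p.1 * osc l (ramp a δ) m U p * η p := by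
    rw [← integral_const_mul]
    refine integral_mono_ae (Integrable.const_mul (by simpa only [mul_comm] using j8) _) j1 ?_
    filter_upwards [osc0] with p hp
    have : 0 ≤ η p := mul_nonneg (mul_self_nonneg _) (mul_self_nonneg _)
    calc c * (η p * osc l (ramp a δ) m U p) ≤ ρ p.1 * (η p * osc l (ramp a δ) m U p) :=
          mul_le_mul_of_nonneg_right (h.le_ρ _) (mul_nonneg this hp)
      _ = _ := by ring
  refine osc_estimate_arith hl hs0 hs1 hε h.hm h.σ_le hcp hg hB hC hY0 D0 ?_
  have E4 := mul_le_mul_of_nonneg_left E3 hl0.le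
  rw [E1] at main
  linarith

theorem exists_cutoff {F : Type*} [NormedAddCommGroup F] [NormedSpace ℝ F]
    [FiniteDimensional ℝ F] {K O : Set F} (hK : IsCompact K) (hO : IsOpen O) (hKO : K ⊆ O) :
    ∃ χ : F → ℝ, Sm χ ∧ HasCompactSupport χ ∧ (∀ p, 0 ≤ χ p) ∧ (∀ p, χ p ≤ 1) ∧
      (∀ p ∈ K, χ p = 1) ∧ tsupport χ ⊆ O := by
  obtain ⟨L, hL, hKL, hLO⟩ := exists_compact_between hK hO hKO
  obtain ⟨f, f0, f1, f01⟩ := exists_contMDiffMap_zero_one_of_isClosed (n := ⊤)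
    (modelWithCornersSelf ℝ F) isOpen_interior.isClosed_compl hK.isClosed
    (disjoint_left.2 fun x hx h => hx (hKL h))
  have hs : tsupport f ⊆ L := closure_minimal (fun x hx => by
    by_contra h
    exact hx (f0 fun hi => h (interior_subset hi))) hL.isClosed
  exact ⟨f, f.contMDiff.contDiff, hL.of_isClosed_subset (isClosed_tsupport _) hs,
    fun p => (f01 p).1, fun p => (f01 p).2, fun p hp => f1 hp, hs.trans hLO⟩

/-- Algebraic decay in `l` of the oscillation, locally in `O`. -/
def Decay (m : ℝ) (U : EuT N → ℝ) (a δ : ℝ) (O : Set (EuT N)) (α : ℝ) : Prop :=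
  ∀ K, IsCompact K → K ⊆ O → ∃ A, 0 ≤ A ∧ ∀ l : ℝ, 1 ≤ l →
    ∫ p in K, osc l (ramp a δ) m U p ≤ A * l ^ (-α)

theorem Decay.anti {O : Set (EuT N)} {α β : ℝ} (h : Decay m U a δ O β) (hαβ : α ≤ β) :
    Decay m U a δ O α := by
  intro K hK hKO
  obtain ⟨A, hA, H⟩ := h K hK hKO
  exact ⟨A, hA, fun l hl => (H l hl).trans
    (mul_le_mul_of_nonneg_left (rpow_le_rpow_of_exponent_le hl (by linarith)) hA)⟩

theorem Loc.decay_zero (h : Loc ρ m σ U G a b c C M) (O : Set (EuT N)) :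
    Decay m U a δ O 0 := by
  intro K _ _
  have q0 : ∀ p, 0 ≤ U p * U p ^ m := fun p =>
    mul_nonneg (h.nonneg p) (rpow_nonneg (h.nonneg p) _)
  refine ⟨2 * ∫ p, U p * U p ^ m, mul_nonneg zero_le_two (integral_nonneg q0), fun l hl => ?_⟩
  have hl0 : 0 < l := by linarith
  have i1 := h.intQ
  have i2 := av_integrable (a := a) (δ := δ) hl0 i1
  calc _ ≤ ∫ p, osc l (ramp a δ) m U p := setIntegral_le_integral (h.osc_integrable hl0)
        ((h.mix hl0).mono fun p hp => hp.osc_nonneg)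
    _ ≤ ∫ p, (U p * U p ^ m + av l (ramp a δ) (fun q => U q * U q ^ m) p) :=
        integral_mono (h.osc_integrable hl0) (i1.add i2) fun p => by
          have e1 := mul_nonneg (h.nonneg p) (av_nonneg (l := l) (θ := ramp a δ) ramp_nonneg
            (fun q => rpow_nonneg (h.nonneg q) m) p)
          have e2 := mul_nonneg (av_nonneg (l := l) (θ := ramp a δ) ramp_nonneg h.nonneg p)
            (rpow_nonneg (h.nonneg p) m)
          simp only [osc]
          linarith
    _ ≤ _ := by
        rw [integral_add i1 i2, neg_zero, Real.rpow_zero]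
        linarith [integral_av_le (a := a) (δ := δ) hl0 i1 q0]

theorem decay_arith {l σ α β γ A D : ℝ} (hm : 1 < m) (hl : 1 ≤ l)
    (hα1 : α ≤ 1) (hγ : γ = 1 / (m + 1)) (hβ : β = γ / m) (hA : 0 ≤ A)
    (hD : D ≤ A * l ^ (-α)) :
    l ^ (-β) * l ^ (-σ) + (l ^ (-β)) ^ (1 - m) / l *
      (l ^ (-σ) + l ^ (-(α * γ)) + (l ^ (-(α * γ))) ^ (-m) * D)
      ≤ (3 + A) * l ^ (-(min σ α + β)) := by
  have hl0 : 0 < l := by linarith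
  have hγ0 : 0 < γ := by rw [hγ]; exact one_div_pos.2 (by linarith)
  have e1 : γ * m + γ = 1 := by rw [hγ]; field_simp
  have e2 : β * m = γ := by rw [hβ]; field_simp
  have f1 : (l ^ (-β)) ^ (1 - m) / l = l ^ (γ - β - 1) := by
    rw [← rpow_mul hl0.le, Real.rpow_sub_one hl0.ne']
    congr 2
    linarith
  have f2 : (l ^ (-(α * γ))) ^ (-m) * D ≤ A * l ^ (-(α * γ)) := by
    rw [← rpow_mul hl0.le]
    refine (mul_le_mul_of_nonneg_left hD (rpow_nonneg hl0.le _)).trans_eq ?_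
    rw [mul_left_comm, ← rpow_add hl0]
    congr 2
    linear_combination α * e1
  have g : ∀ x : ℝ, x ≤ -(min σ α + β) → l ^ x ≤ l ^ (-(min σ α + β)) := fun x hx =>
    rpow_le_rpow_of_exponent_le hl hx
  have g1 := g (-β + -σ) (by linarith [min_le_left σ α])
  have hγ1 : γ ≤ 1 := by nlinarith
  have g2 := g (γ - β - 1 + -σ) (by linarith [min_le_left σ α])
  have g3 := g (γ - β - 1 + -(α * γ)) (by nlinarith [min_le_right σ α])
  rw [rpow_add hl0] at g1 g2 g3
  rw [f1]
  have f3 := mul_le_mul_of_nonneg_left f2 (rpow_nonneg hl0.le (γ - β - 1))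
  have f4 := mul_le_mul_of_nonneg_left g3 hA
  linarith

theorem Loc.decay_step (h : Loc ρ m σ U G a b c C M) (hδ : 0 < δ) {α : ℝ}
    (h1 : α ≤ 1) (hd : Decay m U a δ (G ×ˢ Ioo (a + 3 * δ) b) α) :
    Decay m U a δ (G ×ˢ Ioo (a + 3 * δ) b) (min σ α + 1 / (m + 1) / m) := by
  intro K hK hKO
  obtain ⟨χ, sχ, cχ, χ0, χ1, χK, χO⟩ := exists_cutoff hK (h.isOpen.prod isOpen_Ioo) hKO
  have χ2 : ∀ p, χ p * χ p ≤ 1 := fun p => mul_le_one₀ (χ1 p) (χ0 p) (χ1 p)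
  obtain ⟨A, hA, HA⟩ := hd _ cχ χO
  obtain ⟨B, hB, HB⟩ := h.osc_estimate hδ sχ cχ (fun p => by rw [sq]; exact χ2 p) χO
  refine ⟨B * (3 + A), by positivity, fun l hl => ?_⟩
  have hl0 : 0 < l := by linarith
  have hγ : 0 < 1 / (m + 1) := one_div_pos.2 (by linarith [h.hm])
  have hβ : 0 < 1 / (m + 1) / m := div_pos hγ (by linarith [h.hm])
  have o := (h.mix (δ := δ) hl0).mono fun p hp => hp.osc_nonneg
  have io := h.osc_integrable (δ := δ) hl0
  have kc : Continuous χ := sχ.cont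
  have i2 : Integrable fun p => χ p * χ p * osc l (ramp a δ) m U p :=
    io.bdd_mul (c := 1) (kc.mul kc).aestronglyMeasurable
      (of_forall fun p => by
        rw [norm_eq_abs, abs_of_nonneg (mul_self_nonneg _)]; exact χ2 p)
  have i4 : Integrable fun p => χ p * χ p * (χ p * χ p) * osc l (ramp a δ) m U p :=
    io.bdd_mul (c := 1) ((kc.mul kc).mul (kc.mul kc)).aestronglyMeasurable
      (of_forall fun p => by
        rw [norm_eq_abs, abs_of_nonneg (mul_self_nonneg _)]
        exact mul_le_one₀ (χ2 p) (mul_self_nonneg _) (χ2 p))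
  have D : ∫ p, χ p * χ p * osc l (ramp a δ) m U p ≤ A * l ^ (-α) := by
    refine le_trans ?_ (HA l hl)
    rw [← integral_indicator (isClosed_tsupport χ).measurableSet]
    refine integral_mono_ae i2 (io.indicator (isClosed_tsupport χ).measurableSet) ?_
    filter_upwards [o] with p hp
    by_cases hs : p ∈ tsupport χ
    · rw [indicator_of_mem hs]
      exact mul_le_of_le_one_left hp (χ2 p)
    · rw [indicator_of_notMem hs, image_eq_zero_of_notMem_tsupport hs]
      simp
  have E : ∫ p in K, osc l (ramp a δ) m U p
      ≤ ∫ p, χ p * χ p * (χ p * χ p) * osc l (ramp a δ) m U p := by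
    rw [← integral_indicator hK.measurableSet]
    refine integral_mono_ae (io.indicator hK.measurableSet) i4 ?_
    filter_upwards [o] with p hp
    by_cases hs : p ∈ K
    · rw [indicator_of_mem hs, χK p hs]
      simp
    · rw [indicator_of_notMem hs]
      exact mul_nonneg (mul_self_nonneg _) hp
  refine (E.trans (HB l (l ^ (-(1 / (m + 1) / m))) (l ^ (-(α * (1 / (m + 1))))) hl
    (rpow_pos_of_pos hl0 _) (Real.rpow_le_one_of_one_le_of_nonpos hl (by linarith))
    (rpow_pos_of_pos hl0 _))).trans ?_
  rw [mul_assoc]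
  exact mul_le_mul_of_nonneg_left (decay_arith h.hm hl h1 rfl rfl hA D) hB

theorem Loc.decay (h : Loc ρ m σ U G a b c C M) (hδ : 0 < δ) :
    Decay m U a δ (G ×ˢ Ioo (a + 3 * δ) b) (σ + 1 / (m + 1) / m) := by
  have hβ : 0 < 1 / (m + 1) / m := div_pos (one_div_pos.2 (by linarith [h.hm])) (by linarith [h.hm])
  have key : ∀ j : ℕ, Decay m U a δ (G ×ˢ Ioo (a + 3 * δ) b)
      (min σ (j * (1 / (m + 1) / m))) := by
    intro j
    induction j with
    | zero => simpa [h.σ_nonneg] using h.decay_zero _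
    | succ j ih =>
      refine (h.decay_step hδ ((min_le_left _ _).trans h.σ_le) ih).anti ?_
      push_cast
      rcases min_cases σ (j * (1 / (m + 1) / m)) with ⟨e, _⟩ | ⟨e, _⟩ <;> rw [e]
      · rw [min_self]
        linarith [min_le_left σ ((j + 1) * (1 / (m + 1) / m))]
      · rw [e]
        linarith [min_le_right σ ((j + 1) * (1 / (m + 1) / m))]
  obtain ⟨j, hj⟩ := exists_nat_ge (σ / (1 / (m + 1) / m))
  rw [div_le_iff₀ hβ] at hj
  have := key j
  rw [min_eq_left hj] at this
  simpa using h.decay_step hδ h.σ_le this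

theorem le_add_rpow_mul {m s y : ℝ} (hm : 1 < m) (hs : 0 < s) (hy : 0 ≤ y) :
    y ≤ s + s ^ (1 - m) * y ^ m := by
  have h1 : 0 ≤ s ^ (1 - m) * y ^ m := by positivity
  rcases le_total y s with h | h
  · linarith
  · have hy0 := hs.trans_le h
    have e : y = y ^ (1 - m) * y ^ m := by
      rw [← rpow_add hy0, sub_add_cancel, rpow_one]
    have := mul_le_mul_of_nonneg_right (rpow_le_rpow_of_nonpos hs h (by linarith : 1 - m ≤ 0))
      (rpow_nonneg hy m)
    linarith

theorem Mix.osc_ge {θ : ℝ → ℝ} {p : EuT N} (h : Mix l θ m U p) (hM : 0 < M)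
    (hv : av l θ (fun q => U q ^ m) p ≤ l * M) (hu : 8 ^ (m + 1) * (l * M) ≤ U p ^ m) :
    U p * U p ^ m ≤ 2 * osc l θ m U p := by
  have hm := h.hm
  have hl := h.hl
  have h8 : (8 : ℝ) ^ (m + 1) = 8 ^ m * 8 := by rw [rpow_add_one (by norm_num)]
  have h81 : (1 : ℝ) ≤ 8 ^ m := one_le_rpow (by norm_num) (by linarith)
  have lM : 0 < l * M := mul_pos hl hM
  have hup : 0 < U p := by
    refine (h.nonneg p).lt_of_ne' fun e => ?_
    rw [e, zero_rpow (by linarith)] at hu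
    have : 0 < (8 : ℝ) ^ (m + 1) * (l * M) := by positivity
    linarith
  have hs : 0 < U p / 8 := by linarith
  have k := h.mix (U p / 8) (-1) ((U p / 8) ^ (1 - m)) 0 fun y hy => by
    linarith [le_add_rpow_mul hm hs hy]
  have e : (U p / 8) ^ (1 - m) * U p ^ m = U p / 8 * 8 ^ m := by
    rw [Real.rpow_sub hs, rpow_one, Real.div_rpow hup.le (by norm_num)]
    have := (rpow_pos_of_pos hup m).ne'
    field_simp
  have e2 : (U p / 8) ^ (1 - m) * av l θ (fun q => U q ^ m) p ≤ U p / 8 := by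
    have p1 : 0 < (U p / 8) ^ (1 - m) := rpow_pos_of_pos hs _
    have p2 : (U p / 8) ^ (1 - m) * (8 ^ m * (l * M)) ≤ U p / 8 * 8 ^ m := by
      rw [← e]
      refine mul_le_mul_of_nonneg_left ?_ p1.le
      nlinarith [mul_pos (lt_of_lt_of_le one_pos h81) lM]
    have p3 : (U p / 8) ^ (1 - m) * (l * M) ≤ U p / 8 := by
      refine le_of_mul_le_mul_right ?_ (lt_of_lt_of_le one_pos h81)
      linarith
    exact (mul_le_mul_of_nonneg_left hv p1.le).trans p3
  have b1 : U p * (3 / 4) ≤ U p - av l θ U p := by linarith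
  have b2 : U p ^ m * (3 / 4) ≤ U p ^ m - av l θ (fun q => U q ^ m) p := by
    nlinarith
  have := mul_le_mul b1 b2 (by positivity) (by linarith)
  have := h.mul_sub_le_osc
  have : 0 ≤ U p * U p ^ m := by positivity
  linarith

theorem Loc.tail_le (h : Loc ρ m σ U G a b c C M) (hδ : 0 < δ) {K : Set (EuT N)}
    (hK : IsCompact K) (hKO : K ⊆ G ×ˢ Ioo (a + 3 * δ) b) :
    ∃ A, 0 ≤ A ∧ ∀ l : ℝ, 1 ≤ l →
      ∫⁻ p in K, {p | 8 ^ (m + 1) * (l * M) ≤ U p ^ m}.indicator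
        (fun p => ofReal (U p * U p ^ m)) p
        ≤ ofReal (A * l ^ (-(σ + 1 / (m + 1) / m))) := by
  obtain ⟨A, hA, H⟩ := h.decay hδ K hK hKO
  refine ⟨2 * A, by positivity, fun l hl => ?_⟩
  have hl0 : 0 < l := by linarith
  have io := (h.osc_integrable (δ := δ) hl0).integrableOn (s := K)
  have ho := (h.mix (δ := δ) hl0).mono fun p hp => hp.osc_nonneg
  have hle := mul_le_mul_of_nonneg_left (H l hl) zero_le_two
  rw [← integral_const_mul, ← mul_assoc] at hle
  refine le_trans ?_ (ofReal_le_ofReal hle)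
  rw [ofReal_integral_eq_lintegral_ofReal (io.const_mul 2)
    (ae_restrict_of_ae (ho.mono fun p hp => mul_nonneg zero_le_two hp))]
  refine lintegral_mono_ae (ae_restrict_of_ae ?_)
  filter_upwards [h.mix (δ := δ) hl0, h.avV_le (δ := δ) hl0] with p hp hv
  by_cases hu : 8 ^ (m + 1) * (l * M) ≤ U p ^ m
  · simp only [indicator_apply, mem_ofPred_eq, if_pos hu]
    exact ofReal_le_ofReal (hp.osc_ge (by linarith [h.M_ge]) hv hu)
  · simp only [indicator_apply, mem_ofPred_eq, if_neg hu]
    exact zero_le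

theorem dyadic_le {q v B s : ℝ} (hq : 0 ≤ q) (hv : 0 ≤ v) (hB : 0 < B) (hs : 0 ≤ s) :
    ofReal (q * v ^ s) ≤ ofReal (B ^ s * q) +
      ∑' j : ℕ, ofReal ((2 * B) ^ s * (2 ^ s) ^ j) *
        (if B * 2 ^ j ≤ v then ofReal q else 0) := by
  rcases lt_or_ge v B with h | h
  · refine le_add_right (ofReal_le_ofReal ?_)
    rw [mul_comm]
    exact mul_le_mul_of_nonneg_right (rpow_le_rpow hv h.le hs) hq
  · obtain ⟨j, j1, j2⟩ := exists_nat_pow_near ((one_le_div hB).2 h) one_lt_two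
    rw [le_div_iff₀ hB] at j1
    rw [div_lt_iff₀ hB] at j2
    refine le_add_left (le_trans ?_ (ENNReal.le_tsum j))
    rw [if_pos (by linarith), ← ofReal_mul (by positivity), mul_comm q]
    refine ofReal_le_ofReal (mul_le_mul_of_nonneg_right ?_ hq)
    rw [← rpow_natCast (2 ^ s), ← rpow_mul zero_le_two, mul_comm s,
      rpow_mul zero_le_two, rpow_natCast, ← mul_rpow (by positivity) (by positivity)]
    exact rpow_le_rpow hv (by rw [pow_succ] at j2; linarith) hs

theorem Loc.tail (h : Loc ρ m σ U G a b c C M) (hδ : 0 < δ) {K : Set (EuT N)}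
    (hK : IsCompact K) (hKO : K ⊆ G ×ˢ Ioo (a + 3 * δ) b) {s : ℝ} (hs : 0 ≤ s)
    (hs' : s < σ + 1 / (m + 1) / m) :
    IntegrableOn (fun p => (U p ^ m) ^ (1 + 1 / m + s)) K := by
  obtain ⟨A, hA, H⟩ := h.tail_le hδ hK hKO
  set e := σ + 1 / (m + 1) / m with he
  set B := 8 ^ (m + 1) * M with hB
  have hB0 : 0 < B := mul_pos (by positivity) (by linarith [h.M_ge])
  have v0 : ∀ p, 0 ≤ U p ^ m := fun p => rpow_nonneg (h.nonneg p) m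
  have q0 : ∀ p, 0 ≤ U p * U p ^ m := fun p => mul_nonneg (h.nonneg p) (v0 p)
  have hq : ∀ p, (U p ^ m) ^ (1 + 1 / m + s) = U p * U p ^ m * (U p ^ m) ^ s := fun p => by
    have hm := h.hm
    rw [Real.rpow_add' (v0 p) (by positivity), Real.rpow_add' (v0 p) (by positivity),
      rpow_one, ← rpow_mul (h.nonneg p), mul_one_div_cancel (by linarith), rpow_one,
      mul_comm (U p)]
  have mV : Measurable fun p => U p ^ m := h.meas.pow_const m
  have mQ : Measurable fun p => U p * U p ^ m := h.meas.mul mV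
  have mW : Measurable fun p => U p * U p ^ m * (U p ^ m) ^ s := mQ.mul (mV.pow_const s)
  simp only [hq]
  refine ⟨mW.aestronglyMeasurable, ?_⟩
  rw [hasFiniteIntegral_iff_ofReal (of_forall fun p =>
    mul_nonneg (q0 p) (rpow_nonneg (v0 p) _))]
  have mS : ∀ j : ℕ, Measurable fun p => if B * 2 ^ j ≤ U p ^ m then
      ofReal (U p * U p ^ m) else 0 := fun j =>
    Measurable.ite (measurableSet_le measurable_const mV) mQ.ennreal_ofReal measurable_const
  refine lt_of_le_of_lt (lintegral_mono fun p => dyadic_le (q0 p) (v0 p) hB0 hs) ?_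
  rw [lintegral_add_left ((mQ.const_mul _).ennreal_ofReal),
    lintegral_tsum fun j => ((mS j).const_mul _).aemeasurable]
  refine ENNReal.add_lt_top.2 ⟨(h.intQ.integrableOn.const_mul _).lintegral_lt_top, ?_⟩
  set r : ℝ := 2 ^ s * 2 ^ (-e) with hr
  have hr0 : 0 < r := by positivity
  have hr1 : r < 1 := by
    rw [hr, ← rpow_add two_pos]
    exact Real.rpow_lt_one_of_one_lt_of_neg one_lt_two (by linarith)
  have hterm : ∀ j : ℕ, ∫⁻ p in K, ofReal ((2 * B) ^ s * (2 ^ s) ^ j) *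
      (if B * 2 ^ j ≤ U p ^ m then ofReal (U p * U p ^ m) else 0)
      ≤ ofReal ((2 * B) ^ s * A * r ^ j) := by
    intro j
    rw [lintegral_const_mul _ (mS j)]
    have := H (2 ^ j) (one_le_pow₀ one_le_two)
    simp only [indicator_apply, mem_ofPred_eq] at this
    have e1 : (8 : ℝ) ^ (m + 1) * (2 ^ j * M) = B * 2 ^ j := by rw [hB]; ring
    rw [e1] at this
    refine (mul_le_mul_right this _).trans_eq ?_
    rw [← ofReal_mul (by positivity), hr, mul_pow, ← rpow_natCast 2 j,
      ← rpow_mul zero_le_two, mul_comm (j : ℝ), rpow_mul zero_le_two, rpow_natCast]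
    congr 1
    ring
  refine (ENNReal.tsum_le_tsum hterm).trans_lt ?_
  rw [← ENNReal.ofReal_tsum_of_nonneg (fun j => by positivity)
    ((summable_geometric_of_lt_one hr0.le hr1).mul_left _)]
  exact ENNReal.ofReal_lt_top

/-- The primitive vanishing at the origin. -/
def prim (g : ℝ → ℝ) (y : ℝ) : ℝ := ∫ s in 0..y, g s

theorem prim_zero (g : ℝ → ℝ) : prim g 0 = 0 := intervalIntegral.integral_same

theorem hasDerivAt_prim {g : ℝ → ℝ} (hg : Continuous g) (y : ℝ) : HasDerivAt (prim g) (g y) y :=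
  (hg.integral_hasStrictDerivAt 0 y).hasDerivAt

theorem continuous_prim {g : ℝ → ℝ} (hg : Continuous g) : Continuous (prim g) :=
  continuous_iff_continuousAt.2 fun y => (hasDerivAt_prim hg y).continuousAt

theorem prim_nonneg {g : ℝ → ℝ} (h0 : ∀ s, 0 ≤ g s) {y : ℝ} (hy : 0 ≤ y) : 0 ≤ prim g y :=
  intervalIntegral.integral_nonneg hy fun s _ => h0 s

theorem prim_sub_le {g : ℝ → ℝ} (hg : Continuous g) (hm : MonotoneOn g (Ici 0)) {x y : ℝ}
    (hx : 0 ≤ x) (hy : 0 ≤ y) : prim g x - prim g y ≤ g x * (x - y) := by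
  have i := fun u v => hg.intervalIntegrable (μ := volume) u v
  rw [prim, prim, intervalIntegral.integral_interval_sub_left (i _ _) (i _ _)]
  rcases le_total y x with h | h
  · refine (intervalIntegral.integral_mono_on h (i _ _) intervalIntegrable_const
      fun s hs => hm (mem_Ici.2 (hy.trans hs.1)) hx hs.2).trans_eq ?_
    simp [mul_comm]
  · rw [intervalIntegral.integral_symm]
    have := intervalIntegral.integral_mono_on h intervalIntegrable_const (i _ _)
      fun s hs => hm hx (mem_Ici.2 (hx.trans hs.1)) hs.1
    simp only [intervalIntegral.integral_const, smul_eq_mul] at this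
    linarith

theorem prim_le {g : ℝ → ℝ} (hg : Continuous g) (hm : MonotoneOn g (Ici 0))
    (h1 : ∀ s, g s ≤ 1) {k y : ℝ} (hk : 0 ≤ k) (hz : ∀ s, 0 ≤ s → s ≤ k → g s = 0) (hy : 0 ≤ y) :
    prim g y ≤ max (y - k) 0 := by
  have e := prim_sub_le hg hm hk le_rfl
  rw [prim_zero, hz k hk le_rfl] at e
  rcases le_total y k with h | h
  · have := prim_sub_le hg hm hy le_rfl
    rw [prim_zero, hz y hy h] at this
    exact le_max_of_le_right (by linarith)
  · have := prim_sub_le hg hm hy hk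
    exact le_max_of_le_left (by nlinarith [h1 y])

theorem le_prim {g : ℝ → ℝ} (hg : Continuous g) (hm : MonotoneOn g (Ici 0)) (h0 : ∀ s, 0 ≤ g s)
    {k y : ℝ} (hk : 0 ≤ k) (h1 : g k = 1) (hy : 0 ≤ y) : max (y - k) 0 ≤ prim g y := by
  have := prim_sub_le hg hm hk hy
  rw [h1] at this
  exact max_le (by linarith [prim_nonneg h0 hk]) (prim_nonneg h0 hy)

theorem abs_prim_sub_le {g : ℝ → ℝ} (hg : Continuous g) (hm : MonotoneOn g (Ici 0))
    (h0 : ∀ s, 0 ≤ g s) (h1 : ∀ s, g s ≤ 1) {x y : ℝ} (hx : 0 ≤ x) (hy : 0 ≤ y) :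
    |prim g x - prim g y| ≤ |x - y| := by
  have e : ∀ s t : ℝ, g s * t ≤ |t| := fun s t =>
    (mul_le_mul_of_nonneg_left (le_abs_self t) (h0 s)).trans
      (mul_le_of_le_one_left (abs_nonneg t) (h1 s))
  refine abs_le.2 ⟨?_, (prim_sub_le hg hm hx hy).trans (e _ _)⟩
  have := (prim_sub_le hg hm hy hx).trans (e _ _)
  rw [abs_sub_comm y x] at this
  linarith

theorem prim_smooth {g : ℝ → ℝ} (hg : Sm g) : Sm (prim g) := by
  have hc : Continuous g := hg.cont
  refine contDiff_infty_iff_deriv.2 ⟨fun y => (hasDerivAt_prim hc y).differentiableAt, ?_⟩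
  rwa [funext fun y => (hasDerivAt_prim hc y).deriv]

/-- Kato's inequality for limits of smooth functions. -/
theorem kato_limit {w F ψ : EuT N → ℝ} {g : ℝ → ℝ} (hw : Integrable w) (w0 : ∀ p, 0 ≤ w p)
    (hF : Integrable F) (hψ : Sm ψ) (hc : HasCompactSupport ψ) (ψ0 : ∀ p, 0 ≤ ψ p)
    (hg : Sm g) (hm : Monotone g) (h0 : ∀ s, 0 ≤ g s) (h1 : ∀ s, g s ≤ 1)
    (hlap : ∀ᶠ n in atTop, ∀ p ∈ tsupport ψ, lapS eX (mo volume n w) p = mo volume n F p) :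
    ∫ p, g (w p) * F p * ψ p ≤ ∫ p, prim g (w p) * lapS eX ψ p := by
  have cg : Continuous g := hg.cont
  have cψ : Continuous ψ := hψ.cont
  have cl : Continuous (lapS eX ψ) := (Sm.lapS hψ eX).cont
  obtain ⟨B, hB⟩ := exists_bound_of_compact cψ hc
  obtain ⟨D, hD⟩ := exists_bound_of_compact cl (HasCompactSupport.lapS hc eX)
  have cw : ∀ n, Continuous (mo volume n w) := fun n =>
    (mo_smooth n hw.locallyIntegrable).cont
  have cF : ∀ n, Continuous (mo volume n F) := fun n =>
    (mo_smooth n hF.locallyIntegrable).cont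
  have cp := continuous_prim cg
  have pw : ∀ y, 0 ≤ y → |prim g y| ≤ y := fun y hy => by
    simpa [prim_zero, abs_of_nonneg hy] using abs_prim_sub_le cg (hm.monotoneOn _) h0 h1 hy le_rfl
  have B0 : 0 ≤ B := (abs_nonneg _).trans (hB 0)
  have D0 : 0 ≤ D := (abs_nonneg _).trans (hD 0)
  have c1 : ∀ n, Continuous fun p => g (mo volume n w p) * mo volume n F p * ψ p := fun n =>
    ((cg.comp (cw n)).mul (cF n)).mul cψ
  have c2 : ∀ n, Continuous fun p => prim g (mo volume n w p) * lapS eX ψ p := fun n =>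
    (cp.comp (cw n)).mul cl
  have L1 := (tendsto_integral_of_le_mo (H := fun p => B * |F p|)
    (f := fun n p => g (mo volume n w p) * mo volume n F p * ψ p)
    (g := fun p => g (w p) * F p * ψ p) (fun n => (c1 n).aestronglyMeasurable)
    (((cg.comp_aestronglyMeasurable hw.1).mul hF.1).mul cψ.aestronglyMeasurable)
    (hF.abs.const_mul B) (fun p => mul_nonneg B0 (abs_nonneg _))
    (of_forall fun n p => ?_) ?_).2
  rotate_left
  · rw [mo_const_mul, abs_mul, abs_mul, abs_of_nonneg (h0 _), mul_comm B]
    exact mul_le_mul ((mul_le_of_le_one_left (abs_nonneg _) (h1 _)).trans (mo_abs_le n p)) (hB p)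
      (abs_nonneg _) (mo_nonneg n (fun _ => abs_nonneg _) p)
  · filter_upwards [mo_ae hw.locallyIntegrable, mo_ae hF.locallyIntegrable] with p p1 p2
    exact (((cg.tendsto _).comp p1).mul p2).mul_const _
  have L2 := (tendsto_integral_of_le_mo (H := fun p => D * w p)
    (f := fun n p => prim g (mo volume n w p) * lapS eX ψ p)
    (g := fun p => prim g (w p) * lapS eX ψ p) (fun n => (c2 n).aestronglyMeasurable)
    ((cp.comp_aestronglyMeasurable hw.1).mul cl.aestronglyMeasurable)
    (hw.const_mul D) (fun p => mul_nonneg D0 (w0 p))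
    (of_forall fun n p => ?_) ?_).2
  rotate_left
  · rw [mo_const_mul, abs_mul, mul_comm D]
    exact mul_le_mul (pw _ (mo_nonneg n w0 p)) (hD p) (abs_nonneg _) (mo_nonneg n w0 p)
  · filter_upwards [mo_ae hw.locallyIntegrable] with p p1
    exact ((cp.tendsto _).comp p1).mul_const _
  refine le_of_tendsto_of_tendsto L1 L2 (hlap.mono fun n hn => ?_)
  have sw := mo_smooth n hw.locallyIntegrable
  have sp : Sm fun p => prim g (mo volume n w p) := ContDiff.comp (prim_smooth hg) sw
  have key := integral_mul_lapS (μ := volume) hψ sp hc (eX (N := N))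
  have e1 : ∫ p, prim g (mo volume n w p) * lapS eX ψ p
      = ∫ p, ψ p * lapS eX (fun p => prim g (mo volume n w p)) p := by
    rw [key]
    exact integral_congr_ae (of_forall fun p => mul_comm _ _)
  beta_reduce
  rw [e1]
  refine integral_mono ((c1 n).integrable_of_hasCompactSupport hc.mul_left)
    ((cψ.mul (Sm.lapS sp eX).cont).integrable_of_hasCompactSupport hc.mul_right)
    fun p => ?_
  by_cases hp : p ∈ tsupport ψ
  · have d1 : deriv (prim g) = g := funext fun y => (hasDerivAt_prim cg y).deriv
    have e2 := lapS_scomp sw (prim_smooth hg) (eX (N := N)) p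
    rw [d1, hn p hp] at e2
    simp only [e2]
    have : 0 ≤ deriv g (mo volume n w p) * ∑ i, Dv (eX i) (mo volume n w) p ^ 2 :=
      mul_nonneg (hm.deriv_nonneg) (sum_nonneg fun i _ => sq_nonneg _)
    nlinarith [ψ0 p]
  · simp [image_eq_zero_of_notMem_tsupport hp]

/-- Smooth truncation of the pressure-like variable. -/
def trH (k d : ℝ) : ℝ → ℝ := prim (ramp k d)

/-- Smooth truncation of the density, conjugate to `trH`. -/
def trF (m k d : ℝ) : ℝ → ℝ := prim fun s => ramp k d (s ^ m)

theorem ramp_monotone {k d : ℝ} (hd : 0 < d) : Monotone (ramp k d) :=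
  monotone_of_deriv_nonneg ((ramp_smooth (a := k) (δ := d)).differentiable (by simp))
    (ramp_deriv_nonneg hd)

theorem ramp_continuous (k d : ℝ) : Continuous (ramp k d) :=
  (ramp_smooth (a := k) (δ := d)).cont

theorem ramp_rpow_continuous (hm : 1 < m) (k d : ℝ) : Continuous fun s : ℝ => ramp k d (s ^ m) :=
  (ramp_continuous k d).comp (Real.continuous_rpow_const (by linarith))

theorem ramp_rpow_monotone (hm : 1 < m) {k d : ℝ} (hd : 0 < d) :
    MonotoneOn (fun s : ℝ => ramp k d (s ^ m)) (Ici 0) := fun _ hx _ _ hxy =>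
  ramp_monotone hd (rpow_le_rpow hx hxy (by linarith))

theorem mul_sub_le_mul {x e y L o : ℝ} (hL : 0 ≤ L) (ho : 0 ≤ o) (h : x * e ≤ o)
    (h1 : 0 ≤ e → 0 ≤ y ∧ y ≤ L * e) (h2 : e ≤ 0 → L * e ≤ y ∧ y ≤ 0) : x * y ≤ L * o := by
  have hLo := mul_nonneg hL ho
  have hx := mul_le_mul_of_nonneg_left h hL
  rcases le_total 0 e with he | he <;> rcases le_total 0 x with hx0 | hx0
  · nlinarith [h1 he]
  · nlinarith [h1 he]
  · nlinarith [h2 he]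
  · nlinarith [h2 he]

theorem kato_pointwise {r C g l L m B D φ o Φ Φb layer ψ Δ H Hb U u v vb : ℝ} (hr : 0 ≤ r)
    (hrC : r ≤ C) (hl : 1 ≤ l) (hL : 0 ≤ L) (hφ : 0 ≤ φ) (hφ1 : φ ≤ 1) (ho : 0 ≤ o)
    (hΦ : Φ - Φb ≤ φ * (U - u) + L * o) (hly : 0 ≤ layer) (hlg : layer ≤ g / l)
    (hψ : 0 ≤ ψ) (hψB : ψ ≤ B) (hΔ : |Δ| ≤ D) (hH : |Hb - H| ≤ |vb - v|)
    (hv0 : 0 ≤ v) (hvb0 : 0 ≤ vb) (hm : 0 ≤ m)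
    (hv : |vb - v| ≤ l * o + m / (2 * l) * (v + vb + 1)) :
    l * (r * Φ * ψ) - l * (r * Φb * ψ) - H * Δ
      ≤ φ * (l * (r * U - r * u) - r * layer) * ψ - Hb * Δ
        + ((B * L * C + D) * (l * o) + (B * C * g + D * m) / l * (v + vb + 1)) := by
  have hl0 : 0 < l := by linarith
  have hC : 0 ≤ C := hr.trans hrC
  have hB : 0 ≤ B := hψ.trans hψB
  have hD : 0 ≤ D := (abs_nonneg _).trans hΔ
  have a1 : (Hb - H) * Δ ≤ D * (l * o + m / (2 * l) * (v + vb + 1)) := by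
    rw [mul_comm D]
    refine (le_abs_self _).trans ?_
    rw [abs_mul]
    exact mul_le_mul (hH.trans hv) hΔ (abs_nonneg _) (by positivity)
  have a2 : m / (2 * l) ≤ m / l := by gcongr; linarith
  have a3 : D * (m / (2 * l) * (v + vb + 1)) ≤ D * (m / l * (v + vb + 1)) := by gcongr
  have a4 : r * ψ ≤ C * B := mul_le_mul hrC hψB hψ hC
  have a0 : 0 ≤ r * ψ := mul_nonneg hr hψ
  have a5 : r * ψ * (φ * layer) ≤ C * B * (g / l * (v + vb + 1)) := by
    refine mul_le_mul a4 ?_ (by positivity) (by positivity)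
    have : φ * layer ≤ layer := mul_le_of_le_one_left hly hφ1
    nlinarith [hly.trans hlg]
  have a6 : l * (r * ψ) * (Φ - Φb) ≤ l * (r * ψ) * (φ * (U - u) + L * o) :=
    mul_le_mul_of_nonneg_left hΦ (by positivity)
  have a7 : r * ψ * (l * L * o) ≤ C * B * (l * L * o) := mul_le_mul_of_nonneg_right a4 (by positivity)
  have e : (B * C * g + D * m) / l * (v + vb + 1)
      = C * B * (g / l * (v + vb + 1)) + D * (m / l * (v + vb + 1)) := by ring
  rw [e]
  linarith

theorem Loc.kato (h : Loc ρ m σ U G a b c C M) (hδ : 0 < δ) {α : ℝ} (hα : 1 < α)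
    (hdec : Decay m U a δ (G ×ˢ Ioo (a + 3 * δ) b) α) {k d : ℝ} (hd : 0 < d) :
    SubPair (G ×ˢ Ioo (a + 3 * δ) b) (fun p => ρ p.1 * trF m k d (U p))
      fun p => trH k d (U p ^ m) := by
  intro ψ sψ cψ hs ψ0
  have hm := h.hm
  have hr0 : ∀ x, 0 ≤ ρ x := fun x => h.c_pos.le.trans (h.le_ρ x)
  have v0 : ∀ p, 0 ≤ U p ^ m := fun p => rpow_nonneg (h.nonneg p) m
  have r0 := ramp_nonneg (a := k) (δ := d)
  have r1 := ramp_le_one (a := k) (δ := d)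
  have rc := ramp_continuous k d
  have fc := ramp_rpow_continuous hm k d
  have fm := ramp_rpow_monotone hm (k := k) hd
  obtain ⟨L, hL0, hL⟩ := exists_ramp_deriv_le (a := k) hd
  have lip : ∀ x y, x ≤ y → ramp k d y - ramp k d x ≤ L * (y - x) := fun x y hxy =>
    image_sub_le_mul_sub_of_deriv_le ((ramp_smooth (a := k) (δ := d)).differentiable (by simp)) hL hxy
  have F0 : ∀ p, 0 ≤ trF m k d (U p) := fun p => prim_nonneg (fun s => r0 _) (h.nonneg p)
  have F1 : ∀ p, |trF m k d (U p)| ≤ U p := fun p => by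
    simpa [trF, prim_zero, abs_of_nonneg (h.nonneg p)] using
      abs_prim_sub_le fc fm (fun s => r0 _) (fun s => r1 _) (h.nonneg p) le_rfl
  have H1 : ∀ y, 0 ≤ y → |trH k d y| ≤ y := fun y hy => by
    simpa [trH, prim_zero, abs_of_nonneg hy] using
      abs_prim_sub_le rc ((ramp_monotone hd).monotoneOn _) r0 r1 hy le_rfl
  have iF : Integrable fun p => trF m k d (U p) :=
    h.intU.mono' ((continuous_prim fc).measurable.comp h.meas).aestronglyMeasurable
      (of_forall F1)
  have iH : ∀ w : EuT N → ℝ, Integrable w → (∀ p, 0 ≤ w p) → Integrable fun p => trH k d (w p) :=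
    fun w hw w0 => hw.mono' ((continuous_prim rc).comp_aestronglyMeasurable hw.1)
      (of_forall fun p => H1 _ (w0 p))
  have sd := Sm.dv sψ (eT (N := N))
  have cd : HasCompactSupport (Dv eT ψ) := cψ.dv _
  have sdd := Sm.dv sd (eT (N := N))
  have cdd : HasCompactSupport (Dv eT (Dv eT ψ)) := cd.dv _
  have kψ := sψ.cont
  have kd := sd.cont
  have kl := (Sm.lapS sψ (eX (N := N))).cont
  have cl : HasCompactSupport (lapS eX ψ) := HasCompactSupport.lapS cψ eX
  obtain ⟨B, hB⟩ := exists_bound_of_compact kψ cψ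
  obtain ⟨D, hD⟩ := exists_bound_of_compact kl cl
  obtain ⟨E, hE⟩ := exists_bound_of_compact sdd.cont cdd
  have hK : IsCompact (tsupport ψ) := cψ
  have mK := hK.measurableSet
  obtain ⟨A, hA, HA⟩ := hdec _ hK hs
  obtain ⟨g, hg0, hg⟩ := h.layer_le hδ
  have B0 : 0 ≤ B := (abs_nonneg _).trans (hB 0)
  have D0 : 0 ≤ D := (abs_nonneg _).trans (hD 0)
  have hC0 : 0 ≤ C := by linarith [h.C_ge]
  have iV := h.intV
  have iVH := iH _ iV v0
  have late : ∀ p ∈ tsupport ψ, a + 2 * δ ≤ p.2 := fun p hp => by linarith [(hs hp).2.1]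
  set I := (∫ p, ρ p.1 * trF m k d (U p) * Dv eT ψ p) + ∫ p, trH k d (U p ^ m) * lapS eX ψ p with hI
  set P := (B * C * g + D * m) * (2 * (∫ p, U p ^ m) + volume.real (tsupport ψ))
    + E * C * ∫ p, trF m k d (U p) with hP
  set Q := (B * L * C + D) * A with hQ
  have main : ∀ l : ℝ, 1 ≤ l → 0 ≤ I + (P * l⁻¹ + Q * l ^ (-(α - 1))) := by
    intro l hl
    have hl0 : 0 < l := by linarith
    set vb := av l (ramp a δ) fun q => U q ^ m with hvb
    set ub := av l (ramp a δ) U with hub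
    set Fb := av l (ramp a δ) fun q => trF m k d (U q) with hFb
    have iu : Integrable ub := av_integrable hl0 h.intU
    have iv : Integrable vb := av_integrable hl0 iV
    have ifb : Integrable Fb := av_integrable hl0 iF
    have vb0 : ∀ p, 0 ≤ vb p := av_nonneg ramp_nonneg v0
    have io := h.osc_integrable (δ := δ) hl0
    have iρ1 : Integrable fun p => ρ p.1 * U p - ρ p.1 * ub p := (h.weight h.intU).sub (h.weight iu)
    have iρ2 : Integrable fun p => l * (ρ p.1 * U p - ρ p.1 * ub p) := iρ1.const_mul l
    have iρ3 := h.weight (h.layer_integrable (δ := δ) hl0 hδ)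
    have iρ : Integrable fun p => l * (ρ p.1 * U p - ρ p.1 * ub p) - ρ p.1 * layer l a δ U p :=
      iρ2.sub iρ3
    have key := kato_limit iv vb0 iρ sψ cψ ψ0 (ramp_smooth (a := k) (δ := d)) (ramp_monotone hd)
      r0 r1 (by
        filter_upwards [h.relax hl0 hδ hK hs] with n hn p hp
        rw [mo_sub n iρ2.locallyIntegrable iρ3.locallyIntegrable, mo_const_mul,
          mo_sub n (h.weight h.intU).locallyIntegrable (h.weight iu).locallyIntegrable]
        exact (hn ψ sψ cψ le_rfl).lap_Vb p hp)
    have j1 := integrable_mul_of_compact (h.weight iF) kψ cψ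
    have j2 := integrable_mul_of_compact (h.weight ifb) kψ cψ
    have j3 := integrable_mul_of_compact iVH kl cl
    have j4 : Integrable fun p => prim (ramp k d) (vb p) * lapS eX ψ p :=
      integrable_mul_of_compact (iH _ iv vb0) kl cl
    have j5' := integrable_mul_of_compact iρ kψ cψ
    have j5 : Integrable fun p => ramp k d (vb p) *
        (l * (ρ p.1 * U p - ρ p.1 * ub p) - ρ p.1 * layer l a δ U p) * ψ p := by
      simp only [mul_assoc (ramp k d _)]
      exact j5'.bdd_mul (c := 1) (rc.comp_aestronglyMeasurable iv.1)
        (of_forall fun p => by rw [norm_eq_abs, abs_of_nonneg (r0 _)]; exact r1 _)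
    have j1l := j1.const_mul l
    have j2l := j2.const_mul l
    have j12 : Integrable fun p => l * (ρ p.1 * trF m k d (U p) * ψ p) - l * (ρ p.1 * Fb p * ψ p) :=
      j1l.sub j2l
    have j54 : Integrable fun p => ramp k d (vb p) *
        (l * (ρ p.1 * U p - ρ p.1 * ub p) - ρ p.1 * layer l a δ U p) * ψ p
        - prim (ramp k d) (vb p) * lapS eX ψ p := j5.sub j4
    have ivv : Integrable fun p => U p ^ m + vb p := iV.add iv
    have i1 : IntegrableOn (fun _ => (1 : ℝ)) (tsupport ψ) := integrableOn_const hK.measure_lt_top.ne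
    have ivv1 : IntegrableOn (fun p => U p ^ m + vb p + 1) (tsupport ψ) := ivv.integrableOn.add i1
    have io1 := (io.integrableOn (s := tsupport ψ)).const_mul l
    have io2 := io1.const_mul (B * L * C + D)
    have ivv2 := ivv1.const_mul ((B * C * g + D * m) / l)
    have jR : IntegrableOn (fun p => (B * L * C + D) * (l * osc l (ramp a δ) m U p)
        + (B * C * g + D * m) / l * (U p ^ m + vb p + 1)) (tsupport ψ) := io2.add ivv2
    have step : (∫ p, ((l * (ρ p.1 * trF m k d (U p) * ψ p) - l * (ρ p.1 * Fb p * ψ p))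
        - trH k d (U p ^ m) * lapS eX ψ p)) ≤ ∫ p, ((ramp k d (vb p) *
        (l * (ρ p.1 * U p - ρ p.1 * ub p) - ρ p.1 * layer l a δ U p) * ψ p
        - prim (ramp k d) (vb p) * lapS eX ψ p) + (tsupport ψ).indicator
          (fun p => (B * L * C + D) * (l * osc l (ramp a δ) m U p)
            + (B * C * g + D * m) / l * (U p ^ m + vb p + 1)) p) := by
      refine integral_mono_ae (j12.sub j3) (j54.add ((integrable_indicator_iff mK).2 jR)) ?_
      filter_upwards [h.mix (δ := δ) hl0, hg l hl0,
        avg_slice hl0 (ramp_integrable (a := a) (δ := δ) iF)] with p hp hgp hip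
      by_cases hpK : p ∈ tsupport ψ
      swap
      · have z1 : ψ p = 0 := image_eq_zero_of_notMem_tsupport hpK
        have z2 : lapS eX ψ p = 0 := lapS_eq_zero hpK eX
        simp [z1, z2, hpK]
      rw [indicator_of_mem hpK]
      have sub := hp.mix_with (k := trF m k d) (prim_zero _) hip
        (trF m k d (U p) * (-1) + ramp k d (U p ^ m) * U p) (-ramp k d (U p ^ m)) 0 0 1 fun y hy => by
          have := prim_sub_le fc fm (h.nonneg p) hy
          simp only [trF]
          linarith
      have cross := mul_sub_le_mul (y := ramp k d (U p ^ m) - ramp k d (vb p)) hL0 hp.osc_nonneg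
        hp.mul_sub_le_osc
        (fun he => ⟨sub_nonneg.2 (ramp_monotone hd (by linarith)), lip _ _ (by linarith)⟩)
        (fun he => ⟨by linarith [lip (U p ^ m) (vb p) (by linarith)],
          sub_nonpos.2 (ramp_monotone hd (by linarith))⟩)
      have f1 := hp.flux one_pos hl0 (1 / 2)
      have f2 := hp.flux one_pos hl0 (-1 / 2)
      rw [Real.one_rpow] at f1 f2
      refine kato_pointwise (hr0 _) (h.ρ_le _) hl hL0 (r0 _) (r1 _) hp.osc_nonneg ?_
        (layer_nonneg hδ h.nonneg p) hgp (ψ0 p) ((le_abs_self _).trans (hB p)) (hD p)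
        (abs_prim_sub_le rc ((ramp_monotone hd).monotoneOn _) r0 r1 (vb0 p) (v0 p))
        (v0 p) (vb0 p) (by linarith) ?_
      · linarith
      · have e : m / (2 * l) = 2 * m * (1 / 2) ^ 2 / l := by field_simp
        have e' : (-1 / 2 : ℝ) ^ 2 = (1 / 2) ^ 2 := by norm_num
        rw [e'] at f2
        rw [e, abs_le]
        constructor <;> linarith
    rw [integral_sub j12 j3, integral_sub j1l j2l, integral_const_mul, integral_const_mul,
      integral_add j54 ((integrable_indicator_iff mK).2 jR), integral_sub j5 j4,
      integral_indicator mK, integral_add io2 ivv2, integral_const_mul, integral_const_mul,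
      integral_const_mul, integral_add ivv.integrableOn i1, integral_const,
      measureReal_restrict_apply_univ, smul_eq_mul, mul_one] at step
    have t1 := h.avg_weight_dt hl0 hδ iF sψ cψ late
    have t2 := h.avg_weight_dt hl0 hδ iF sd cd fun p hp => late p (tsupport_dv_subset _ _ hp)
    have t3 : |∫ p, ρ p.1 * Fb p * Dv eT (Dv eT ψ) p| ≤ E * C * ∫ p, trF m k d (U p) := by
      rw [← norm_eq_abs]
      refine (norm_integral_le_of_norm_le (ifb.const_mul (E * C))
        (of_forall fun p => ?_)).trans ?_
      · have : 0 ≤ Fb p := av_nonneg ramp_nonneg F0 p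
        rw [norm_eq_abs, abs_mul, abs_mul, abs_of_nonneg (hr0 _), abs_of_nonneg this, mul_comm,
          mul_assoc E]
        exact mul_le_mul (hE p) (mul_le_mul_of_nonneg_right (h.ρ_le _) this) (by
          have := hr0 p.1; positivity) ((abs_nonneg _).trans (hE p))
      · rw [integral_const_mul]
        exact mul_le_mul_of_nonneg_left (integral_av_le hl0 iF F0)
          (mul_nonneg ((abs_nonneg _).trans (hE 0)) hC0)
    have t4 : ∫ p in tsupport ψ, (U p ^ m + vb p) ≤ 2 * ∫ p, U p ^ m := by
      refine (setIntegral_le_integral ivv (of_forall fun p =>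
        add_nonneg (v0 p) (vb0 p))).trans ?_
      rw [integral_add iV iv]
      linarith [integral_av_le (a := a) (δ := δ) hl0 iV v0]
    have t5 : l * l ^ (-α) = l ^ (-(α - 1)) := by
      rw [neg_sub, sub_eq_add_neg, Real.rpow_one_add' hl0.le (by linarith)]
    have t6 := mul_le_mul_of_nonneg_left (mul_le_mul_of_nonneg_left (HA l hl) hl0.le)
      (by positivity : 0 ≤ B * L * C + D)
    have t7 := mul_le_mul_of_nonneg_left (add_le_add_left t4 (volume.real (tsupport ψ)))
      (by positivity : 0 ≤ (B * C * g + D * m) / l)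
    have t8 : (∫ p, ρ p.1 * Fb p * Dv eT ψ p) ≤ (∫ p, ρ p.1 * trF m k d (U p) * Dv eT ψ p)
        + (E * C * ∫ p, trF m k d (U p)) / l := by
      have := (le_abs_self _).trans t3
      rw [t2, ← mul_sub] at this
      rw [← sub_le_iff_le_add', le_div_iff₀ hl0]
      linarith
    have t9 : (B * L * C + D) * (l * (A * l ^ (-α))) = Q * l ^ (-(α - 1)) := by
      rw [hQ, ← t5]
      ring
    have t10 : P * l⁻¹ = (B * C * g + D * m) / l * (2 * (∫ p, U p ^ m) + volume.real (tsupport ψ))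
        + (E * C * ∫ p, trF m k d (U p)) / l := by
      rw [hP]
      ring
    simp only [trH] at step hI
    linarith
  have lim : Tendsto (fun l : ℝ => I + (P * l⁻¹ + Q * l ^ (-(α - 1)))) atTop
      (𝓝 (I + (P * 0 + Q * 0))) :=
    ((tendsto_inv_atTop_zero.const_mul P).add
      ((tendsto_rpow_neg_atTop (by linarith)).const_mul Q)).const_add I
  have := ge_of_tendsto lim ((eventually_ge_atTop 1).mono main)
  rw [mul_zero, mul_zero, add_zero, add_zero, hI] at this
  rwa [integral_add (integrable_mul_of_compact (h.weight iF) kd cd)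
    (integrable_mul_of_compact iVH kl cl)]

/-- Away from the origin, solutions on cylinders can be localised. -/
theorem Sol.exists_loc {Cw α s0 s1 : ℝ} {B : Set (Eu N)} (hm : 1 < m) (hW : Wt N ρ Cw α)
    (h : Sol ρ m (B ×ˢ Ioo s0 s1) U) (hB : IsOpen B) (hs : s0 < s1)
    (hM : ∀ᵐ x, ∫⁻ t, ofReal (U (x, t) ^ m) ≤ ofReal M) (h0 : 0 ≤ σ) (h1 : σ ≤ 1)
    (hS : ∀ K, IsCompact K → K ⊆ (B \ {0}) ×ˢ Ioo s0 s1 →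
      IntegrableOn (fun p => (U p ^ m) ^ (1 + 1 / m + σ)) K)
    {K : Set (EuT N)} (hK : IsCompact K) (hKO : K ⊆ (B \ {0}) ×ˢ Ioo s0 s1) :
    ∃ (ρ' : Eu N → ℝ) (U' : EuT N → ℝ) (G : Set (Eu N)) (a b δ c C M' : ℝ), 0 < δ ∧
      Loc ρ' m σ U' G a b c C M' ∧ K ⊆ G ×ˢ Ioo (a + 3 * δ) b ∧
      (∀ p ∈ G ×ˢ Ioo a b, U' p = U p) ∧ ∀ x ∈ G, ρ' x = ρ x := by
  obtain ⟨L, hL, hKL, hLB⟩ := exists_compact_between (hK.image continuous_fst)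
    (hB.sdiff isClosed_singleton) (U := B \ {0}) (by rintro _ ⟨p, hp, rfl⟩; exact (hKO hp).1)
  have hT : IsCompact (insert ((s0 + s1) / 2) (Prod.snd '' K)) := (hK.image continuous_snd).insert _
  have hTs : insert ((s0 + s1) / 2) (Prod.snd '' K) ⊆ Ioo s0 s1 := by
    rw [insert_subset_iff]
    refine ⟨⟨by linarith, by linarith⟩, ?_⟩
    rintro _ ⟨p, hp, rfl⟩
    exact (hKO hp).2
  obtain ⟨t0, ht0, hmin⟩ := hT.exists_isLeast (insert_nonempty _ _)
  obtain ⟨t1, ht1, hmax⟩ := hT.exists_isGreatest (insert_nonempty _ _)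
  have e0 := (hTs ht0).1
  have e1 := (hTs ht1).2
  have e01 := hmin ht1
  obtain ⟨r, hr, hrL⟩ := Metric.isOpen_iff.1 hL.isClosed.isOpen_compl 0 fun h => (hLB h).2 rfl
  obtain ⟨R, hR⟩ := hL.isBounded.subset_ball (0 : Eu N)
  obtain ⟨c, hc, hcρ⟩ := hW.lower R
  obtain ⟨C, hC⟩ := hW.upper r hr
  set a := (s0 + t0) / 2 with ha
  set b := (t1 + s1) / 2 with hb
  have hsub : interior L ×ˢ Ioo a b ⊆ L ×ˢ Icc a b := Set.prod_mono interior_subset Ioo_subset_Icc_self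
  have hLO : L ×ˢ Icc a b ⊆ (B \ {0}) ×ˢ Ioo s0 s1 := Set.prod_mono hLB fun t ht =>
    ⟨by linarith [ht.1], by linarith [ht.2]⟩
  have hO : IsOpen (interior L ×ˢ Ioo a b) := isOpen_interior.prod isOpen_Ioo
  have hLc : IsCompact (L ×ˢ Icc a b) := hL.prod isCompact_Icc
  obtain ⟨hs', i1, i2⟩ := h.restrict hm hO hLc hsub
    (hLO.trans (Set.prod_mono sdiff_subset Subset.rfl))
  have hρ : ∀ x ∈ interior L, max c (min (ρ x) (max (max 1 c) C)) = ρ x := fun x hx => by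
    have hx := interior_subset hx
    rw [min_eq_left ((hC x (by
      by_contra hxr
      exact hrL (mem_ball_zero_iff.2 (not_le.1 hxr)) hx)).trans (le_max_right _ _)),
      max_eq_right (hcρ x (hR hx))]
  refine ⟨fun x => max c (min (ρ x) (max (max 1 c) C)), (interior L ×ˢ Ioo a b).indicator U,
    interior L, a, b, (t0 - s0) / 12, c, max (max 1 c) C, max 1 M, by linarith,
    ⟨hm, h0, h1, measurable_const.max (hW.meas.min measurable_const), hc, fun _ => le_max_left _ _,
      fun _ => max_le ((le_max_right _ _).trans (le_max_left _ _)) (min_le_right _ _),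
      (le_max_left _ _).trans (le_max_left _ _), le_max_left _ _, by linarith, isOpen_interior,
      (measure_mono hsub).trans_lt hLc.measure_lt_top, hs'.meas, hs'.nonneg,
      fun p hp => indicator_of_notMem hp U,
      hs'.pair.congr (of_forall fun p hp => by simp only [hρ p.1 hp.1])
        (of_forall fun p hp => rfl), ?_, ?_⟩, fun p hp => ⟨hKL ⟨p, hp, rfl⟩, ?_, ?_⟩,
    fun p hp => indicator_of_mem hp U, hρ⟩
  · filter_upwards [hM] with x hx
    refine (lintegral_mono fun t => ?_).trans
      (hx.trans (ofReal_le_ofReal (le_max_right 1 M)))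
    exact ofReal_le_ofReal (rpow_le_rpow (hs'.nonneg _)
      (indicator_le_self' (fun _ _ => h.nonneg _) _) (by linarith))
  · have e : (fun p => ((interior L ×ˢ Ioo a b).indicator U p ^ m) ^ (1 + 1 / m + σ))
        = (interior L ×ˢ Ioo a b).indicator fun p => (U p ^ m) ^ (1 + 1 / m + σ) := by
      have : 1 + 1 / m + σ ≠ 0 := by positivity
      ext p; by_cases hp : p ∈ interior L ×ˢ Ioo a b
      · simp only [indicator_of_mem hp]
      · simp only [indicator_of_notMem hp, zero_rpow (by linarith : m ≠ 0), zero_rpow this]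
    rw [e, integrable_indicator_iff hO.measurableSet]
    exact (hS _ hLc hLO).mono_set hsub
  · have := hmin (mem_insert_of_mem _ ⟨p, hp, rfl⟩)
    linarith
  · have := hmax (mem_insert_of_mem _ ⟨p, hp, rfl⟩)
    linarith

/-- Truncations of a solution are subsolutions away from the origin. -/
theorem Sol.kato {Cw α s0 s1 : ℝ} {B : Set (Eu N)} (hm : 1 < m) (hW : Wt N ρ Cw α)
    (h : Sol ρ m (B ×ˢ Ioo s0 s1) U) (hB : IsOpen B) (hs : s0 < s1)
    (hM : ∀ᵐ x, ∫⁻ t, ofReal (U (x, t) ^ m) ≤ ofReal M)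
    (hS : IntegrableOn (fun p => U p ^ (m + 1)) (B ×ˢ Ioo s0 s1)) {k d : ℝ} (hd : 0 < d) :
    SubPair ((B \ {0}) ×ˢ Ioo s0 s1) (fun p => ρ p.1 * trF m k d (U p))
      fun p => trH k d (U p ^ m) := by
  have hβ : 0 < 1 / (m + 1) / m := by positivity
  have key : ∀ j : ℕ, ∀ K, IsCompact K → K ⊆ (B \ {0}) ×ˢ Ioo s0 s1 →
      IntegrableOn (fun p => (U p ^ m) ^ (1 + 1 / m + min 1 (j * (1 / (m + 1) / m / 2)))) K := by
    intro j
    induction j with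
    | zero =>
      intro K hK hKO
      have e : m * (1 + 1 / m) = m + 1 := by field_simp
      simp only [Nat.cast_zero, zero_mul, min_eq_right zero_le_one, add_zero,
        ← rpow_mul (h.nonneg _), e]
      exact hS.mono_set (hKO.trans (Set.prod_mono sdiff_subset Subset.rfl))
    | succ j ih =>
      intro K hK hKO
      obtain ⟨ρ', U', G, a, b, δ, c, C, M', hδ, hL, hKG, hU, -⟩ :=
        h.exists_loc hm hW hB hs hM (by positivity) (min_le_left _ _) ih hK hKO
      refine (hL.tail hδ hK hKG (s := min 1 ((j + 1 : ℕ) * (1 / (m + 1) / m / 2)))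
        (by positivity) ?_).congr_fun (fun p hp => ?_) hK.measurableSet
      · push_cast
        rw [min_add]
        exact lt_min (min_lt_of_left_lt (by linarith)) (min_lt_of_right_lt (by linarith))
      · beta_reduce
        rw [hU p ⟨(hKG hp).1, by linarith [(hKG hp).2.1], (hKG hp).2.2⟩]
  obtain ⟨j, hj⟩ := exists_nat_ge (1 / (1 / (m + 1) / m / 2))
  rw [div_le_iff₀ (by positivity)] at hj
  have key := key j
  rw [min_eq_left hj] at key
  intro ψ sψ cψ hψ ψ0
  obtain ⟨ρ', U', G, a, b, δ, c, C, M', hδ, hL, hKG, hU, hρ⟩ :=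
    h.exists_loc hm hW hB hs hM zero_le_one le_rfl key cψ hψ
  have hsub : G ×ˢ Ioo (a + 3 * δ) b ⊆ G ×ˢ Ioo a b :=
    Set.prod_mono Subset.rfl (Ioo_subset_Ioo_left (by linarith))
  exact (hL.kato (k := k) hδ (by linarith) (hL.decay hδ) hd).congr
    (of_forall fun p hp => by simp only [hρ _ hp.1, hU _ (hsub hp)])
    (of_forall fun p hp => by simp only [hU _ (hsub hp)]) ψ sψ cψ hKG ψ0

theorem Dv_scale {Z : Eu N → ℝ} (hZ : Sm Z) (k : ℝ) (e y : Eu N) :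
    Dv e (fun y => Z (k • y)) y = k * Dv e Z (k • y) := by
  have := Dv_lin hZ (k • ContinuousLinearMap.id ℝ (Eu N)) e y
  simpa [Dv] using this

theorem lapS_scale {Z : Eu N → ℝ} (hZ : Sm Z) (k : ℝ) (y : Eu N) :
    lapS eB (fun y => Z (k • y)) y = k ^ 2 * lapS eB Z (k • y) := by
  simp only [lapS, mul_sum]
  refine sum_congr rfl fun i _ => ?_
  have hd : Sm fun y => Dv (eB i) Z (k • y) :=
    (Sm.dv hZ _).lin (k • ContinuousLinearMap.id ℝ (Eu N))
  rw [show Dv (eB i) (fun y => Z (k • y)) = fun y => k * Dv (eB i) Z (k • y) from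
    funext fun y => Dv_scale hZ k _ y, Dv_const_mul hd, Dv_scale (Sm.dv hZ _)]
  ring

theorem slab_integral_le {g : EuT N → ℝ} (hg : Integrable g) (g0 : ∀ p, 0 ≤ g p) (hM : 0 ≤ M)
    (slab : ∀ᵐ x, ∫⁻ t, ofReal (g (x, t)) ≤ ofReal M) {S : Set (Eu N)}
    (hv : volume S ≠ ∞) :
    ∫ p in S ×ˢ univ, g p ≤ M * volume.real S := by
  rw [integral_eq_lintegral_of_nonneg_ae (of_forall g0) hg.1.restrict]
  refine ENNReal.toReal_le_of_le_ofReal (by positivity) ?_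
  rw [Measure.volume_eq_prod, ← Measure.prod_restrict, Measure.restrict_univ]
  have hgm : AEMeasurable (fun p => ofReal (g p)) ((volume.restrict S).prod volume) := by
    refine (hg.1.aemeasurable.ennreal_ofReal).mono_measure ?_
    rw [Measure.volume_eq_prod]
    exact Measure.prod_mono Measure.restrict_le_self le_rfl
  rw [lintegral_prod _ hgm, ofReal_mul hM, Measure.real, ENNReal.ofReal_toReal hv,
    ← setLIntegral_const]
  exact lintegral_mono_ae (ae_restrict_of_ae slab)

/-- Points of space are removable for subsolutions with bounded time integrals. -/
theorem SubPair.across {A g : EuT N → ℝ} {B : Set (Eu N)} {T : Set ℝ} (hN : 3 ≤ N)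
    (h : SubPair ((B \ {0}) ×ˢ T) A g) (hA : Integrable A) (hg : Integrable g) (g0 : ∀ p, 0 ≤ g p)
    (hM : 0 ≤ M) (slab : ∀ᵐ x, ∫⁻ t, ofReal (g (x, t)) ≤ ofReal M) :
    SubPair (B ×ˢ T) A g := by
  intro ψ sψ cψ hs ψ0
  obtain ⟨χ, sχ, cχ, χ01, χ1, χs⟩ := exists_space_cutoff (0 : Eu N) one_pos one_lt_two
  obtain ⟨c, hc1, hc⟩ := exists_deriv_bound sχ cχ
  have kψ := sψ.cont
  obtain ⟨P, hP⟩ := exists_bound_of_compact kψ cψ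
  choose Q hQ using fun i : Fin N => exists_bound_of_compact
    (Sm.dv sψ (eX i)).cont (HasCompactSupport.dv cψ (eX i))
  set J := fun p => A p * Dv eT ψ p + g p * lapS eX ψ p with hJ
  have iJ : Integrable J := (integrable_mul_of_compact hA (Sm.dv sψ _).cont
    (HasCompactSupport.dv cψ _)).add (integrable_mul_of_compact hg
      (Sm.lapS sψ _).cont (HasCompactSupport.lapS cψ _))
  set w : ℝ → Eu N → ℝ := fun k x => 1 - χ (k • x) with hw
  set E := (∑ i : Fin N, (P * c + 2 * (Q i * c))) with hE
  have P0 : 0 ≤ P := (abs_nonneg _).trans (hP 0)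
  have Q0 : ∀ i, 0 ≤ Q i := fun i => (abs_nonneg _).trans (hQ i 0)
  have E0 : 0 ≤ E := sum_nonneg fun i _ => by have := Q0 i; positivity
  have sc : ∀ k : ℝ, Sm fun y => χ (k • y) := fun k =>
    Sm.lin sχ (k • ContinuousLinearMap.id ℝ (Eu N))
  have sw : ∀ k : ℝ, Sm (w k) := fun k => contDiff_const.sub (sc k)
  have dw : ∀ (k : ℝ) (e y : Eu N), Dv e (w k) y = - (k * Dv e χ (k • y)) := fun k e y => by
    rw [hw, Dv_sub contDiff_const (sc k), Dv_scale sχ]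
    simp [Dv]
  have lw : ∀ (k : ℝ) (y : Eu N), lapS eB (w k) y = - (k ^ 2 * lapS eB χ (k • y)) := fun k y => by
    rw [← lapS_scale sχ, lapS, lapS, ← Finset.sum_neg_distrib]
    refine sum_congr rfl fun i _ => ?_
    rw [show Dv (eB i) (w k) = fun y => (-1) * Dv (eB i) (fun y => χ (k • y)) y from
      funext fun y => by rw [dw, Dv_scale sχ]; ring, Dv_const_mul (Sm.dv (sc k) _)]
    ring
  have err : ∀ k : ℝ, 1 ≤ k → ∀ p : EuT N,
      ψ p * lapS eX (fun p : EuT N => w k p.1) p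
        + 2 * ∑ i, Dv (eX i) ψ p * Dv (eX i) (fun p : EuT N => w k p.1) p
      ≤ (ball (0 : Eu N) (2 / k) ×ˢ (univ : Set ℝ)).indicator (fun _ => k ^ 2 * E) p := by
    intro k hk p
    have hk0 : 0 < k := by linarith
    simp only [lapS_eX_fst (sw k), Dv_fst (sw k), lw, dw, eX]
    by_cases hp : p ∈ ball (0 : Eu N) (2 / k) ×ˢ (univ : Set ℝ)
    · rw [indicator_of_mem hp, lapS, hE, mul_sum, mul_sum, mul_sum,
        ← Finset.sum_neg_distrib, mul_sum, ← sum_add_distrib]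
      refine sum_le_sum fun i _ => ?_
      obtain ⟨h1, h2⟩ := hc (k • p.1) i
      have a1 : |ψ p * Dv (eB i) (Dv (eB i) χ) (k • p.1)| ≤ P * c := by
        rw [abs_mul]; exact mul_le_mul (hP p) h2 (abs_nonneg _) P0
      have a2 : |Dv (eX i) ψ p * Dv (eB i) χ (k • p.1)| ≤ Q i * c := by
        rw [abs_mul]; exact mul_le_mul (hQ i p) h1 (abs_nonneg _) (Q0 i)
      have b1 := mul_le_mul_of_nonneg_left (neg_le_of_abs_le a1) (sq_nonneg k)
      have b2 := mul_le_mul_of_nonneg_left (neg_le_of_abs_le a2) hk0.le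
      have b3 : k * (Q i * c) ≤ k ^ 2 * (Q i * c) := by
        have := Q0 i
        gcongr
        nlinarith
      simp only [eX, eB] at b1 b2 ⊢
      nlinarith
    · rw [indicator_of_notMem hp]
      have hk : k • p.1 ∉ tsupport χ := fun hx => hp ⟨by
        have := mem_ball_zero_iff.1 (χs hx)
        rw [norm_smul, norm_eq_abs, abs_of_pos hk0] at this
        rw [mem_ball_zero_iff, lt_div_iff₀ hk0]
        linarith, mem_univ _⟩
      simp [lapS_eq_zero hk, dv_eq_zero hk]
  have main : ∀ n : ℕ, 0 ≤ (∫ p, w (n + 1) p.1 * J p)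
      + E * (M * (2 ^ N * volume.real (ball (0 : Eu N) 1))) * (1 / ((n : ℝ) + 1)) := by
    intro n
    have hk : (1 : ℝ) ≤ n + 1 := by have := n.cast_nonneg (α := ℝ); linarith
    have hk0 : (0 : ℝ) < n + 1 := by linarith
    set k : ℝ := n + 1
    have swp := fst_smooth (sw k)
    have hts : tsupport (fun p => ψ p * w k p.1) ⊆ (B \ {0}) ×ˢ T := by
      intro p hp
      have h1 := hs (tsupport_mul_subset_left hp)
      refine ⟨⟨h1.1, fun h0 => ?_⟩, h1.2⟩
      refine (notMem_tsupport_iff_eventuallyEq.2 ?_) hp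
      have : IsOpen {q : EuT N | k • q.1 ∈ ball (0 : Eu N) 1} :=
        isOpen_ball.preimage (by fun_prop)
      filter_upwards [this.mem_nhds (by
        rw [mem_ofPred_eq, mem_singleton_iff.1 h0]; simp)] with q hq
      simp [hw, χ1 _ hq]
    have hψ := h _ (ContDiff.mul sψ swp) (cψ.mul_right) hts fun p => mul_nonneg (ψ0 p)
      (sub_nonneg.2 (χ01 _).2)
    have iw : Integrable fun p => w k p.1 * J p := by
      refine iJ.bdd_mul (c := 1) swp.cont.aestronglyMeasurable
        (of_forall fun p => ?_)
      rw [norm_eq_abs, abs_le]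
      constructor <;> simp only [hw] <;> linarith [(χ01 (k • p.1)).1, (χ01 (k • p.1)).2]
    have mS : MeasurableSet (ball (0 : Eu N) (2 / k) ×ˢ (univ : Set ℝ)) :=
      measurableSet_ball.prod MeasurableSet.univ
    have ig : Integrable ((ball (0 : Eu N) (2 / k) ×ˢ (univ : Set ℝ)).indicator
        fun p => k ^ 2 * E * g p) := (hg.const_mul _).indicator mS
    have step : ∫ p, (A p * Dv eT (fun p => ψ p * w k p.1) p
        + g p * lapS eX (fun p => ψ p * w k p.1) p)
        ≤ ∫ p, (w k p.1 * J p + (ball (0 : Eu N) (2 / k) ×ˢ (univ : Set ℝ)).indicator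
          (fun p => k ^ 2 * E * g p) p) := by
      have c' : HasCompactSupport fun p => ψ p * w k p.1 := cψ.mul_right
      have s' : Sm fun p => ψ p * w k p.1 := ContDiff.mul sψ swp
      refine integral_mono ((integrable_mul_of_compact hA (Sm.dv s' _).cont
        (HasCompactSupport.dv c' _)).add (integrable_mul_of_compact hg
          (Sm.lapS s' _).cont (HasCompactSupport.lapS c' _))) (iw.add ig) fun p => ?_
      have d0 : Dv eT (fun p : EuT N => w k p.1) p = 0 := by
        rw [Dv_fst (sw k)]
        exact Dv_zero_dir _ _
      have e1 := mul_le_mul_of_nonneg_left (err k hk p) (g0 p)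
      have e2 : (ball (0 : Eu N) (2 / k) ×ˢ (univ : Set ℝ)).indicator (fun p => k ^ 2 * E * g p) p
          = g p * (ball (0 : Eu N) (2 / k) ×ˢ (univ : Set ℝ)).indicator (fun _ => k ^ 2 * E) p := by
        by_cases hp : p ∈ ball (0 : Eu N) (2 / k) ×ˢ (univ : Set ℝ)
        · simp only [indicator_of_mem hp]; ring
        · simp only [indicator_of_notMem hp, mul_zero]
      simp only [Dv_mul sψ swp, lapS_mul sψ swp, d0, e2, hJ]
      linarith
    have sl := slab_integral_le hg g0 hM slab
      (measure_ball_lt_top (x := (0 : Eu N)) (r := 2 / k)).ne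
    rw [integral_add iw ig, integral_indicator mS, integral_const_mul] at step
    have vb : volume.real (ball (0 : Eu N) (2 / k)) = (2 / k) ^ N * volume.real (ball (0 : Eu N) 1) := by
      rw [Measure.real, Measure.addHaar_ball_of_pos _ _ (by positivity), ENNReal.toReal_mul,
        toReal_ofReal (by positivity), Measure.real]
      simp
    have e : k ^ 2 * E * (M * ((2 / k) ^ N * volume.real (ball (0 : Eu N) 1)))
        ≤ E * (M * (2 ^ N * volume.real (ball (0 : Eu N) 1))) * (1 / k) := by
      have : k ^ 2 * (2 / k) ^ N ≤ 2 ^ N * (1 / k) := by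
        rw [div_pow, mul_div_assoc', mul_one_div, div_le_div_iff₀ (by positivity) hk0]
        calc k ^ 2 * 2 ^ N * k = 2 ^ N * k ^ 3 := by ring
          _ ≤ 2 ^ N * k ^ N := by gcongr
      calc _ = (k ^ 2 * (2 / k) ^ N) * (E * (M * volume.real (ball (0 : Eu N) 1))) := by ring
        _ ≤ (2 ^ N * (1 / k)) * (E * (M * volume.real (ball (0 : Eu N) 1))) :=
          mul_le_mul_of_nonneg_right this (by positivity)
        _ = _ := by ring
    have := mul_le_mul_of_nonneg_left sl (by positivity : 0 ≤ k ^ 2 * E)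
    rw [vb] at this
    linarith
  have lim : Tendsto (fun n : ℕ => ∫ p, w (n + 1) p.1 * J p) atTop (𝓝 (∫ p, J p)) := by
    refine tendsto_integral_of_dominated_convergence (fun p => ‖J p‖) (fun n =>
      ((fst_smooth (sw _)).cont.aestronglyMeasurable.mul iJ.1)) iJ.norm
      (fun n => of_forall fun p => ?_) ?_
    · rw [norm_mul]
      refine mul_le_of_le_one_left (norm_nonneg _) ?_
      rw [norm_eq_abs, abs_le]
      constructor <;> simp only [hw] <;>
        linarith [(χ01 (((n : ℝ) + 1) • p.1)).1, (χ01 (((n : ℝ) + 1) • p.1)).2]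
    · have : NeZero N := ⟨by omega⟩
      have h0 : ∀ᵐ x : Eu N, x ≠ 0 := by simp [ae_iff]
      filter_upwards [ae_fst h0] with p hp
      refine tendsto_const_nhds.congr' ?_
      obtain ⟨n0, hn0⟩ := exists_nat_ge (2 / ‖p.1‖)
      filter_upwards [eventually_ge_atTop n0] with n hn
      have hp' := norm_pos_iff.2 hp
      rw [div_le_iff₀ hp'] at hn0
      have : χ (((n : ℝ) + 1) • p.1) = 0 := image_eq_zero_of_notMem_tsupport fun hx => by
        have h2 := mem_ball_zero_iff.1 (χs hx)
        rw [norm_smul, norm_eq_abs, abs_of_pos (by positivity)] at h2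
        have : (n0 : ℝ) ≤ n := by exact_mod_cast hn
        nlinarith
      simp only [hw, this]
      ring
  have := ge_of_tendsto (lim.add (tendsto_one_div_add_atTop_nhds_zero_nat.const_mul
    (E * (M * (2 ^ N * volume.real (ball (0 : Eu N) 1)))))) (of_forall main)
  simpa [hJ] using this

theorem ramp_deriv_compact (hδ : 0 < δ) : HasCompactSupport (deriv (ramp a δ)) :=
  HasCompactSupport.intro (isCompact_Icc (a := a + δ) (b := a + 2 * δ)) fun s hs =>
    ramp_deriv_eq_zero hδ (by
      by_contra! h
      exact hs h)

/-- Cutoff functions between concentric balls with quantitative derivative bounds. -/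
theorem exists_sharp_cutoff (N : ℕ) : ∃ E : ℝ, 1 ≤ E ∧ ∀ (x0 : Eu N) (r R : ℝ), 0 < r → r < R → R ≤ 1 →
    ∃ ξ : Eu N → ℝ, Sm ξ ∧ HasCompactSupport ξ ∧ (∀ y, 0 ≤ ξ y ∧ ξ y ≤ 1) ∧
      (∀ y ∈ ball x0 r, ξ y = 1) ∧ tsupport ξ ⊆ ball x0 R ∧ ∀ y i,
        |Dv (eB i) ξ y| ≤ E / (R - r) ^ 4 ∧ |Dv (eB i) (Dv (eB i) ξ) y| ≤ E / (R - r) ^ 4 := by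
  have sH : Sm (ramp 0 1) := ramp_smooth
  have sH1 : Sm (deriv (ramp 0 1)) := sH.iterate_deriv 1
  have sH2 : Sm (deriv (deriv (ramp 0 1))) := sH1.iterate_deriv 1
  have cH : HasCompactSupport (deriv (ramp 0 1)) := ramp_deriv_compact one_pos
  obtain ⟨E1, h1⟩ := exists_bound_of_compact sH1.cont cH
  obtain ⟨E2, h2⟩ := exists_bound_of_compact sH2.cont cH.deriv
  have E10 : 0 ≤ E1 := (abs_nonneg _).trans (h1 0)
  have E20 : 0 ≤ E2 := (abs_nonneg _).trans (h2 0)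
  refine ⟨16 * (2 * E1 + 4 * E2) + 1, by linarith, fun x0 r R hr hrR hR => ?_⟩
  set w := R - r with hw
  have w0 : 0 < w := by linarith
  set k := 4 / w ^ 2 with hk
  have k1 : 1 ≤ k := by rw [hk, one_le_div (by positivity)]; nlinarith
  set Q : Eu N → ℝ := fun y => (k * ((r + w / 2) ^ 2 - qr 0 (y - x0)) + 1 : ℝ) with hQ
  have sq : Sm fun y : Eu N => qr 0 (y - x0) := sub_smooth (qr_smooth 0) x0
  have sQ : Sm Q := (contDiff_const.mul (contDiff_const.sub sq)).add contDiff_const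
  have sξ : Sm fun y => ramp 0 1 (Q y) := sH.comp sQ
  have dQ : ∀ (i : Fin N) y, Dv (eB i) Q y = -2 * k * (y i - x0 i) := by
    intro i y
    have d1 : Dv (eB i) (fun y : Eu N => qr 0 (y - x0)) y = 2 * (y i - x0 i) := by
      have := Dv_affine (qr_smooth (N := N) 0) (ContinuousLinearMap.id ℝ (Eu N)) (-x0) (eB i) y
      simp only [ContinuousLinearMap.id_apply, ← sub_eq_add_neg] at this
      rw [this, Dv_qr]
      simp
    rw [hQ, Dv_add (contDiff_const.mul (contDiff_const.sub sq)) contDiff_const,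
      Dv_const_mul (contDiff_const.sub sq), Dv_sub contDiff_const sq, d1]
    simp [Dv]
    ring
  have sup : ∀ y, ramp 0 1 (Q y) ≠ 0 → ‖y - x0‖ < r + w / 2 := fun y hy => by
    by_contra! h
    refine hy (ramp_eq_zero one_pos ?_)
    have : (r + w / 2) ^ 2 ≤ ‖y - x0‖ ^ 2 := by gcongr
    simp only [hQ, qr]
    nlinarith
  have ts : tsupport (fun y => ramp 0 1 (Q y)) ⊆ closedBall x0 (r + w / 2) :=
    closure_minimal (fun y hy => by
      rw [mem_closedBall, dist_eq_norm]; exact (sup y hy).le) isClosed_closedBall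
  have dξ : ∀ (i : Fin N) y, Dv (eB i) (fun y => ramp 0 1 (Q y)) y
      = deriv (ramp 0 1) (Q y) * (-2 * k * (y i - x0 i)) := fun i y => by
    rw [Dv_scomp sQ (sH.differentiable (by simp)), dQ]
  have ddξ : ∀ (i : Fin N) y, Dv (eB i) (Dv (eB i) (fun y => ramp 0 1 (Q y))) y
      = deriv (ramp 0 1) (Q y) * (-2 * k)
        + (-2 * k * (y i - x0 i)) * (deriv (deriv (ramp 0 1)) (Q y) * (-2 * k * (y i - x0 i))) := by
    intro i y
    have sl : Sm fun y : Eu N => -2 * k * (y i - x0 i) :=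
      contDiff_const.mul ((coord_smooth i).sub contDiff_const)
    have s1 : Sm fun y => deriv (ramp 0 1) (Q y) := sH1.comp sQ
    rw [show Dv (eB i) (fun y => ramp 0 1 (Q y)) = fun y => deriv (ramp 0 1) (Q y) *
      (-2 * k * (y i - x0 i)) from funext (dξ i), Dv_mul s1 sl,
      Dv_scomp sQ (sH1.differentiable (by simp)), dQ,
      Dv_const_mul ((coord_smooth i).sub contDiff_const), Dv_sub (coord_smooth i) contDiff_const,
      Dv_coord]
    simp [Dv]
  refine ⟨fun y => ramp 0 1 (Q y), sξ, HasCompactSupport.of_support_subset_isCompact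
    (isCompact_closedBall x0 (r + w / 2)) (subset_closure.trans ts),
    fun y => ⟨ramp_nonneg _, ramp_le_one _⟩, fun y hy => ramp_eq_one one_pos ?_,
    ts.trans (closedBall_subset_ball (by linarith)), fun y i => ?_⟩
  · have h3 : ‖y - x0‖ ^ 2 ≤ r ^ 2 := by
      rw [mem_ball, dist_eq_norm] at hy
      gcongr
    have h4 : k * (w / 2) ^ 2 = 1 := by rw [hk]; field_simp; norm_num
    have h5 : k * (w / 2) ^ 2 ≤ k * ((r + w / 2) ^ 2 - ‖y - x0‖ ^ 2) := by
      gcongr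
      nlinarith
    simp only [hQ, qr]
    linarith
  · have e : (16 * (2 * E1 + 4 * E2) + 1) / w ^ 4 = (2 * E1 + 4 * E2) * k ^ 2 + 1 / w ^ 4 := by
      rw [hk]; field_simp; ring
    have e0 : 0 ≤ 1 / w ^ 4 := by positivity
    by_cases hy : y ∈ tsupport (fun y => ramp 0 1 (Q y))
    swap
    · rw [dv_eq_zero hy, dv_eq_zero fun h => hy (tsupport_dv_subset _ _ h), abs_zero]
      exact ⟨by positivity, by positivity⟩
    have hb : |y i - x0 i| ≤ 1 := by
      have := mem_closedBall.1 (ts hy)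
      rw [dist_eq_norm] at this
      have h6 := PiLp.norm_apply_le (y - x0) i
      rw [PiLp.sub_apply, norm_eq_abs] at h6
      linarith
    have hk2 : k ≤ k ^ 2 := by nlinarith
    have hl : |-2 * k * (y i - x0 i)| ≤ 2 * k := by
      rw [abs_mul, abs_mul, abs_of_pos (by linarith : 0 < k)]
      norm_num
      nlinarith
    have a1 : |deriv (ramp 0 1) (Q y) * (-2 * k * (y i - x0 i))| ≤ E1 * (2 * k) := by
      rw [abs_mul]; exact mul_le_mul (h1 _) hl (abs_nonneg _) E10
    have a2 : |deriv (ramp 0 1) (Q y) * (-2 * k)| ≤ E1 * (2 * k) := by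
      rw [abs_mul]
      refine mul_le_mul (h1 _) ?_ (abs_nonneg _) E10
      rw [abs_mul, abs_of_pos (by linarith : 0 < k)]
      norm_num
    have a3 : |(-2 * k * (y i - x0 i)) * (deriv (deriv (ramp 0 1)) (Q y) * (-2 * k * (y i - x0 i)))|
        ≤ 2 * k * (E2 * (2 * k)) := by
      rw [abs_mul, abs_mul (deriv _ _)]
      exact mul_le_mul hl (mul_le_mul (h2 _) hl (abs_nonneg _) E20) (by positivity) (by linarith)
    rw [e, dξ, ddξ]
    have := mul_le_mul_of_nonneg_left hk2 E10
    have := mul_nonneg E20 (sq_nonneg k)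
    refine ⟨by nlinarith, (abs_add_le _ _).trans (by nlinarith)⟩

theorem bilinear_arith {S1 A X ε S D d w κ : ℝ} {n : ℕ} (hn : 1 ≤ n) (hA : 0 ≤ A) (hX : 0 < X)
    (hX1 : X ≤ 1) (hε0 : 0 < ε) (hε : ε ≤ 1) (hw : 0 < w) (hw1 : w ≤ 1) (hκ : 0 < κ) (hd : d = w / 2)
    (hD : D = A / w ^ n) (hS0 : 0 ≤ S) (hS : S ≤ S1 * X ^ ε) :
    ((S / d + D * X) * (X / d + D * X) + 2 * D * (X / d + D * X) * X) / (2 * κ)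
      ≤ (S1 + 3) * (A + 2) ^ 2 / κ / w ^ (2 * n) * X ^ (1 + ε) := by
  set b := (A + 2) / w ^ n with hb
  have h1 : 1 / d ≤ b := by
    rw [hd, hb, div_le_div_iff₀ (by positivity) (by positivity)]
    have : w ^ n ≤ w := by simpa using pow_le_pow_of_le_one hw.le hw1 hn
    nlinarith
  have h2 : D ≤ b := by rw [hD, hb]; gcongr; linarith
  have hD0 : 0 ≤ D := by rw [hD]; positivity
  have hd0 : 0 < d := by rw [hd]; positivity
  have hb0 : 0 ≤ b := hD0.trans h2
  have hX2 : X ≤ X ^ ε := by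
    simpa using Real.rpow_le_rpow_of_exponent_ge hX hX1 hε
  have e1 : S / d ≤ b * S := by rw [div_eq_mul_one_div, mul_comm]; gcongr
  have e2 : X / d ≤ b * X := by rw [div_eq_mul_one_div, mul_comm]; gcongr
  have e4 : (S / d + D * X) * (X / d + D * X) + 2 * D * (X / d + D * X) * X
      ≤ (b * S + b * X) * (b * X + b * X) + 2 * b * (b * X + b * X) * X := by gcongr
  have e5 : (b * S + b * X) * (b * X + b * X) + 2 * b * (b * X + b * X) * X
      = 2 * b ^ 2 * X * (S + 3 * X) := by ring
  have e7 : (S1 + 3) * (A + 2) ^ 2 / κ / w ^ (2 * n) * X ^ (1 + ε) * (2 * κ)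
      = 2 * b ^ 2 * X * ((S1 + 3) * X ^ ε) := by
    rw [Real.rpow_one_add' hX.le (by positivity), hb, div_pow, ← pow_mul, mul_comm n 2]
    field_simp
  rw [div_le_iff₀ (by positivity), e7]
  exact e4.trans (e5.le.trans (mul_le_mul_of_nonneg_left (by linarith) (by positivity)))

/-- Higher integrability of truncated subsolutions on smaller boxes. -/
theorem exists_product_bound {α : ℝ} (hN : 3 ≤ N) (hW : Wt N ρ C α) (p : EuT N) (hM : 0 ≤ M) :
    ∃ T ε : ℝ, 0 < T ∧ 0 < ε ∧ ∀ (r R X : ℝ) (f g : EuT N → ℝ), 0 < r → r < R → R ≤ 1 →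
      0 < X → X ≤ 1 → Measurable f → (∀ q, 0 ≤ f q) → (∀ q, 0 ≤ g q) →
      Integrable (fun q => ρ q.1 * f q) → Integrable g →
      (∀ᵐ x, ∫⁻ t, ofReal (f (x, t)) ≤ ofReal M) →
      SubPair (box p R R) (fun q => ρ q.1 * f q) g →
      (∫ q in box p R R, ρ q.1 * f q) ≤ X → (∫ q in box p R R, g q) ≤ X →
      ∫⁻ q in box p r r, ofReal (ρ q.1 * f q * g q)
        ≤ ofReal (T / (R - r) ^ (16 * N) * X ^ (1 + ε)) := by
  obtain ⟨E, hE, hcut⟩ := exists_sharp_cutoff N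
  have hC := hW.C_pos
  have hα := hW.α_pos
  have hN' : (3 : ℝ) ≤ N := by exact_mod_cast hN
  set ε := min α 1 / (2 * N) with hε
  have hε0 : 0 < ε := by positivity
  have hε1 : ε ≤ 1 / (2 * N) := by rw [hε]; gcongr; exact min_le_right _ _
  have hk := kapN_pos N
  have hE0 : 0 ≤ kerC N E := kerC_nonneg N hE
  refine ⟨(3 * (M * C) + 3 + 3) * (kerC N E + 2) ^ 2 / kapN N, ε, by positivity, hε0, ?_⟩
  intro r R X f g hr hrR hR hX hX1 hf f0 g0 iA ig slab hsub hXa hXg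
  obtain ⟨ξ, sξ, cξ, h01, ξ1, ξs, hd⟩ := hcut p.1 r R hr hrR hR
  set w := R - r
  have w0 : 0 < w := by linarith
  have w1 : w ≤ 1 := by linarith
  obtain ⟨hc, hts⟩ := cut_of_bounds hN hR sξ cξ h01 ξs (by
    rw [one_le_div (by positivity)]
    exact (pow_le_one₀ w0.le w1).trans hE) hd
  have mB := (isOpen_box p R R).measurableSet
  set F := (box p R R).indicator f with hF
  set H := (box p R R).indicator g with hH
  have eA : (fun q => ρ q.1 * F q) = (box p R R).indicator fun q => ρ q.1 * f q := by
    ext q; by_cases hq : q ∈ box p R R <;> simp [hF, hq]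
  have F0 : ∀ q, 0 ≤ F q := fun q => indicator_nonneg (fun _ _ => f0 _) q
  have iA' : Integrable fun q => ρ q.1 * F q := by rw [eA]; exact iA.indicator mB
  have slab' : ∀ᵐ x, ∫⁻ t, ofReal (F (x, t)) ≤ ofReal M := by
    filter_upwards [slab] with x hx
    exact (lintegral_mono fun t => ofReal_le_ofReal
      (indicator_le_self' (fun _ _ => f0 _) _)).trans hx
  have XA : ∫ q, ρ q.1 * F q ≤ X := by rw [eA, integral_indicator mB]; exact hXa
  have XH : ∫ q, H q ≤ X := by rw [hH, integral_indicator mB]; exact hXg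
  set κ := X ^ (1 / (2 * N : ℝ)) with hκ
  have hS0 : 0 ≤ 3 * (M * (C * κ ^ α)) + 3 * κ ^ (2 - N : ℝ) * X := by positivity
  have key := bilinear_lintegral_le hN (hsub.congr (of_forall fun q hq => by simp only [hF, indicator_of_mem hq]) (of_forall fun q hq => by simp only [hH, indicator_of_mem hq])) (isOpen_box _ _ _) iA' (ig.indicator mB)
    (fun q => mul_nonneg (hW.pos _).le (F0 q)) (fun q => indicator_nonneg (fun _ _ => g0 _) q) hc (t0 := p.2 - r - w / 2) (t2 := p.2 + r)
    (d := w / 2) (by positivity) (by linarith)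
    (Set.prod_mono (hts.trans ξs) fun t ht => ⟨by linarith [ht.1], by linarith [ht.2]⟩)
    isOpen_ball (hts.trans ξs) hS0
    (fun s hs hs1 x hx => integral_kernel_le hN hW.pot hW.meas (fun x => (hW.pos x).le)
      (hf.indicator mB) F0 iA' hR (fun q hq => indicator_of_notMem (fun h => hq h.1) _) hM hC.le
      slab' XA (rpow_pos_of_pos hX _) hs hs1 hx) XA XH
  have hSX : 3 * (M * (C * κ ^ α)) + 3 * κ ^ (2 - N : ℝ) * X ≤ (3 * (M * C) + 3) * X ^ ε := by
    have e1 : κ ^ α ≤ X ^ ε := by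
      rw [hκ, ← rpow_mul hX.le]
      exact Real.rpow_le_rpow_of_exponent_ge hX hX1 (by rw [one_div_mul_eq_div]; exact (by rw [hε]; gcongr; exact min_le_left _ _))
    have e2 : κ ^ (2 - N : ℝ) * X ≤ X ^ ε := by
      rw [hκ, ← rpow_mul hX.le, ← rpow_add_one hX.ne']
      refine Real.rpow_le_rpow_of_exponent_ge hX hX1 (hε1.trans ?_)
      rw [one_div_mul_eq_div, ← sub_nonneg]
      have : ((2 - N) / (2 * N) + 1 - 1 / (2 * N) : ℝ) = (N + 1) / (2 * N) := by field_simp; ring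
      rw [this]
      positivity
    have := mul_le_mul_of_nonneg_left e1 (by positivity : 0 ≤ M * C)
    linarith
  have hin : box p r r ⊆ tsupport (fun x => ξ x ^ (2 * N)) ×ˢ
      Ioc (p.2 - r - w / 2 + w / 2) (p.2 + r) := fun q hq =>
    ⟨subset_tsupport _ (by rw [Function.mem_support, ξ1 _ hq.1]; simp), by linarith [hq.2.1],
      hq.2.2.le⟩
  calc ∫⁻ q in box p r r, ofReal (ρ q.1 * f q * g q)
      ≤ ∫⁻ q in box p r r, ofReal
          (ξ q.1 ^ (2 * N) * (ρ q.1 * F q) * (ξ q.1 ^ (2 * N) * H q)) := by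
        refine setLIntegral_mono' (isOpen_box _ _ _).measurableSet fun q hq => ?_
        have hq' : q ∈ box p R R := ⟨ball_subset_ball hrR.le hq.1, by linarith [hq.2.1],
          by linarith [hq.2.2]⟩
        rw [hF, hH, indicator_of_mem hq', indicator_of_mem hq', ξ1 _ hq.1]
        simp
    _ ≤ _ := lintegral_mono_set hin
    _ ≤ _ := key
    _ ≤ _ := by
        refine ofReal_le_ofReal ?_
        rw [show 16 * N = 2 * (8 * N) by ring]
        refine bilinear_arith (by omega) hE0 hX hX1 hε0 ?_ w0 w1 hk rfl ?_ hS0 hSX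
        · refine hε1.trans ?_
          rw [div_le_one (by positivity)]
          linarith
        · rw [kerC, kerC, div_pow, ← pow_mul, mul_div_assoc']
          ring_nf

theorem trF_nonneg (m k : ℝ) {d y : ℝ} (hy : 0 ≤ y) : 0 ≤ trF m k d y :=
  prim_nonneg (fun _ => ramp_nonneg _) hy

theorem trH_nonneg (k : ℝ) {d y : ℝ} (hy : 0 ≤ y) : 0 ≤ trH k d y :=
  prim_nonneg (fun _ => ramp_nonneg _) hy

theorem trF_le (hm : 1 < m) {k d κ y : ℝ} (hd : 0 < d) (hκ : 0 ≤ κ) (h : κ ^ m ≤ k + d)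
    (hy : 0 ≤ y) : trF m k d y ≤ max (y - κ) 0 :=
  prim_le (ramp_rpow_continuous hm k d) (ramp_rpow_monotone hm hd) (fun _ => ramp_le_one _) hκ
    (fun _ h0 hs => ramp_eq_zero hd ((rpow_le_rpow h0 hs (by linarith)).trans h)) hy

theorem trH_le {k d κ y : ℝ} (hd : 0 < d) (hκ : 0 ≤ κ) (h : κ ≤ k + d) (hy : 0 ≤ y) :
    trH k d y ≤ max (y - κ) 0 :=
  prim_le (ramp_continuous k d) ((ramp_monotone hd).monotoneOn _) (fun _ => ramp_le_one _) hκ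
    (fun _ _ hs => ramp_eq_zero hd (hs.trans h)) hy

theorem le_trF (hm : 1 < m) {k d κ y : ℝ} (hd : 0 < d) (hκ : 0 ≤ κ) (h : k + 2 * d ≤ κ ^ m)
    (hy : 0 ≤ y) : max (y - κ) 0 ≤ trF m k d y :=
  le_prim (ramp_rpow_continuous hm k d) (ramp_rpow_monotone hm hd) (fun _ => ramp_nonneg _) hκ
    (ramp_eq_one hd h) hy

theorem le_trH {k d κ y : ℝ} (hd : 0 < d) (hκ : 0 ≤ κ) (h : k + 2 * d ≤ κ) (hy : 0 ≤ y) :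
    max (y - κ) 0 ≤ trH k d y :=
  le_prim (ramp_continuous k d) ((ramp_monotone hd).monotoneOn _) (fun _ => ramp_nonneg _) hκ
    (ramp_eq_one hd h) hy

theorem measurable_trF (hm : 1 < m) (k d : ℝ) : Measurable (trF m k d) :=
  (continuous_prim (ramp_rpow_continuous hm k d)).measurable

theorem measurable_trH (k d : ℝ) : Measurable (trH k d) :=
  (continuous_prim (ramp_continuous k d)).measurable

theorem trF_le_self (hm : 1 < m) {k d y : ℝ} (hd : 0 < d) (h : 0 ≤ k + d) (hy : 0 ≤ y) :
    trF m k d y ≤ y := by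
  simpa [hy] using trF_le hm hd le_rfl (by rwa [zero_rpow (by linarith)]) hy

theorem trH_le_self {k d y : ℝ} (hd : 0 < d) (h : 0 ≤ k + d) (hy : 0 ≤ y) : trH k d y ≤ y := by
  simpa [hy] using trH_le hd le_rfl h hy

theorem lintegral_le_of_rpow (hm : 1 < m) {v : ℝ → ℝ} (v0 : ∀ t, 0 ≤ v t) {s0 s1 : ℝ}
    (hs : s0 ≤ s1) (hz : ∀ t, t ∉ Ioo s0 s1 → v t = 0) (hM : 0 ≤ M)
    (h : ∫⁻ t, ofReal (v t ^ m) ≤ ofReal M) :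
    ∫⁻ t, ofReal (v t) ≤ ofReal (s1 - s0 + M) := by
  calc ∫⁻ t, ofReal (v t)
      ≤ ∫⁻ t, ((Ioo s0 s1).indicator 1 t + ofReal (v t ^ m)) := by
        refine lintegral_mono fun t => ?_
        by_cases ht : t ∈ Ioo s0 s1
        · rw [indicator_of_mem ht, Pi.one_apply, ← ENNReal.ofReal_one,
            ← ofReal_add zero_le_one (rpow_nonneg (v0 _) _)]
          exact ofReal_le_ofReal (le_one_add_rpow hm (v0 _))
        · rw [hz t ht]; simp
    _ ≤ _ := by
        rw [lintegral_add_left (measurable_one.indicator measurableSet_Ioo),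
          lintegral_indicator_one measurableSet_Ioo, Real.volume_Ioo,
          ofReal_add (by linarith) hM]
        exact add_le_add le_rfl h

/-- Near each point a solution has integrable truncations which are subsolutions. -/
structure Truncated (ρ : Eu N → ℝ) (m : ℝ) (p : EuT N) (R M : ℝ) (V : EuT N → ℝ) : Prop where
  meas : Measurable V
  nonneg : ∀ q, 0 ≤ V q
  intA : Integrable fun q => ρ q.1 * V q
  intV : Integrable fun q => V q ^ m
  slab : ∀ᵐ x, ∫⁻ t, ofReal (V (x, t)) ≤ ofReal M
  intF : ∀ k d, 0 < d → 0 ≤ k + d → Integrable fun q => ρ q.1 * trF m k d (V q)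
  intH : ∀ k d, 0 < d → 0 ≤ k + d → Integrable fun q => trH k d (V q ^ m)
  pair : ∀ k d, 0 < d → 0 ≤ k + d → SubPair (box p R R) (fun q => ρ q.1 * trF m k d (V q))
    fun q => trH k d (V q ^ m)

theorem Sol.exists_trunc {O : Set (EuT N)} {α : ℝ} (hN : 3 ≤ N) (hm : 1 < m)
    (hW : Wt N ρ C α) (h : Sol ρ m O U) {p : EuT N} (hp : p ∈ O) :
    ∃ R M V, 0 < R ∧ R ≤ 1 ∧ 0 ≤ M ∧ Truncated ρ m p R M V ∧ ∀ q ∈ box p R R, V q = U q := by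
  obtain ⟨R1, hR1, h11, hRO, M, hM0, hM⟩ := h.exists_time_bound hN hm hW hp
  obtain ⟨R2, hR2, hS⟩ := h.exists_energy_bound hN hm hW hp
  set R := min R1 R2 with hR
  have hR0 : 0 < R := lt_min hR1 hR2
  have r1 : R ≤ R1 := min_le_left _ _
  have r2 : R ≤ R2 := min_le_right _ _
  obtain ⟨hs, i1, i2⟩ := h.restrict hm (isOpen_box p R R)
    ((isCompact_closedBall _ _).prod isCompact_Icc) (box_subset r1 (by linarith)) hRO
  set V := (box p R R).indicator U with hV
  have hVU : ∀ q ∈ box p R R, V q = U q := fun q hq => indicator_of_mem hq _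
  have hsm : ∀ᵐ x, ∫⁻ t, ofReal (V (x, t) ^ m) ≤ ofReal M := by
    filter_upwards [hM] with x hx
    by_cases hxb : x ∈ ball p.1 R
    · refine le_trans ?_ (hx (ball_subset_ball r1 hxb))
      rw [← lintegral_indicator measurableSet_Ioo]
      refine lintegral_mono fun t => ?_
      by_cases ht : t ∈ Ioo (p.2 - R) (p.2 + R)
      · rw [hVU _ (by exact ⟨hxb, ht⟩), indicator_of_mem (by
          exact ⟨by linarith [ht.1], by linarith [ht.2]⟩)]
      · rw [hV, indicator_of_notMem (fun h => ht h.2), zero_rpow (by linarith)]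
        simp
    · have e : ∀ t, V (x, t) = 0 := fun t => indicator_of_notMem (fun h => hxb h.1) _
      simp [e, zero_rpow (by linarith : m ≠ 0)]
  have slab : ∀ᵐ x, ∫⁻ t, ofReal (V (x, t))
      ≤ ofReal (p.2 + R - (p.2 - R) + M) := by
    filter_upwards [hsm] with x hx
    exact lintegral_le_of_rpow hm (fun t => hs.nonneg _) (by linarith)
      (fun t ht => indicator_of_notMem (fun h => ht h.2) _) hM0 hx
  have hS' : IntegrableOn (fun q => V q ^ (m + 1)) (box p R R) := by
    refine (integrableOn_congr_fun (fun q hq => ?_) (isOpen_box _ _ _).measurableSet).1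
      (hS.mono_set (Set.prod_mono (ball_subset_ball r2) (Ioo_subset_Ioo (by linarith)
        (by linarith))))
    rw [hVU q hq]
  have V0 : ∀ q, 0 ≤ V q ^ m := fun q => rpow_nonneg (hs.nonneg q) _
  have iF : ∀ k d, 0 < d → 0 ≤ k + d → Integrable fun q => ρ q.1 * trF m k d (V q) :=
    fun k d hd hk => by
      refine i1.mono' ((hW.meas.comp measurable_fst).mul
        ((measurable_trF hm k d).comp hs.meas)).aestronglyMeasurable
        (of_forall fun q => ?_)
      rw [norm_eq_abs, abs_of_nonneg
        (mul_nonneg (hW.pos _).le (trF_nonneg m k (hs.nonneg q)))]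
      exact mul_le_mul_of_nonneg_left (trF_le_self hm hd hk (hs.nonneg q)) (hW.pos _).le
  have iH : ∀ k d, 0 < d → 0 ≤ k + d → Integrable fun q => trH k d (V q ^ m) :=
    fun k d hd hk => by
      refine i2.mono' ((measurable_trH k d).comp (hs.meas.pow_const m)).aestronglyMeasurable
        (of_forall fun q => ?_)
      rw [norm_eq_abs, abs_of_nonneg (trH_nonneg k (V0 q))]
      exact trH_le_self hd hk (V0 q)
  refine ⟨R, _, V, hR0, r1.trans h11, by linarith, ⟨hs.meas, hs.nonneg, i1, i2, slab, iF, iH,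
    fun k d hd hk => ?_⟩, hVU⟩
  refine (hs.kato hm hW isOpen_ball (by linarith) hsm hS' hd).across hN (iF k d hd hk) (iH k d hd hk)
    (fun q => trH_nonneg k (V0 q)) hM0 ?_
  filter_upwards [hsm] with x hx
  exact (lintegral_mono fun t => ofReal_le_ofReal (trH_le_self hd hk (V0 _))).trans hx

theorem exists_geometric {T ε Λ : ℝ} (hT : 0 ≤ T) (hε : 0 < ε) (hΛ : 1 ≤ Λ) :
    ∃ η q : ℝ, 0 < η ∧ η ≤ 1 ∧ 1 < q ∧
      ∀ j : ℕ, T * Λ ^ j * (η / q ^ j) ^ (1 + ε) ≤ η / q ^ (j + 1) := by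
  set q := 2 * Λ ^ ε⁻¹ with hq
  have q1 : 1 < q := by linarith [one_le_rpow hΛ (inv_pos.2 hε).le]
  have qΛ : Λ ≤ q ^ ε := by
    rw [hq, mul_rpow (by norm_num) (by positivity), ← rpow_mul (by linarith),
      inv_mul_cancel₀ hε.ne', rpow_one]
    exact le_mul_of_one_le_left (by linarith) (one_le_rpow (by norm_num) hε.le)
  set z := ((T + 1) * q)⁻¹ with hz
  have z0 : 0 < z := by positivity
  refine ⟨min 1 (z ^ ε⁻¹), q, by positivity, min_le_left _ _, q1, fun j => ?_⟩
  set η := min 1 (z ^ ε⁻¹) with hη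
  have η0 : 0 < η := by positivity
  have ηz : η ^ ε ≤ z := by
    calc η ^ ε ≤ (z ^ ε⁻¹) ^ ε := rpow_le_rpow η0.le (min_le_right _ _) hε.le
      _ = z := by rw [← rpow_mul z0.le, inv_mul_cancel₀ hε.ne', rpow_one]
  have q0 : 0 < q := by linarith
  have e1 : (η / q ^ j) ^ ε = η ^ ε / (q ^ ε) ^ j := by
    rw [Real.div_rpow η0.le (by positivity), ← Real.rpow_natCast_mul q0.le,
      ← Real.rpow_mul_natCast q0.le, mul_comm (j : ℝ)]
  have e2 : Λ ^ j / (q ^ ε) ^ j ≤ 1 := by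
    rw [← div_pow]
    exact pow_le_one₀ (by positivity) ((div_le_one (by positivity)).2 qΛ)
  have e3 : T * η ^ ε ≤ q⁻¹ := by
    calc T * η ^ ε ≤ (T + 1) * z := by gcongr; linarith
      _ = q⁻¹ := by rw [hz]; field_simp
  calc T * Λ ^ j * (η / q ^ j) ^ (1 + ε)
      = η / q ^ j * (T * η ^ ε * (Λ ^ j / (q ^ ε) ^ j)) := by
        rw [Real.rpow_one_add' (by positivity) (by positivity), e1]; ring
    _ ≤ η / q ^ j * (q⁻¹ * 1) := by gcongr
    _ = _ := by rw [pow_succ]; field_simp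

theorem setIntegral_le_mul {X : Type*} [MeasurableSpace X] {μ : Measure X} {F H : X → ℝ}
    {S : Set X} (hS : MeasurableSet S) (hF : Integrable F μ) (F0 : ∀ q, 0 ≤ F q) {c Z : ℝ}
    (hc : 0 ≤ c) (hZ : 0 ≤ Z) (h : ∀ q ∈ S, F q ≤ c * H q)
    (hH : ∫⁻ q in S, ofReal (H q) ∂μ ≤ ofReal Z) : ∫ q in S, F q ∂μ ≤ c * Z := by
  rw [← ENNReal.ofReal_le_ofReal_iff (by positivity),
    ofReal_integral_eq_lintegral_ofReal hF.restrict (of_forall F0),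
    ofReal_mul hc]
  calc ∫⁻ q in S, ofReal (F q) ∂μ
      ≤ ∫⁻ q in S, ofReal c * ofReal (H q) ∂μ := by
        refine setLIntegral_mono' hS fun q hq => ?_
        rw [← ofReal_mul hc]
        exact ofReal_le_ofReal (h q hq)
    _ = ofReal c * ∫⁻ q in S, ofReal (H q) ∂μ :=
        lintegral_const_mul' _ _ ofReal_ne_top
    _ ≤ _ := mul_le_mul' le_rfl hH

theorem sub_le_rpow_sub (hm : 1 < m) {x y : ℝ} (hy : 1 ≤ y) (h : y ≤ x) :
    x - y ≤ x ^ m - y ^ m := by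
  have e : ∀ z : ℝ, 1 ≤ z → z ^ m = z * z ^ (m - 1) := fun z hz => by
    rw [← Real.rpow_one_add' (by linarith) (by linarith)]; ring_nf
  have h1 : y ^ (m - 1) ≤ x ^ (m - 1) := rpow_le_rpow (by linarith) h (by linarith)
  have h2 : 1 ≤ y ^ (m - 1) := one_le_rpow hy (by linarith)
  rw [e x (hy.trans h), e y hy]
  nlinarith

/-- Truncation of the density between two levels. -/
def lvF (m k k' : ℝ) : ℝ → ℝ := trF m (2 * k ^ m - k' ^ m) (k' ^ m - k ^ m)

/-- Truncation of the pressure between two levels. -/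
def lvH (m k k' y : ℝ) : ℝ := trH (2 * k ^ m - k' ^ m) (k' ^ m - k ^ m) (y ^ m)

theorem lv_bounds (hm : 1 < m) {k k' y : ℝ} (hk : 1 ≤ k) (hk' : k < k') (hy : 0 ≤ y) :
    (max (y - k') 0 ≤ lvF m k k' y ∧ lvF m k k' y ≤ max (y - k) 0) ∧
      max (y ^ m - k' ^ m) 0 ≤ lvH m k k' y ∧ lvH m k k' y ≤ max (y ^ m - k ^ m) 0 := by
  have hd : 0 < k' ^ m - k ^ m := sub_pos.2 (Real.rpow_lt_rpow (by linarith) hk' (by linarith))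
  have hy' := rpow_nonneg hy m
  exact ⟨⟨le_trF hm hd (by linarith) (by linarith) hy, trF_le hm hd (by linarith) (by linarith) hy⟩,
    le_trH hd (rpow_nonneg (by linarith) _) (by linarith) hy',
    trH_le hd (rpow_nonneg (by linarith) _) (by linarith) hy'⟩

theorem lv_step (hm : 1 < m) {k k' l l' y h : ℝ} (hk : 1 ≤ k) (hk' : k < k') (hh : 0 < h)
    (hl : h ≤ l - k') (hl' : l < l') (hy : 0 ≤ y) :
    h * lvF m l l' y ≤ lvF m k k' y * lvH m k k' y ∧
      h * lvH m l l' y ≤ lvF m k k' y * lvH m k k' y := by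
  obtain ⟨⟨a1, -⟩, a3, -⟩ := lv_bounds hm hk hk' hy
  obtain ⟨⟨-, b2⟩, -, b4⟩ := lv_bounds hm (by linarith : 1 ≤ l) hl' hy
  have f0 := (le_max_right _ _).trans a1
  have h0 := (le_max_right _ _).trans a3
  have f1 := (le_max_left _ _).trans a1
  have h1 := (le_max_left _ _).trans a3
  have hkl : k' ^ m ≤ l ^ m := rpow_le_rpow (by linarith) (by linarith) (by linarith)
  rcases le_or_gt y l with hyl | hyl
  · rw [max_eq_right (by linarith)] at b2
    rw [max_eq_right (sub_nonpos.2 (rpow_le_rpow hy hyl (by linarith)))] at b4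
    constructor <;> nlinarith [mul_nonneg f0 h0]
  · have hyl' := rpow_le_rpow (by linarith) hyl.le (by linarith : 0 ≤ m)
    rw [max_eq_left (by linarith)] at b2
    rw [max_eq_left (by linarith)] at b4
    have h2 : h ≤ lvF m k k' y := by linarith
    have h3 : h ≤ lvH m k k' y := by
      linarith [sub_le_rpow_sub hm (by linarith : 1 ≤ k') (by linarith : k' ≤ y)]
    constructor
    · rw [mul_comm]; exact mul_le_mul (by linarith) h3 hh.le f0
    · exact mul_le_mul h2 (by linarith) ((le_max_right _ _).trans
        (lv_bounds hm (by linarith : 1 ≤ l) hl' hy).2.1) f0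

theorem Truncated.exists_level {V : EuT N → ℝ} {p : EuT N} {R α : ℝ} (hm : 1 < m)
    (hW : Wt N ρ C α) (hV : Truncated ρ m p R M V) {η : ℝ} (hη : 0 < η) :
    ∃ K, 1 ≤ K ∧ ∫ q, ρ q.1 * max (V q - K) 0 ≤ η ∧ ∫ q, max (V q ^ m - K ^ m) 0 ≤ η := by
  have hlim : ∀ F : ℕ → EuT N → ℝ, ∀ B : EuT N → ℝ, (∀ n, Measurable (F n)) → Integrable B →
      (∀ n q, 0 ≤ F n q ∧ F n q ≤ B q) → (∀ (n : ℕ) q, V q ≤ n + 1 → F n q = 0) →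
      ∀ᶠ n : ℕ in atTop, ∫ q, F n q ≤ η := by
    intro F B hF hB hFB hF0
    have := tendsto_integral_of_dominated_convergence (F := F) (f := fun _ => 0) B
      (fun n => (hF n).aestronglyMeasurable) hB
      (fun n => of_forall fun q => by
        rw [norm_eq_abs, abs_of_nonneg (hFB n q).1]; exact (hFB n q).2)
      (of_forall fun q => tendsto_const_nhds.congr' (by
        filter_upwards [eventually_ge_atTop ⌈V q⌉₊] with n hn
        refine (hF0 n q ?_).symm
        have := (Nat.le_ceil (V q)).trans (Nat.cast_le.2 hn)
        linarith))
    rw [integral_zero] at this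
    exact (this.eventually (gt_mem_nhds hη)).mono fun n h => h.le
  have h1 := hlim (fun n q => ρ q.1 * max (V q - (n + 1)) 0) _ (fun n => by
      have := hW.meas; have := hV.meas; fun_prop) hV.intA
    (fun n q => ⟨mul_nonneg (hW.pos _).le (le_max_right _ _),
      mul_le_mul_of_nonneg_left (max_le (by linarith [n.cast_nonneg (α := ℝ)]) (hV.nonneg q))
        (hW.pos _).le⟩) fun n q h => by simp [h]
  have h2 := hlim (fun n q => max (V q ^ m - (n + 1 : ℝ) ^ m) 0) _
    (fun n => ((hV.meas.pow_const m).sub_const _).max measurable_const) hV.intV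
    (fun n q => ⟨le_max_right _ _, max_le (by
      linarith [rpow_nonneg (by positivity : 0 ≤ (n + 1 : ℝ)) m])
      (rpow_nonneg (hV.nonneg q) _)⟩) fun n q h => by
      simp [rpow_le_rpow (hV.nonneg q) h (by linarith : 0 ≤ m)]
  obtain ⟨n, h1, h2⟩ := (h1.and h2).exists
  exact ⟨n + 1, by linarith [n.cast_nonneg (α := ℝ)], h1, h2⟩

/-- De Giorgi iteration. -/
theorem Truncated.bounded {V : EuT N → ℝ} {p : EuT N} {R α : ℝ} (hN : 3 ≤ N) (hm : 1 < m)
    (hW : Wt N ρ C α) (hR0 : 0 < R) (hR1 : R ≤ 1) (hM : 0 ≤ M) (hV : Truncated ρ m p R M V) :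
    ∃ L, ∀ᵐ q, q ∈ box p (R / 2) (R / 2) → V q ≤ L := by
  obtain ⟨T, ε, hT, hε, hprod⟩ := exists_product_bound hN hW p hM
  obtain ⟨c0, hc0, hcρ⟩ := hW.lower (‖p.1‖ + R)
  set T' := 4 * (1 + c0⁻¹) * T * (4 / R) ^ (16 * N) with hT'
  obtain ⟨η, q, hη, hη1, hq1, hgeo⟩ := exists_geometric (T := T') (Λ := 2 * 2 ^ (16 * N))
    (by positivity) hε (by
      have : (1 : ℝ) ≤ 2 ^ (16 * N) := one_le_pow₀ (by norm_num)
      linarith)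
  obtain ⟨K, hK, hK1, hK2⟩ := hV.exists_level hm hW hη
  set z : ℕ → ℝ := fun j => 1 / 2 ^ j with hz
  have z0 : ∀ j, 0 < z j := fun j => by positivity
  have z1 : ∀ j, z j ≤ 1 := fun j =>
    (div_le_one (by positivity)).2 (one_le_pow₀ (by norm_num))
  have zs : ∀ j, z (j + 1) = z j / 2 := fun j => by simp only [hz, pow_succ]; field_simp
  set k : ℕ → ℝ := fun j => K * (2 - z j) with hk
  set k' : ℕ → ℝ := fun j => K * (2 - 3 / 4 * z j) with hk'
  have k1 : ∀ j, 1 ≤ k j := fun j => by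
    have := z1 j
    exact hK.trans (le_mul_of_one_le_right (by linarith) (by linarith))
  have kk : ∀ j, k j < k' j := fun j => by
    have := z0 j
    exact mul_lt_mul_of_pos_left (by linarith) (by linarith)
  set r : ℕ → ℝ := fun j => R / 2 * (1 + z j) with hr
  have rR : ∀ j, r j ≤ R := fun j => by
    have := mul_le_mul_of_nonneg_left (z1 j) hR0.le
    simp only [hr]; linarith
  have r2 : ∀ j, R / 2 ≤ r j := fun j => by
    have := mul_pos hR0 (z0 j)
    simp only [hr]; linarith
  have rr : ∀ j, r j - r (j + 1) = R / 4 * z j := fun j => by simp only [hr, zs]; ring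
  set f : ℕ → EuT N → ℝ := fun j q => lvF m (k j) (k' j) (V q) with hf
  set g : ℕ → EuT N → ℝ := fun j q => lvH m (k j) (k' j) (V q) with hg
  have hb := fun j q => lv_bounds hm (k1 j) (kk j) (hV.nonneg q)
  have f0 : ∀ j q, 0 ≤ f j q := fun j q => (le_max_right _ _).trans (hb j q).1.1
  have g0 : ∀ j q, 0 ≤ g j q := fun j q => (le_max_right _ _).trans (hb j q).2.1
  have A0 : ∀ j q, 0 ≤ ρ q.1 * f j q := fun j q => mul_nonneg (hW.pos _).le (f0 j q)
  have hkm : ∀ j, 0 ≤ k j ^ m := fun j => rpow_nonneg (by linarith [k1 j]) _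
  have hd : ∀ j, 0 < k' j ^ m - k j ^ m := fun j =>
    sub_pos.2 (Real.rpow_lt_rpow (by linarith [k1 j]) (kk j) (by linarith))
  have iF : ∀ j, Integrable fun q => ρ q.1 * f j q := fun j =>
    hV.intF _ _ (hd j) (by linarith [hkm j])
  have iG : ∀ j, Integrable (g j) := fun j => hV.intH _ _ (hd j) (by linarith [hkm j])
  have fV : ∀ j q, f j q ≤ V q := fun j q => (hb j q).1.2.trans
    (max_le (by linarith [k1 j]) (hV.nonneg q))
  have main : ∀ j, (∫ q in box p (r j) (r j), ρ q.1 * f j q) ≤ η / q ^ j ∧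
      (∫ q in box p (r j) (r j), g j q) ≤ η / q ^ j := by
    intro j
    induction j with
    | zero =>
      have e : k 0 = K := by simp only [hk, hz]; norm_num
      rw [pow_zero, div_one]
      refine ⟨(setIntegral_le_integral (iF 0) (of_forall (A0 0))).trans
        (le_trans (integral_mono_of_nonneg (of_forall (A0 0)) ?_
          (of_forall fun q => ?_)) hK1),
        (setIntegral_le_integral (iG 0) (of_forall (g0 0))).trans
        (le_trans (integral_mono_of_nonneg (of_forall (g0 0)) ?_
          (of_forall fun q => ?_)) hK2)⟩
      · have := hW.meas
        have := hV.meas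
        refine hV.intA.mono' (by fun_prop) (of_forall fun q => ?_)
        rw [norm_eq_abs, abs_of_nonneg (mul_nonneg (hW.pos _).le (le_max_right _ _))]
        exact mul_le_mul_of_nonneg_left (max_le (by linarith) (hV.nonneg q)) (hW.pos _).le
      · have : f 0 q ≤ max (V q - K) 0 := (hb 0 q).1.2.trans_eq (by rw [e])
        exact mul_le_mul_of_nonneg_left this (hW.pos _).le
      · refine hV.intV.mono' (((hV.meas.pow_const m).sub_const _).max
          measurable_const).aestronglyMeasurable (of_forall fun q => ?_)
        rw [norm_eq_abs, abs_of_nonneg (le_max_right _ _)]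
        exact max_le (by linarith [rpow_nonneg (by linarith : 0 ≤ K) m])
          (rpow_nonneg (hV.nonneg q) _)
      · exact (hb 0 q).2.2.trans_eq (by rw [e])
    | succ j ih =>
      have hrj : 0 < R / 4 * z j := mul_pos (by linarith) (z0 j)
      have hY : 0 < η / q ^ j := by positivity
      have hp := hprod (r (j + 1)) (r j) (η / q ^ j) (f j) (g j) (by linarith [r2 (j + 1)])
        (by linarith [rr j]) ((rR j).trans hR1) hY
        ((div_le_one (by positivity)).2 (hη1.trans (one_le_pow₀ hq1.le)))
        ((measurable_trF hm _ _).comp hV.meas) (f0 j) (g0 j) (iF j) (iG j) (by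
          filter_upwards [hV.slab] with x hx
          exact (lintegral_mono fun t => ofReal_le_ofReal (fV j _)).trans hx)
        ((hV.pair _ _ (hd j) (by linarith [hkm j])).mono (Set.prod_mono (ball_subset_ball (rR j))
          (Ioo_subset_Ioo (by linarith [rR j]) (by linarith [rR j])))) ih.1 ih.2
      rw [rr] at hp
      set Z := T / (R / 4 * z j) ^ (16 * N) * (η / q ^ j) ^ (1 + ε) with hZ
      have hZ0 : 0 ≤ Z := by positivity
      set h := z j / 4 with hh
      have h0 : 0 < h := by linarith [z0 j]
      have hl : h ≤ k (j + 1) - k' j := by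
        have e : k (j + 1) - k' j = K * h := by simp only [hk, hk', zs, hh]; ring
        rw [e]; exact le_mul_of_one_le_left h0.le hK
      have hst := fun q => lv_step hm (k1 j) (kk j) h0 hl (kk (j + 1)) (hV.nonneg q)
      have hfin : (1 + c0⁻¹) / h * Z ≤ η / q ^ (j + 1) := by
        refine le_trans (le_of_eq ?_) (hgeo j)
        rw [hZ, hh, hT', mul_pow 2, mul_pow (R / 4)]
        simp only [hz]
        rw [one_div_pow, ← pow_mul, ← pow_mul, mul_comm j, div_pow R, div_pow 4 R]
        field_simp
      have hmb := (isOpen_box p (r (j + 1)) (r (j + 1))).measurableSet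
      have hci : 0 ≤ c0⁻¹ := by positivity
      refine ⟨(setIntegral_le_mul hmb (iF (j + 1)) (A0 (j + 1)) (by positivity) hZ0
        (fun q hq => ?_) hp).trans hfin, (setIntegral_le_mul hmb (iG (j + 1)) (g0 (j + 1))
        (by positivity) hZ0 (fun q hq => ?_) hp).trans hfin⟩
      · rw [div_mul_eq_mul_div, le_div_iff₀ h0]
        have e1 := mul_le_mul_of_nonneg_left (hst q).1 (hW.pos q.1).le
        have e2 := mul_nonneg (A0 j q) (g0 j q)
        have e3 := mul_nonneg hci e2
        simp only [hf, hg] at e1 e2 e3 ⊢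
        linarith
      · rw [div_mul_eq_mul_div, le_div_iff₀ h0]
        have hq1 : c0 ≤ ρ q.1 := hcρ _ (by
          rw [mem_ball_zero_iff]
          have := norm_le_norm_add_norm_sub' q.1 p.1
          have h4 : ‖q.1 - p.1‖ < r (j + 1) := by rw [← dist_eq_norm]; exact hq.1
          linarith [rR (j + 1)])
        have e2 := mul_nonneg (f0 j q) (g0 j q)
        have e1 : 1 ≤ c0⁻¹ * ρ q.1 := by rwa [inv_mul_eq_div, one_le_div hc0]
        have e3 := mul_le_mul_of_nonneg_right e1 e2
        have e4 := mul_nonneg (A0 j q) (g0 j q)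
        have e5 := (hst q).2
        simp only [hf, hg] at e3 e4 e5 ⊢
        linarith
  have iK : Integrable fun q => ρ q.1 * max (V q - 2 * K) 0 := by
    have := hW.meas
    have := hV.meas
    refine hV.intA.mono' (by fun_prop) (of_forall fun q => ?_)
    rw [norm_eq_abs, abs_of_nonneg (mul_nonneg (hW.pos _).le (le_max_right _ _))]
    exact mul_le_mul_of_nonneg_left (max_le (by linarith) (hV.nonneg q)) (hW.pos _).le
  have nK : ∀ q : EuT N, 0 ≤ ρ q.1 * max (V q - 2 * K) 0 := fun q =>
    mul_nonneg (hW.pos _).le (le_max_right _ _)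
  have hle : ∀ j, (∫ q in box p (R / 2) (R / 2), ρ q.1 * max (V q - 2 * K) 0) ≤ η / q ^ j := by
    intro j
    refine le_trans ?_ (main j).1
    calc ∫ q in box p (R / 2) (R / 2), ρ q.1 * max (V q - 2 * K) 0
        ≤ ∫ q in box p (r j) (r j), ρ q.1 * max (V q - 2 * K) 0 :=
          setIntegral_mono_set iK.integrableOn (of_forall nK)
            (of_forall (Set.prod_mono (ball_subset_ball (r2 j))
          (Ioo_subset_Ioo (by linarith [r2 j]) (by linarith [r2 j]))))
      _ ≤ _ := integral_mono iK.integrableOn (iF j).integrableOn fun q => by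
          refine mul_le_mul_of_nonneg_left (le_trans (max_le_max ?_ le_rfl) (hb j q).1.1)
            (hW.pos _).le
          have := mul_nonneg (by linarith : 0 ≤ K) (z0 j).le
          simp only [hk']
          linarith
  have hzero : (∫ q in box p (R / 2) (R / 2), ρ q.1 * max (V q - 2 * K) 0) = 0 := by
    exact le_antisymm (ge_of_tendsto' ((tendsto_pow_atTop_atTop_of_one_lt hq1).const_div_atTop η) hle)
      (integral_nonneg nK)
  rw [setIntegral_eq_zero_iff_of_nonneg_ae (of_forall nK) iK.integrableOn] at hzero
  refine ⟨2 * K, (ae_restrict_iff' (isOpen_box _ _ _).measurableSet).1 ?_⟩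
  filter_upwards [hzero] with q hq
  rcases mul_eq_zero.1 hq with h | h
  · exact absurd h (hW.pos _).ne'
  · have := le_max_left (V q - 2 * K) 0
    rw [h] at this
    linarith

theorem WeightCond.exists_wt (hN : 3 ≤ N) {γ Cl Cu : ℝ} (h : WeightCond N γ Cl Cu ρ) :
    ∃ ρ' C α, Wt N ρ' C α ∧ ∀ᵐ x, ρ' x = ρ x := by
  obtain ⟨hm, h0, h2, hl, hlu, hb⟩ := h
  have hu : 0 < Cu := hl.trans hlu
  set ρ' : Eu N → ℝ := fun x => max (Cl * (1 + ‖x‖) ^ (-γ)) (min (ρ x) (Cu * ‖x‖ ^ (-γ))) with hρ'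
  have ml : Measurable fun x : Eu N => Cl * (1 + ‖x‖) ^ (-γ) :=
    ((measurable_norm.const_add _).pow_const _).const_mul _
  have mu : Measurable fun x : Eu N => Cu * ‖x‖ ^ (-γ) :=
    (measurable_norm.pow_const _).const_mul _
  have mρ : Measurable ρ' := ml.max (hm.min mu)
  have lo : ∀ x, Cl * (1 + ‖x‖) ^ (-γ) ≤ ρ' x := fun x => le_max_left _ _
  have pos : ∀ x, 0 < ρ' x := fun x => lt_of_lt_of_le (by positivity) (lo x)
  have e : ∀ᵐ x, ρ' x = ρ x := by
    filter_upwards [hb] with x hx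
    simp only [hρ']
    rw [min_eq_left hx.2, max_eq_right hx.1]
  obtain ⟨C, hC, hpot⟩ := potBound_of_le hN h0 h2 hu.le mρ (fun x => (pos x).le) (by
    filter_upwards [e, hb] with x hx hb
    exact hx.trans_le hb.2)
  refine ⟨ρ', C, 2 - γ, ⟨mρ, pos, by linarith, hC, hpot, fun R => ⟨Cl * (1 + |R|) ^ (-γ),
    by positivity, fun x hx => le_trans ?_ (lo x)⟩, fun r hr =>
    ⟨max Cl (Cu * r ^ (-γ)), fun x hx => max_le_max ?_ ((min_le_right _ _).trans ?_)⟩⟩, e⟩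
  · refine mul_le_mul_of_nonneg_left (rpow_le_rpow_of_nonpos (by positivity) ?_
      (by linarith)) hl.le
    linarith [mem_ball_zero_iff.1 hx, le_abs_self R]
  · exact mul_le_of_le_one_right hl.le
      (Real.rpow_le_one_of_one_le_of_nonpos (by linarith [norm_nonneg x]) (by linarith))
  · exact mul_le_mul_of_nonneg_left (rpow_le_rpow_of_nonpos hr hx (by linarith)) hu.le

theorem VWS.exists_sol {ρ' : Eu N → ℝ} {Ω : Set (Eu N)} {τ₁ τ₂ : ℝ} {u : Eu N → ℝ → ℝ}
    (hm : 1 < m) (hΩ : IsOpen Ω) (hρ : ∀ᵐ x, ρ' x = ρ x) (hu : VWS ρ m Ω τ₁ τ₂ u)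
    (hpos : ∀ᵐ p ∂(volume.restrict (Ω ×ˢ Ioo τ₁ τ₂) : Measure (EuT N)), 0 ≤ u p.1 p.2) :
    ∃ U, Sol ρ' m (Ω ×ˢ Ioo τ₁ τ₂) U ∧
      ∀ᵐ p, p ∈ Ω ×ˢ Ioo τ₁ τ₂ → 0 ≤ u p.1 p.2 ∧ u p.1 p.2 = U p := by
  have hO : IsOpen (Ω ×ˢ Ioo τ₁ τ₂) := hΩ.prod isOpen_Ioo
  set U : EuT N → ℝ := fun p => max (hu.aemeas.mk _ p) 0 with hU
  have key : ∀ᵐ p, p ∈ Ω ×ˢ Ioo τ₁ τ₂ → 0 ≤ u p.1 p.2 ∧ u p.1 p.2 = U p := by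
    rw [← ae_restrict_iff' hO.measurableSet]
    filter_upwards [hpos, hu.aemeas.ae_eq_mk] with p h0 h1
    exact ⟨h0, by simp only [hU]; rw [← h1, max_eq_left h0]⟩
  have hρ2 : ∀ᵐ p : EuT N, ρ' p.1 = ρ p.1 := ae_fst hρ
  refine ⟨U, ⟨hu.aemeas.measurable_mk.max measurable_const, fun p => le_max_right _ _, hO,
    fun K hK hKO => (hu.locint K hK hKO).1.congr ?_,
    fun K hK hKO => (hu.locint K hK hKO).2.congr ?_, fun ψ sψ cψ hs => ?_⟩, key⟩
  · rw [EventuallyEq, ae_restrict_iff' hK.measurableSet]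
    filter_upwards [key, hρ2] with p h1 h2 hp
    rw [abs_of_nonneg (h1 (hKO hp)).1, (h1 (hKO hp)).2, h2, mul_comm]
  · rw [EventuallyEq, ae_restrict_iff' hK.measurableSet]
    filter_upwards [key] with p h1 hp
    rw [abs_of_nonneg (h1 (hKO hp)).1, (h1 (hKO hp)).2]
  · rw [← hu.weak ψ sψ cψ hs, ← integral_indicator hO.measurableSet]
    refine integral_congr_ae ?_
    filter_upwards [key, hρ2] with p h1 h2
    by_cases hp : p ∈ Ω ×ˢ Ioo τ₁ τ₂
    · obtain ⟨h3, h4⟩ := h1 hp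
      rw [indicator_of_mem hp, spow, abs_of_nonneg h3, h2, ← Real.rpow_add_one' h3 (by linarith),
        sub_add_cancel, h4]
      change ρ p.1 * U p * ptder ψ p + U p ^ m * lapX ψ p = _
      ring
    · have hn : p ∉ tsupport ψ := fun h => hp (hs h)
      rw [indicator_of_notMem hp, dv_eq_zero hn, lapS_eq_zero hn]
      simp

/-- **Local boundedness** (Theorem 2.12): non-negative very weak solutions of the weighted
porous medium equation are locally bounded. -/
theorem stmt_4 {N : ℕ} (hN : 3 ≤ N) (m γ Cl Cu : ℝ) (hm : 1 < m)
    (ρ : Eu N → ℝ) (hρ : WeightCond N γ Cl Cu ρ)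
    (Ω : Set (Eu N)) (hΩ : IsOpen Ω) (τ₁ τ₂ : ℝ) (hτ₁ : 0 ≤ τ₁) (hτ : τ₁ < τ₂)
    (u : Eu N → ℝ → ℝ) (hu : VWS ρ m Ω τ₁ τ₂ u)
    (hpos : ∀ᵐ p ∂(volume.restrict (Ω ×ˢ Ioo τ₁ τ₂) : Measure (Eu N × ℝ)), 0 ≤ u p.1 p.2) :
    ∀ K : Set (Eu N × ℝ), IsCompact K → K ⊆ Ω ×ˢ Ioo τ₁ τ₂ →
      ∃ M : ℝ, ∀ᵐ p ∂(volume.restrict K : Measure (Eu N × ℝ)), |u p.1 p.2| ≤ M := by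
  intro K hK hKO
  obtain ⟨ρ', C, α, hW, hρ'⟩ := hρ.exists_wt hN
  obtain ⟨U, hU, key⟩ := hu.exists_sol hm hΩ hρ' hpos
  refine hK.induction_on (p := fun S => ∃ M : ℝ, ∀ᵐ p ∂(volume.restrict S : Measure (Eu N × ℝ)),
    |u p.1 p.2| ≤ M) ⟨0, by simp⟩ ?_ ?_ fun p hp => ?_
  · rintro S T hST ⟨M, hM⟩
    exact ⟨M, ae_restrict_of_ae_restrict_of_subset hST hM⟩
  · rintro S T ⟨M1, h1⟩ ⟨M2, h2⟩
    exact ⟨max M1 M2, (ae_restrict_union_iff _ _ _).2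
      ⟨h1.mono fun p hp => hp.trans (le_max_left _ _),
        h2.mono fun p hp => hp.trans (le_max_right _ _)⟩⟩
  obtain ⟨R, M, V, hR, hR1, hM, hV, hVU⟩ := hU.exists_trunc hN hm hW (hKO hp)
  obtain ⟨L, hL⟩ := hV.bounded hN hm hW hR hR1 hM
  have hmem : box p (R / 2) (R / 2) ∩ Ω ×ˢ Ioo τ₁ τ₂ ∈ 𝓝 p :=
    (((isOpen_box _ _ _).inter hU.isOpen).mem_nhds
      ⟨⟨mem_ball_self (by positivity), by linarith, by linarith⟩, hKO hp⟩)
  refine ⟨_, mem_nhdsWithin_of_mem_nhds hmem, L,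
    (ae_restrict_iff' ((isOpen_box _ _ _).inter hU.isOpen).measurableSet).2 ?_⟩
  filter_upwards [hL, key] with q h1 h2 hq
  rw [abs_of_nonneg (h2 hq.2).1, (h2 hq.2).2, ← hVU q ⟨ball_subset_ball (by linarith) hq.1.1,
    by linarith [hq.1.2.1], by linarith [hq.1.2.2]⟩]
  exact h1 hq.1
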